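/- Let d = 2 and suppose (X_i)_{i∈ℤ} is strictly stationary with alpha-mixing coefficients α(k) = O(a^k) for some a ∈ (0,1), continuous marginal c.d.f.s, and copula C satisfying Condition 2.1. Suppose J ∈ BVHK_loc((0,1)²) is right-continuous and there exists ω ∈ (0,1/2) such that |J(u,v)| ≤ const · g_ω(u,v)^{−1} for all (u,v) ∈ (0,1)², ∫_{(0,1)²} g_ω(u,v) |dJ(u,v)| < ∞, and, as δ → 0: ∫_{(δ,1−δ]} |J(du,δ)| = O(δ^{−ω}), ∫_{(δ,1−δ]} |J(du,1−δ)| = O(δ^{−ω}), ∫_{(δ,1−δ]} |J(δ,dv)| = O(δ^{−ω}) and ∫_{(δ,1−δ]} |J(1−δ,dv)| = O(δ^{−ω}). Then, as n → ∞, √n ( R_n − E[J(U_{11}, U_{12})] ) converges in distribution to the centered normal law with variance σ² = ∫_{(0,1)²} ∫_{(0,1)²} Γ(u,v) dJ(u) dJ(v). -/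

import Mathlib

open MeasureTheory Filter Set
open scoped ENNReal NNReal

noncomputable section

namespace BBV

variable {Ω : Type*} [MeasurableSpace Ω] {E : Type*} [MeasurableSpace E] {d : ℕ}

/-- The real-valued indicator function of a set. -/
def indic {α : Type*} (s : Set α) (x : α) : ℝ := s.indicator (fun _ => (1 : ℝ)) x

/-- `Z n = o_P(r n)`: convergence to zero in (outer) probability at rate `r`. -/
def oP (P : Measure Ω) (Z : ℕ → Ω → ℝ) (r : ℕ → ℝ) : Prop :=
  ∀ ε : ℝ, 0 < ε → Tendsto (fun n => P {ω | ε * r n < |Z n ω|}) atTop (nhds 0)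

/-- `Z n = o_P(1)`: convergence to zero in (outer) probability. -/
def oP1 (P : Measure Ω) (Z : ℕ → Ω → ℝ) : Prop := oP P Z fun _ => 1

/-- `Z n = O_P(1)`: boundedness in (outer) probability. -/
def bigOP (P : Measure Ω) (Z : ℕ → Ω → ℝ) : Prop :=
  ∀ ε : ℝ, 0 < ε → ∃ M : ℝ, ∀ᶠ n in atTop, P {ω | M < |Z n ω|} ≤ ENNReal.ofReal ε

/-- Strict stationarity of a two-sided sequence: all finite-dimensional distributions
are invariant under shifts. -/
def StrictlyStationary (P : Measure Ω) (X : ℤ → Ω → E) : Prop :=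
  ∀ (m : ℕ) (idx : Fin m → ℤ) (k : ℤ),
    Measure.map (fun ω (p : Fin m) => X (idx p + k) ω) P =
      Measure.map (fun ω (p : Fin m) => X (idx p) ω) P

/-- The sigma-field generated by the variables `X i`, `i ∈ S`. -/
def mixSigma (X : ℤ → Ω → E) (S : Set ℤ) : MeasurableSpace Ω :=
  ⨆ i ∈ S, MeasurableSpace.comap (X i) inferInstance

/-- The alpha-mixing coefficient of the sequence `X`. -/
def alphaMix (P : Measure Ω) (X : ℤ → Ω → E) (k : ℕ) : ℝ :=
  sSup {r : ℝ | ∃ (i : ℤ) (A B : Set Ω),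
    MeasurableSet[mixSigma X (Set.Iic i)] A ∧
    MeasurableSet[mixSigma X (Set.Ici (i + (k : ℤ)))] B ∧
    r = |(P (A ∩ B)).toReal - (P A).toReal * (P B).toReal|}

/-- Exponentially decaying alpha-mixing coefficients: `α(k) = O(a^k)` for some `a ∈ (0,1)`. -/
def ExpAlphaMixing (P : Measure Ω) (X : ℤ → Ω → E) : Prop :=
  ∃ a ∈ Set.Ioo (0 : ℝ) 1, ∃ c : ℝ, ∀ k : ℕ, 1 ≤ k → alphaMix P X k ≤ c * a ^ k

/-- Marginal c.d.f. `F_j` of the stationary sequence. -/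
def margF (P : Measure Ω) (X : ℤ → Ω → Fin d → ℝ) (j : Fin d) (x : ℝ) : ℝ :=
  (P {ω | X 0 ω j ≤ x}).toReal

/-- `U_i = (F_1(X_{i1}),…,F_d(X_{id}))`. -/
def Uv (P : Measure Ω) (X : ℤ → Ω → Fin d → ℝ) (i : ℤ) (ω : Ω) (j : Fin d) : ℝ :=
  margF P X j (X i ω j)

/-- The copula `C` of the stationary distribution, i.e. the c.d.f. of `U_0`. -/
def cop (P : Measure Ω) (X : ℤ → Ω → Fin d → ℝ) (u : Fin d → ℝ) : ℝ :=
  (P {ω | ∀ j, Uv P X 0 ω j ≤ u j}).toReal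

/-- Empirical c.d.f. `G_n` of the (unobservable) sample `U_1,…,U_n`. -/
def Gn (P : Measure Ω) (X : ℤ → Ω → Fin d → ℝ) (n : ℕ) (u : Fin d → ℝ) (ω : Ω) : ℝ :=
  (n : ℝ)⁻¹ * ∑ i ∈ Finset.Icc (1 : ℤ) (n : ℤ), indic {ω' | ∀ j, Uv P X i ω' j ≤ u j} ω

/-- The empirical process `α_n = √n (G_n − C)`. -/
def alphan (P : Measure Ω) (X : ℤ → Ω → Fin d → ℝ) (n : ℕ) (u : Fin d → ℝ) (ω : Ω) : ℝ :=
  Real.sqrt n * (Gn P X n u ω - cop P X u)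

/-- Marginal empirical c.d.f. `G_{nj}` based on `U_{1j},…,U_{nj}`. -/
def Gnj (P : Measure Ω) (X : ℤ → Ω → Fin d → ℝ) (n : ℕ) (j : Fin d) (s : ℝ) (ω : Ω) : ℝ :=
  (n : ℝ)⁻¹ * ∑ i ∈ Finset.Icc (1 : ℤ) (n : ℤ), indic {ω' | Uv P X i ω' j ≤ s} ω

/-- The marginal empirical process `α_{nj}(s) = √n (G_{nj}(s) − s)`. -/
def alphanj (P : Measure Ω) (X : ℤ → Ω → Fin d → ℝ) (n : ℕ) (j : Fin d) (s : ℝ) (ω : Ω) : ℝ :=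
  Real.sqrt n * (Gnj P X n j s ω - s)

/-- Left-continuous generalized inverse: `H⁻(s) = inf{x : H(x) ≥ s}` for `s ≠ 0`,
and `H⁻(0) = sup{x : H(x) = 0}`. -/
def genInv (H : ℝ → ℝ) (s : ℝ) : ℝ :=
  if s = 0 then sSup {x | H x = 0} else sInf {x | s ≤ H x}

/-- The marginal quantile process `β_{nj}(s) = √n (G_{nj}⁻(s) − s)`. -/
def betanj (P : Measure Ω) (X : ℤ → Ω → Fin d → ℝ) (n : ℕ) (j : Fin d) (s : ℝ) (ω : Ω) : ℝ :=
  Real.sqrt n * (genInv (fun x => Gnj P X n j x ω) s - s)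

/-- Marginal empirical c.d.f. `F_{nj}` of the observations `X_{1j},…,X_{nj}`. -/
def empCdfX (X : ℤ → Ω → Fin d → ℝ) (n : ℕ) (j : Fin d) (x : ℝ) (ω : Ω) : ℝ :=
  (n : ℝ)⁻¹ * ∑ i ∈ Finset.Icc (1 : ℤ) (n : ℤ), indic {ω' | X i ω' j ≤ x} ω

/-- Pseudo-observations `Û_{ij} = n/(n+1) · F_{nj}(X_{ij})`. -/
def pseudoObs (X : ℤ → Ω → Fin d → ℝ) (n : ℕ) (i : ℤ) (ω : Ω) (j : Fin d) : ℝ :=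
  (n : ℝ) / ((n : ℝ) + 1) * empCdfX X n j (X i ω j) ω

/-- The empirical copula `Ĉ_n`. -/
def empCop (X : ℤ → Ω → Fin d → ℝ) (n : ℕ) (u : Fin d → ℝ) (ω : Ω) : ℝ :=
  (n : ℝ)⁻¹ * ∑ i ∈ Finset.Icc (1 : ℤ) (n : ℤ), indic {ω' | ∀ j, pseudoObs X n i ω' j ≤ u j} ω

/-- The empirical copula process `ĈP_n = √n (Ĉ_n − C)`. -/
def hatCP (P : Measure Ω) (X : ℤ → Ω → Fin d → ℝ) (n : ℕ) (u : Fin d → ℝ) (ω : Ω) : ℝ :=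
  Real.sqrt n * (empCop X n u ω - cop P X u)

/-- First-order partial derivative `Ċ_j` of `C`, defined everywhere as the limsup of
difference quotients (which coincides with the partial derivative wherever it exists). -/
def Cdot (C : (Fin d → ℝ) → ℝ) (j : Fin d) (u : Fin d → ℝ) : ℝ :=
  Filter.limsup (fun h : ℝ => (C (Function.update u j (u j + h)) - C u) / h)
    (nhdsWithin 0 {(0 : ℝ)}ᶜ)

/-- The process `C̄_n(u) = α_n(u) − Σ_j Ċ_j(u) α_n(u^{(j)})`. -/
def Cbar (P : Measure Ω) (X : ℤ → Ω → Fin d → ℝ) (n : ℕ) (u : Fin d → ℝ) (ω : Ω) : ℝ :=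
  alphan P X n u ω -
    ∑ j, Cdot (cop P X) j u * alphan P X n (Function.update (fun _ => (1 : ℝ)) j (u j)) ω

/-- `C_n(u) = G_n(G_{n1}⁻(u₁),…,G_{nd}⁻(u_d))`. -/
def copGI (P : Measure Ω) (X : ℤ → Ω → Fin d → ℝ) (n : ℕ) (u : Fin d → ℝ) (ω : Ω) : ℝ :=
  Gn P X n (fun j => genInv (fun x => Gnj P X n j x ω) (u j)) ω

/-- The empirical copula process `𝔺_n = √n (C_n − C)` based on generalized inverses. -/
def CPgi (P : Measure Ω) (X : ℤ → Ω → Fin d → ℝ) (n : ℕ) (u : Fin d → ℝ) (ω : Ω) : ℝ :=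
  Real.sqrt n * (copGI P X n u ω - cop P X u)

/-- `g₁(u) = min{ min_j u_j , min_j [1 − min_{k ≠ j} u_k] }`. -/
def g1 (u : Fin d → ℝ) : ℝ :=
  min (⨅ j, u j) (⨅ j : Fin d, (1 - ⨅ k : {k : Fin d // k ≠ j}, u (k : Fin d)))

/-- The weight function `g_ω(u) = g₁(u)^ω`. -/
def gW (w : ℝ) (u : Fin d → ℝ) : ℝ := g1 u ^ w

/-- `g̃_ω(u) = g_ω(u) + 1{g_ω(u) = 0}`. -/
def gTilde (w : ℝ) (u : Fin d → ℝ) : ℝ := if gW w u = 0 then 1 else gW w u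

/-- `N(a,b) = {u ∈ [0,1]^d : a < g₁(u) ≤ b}`. -/
def NN (d : ℕ) (a b : ℝ) : Set (Fin d → ℝ) :=
  {u | (∀ j, 0 ≤ u j ∧ u j ≤ 1) ∧ a < g1 u ∧ g1 u ≤ b}

/-- `V_j = {u ∈ [0,1]^d : u_j ∈ (0,1)}`. -/
def VV (d : ℕ) (j : Fin d) : Set (Fin d → ℝ) :=
  {u | (∀ k, 0 ≤ u k ∧ u k ≤ 1) ∧ 0 < u j ∧ u j < 1}

/-- Condition 2.1: existence, continuity and growth bounds for the first and second
order partial derivatives of the copula `C`. -/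
def Condition21 (C : (Fin d → ℝ) → ℝ) : Prop :=
  (∀ j : Fin d, ∀ u ∈ VV d j,
    HasDerivAt (fun t => C (Function.update u j t)) (Cdot C j u) (u j)) ∧
  (∀ j : Fin d, ContinuousOn (Cdot C j) (VV d j)) ∧
  ∃ Cdd : Fin d → Fin d → (Fin d → ℝ) → ℝ,
    (∀ j₁ j₂ : Fin d, ∀ u ∈ VV d j₁ ∩ VV d j₂,
      HasDerivAt (fun t => Cdot C j₂ (Function.update u j₁ t)) (Cdd j₁ j₂ u) (u j₁)) ∧
    (∀ j₁ j₂ : Fin d, ContinuousOn (Cdd j₁ j₂) (VV d j₁ ∩ VV d j₂)) ∧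
    ∃ K : ℝ, 0 < K ∧ ∀ j₁ j₂ : Fin d, ∀ u ∈ VV d j₁ ∩ VV d j₂,
      |Cdd j₁ j₂ u| ≤ K * min (1 / (u j₁ * (1 - u j₁))) (1 / (u j₂ * (1 - u j₂)))

/-- The weighted modulus of continuity `M_n(δ,μ)` of the empirical process. -/
def Mn (P : Measure Ω) (X : ℤ → Ω → Fin d → ℝ) (n : ℕ) (δ μ : ℝ) (ω : Ω) : ℝ :=
  ⨆ q ∈ {q : (Fin d → ℝ) × (Fin d → ℝ) |
      q.1 ∈ Set.Icc 0 1 ∧ q.2 ∈ Set.Icc 0 1 ∧ dist q.1 q.2 ≤ δ},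
    |alphan P X n q.1 ω - alphan P X n q.2 ω| / max (dist q.1 q.2 ^ μ) ((n : ℝ) ^ (-μ))

/-- Condition 4.1 with parameter `θ₁`. -/
def Condition41 (P : Measure Ω) (X : ℤ → Ω → Fin d → ℝ) (θ₁ : ℝ) : Prop :=
  ∀ μ ∈ Set.Ioo (0 : ℝ) θ₁, ∀ δ : ℕ → ℝ, Tendsto δ atTop (nhds 0) →
    oP1 P (fun n ω => Mn P X n (δ n) μ ω)

/-- Condition 4.3 with parameters `θ₂, θ₃`. -/
def Condition43 (P : Measure Ω) (X : ℤ → Ω → Fin d → ℝ) (θ₂ θ₃ : ℝ) : Prop :=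
  ∀ w ∈ Set.Ioo (0 : ℝ) θ₂, ∀ lam ∈ Set.Ioo (0 : ℝ) θ₃, ∀ j : Fin d,
    bigOP P (fun n ω => ⨆ s ∈ Set.Ioo (0 : ℝ) 1,
      |alphanj P X n j s ω| / (s * (1 - s)) ^ w) ∧
    bigOP P (fun n ω => ⨆ s ∈ Set.Ioo ((n : ℝ) ^ (-lam)) (1 - (n : ℝ) ^ (-lam)),
      |betanj P X n j s ω| / (s * (1 - s)) ^ w)

/-- The long-run covariance `k(u,v) = Σ_{i∈ℤ} Cov(1(U₀ ≤ u), 1(U_i ≤ v))`. -/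
def kcov {Ω : Type*} [MeasurableSpace Ω] (P : Measure Ω) (X : ℤ → Ω → Fin 2 → ℝ)
    (u v : Fin 2 → ℝ) : ℝ :=
  ∑' i : ℤ,
    ((∫ ω, indic {ω' | ∀ j, Uv P X 0 ω' j ≤ u j} ω * indic {ω' | ∀ j, Uv P X i ω' j ≤ v j} ω ∂P)
      - cop P X u * cop P X v)

/-- `u^{(j)}`: the vector with `u_j` in coordinate `j` and `1` elsewhere. -/
def onePt {d : ℕ} (j : Fin d) (u : Fin d → ℝ) : Fin d → ℝ :=
  Function.update (fun _ => (1 : ℝ)) j (u j)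

/-- `Γ(u,v) = E[C_C(u) C_C(v)]`, the covariance kernel of the Gaussian limit `C_C` of
the empirical copula process, expressed through `k` and the partial derivatives of `C`. -/
def GammaCov {Ω : Type*} [MeasurableSpace Ω] (P : Measure Ω) (X : ℤ → Ω → Fin 2 → ℝ)
    (u v : Fin 2 → ℝ) : ℝ :=
  kcov P X u v
    - ∑ j, Cdot (cop P X) j v * kcov P X u (onePt j v)
    - ∑ j, Cdot (cop P X) j u * kcov P X (onePt j u) v
    + ∑ j, ∑ j', Cdot (cop P X) j u * Cdot (cop P X) j' v * kcov P X (onePt j u) (onePt j' v)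

/-- The signed integral `∫ h dJ = ∫ h dν⁺ − ∫ h dν⁻` with respect to the Jordan pair
`(ν⁺, ν⁻)` of measures associated with `J`. -/
def sJint (νp νm : Measure (Fin 2 → ℝ)) (h : (Fin 2 → ℝ) → ℝ) : ℝ :=
  (∫ u, h u ∂νp) - ∫ u, h u ∂νm

/-- `σ² = ∫∫ E[C_C(u) C_C(v)] dJ(u) dJ(v)`. -/
def sigmaSq {Ω : Type*} [MeasurableSpace Ω] (P : Measure Ω) (X : ℤ → Ω → Fin 2 → ℝ)
    (νp νm : Measure (Fin 2 → ℝ)) : ℝ :=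
  sJint νp νm (fun v => sJint νp νm (fun u => GammaCov P X u v))

/-! ### Covariance inequalities -/

section

/-- Layer-cake comparison of the integrals of a bounded function under two finite measures. -/
lemma abs_integral_sub_integral_le_of_superlevel {α : Type*} [MeasurableSpace α] (μ₁ μ₂ : Measure α)
    [IsFiniteMeasure μ₁] [IsFiniteMeasure μ₂] {f : α → ℝ} (hf : Measurable f) {M D : ℝ}
    (hM : 0 ≤ M) (h1 : ∀ᵐ x ∂μ₁, 0 ≤ f x ∧ f x ≤ M) (h2 : ∀ᵐ x ∂μ₂, 0 ≤ f x ∧ f x ≤ M)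
    (hD : ∀ t, 0 < t → |μ₁.real {a | t ≤ f a} - μ₂.real {a | t ≤ f a}| ≤ D) :
    |∫ x, f x ∂μ₁ - ∫ x, f x ∂μ₂| ≤ M * D := by
  have i1 : Integrable f μ₁ := Integrable.of_bound hf.aestronglyMeasurable M (by
    filter_upwards [h1] with x hx; rw [Real.norm_eq_abs, abs_of_nonneg hx.1]; exact hx.2)
  have i2 : Integrable f μ₂ := Integrable.of_bound hf.aestronglyMeasurable M (by
    filter_upwards [h2] with x hx; rw [Real.norm_eq_abs, abs_of_nonneg hx.1]; exact hx.2)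
  rw [i1.integral_eq_integral_Ioc_meas_le (M := M) (h1.mono fun _ h => h.1) (h1.mono fun _ h => h.2),
    i2.integral_eq_integral_Ioc_meas_le (M := M) (h2.mono fun _ h => h.1) (h2.mono fun _ h => h.2)]
  have hint : ∀ (μ : Measure α) [IsFiniteMeasure μ],
      IntegrableOn (fun t => μ.real {a | t ≤ f a}) (Ioc 0 M) := by
    intro μ _
    have hanti : Antitone (fun t => μ.real {a | t ≤ f a}) := by
      intro s t hst
      exact measureReal_mono (fun a ha => le_trans hst ha)
    refine Measure.integrableOn_of_bounded (M := μ.real univ) (by simp)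
      hanti.measurable.aestronglyMeasurable ?_
    refine ae_of_all _ fun t => ?_
    rw [Real.norm_eq_abs, abs_of_nonneg measureReal_nonneg]
    exact measureReal_mono (subset_univ _)
  rw [← integral_sub (hint μ₁) (hint μ₂), ← Real.norm_eq_abs]
  refine (norm_setIntegral_le_of_norm_le_const (by simp) (C := D) ?_).trans ?_
  · intro t ht; exact hD t ht.1
  · simp [measureReal_def, hM, mul_comm]

/-- Covariance inequality for functions with values in `[0,1]`. -/
lemma abs_cov_le_of_unit {S : Type*} {m₁ m₂ : MeasurableSpace S}
    [m₀ : MeasurableSpace S] (P : Measure S) [IsProbabilityMeasure P] (h₁ : m₁ ≤ m₀) (h₂ : m₂ ≤ m₀) {α : ℝ}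
    (hα : ∀ A B, MeasurableSet[m₁] A → MeasurableSet[m₂] B →
      |P.real (A ∩ B) - P.real A * P.real B| ≤ α)
    {f g : S → ℝ} (hf : Measurable[m₁] f) (hg : Measurable[m₂] g)
    (hf0 : ∀ x, 0 ≤ f x ∧ f x ≤ 1) (hg0 : ∀ x, 0 ≤ g x ∧ g x ≤ 1) :
    |∫ x, f x * g x ∂P - (∫ x, f x ∂P) * ∫ x, g x ∂P| ≤ α := by
  have hf' : Measurable f := hf.mono h₁ le_rfl
  have hg' : Measurable g := hg.mono h₂ le_rfl
  have key : ∀ B, MeasurableSet[m₂] B → |∫ x in B, f x ∂P - P.real B * ∫ x, f x ∂P| ≤ α := by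
    intro B hB
    have hsmul : P.real B * ∫ x, f x ∂P = ∫ x, f x ∂((P B) • P) := by
      rw [integral_smul_measure]; rfl
    have : IsFiniteMeasure ((P B) • P) := by
      refine ⟨?_⟩
      simp
    rw [hsmul, ← one_mul α]
    refine abs_integral_sub_integral_le_of_superlevel (P.restrict B) ((P B) • P) hf' zero_le_one
      (ae_of_all _ hf0) (ae_of_all _ hf0) fun t _ => ?_
    have hS : MeasurableSet[m₁] {a | t ≤ f a} := hf measurableSet_Ici
    have := hα _ B hS hB
    rw [measureReal_restrict_apply (h₁ _ hS), measureReal_ennreal_smul_apply, mul_comm]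
    exact this
  set c := ∫ x, f x ∂P with hc
  have hc0 : 0 ≤ c := integral_nonneg fun x => (hf0 x).1
  have hfi : Integrable f P := Integrable.of_bound hf'.aestronglyMeasurable 1
    (ae_of_all _ fun x => by rw [Real.norm_eq_abs, abs_of_nonneg (hf0 x).1]; exact (hf0 x).2)
  have e1 : ∫ x, f x * g x ∂P = ∫ x, g x ∂(P.withDensity fun x => ENNReal.ofReal (f x)) := by
    rw [integral_withDensity_eq_integral_toReal_smul (by fun_prop) (by simp)]
    refine integral_congr_ae (ae_of_all _ fun x => ?_)
    simp [ENNReal.toReal_ofReal (hf0 x).1]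
  have e2 : c * ∫ x, g x ∂P = ∫ x, g x ∂((ENNReal.ofReal c) • P) := by
    rw [integral_smul_measure, ENNReal.toReal_ofReal hc0]; rfl
  have : IsFiniteMeasure (P.withDensity fun x => ENNReal.ofReal (f x)) :=
    isFiniteMeasure_withDensity_ofReal hfi.2
  have : IsFiniteMeasure ((ENNReal.ofReal c) • P) := by
    refine ⟨?_⟩
    simp
  rw [e1, e2, ← one_mul α]
  refine abs_integral_sub_integral_le_of_superlevel _ _ hg' zero_le_one
      (ae_of_all _ hg0) (ae_of_all _ hg0) fun t _ => ?_
  have hS : MeasurableSet[m₂] {a | t ≤ g a} := hg measurableSet_Ici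
  have hk := key _ hS
  have e3 : (P.withDensity fun x => ENNReal.ofReal (f x)).real {a | t ≤ g a}
      = ∫ x in {a | t ≤ g a}, f x ∂P := by
    rw [measureReal_def, withDensity_apply _ (h₂ _ hS),
      integral_eq_lintegral_of_nonneg_ae (ae_of_all _ fun x => (hf0 x).1)
        hf'.aestronglyMeasurable]
  rw [e3, measureReal_ennreal_smul_apply, ENNReal.toReal_ofReal hc0, mul_comm c]
  exact hk

/-- Covariance inequality for functions bounded by `1`. -/
lemma abs_cov_le_of_bounded {S : Type*} {m₁ m₂ : MeasurableSpace S}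
    [m₀ : MeasurableSpace S] (P : Measure S) [IsProbabilityMeasure P] (h₁ : m₁ ≤ m₀) (h₂ : m₂ ≤ m₀) {α : ℝ}
    (hα : ∀ A B, MeasurableSet[m₁] A → MeasurableSet[m₂] B →
      |P.real (A ∩ B) - P.real A * P.real B| ≤ α)
    {f g : S → ℝ} (hf : Measurable[m₁] f) (hg : Measurable[m₂] g)
    (hf0 : ∀ x, |f x| ≤ 1) (hg0 : ∀ x, |g x| ≤ 1) :
    |∫ x, f x * g x ∂P - (∫ x, f x ∂P) * ∫ x, g x ∂P| ≤ 4 * α := by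
  have hf' : Measurable f := hf.mono h₁ le_rfl
  have hg' : Measurable g := hg.mono h₂ le_rfl
  have hfi : Integrable f P := Integrable.of_bound hf'.aestronglyMeasurable 1 (ae_of_all _ hf0)
  have hgi : Integrable g P := Integrable.of_bound hg'.aestronglyMeasurable 1 (ae_of_all _ hg0)
  have hfgi : Integrable (fun x => f x * g x) P :=
    Integrable.of_bound (hf'.mul hg').aestronglyMeasurable 1 (ae_of_all _ fun x => by
      rw [Real.norm_eq_abs, abs_mul]
      exact mul_le_one₀ (hf0 x) (abs_nonneg _) (hg0 x))
  have hF : Measurable[m₁] (fun x => (f x + 1) / 2) := (hf.add_const 1).div_const 2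
  have hG : Measurable[m₂] (fun x => (g x + 1) / 2) := (hg.add_const 1).div_const 2
  have := abs_cov_le_of_unit P h₁ h₂ hα hF hG
    (fun x => by have := abs_le.1 (hf0 x); constructor <;> linarith)
    (fun x => by have := abs_le.1 (hg0 x); constructor <;> linarith)
  have e1 : ∫ x, (f x + 1) / 2 ∂P = (∫ x, f x ∂P + 1) / 2 := by
    rw [integral_div, integral_add hfi (integrable_const _)]; simp
  have e2 : ∫ x, (g x + 1) / 2 ∂P = (∫ x, g x ∂P + 1) / 2 := by
    rw [integral_div, integral_add hgi (integrable_const _)]; simp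
  have e3 : ∫ x, (f x + 1) / 2 * ((g x + 1) / 2) ∂P
      = (∫ x, f x * g x ∂P + ∫ x, f x ∂P + ∫ x, g x ∂P + 1) / 4 := by
    have : ∀ x, (f x + 1) / 2 * ((g x + 1) / 2) = (f x * g x + f x + g x + 1) / 4 := by
      intro x; ring
    simp_rw [this]
    have i2 : Integrable (fun x => f x * g x + f x) P := hfgi.add hfi
    have i3 : Integrable (fun x => f x * g x + f x + g x) P := i2.add hgi
    rw [integral_div, integral_add i3 (integrable_const _), integral_add i2 hgi,
      integral_add hfgi hfi]
    simp
  rw [e1, e2, e3] at this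
  rw [show ∫ x, f x * g x ∂P - (∫ x, f x ∂P) * ∫ x, g x ∂P =
    4 * ((∫ x, f x * g x ∂P + ∫ x, f x ∂P + ∫ x, g x ∂P + 1) / 4 -
      (∫ x, f x ∂P + 1) / 2 * ((∫ x, g x ∂P + 1) / 2)) by ring, abs_mul]
  simpa using this

/-- Covariance inequality for complex functions bounded by `1`. -/
lemma norm_cov_le_of_bounded {S : Type*} {m₁ m₂ : MeasurableSpace S}
    [m₀ : MeasurableSpace S] (P : Measure S) [IsProbabilityMeasure P] (h₁ : m₁ ≤ m₀) (h₂ : m₂ ≤ m₀) {α : ℝ}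
    (hα : ∀ A B, MeasurableSet[m₁] A → MeasurableSet[m₂] B →
      |P.real (A ∩ B) - P.real A * P.real B| ≤ α)
    {f g : S → ℂ} (hf : Measurable[m₁] f) (hg : Measurable[m₂] g)
    (hf0 : ∀ x, ‖f x‖ ≤ 1) (hg0 : ∀ x, ‖g x‖ ≤ 1) :
    ‖∫ x, f x * g x ∂P - (∫ x, f x ∂P) * ∫ x, g x ∂P‖ ≤ 16 * α := by
  have hf' : Measurable f := hf.mono h₁ le_rfl
  have hg' : Measurable g := hg.mono h₂ le_rfl
  have bnd : ∀ {h : S → ℝ}, Measurable h → (∀ x, |h x| ≤ 1) → Integrable h P := fun hm hb =>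
    Integrable.of_bound hm.aestronglyMeasurable 1 (ae_of_all _ hb)
  have hfi : Integrable f P := Integrable.of_bound hf'.aestronglyMeasurable 1 (ae_of_all _ hf0)
  have hgi : Integrable g P := Integrable.of_bound hg'.aestronglyMeasurable 1 (ae_of_all _ hg0)
  have hfgi : Integrable (fun x => f x * g x) P :=
    Integrable.of_bound (hf'.mul hg').aestronglyMeasurable 1 (ae_of_all _ fun x => by
      rw [norm_mul]; exact mul_le_one₀ (hf0 x) (norm_nonneg _) (hg0 x))
  have rf : ∀ x, |(f x).re| ≤ 1 := fun x => (Complex.abs_re_le_norm _).trans (hf0 x)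
  have jf : ∀ x, |(f x).im| ≤ 1 := fun x => (Complex.abs_im_le_norm _).trans (hf0 x)
  have rg : ∀ x, |(g x).re| ≤ 1 := fun x => (Complex.abs_re_le_norm _).trans (hg0 x)
  have jg : ∀ x, |(g x).im| ≤ 1 := fun x => (Complex.abs_im_le_norm _).trans (hg0 x)
  have mrf := Complex.measurable_re.comp hf
  have mjf := Complex.measurable_im.comp hf
  have mrg := Complex.measurable_re.comp hg
  have mjg := Complex.measurable_im.comp hg
  have b1 := abs_cov_le_of_bounded P h₁ h₂ hα mrf mrg rf rg
  have b2 := abs_cov_le_of_bounded P h₁ h₂ hα mrf mjg rf jg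
  have b3 := abs_cov_le_of_bounded P h₁ h₂ hα mjf mrg jf rg
  have b4 := abs_cov_le_of_bounded P h₁ h₂ hα mjf mjg jf jg
  simp only [Function.comp_def] at b1 b2 b3 b4
  have pb : ∀ {h k : S → ℝ}, Measurable h → Measurable k → (∀ x, |h x| ≤ 1) → (∀ x, |k x| ≤ 1) →
      Integrable (fun x => h x * k x) P := fun hm km hb kb =>
    bnd (hm.mul km) fun x => by rw [abs_mul]; exact mul_le_one₀ (hb x) (abs_nonneg _) (kb x)
  have mrf' : Measurable fun x => (f x).re := Complex.measurable_re.comp hf'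
  have mjf' : Measurable fun x => (f x).im := Complex.measurable_im.comp hf'
  have mrg' : Measurable fun x => (g x).re := Complex.measurable_re.comp hg'
  have mjg' : Measurable fun x => (g x).im := Complex.measurable_im.comp hg'
  have re_int : ∀ {h : S → ℂ}, Integrable h P → (∫ x, h x ∂P).re = ∫ x, (h x).re ∂P :=
    fun h => (integral_re h).symm
  have im_int : ∀ {h : S → ℂ}, Integrable h P → (∫ x, h x ∂P).im = ∫ x, (h x).im ∂P :=
    fun h => (integral_im h).symm
  refine (Complex.norm_le_abs_re_add_abs_im _).trans ?_
  have hre : (∫ x, f x * g x ∂P - (∫ x, f x ∂P) * ∫ x, g x ∂P).re =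
      ((∫ x, (f x).re * (g x).re ∂P) - (∫ x, (f x).re ∂P) * ∫ x, (g x).re ∂P)
      - ((∫ x, (f x).im * (g x).im ∂P) - (∫ x, (f x).im ∂P) * ∫ x, (g x).im ∂P) := by
    rw [Complex.sub_re, Complex.mul_re, re_int hfgi, re_int hfi, re_int hgi, im_int hfi, im_int hgi]
    simp_rw [Complex.mul_re]
    rw [integral_sub (pb mrf' mrg' rf rg) (pb mjf' mjg' jf jg)]
    ring
  have him : (∫ x, f x * g x ∂P - (∫ x, f x ∂P) * ∫ x, g x ∂P).im =
      ((∫ x, (f x).re * (g x).im ∂P) - (∫ x, (f x).re ∂P) * ∫ x, (g x).im ∂P)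
      + ((∫ x, (f x).im * (g x).re ∂P) - (∫ x, (f x).im ∂P) * ∫ x, (g x).re ∂P) := by
    rw [Complex.sub_im, Complex.mul_im, im_int hfgi, re_int hfi, re_int hgi, im_int hfi, im_int hgi]
    simp_rw [Complex.mul_im]
    rw [integral_add (pb mrf' mjg' rf jg) (pb mjf' mrg' jf rg)]
    ring
  rw [hre, him]
  have t1 := abs_sub ((∫ x, (f x).re * (g x).re ∂P) - (∫ x, (f x).re ∂P) * ∫ x, (g x).re ∂P)
    ((∫ x, (f x).im * (g x).im ∂P) - (∫ x, (f x).im ∂P) * ∫ x, (g x).im ∂P)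
  have t2 := abs_add_le ((∫ x, (f x).re * (g x).im ∂P) - (∫ x, (f x).re ∂P) * ∫ x, (g x).im ∂P)
    ((∫ x, (f x).im * (g x).re ∂P) - (∫ x, (f x).im ∂P) * ∫ x, (g x).re ∂P)
  linarith

end

/-! ### Covariance bounds for mixing sequences -/

section

lemma mixSigma_le {X : ℤ → Ω → E} (hmeas : ∀ i, Measurable (X i)) (S : Set ℤ) :
    mixSigma X S ≤ ‹MeasurableSpace Ω› :=
  iSup₂_le fun i _ => (hmeas i).comap_le

lemma measurable_mixSigma (X : ℤ → Ω → E) {S : Set ℤ} {i : ℤ} (hi : i ∈ S) :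
    Measurable[mixSigma X S] (X i) := by
  rw [measurable_iff_comap_le]
  exact le_iSup₂ (f := fun i (_ : i ∈ S) => MeasurableSpace.comap (X i) inferInstance) i hi

lemma abs_prob_inter_sub_le_alphaMix (P : Measure Ω) [IsProbabilityMeasure P] (X : ℤ → Ω → E)
    (i : ℤ) (k : ℕ) {A B : Set Ω} (hA : MeasurableSet[mixSigma X (Set.Iic i)] A)
    (hB : MeasurableSet[mixSigma X (Set.Ici (i + (k : ℤ)))] B) :
    |P.real (A ∩ B) - P.real A * P.real B| ≤ alphaMix P X k := by
  refine le_csSup ⟨1, ?_⟩ ⟨i, A, B, hA, hB, rfl⟩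
  rintro r ⟨_, A, B, _, _, rfl⟩
  have h1 : P.real (A ∩ B) ≤ 1 := measureReal_le_one
  have h2 : P.real A ≤ 1 := measureReal_le_one
  have h3 : P.real B ≤ 1 := measureReal_le_one
  have h4 : 0 ≤ P.real (A ∩ B) := measureReal_nonneg
  have h5 : 0 ≤ P.real A := measureReal_nonneg
  have h6 : 0 ≤ P.real B := measureReal_nonneg
  change |P.real (A ∩ B) - P.real A * P.real B| ≤ 1
  rw [abs_le]
  constructor <;> nlinarith [mul_nonneg h5 h6, mul_le_one₀ h2 h6 h3]

/-- Geometric bound for the dependence between past and future, valid at all lags. -/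
lemma ExpAlphaMixing.exists_bound {P : Measure Ω} [IsProbabilityMeasure P] {X : ℤ → Ω → E}
    (hmix : ExpAlphaMixing P X) :
    ∃ a ∈ Set.Ioo (0 : ℝ) 1, ∃ c : ℝ, 0 < c ∧ ∀ (i : ℤ) (k : ℕ) (A B : Set Ω),
      MeasurableSet[mixSigma X (Set.Iic i)] A →
      MeasurableSet[mixSigma X (Set.Ici (i + (k : ℤ)))] B →
      |P.real (A ∩ B) - P.real A * P.real B| ≤ c * a ^ k := by
  obtain ⟨a, ha, c, hc⟩ := hmix
  refine ⟨a, ha, max c 1, by positivity, fun i k A B hA hB => ?_⟩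
  rcases Nat.eq_zero_or_pos k with rfl | hk
  · have h1 : P.real (A ∩ B) ≤ 1 := measureReal_le_one
    have h2 : P.real A ≤ 1 := measureReal_le_one
    have h3 : P.real B ≤ 1 := measureReal_le_one
    have h4 : 0 ≤ P.real (A ∩ B) := measureReal_nonneg
    have h5 : 0 ≤ P.real A := measureReal_nonneg
    have h6 : 0 ≤ P.real B := measureReal_nonneg
    have : |P.real (A ∩ B) - P.real A * P.real B| ≤ 1 := by
      rw [abs_le]
      constructor <;> nlinarith [mul_nonneg h5 h6, mul_le_one₀ h2 h6 h3]
    simpa using this.trans (le_max_right c 1)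
  · refine (abs_prob_inter_sub_le_alphaMix P X i k hA hB).trans ((hc k hk).trans ?_)
    have := pow_nonneg ha.1.le k
    gcongr
    exact le_max_left _ _

/-- A one-sided version of the geometric mixing bound, for a fixed pair of constants. -/
def MixBound (P : Measure Ω) (X : ℤ → Ω → E) (a c : ℝ) : Prop :=
  0 < a ∧ a < 1 ∧ 0 < c ∧ ∀ (i : ℤ) (k : ℕ) (A B : Set Ω),
      MeasurableSet[mixSigma X (Set.Iic i)] A →
      MeasurableSet[mixSigma X (Set.Ici (i + (k : ℤ)))] B →
      |P.real (A ∩ B) - P.real A * P.real B| ≤ c * a ^ k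

lemma ExpAlphaMixing.exists_mixBound {P : Measure Ω} [IsProbabilityMeasure P] {X : ℤ → Ω → E}
    (hmix : ExpAlphaMixing P X) : ∃ a c, MixBound P X a c := by
  obtain ⟨a, ha, c, hc, h⟩ := hmix.exists_bound
  exact ⟨a, c, ha.1, ha.2, hc, h⟩

lemma StrictlyStationary.integral_shift {P : Measure Ω} {X : ℤ → Ω → E}
    (hstat : StrictlyStationary P X) (hmeas : ∀ i, Measurable (X i)) {G : Type*}
    [NormedAddCommGroup G] [NormedSpace ℝ G] [SecondCountableTopology G] [MeasurableSpace G]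
    [BorelSpace G] {m : ℕ} (idx : Fin m → ℤ) (k : ℤ)
    {F : (Fin m → E) → G} (hF : Measurable F) :
    ∫ ω, F (fun p => X (idx p + k) ω) ∂P = ∫ ω, F (fun p => X (idx p) ω) ∂P := by
  have h1 : Measurable fun ω (p : Fin m) => X (idx p + k) ω := by fun_prop
  have h2 : Measurable fun ω (p : Fin m) => X (idx p) ω := by fun_prop
  rw [← integral_map h1.aemeasurable hF.aestronglyMeasurable,
    ← integral_map h2.aemeasurable hF.aestronglyMeasurable, hstat m idx k]

lemma StrictlyStationary.integral_one {P : Measure Ω} {X : ℤ → Ω → E}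
    (hstat : StrictlyStationary P X) (hmeas : ∀ i, Measurable (X i))
    {φ : E → ℝ} (hφ : Measurable φ) (i : ℤ) :
    ∫ ω, φ (X i ω) ∂P = ∫ ω, φ (X 0 ω) ∂P := by
  have := hstat.integral_shift hmeas (m := 1) (fun _ => 0) i (F := fun x => φ (x 0))
    (hφ.comp (measurable_pi_apply 0))
  simpa using this

lemma StrictlyStationary.integral_two {P : Measure Ω} {X : ℤ → Ω → E}
    (hstat : StrictlyStationary P X) (hmeas : ∀ i, Measurable (X i))
    {φ ψ : E → ℝ} (hφ : Measurable φ) (hψ : Measurable ψ) (i j : ℤ) :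
    ∫ ω, φ (X i ω) * ψ (X j ω) ∂P = ∫ ω, φ (X 0 ω) * ψ (X (j - i) ω) ∂P := by
  have := hstat.integral_shift hmeas (m := 2) ![0, j - i] i (F := fun x => φ (x 0) * ψ (x 1))
    (by fun_prop)
  simpa using this

lemma integrable_of_abs_le {P : Measure Ω} [IsFiniteMeasure P] {f : Ω → ℝ} (hf : Measurable f)
    {M : ℝ} (hM : ∀ x, |f x| ≤ M) : Integrable f P :=
  Integrable.of_bound hf.aestronglyMeasurable M (ae_of_all _ hM)

lemma MixBound.abs_cov_le {P : Measure Ω} [IsProbabilityMeasure P] {X : ℤ → Ω → E} {a c : ℝ}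
    (h : MixBound P X a c) (hmeas : ∀ i, Measurable (X i)) {φ ψ : E → ℝ} (hφ : Measurable φ)
    (hψ : Measurable ψ) (hφ1 : ∀ x, |φ x| ≤ 1) (hψ1 : ∀ x, |ψ x| ≤ 1) (i j : ℤ) :
    |∫ ω, φ (X i ω) * ψ (X j ω) ∂P - (∫ ω, φ (X i ω) ∂P) * ∫ ω, ψ (X j ω) ∂P|
      ≤ 4 * (c * a ^ (j - i).natAbs) := by
  rcases le_total i j with hij | hij
  · refine abs_cov_le_of_bounded P (mixSigma_le hmeas (Iic i))
      (mixSigma_le hmeas (Ici (i + ((j - i).natAbs : ℤ)))) (h.2.2.2 i _)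
      (hφ.comp (measurable_mixSigma X (i := i) (by simp)))
      (hψ.comp (measurable_mixSigma X (i := j) (mem_Ici.2 (by omega)))) (fun _ => hφ1 _) (fun _ => hψ1 _)
  · have := abs_cov_le_of_bounded P (mixSigma_le hmeas (Iic j))
      (mixSigma_le hmeas (Ici (j + ((j - i).natAbs : ℤ)))) (h.2.2.2 j _)
      (hψ.comp (measurable_mixSigma X (i := j) (by simp)))
      (hφ.comp (measurable_mixSigma X (i := i) (mem_Ici.2 (by omega)))) (fun _ => hψ1 _) (fun _ => hφ1 _)
    simpa [Function.comp_def, mul_comm] using this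

lemma summable_pow_natAbs {b : ℝ} (h0 : 0 ≤ b) (h1 : b < 1) :
    Summable fun k : ℤ => b ^ k.natAbs := by
  refine Summable.of_nat_of_neg ?_ ?_ <;> simpa using summable_geometric_of_lt_one h0 h1

lemma sum_pow_natAbs_le {b : ℝ} (h0 : 0 ≤ b) (h1 : b < 1) (I : Finset ℤ) (i : ℤ) :
    ∑ j ∈ I, b ^ (j - i).natAbs ≤ ∑' k : ℤ, b ^ k.natAbs := by
  have := (summable_pow_natAbs h0 h1).sum_le_tsum (I.map (Equiv.subRight i).toEmbedding)
    (fun _ _ => by positivity)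
  simpa using this

lemma integral_sum_mul_sum {P : Measure Ω} {f g : ℤ → Ω → ℝ} (I J : Finset ℤ)
    (h : ∀ i j, Integrable (fun ω => f i ω * g j ω) P) :
    ∫ ω, (∑ i ∈ I, f i ω) * (∑ j ∈ J, g j ω) ∂P = ∑ i ∈ I, ∑ j ∈ J, ∫ ω, f i ω * g j ω ∂P := by
  simp_rw [Finset.sum_mul_sum]
  rw [integral_finsetSum _ fun i _ => integrable_finsetSum _ fun j _ => h i j]
  exact Finset.sum_congr rfl fun i _ => integral_finsetSum _ fun j _ => h i j

/-- Covariance of the centred variables in terms of uncentred moments. -/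
lemma integral_centered_mul {P : Measure Ω} [IsProbabilityMeasure P] {f g : Ω → ℝ}
    (hf : Integrable f P) (hg : Integrable g P) (hfg : Integrable (fun ω => f ω * g ω) P) {m m' : ℝ}
    (hm : ∫ ω, f ω ∂P = m) (hm' : ∫ ω, g ω ∂P = m') :
    ∫ ω, (f ω - m) * (g ω - m') ∂P = ∫ ω, f ω * g ω ∂P - m * m' := by
  have : ∀ ω, (f ω - m) * (g ω - m') = f ω * g ω - f ω * m' - m * g ω + m * m' := fun ω => by ring
  simp_rw [this]
  have i1 : Integrable (fun ω => f ω * m') P := hf.mul_const _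
  have i2 : Integrable (fun ω => m * g ω) P := hg.const_mul _
  have i3 : Integrable (fun ω => f ω * g ω - f ω * m') P := hfg.sub i1
  have i4 : Integrable (fun ω => f ω * g ω - f ω * m' - m * g ω) P := i3.sub i2
  rw [integral_add i4 (integrable_const _), integral_sub i3 i2, integral_sub hfg i1,
    integral_mul_const, integral_const_mul, hm, hm']
  simp

/-- Variance bound for partial sums: the variance grows linearly, with a constant controlled by a
power (less than one) of the first absolute moment of the summands. -/
lemma exists_variance_bound {P : Measure Ω} [IsProbabilityMeasure P] {X : ℤ → Ω → E}
    (hmeas : ∀ i, Measurable (X i)) (hstat : StrictlyStationary P X) (hmix : ExpAlphaMixing P X)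
    {κ : ℝ} (hκ0 : 0 < κ) (hκ : κ < 1 / 2) :
    ∃ C : ℝ, 0 < C ∧ ∀ φ : E → ℝ, Measurable φ → (∀ x, |φ x| ≤ 1) → ∀ I : Finset ℤ,
      ∫ ω, (∑ i ∈ I, (φ (X i ω) - ∫ ω', φ (X 0 ω') ∂P)) ^ 2 ∂P
        ≤ C * I.card * (∫ ω, |φ (X 0 ω)| ∂P) ^ (2 * κ) := by
  obtain ⟨a, c, hac⟩ := hmix.exists_mixBound
  obtain ⟨ha0, ha1, hc, -⟩ := id hac
  have hθ : 0 < 1 - 2 * κ := by linarith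
  set b := a ^ (1 - 2 * κ) with hb
  have hb0 : 0 ≤ b := by positivity
  have hb1 : b < 1 := Real.rpow_lt_one ha0.le ha1 hθ
  have hS : 1 ≤ ∑' k : ℤ, b ^ k.natAbs := by
    simpa using sum_pow_natAbs_le hb0 hb1 {0} 0
  refine ⟨(4 * c) ^ (1 - 2 * κ) * 2 ^ (2 * κ) * ∑' k : ℤ, b ^ k.natAbs, by positivity,
    fun φ hφ hφ1 I => ?_⟩
  set m := ∫ ω', φ (X 0 ω') ∂P with hm
  set ρ := ∫ ω', |φ (X 0 ω')| ∂P with hρ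
  have hρ0 : 0 ≤ ρ := integral_nonneg fun _ => abs_nonneg _
  have hi : ∀ i, Integrable (fun ω => φ (X i ω)) P := fun i =>
    integrable_of_abs_le (hφ.comp (hmeas i)) fun _ => hφ1 _
  have hij : ∀ i j, Integrable (fun ω => φ (X i ω) * φ (X j ω)) P := fun i j =>
    integrable_of_abs_le (M := 1) ((hφ.comp (hmeas i)).mul (hφ.comp (hmeas j))) fun _ => by
      rw [abs_mul]; exact mul_le_one₀ (hφ1 _) (abs_nonneg _) (hφ1 _)
  have hmi : ∀ i, ∫ ω, φ (X i ω) ∂P = m := fun i => hstat.integral_one hmeas hφ i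
  have hmabs : |m| ≤ ρ := abs_integral_le_integral_abs
  have hρ1 : ρ ≤ 1 := by
    refine (integral_mono (hi 0).abs (integrable_const 1) fun ω => hφ1 _).trans (by simp)
  have hm2 : |m * m| ≤ ρ := by
    rw [abs_mul]
    calc |m| * |m| ≤ ρ * 1 := mul_le_mul hmabs (hmabs.trans hρ1) (abs_nonneg _) hρ0
      _ = ρ := mul_one _
  have hcov : ∀ i j, |∫ ω, φ (X i ω) * φ (X j ω) ∂P - m * m| ≤
      (4 * c) ^ (1 - 2 * κ) * 2 ^ (2 * κ) * ρ ^ (2 * κ) * b ^ (j - i).natAbs := by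
    intro i j
    have h1 := hac.abs_cov_le hmeas hφ hφ hφ1 hφ1 i j
    rw [hmi, hmi] at h1
    have h2 : |∫ ω, φ (X i ω) * φ (X j ω) ∂P - m * m| ≤ 2 * ρ := by
      have : |∫ ω, φ (X i ω) * φ (X j ω) ∂P| ≤ ρ := by
        refine abs_integral_le_integral_abs.trans ?_
        rw [hρ, ← hstat.integral_one hmeas hφ.abs i]
        refine integral_mono (hij i j).abs (hi i).abs fun ω => ?_
        simp only [abs_mul]
        exact mul_le_of_le_one_right (abs_nonneg _) (hφ1 _)
      refine (abs_sub _ _).trans (by linarith)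
    set y := |∫ ω, φ (X i ω) * φ (X j ω) ∂P - m * m| with hy
    have hy0 : 0 ≤ y := abs_nonneg _
    calc y = y ^ (1 - 2 * κ) * y ^ (2 * κ) := by
          rw [← Real.rpow_add_of_nonneg hy0 hθ.le (by linarith)]; simp
      _ ≤ (4 * (c * a ^ (j - i).natAbs)) ^ (1 - 2 * κ) * (2 * ρ) ^ (2 * κ) := by gcongr
      _ = _ := by
          rw [← mul_assoc, Real.mul_rpow (by positivity) (by positivity),
            Real.mul_rpow (by positivity) hρ0, hb, ← Real.rpow_natCast (a ^ (1 - 2 * κ)),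
            ← Real.rpow_mul ha0.le, mul_comm (1 - 2 * κ), Real.rpow_mul ha0.le, Real.rpow_natCast]
          ring
  simp_rw [sq]
  have hci : ∀ i j, Integrable (fun ω => (φ (X i ω) - m) * (φ (X j ω) - m)) P := fun i j => by
    refine integrable_of_abs_le (M := 4)
      (((hφ.comp (hmeas i)).sub_const m).mul ((hφ.comp (hmeas j)).sub_const m)) fun ω => ?_
    have := (abs_sub (φ (X i ω)) m).trans (add_le_add (hφ1 _) (hmabs.trans hρ1))
    have := (abs_sub (φ (X j ω)) m).trans (add_le_add (hφ1 _) (hmabs.trans hρ1))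
    rw [abs_mul]
    nlinarith [abs_nonneg (φ (X i ω) - m), abs_nonneg (φ (X j ω) - m)]
  rw [integral_sum_mul_sum (f := fun i ω => φ (X i ω) - m) (g := fun i ω => φ (X i ω) - m) I I hci]
  calc ∑ i ∈ I, ∑ j ∈ I, ∫ ω, (φ (X i ω) - m) * (φ (X j ω) - m) ∂P
      ≤ ∑ i ∈ I, ∑ j ∈ I,
          (4 * c) ^ (1 - 2 * κ) * 2 ^ (2 * κ) * ρ ^ (2 * κ) * b ^ (j - i).natAbs := by
        refine Finset.sum_le_sum fun i _ => Finset.sum_le_sum fun j _ => ?_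
        rw [integral_centered_mul (hi i) (hi j) (hij i j) (hmi i) (hmi j)]
        exact (le_abs_self _).trans (hcov i j)
    _ ≤ ∑ i ∈ I, (4 * c) ^ (1 - 2 * κ) * 2 ^ (2 * κ) * ρ ^ (2 * κ) *
          ∑' k : ℤ, b ^ k.natAbs := by
        refine Finset.sum_le_sum fun i _ => ?_
        rw [← Finset.mul_sum]
        gcongr
        exact sum_pow_natAbs_le hb0 hb1 I i
    _ = _ := by rw [Finset.sum_const, nsmul_eq_mul]; ring

lemma tendsto_overlap_count (k : ℤ) :
    Tendsto (fun n : ℕ => (n : ℝ)⁻¹ * ((Finset.Icc (1 : ℤ) n).filter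
      (fun i => i + k ∈ Finset.Icc (1 : ℤ) n)).card) atTop (nhds 1) := by
  have hlow : ∀ n : ℕ, (n : ℝ) - k.natAbs ≤ ((Finset.Icc (1 : ℤ) n).filter
      (fun i => i + k ∈ Finset.Icc (1 : ℤ) n)).card := by
    intro n
    have h1 := Finset.card_filter_add_card_filter_not (s := Finset.Icc (1 : ℤ) n)
      (fun i => i + k ∈ Finset.Icc (1 : ℤ) n)
    have h2 : ((Finset.Icc (1 : ℤ) n).filter (fun i => ¬ (i + k ∈ Finset.Icc (1 : ℤ) n))).card
        ≤ k.natAbs := by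
      rcases le_total 0 k with hk | hk
      · refine (Finset.card_le_card (t := Finset.Ioc ((n : ℤ) - k) n) fun i hi => ?_).trans ?_
        · simp only [Finset.mem_filter, Finset.mem_Icc, Finset.mem_Ioc] at hi ⊢; omega
        · rw [Int.card_Ioc]; omega
      · refine (Finset.card_le_card (t := Finset.Icc (1 : ℤ) (-k)) fun i hi => ?_).trans ?_
        · simp only [Finset.mem_filter, Finset.mem_Icc] at hi ⊢; omega
        · rw [Int.card_Icc]; omega
    have h3 : (Finset.Icc (1 : ℤ) n).card = n := by simp
    rw [h3] at h1
    have : (n : ℝ) ≤ ((Finset.Icc (1 : ℤ) n).filter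
      (fun i => i + k ∈ Finset.Icc (1 : ℤ) n)).card + k.natAbs := by
      exact_mod_cast (by omega)
    linarith
  have hup : ∀ n : ℕ, (((Finset.Icc (1 : ℤ) n).filter
      (fun i => i + k ∈ Finset.Icc (1 : ℤ) n)).card : ℝ) ≤ n := by
    intro n
    have := Finset.card_filter_le (Finset.Icc (1 : ℤ) n) (fun i => i + k ∈ Finset.Icc (1 : ℤ) n)
    have h3 : (Finset.Icc (1 : ℤ) n).card = n := by simp
    rw [h3] at this
    exact_mod_cast this
  have hlim : Tendsto (fun n : ℕ => 1 - (k.natAbs : ℝ) * (n : ℝ)⁻¹) atTop (nhds 1) := by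
    have := (tendsto_inv_atTop_nhds_zero_nat (𝕜 := ℝ)).const_mul (k.natAbs : ℝ)
    simpa using this.const_sub 1
  refine tendsto_of_tendsto_of_tendsto_of_le_of_le' hlim tendsto_const_nhds ?_ ?_
  · filter_upwards [eventually_gt_atTop 0] with n hn
    have hn' : (0 : ℝ) < n := by exact_mod_cast hn
    have := mul_le_mul_of_nonneg_left (hlow n) (inv_nonneg.2 hn'.le)
    rw [mul_sub, inv_mul_cancel₀ hn'.ne'] at this
    linarith
  · filter_upwards [eventually_gt_atTop 0] with n hn
    have hn' : (0 : ℝ) < n := by exact_mod_cast hn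
    have := mul_le_mul_of_nonneg_left (hup n) (inv_nonneg.2 hn'.le)
    rwa [inv_mul_cancel₀ hn'.ne'] at this

lemma tendsto_cesaro_of_summable {γ : ℤ → ℝ} (hγ : Summable γ) :
    Tendsto (fun n : ℕ => (n : ℝ)⁻¹ * ∑ i ∈ Finset.Icc (1 : ℤ) n, ∑ j ∈ Finset.Icc (1 : ℤ) n,
      γ (j - i)) atTop (nhds (∑' k, γ k)) := by
  have key : ∀ n : ℕ, (n : ℝ)⁻¹ * ∑ i ∈ Finset.Icc (1 : ℤ) n, ∑ j ∈ Finset.Icc (1 : ℤ) n,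
      γ (j - i) = ∑' k, (n : ℝ)⁻¹ * ((Finset.Icc (1 : ℤ) n).filter
      (fun i => i + k ∈ Finset.Icc (1 : ℤ) n)).card * γ k := by
    intro n
    have h1 : ∀ i : ℤ, ∑ j ∈ Finset.Icc (1 : ℤ) n, γ (j - i)
        = ∑' k, if i + k ∈ Finset.Icc (1 : ℤ) n then γ k else 0 := by
      intro i
      rw [← Equiv.tsum_eq (Equiv.subRight i)
        (fun k => if i + k ∈ Finset.Icc (1 : ℤ) n then γ k else 0)]
      rw [tsum_eq_sum (s := Finset.Icc (1 : ℤ) n)]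
      · refine Finset.sum_congr rfl fun j hj => ?_
        simp only [Equiv.subRight_apply, add_sub_cancel]
        rw [if_pos hj]
      · intro j hj
        simp only [Equiv.subRight_apply, add_sub_cancel]
        rw [if_neg hj]
    have hs : ∀ i : ℤ, Summable fun k => if i + k ∈ Finset.Icc (1 : ℤ) n then γ k else 0 := by
      intro i
      refine Summable.of_norm_bounded hγ.norm fun k => ?_
      split_ifs <;> simp
    simp_rw [h1]
    rw [← Summable.tsum_finsetSum fun i _ => hs i, ← tsum_mul_left]
    refine tsum_congr fun k => ?_
    rw [← Finset.sum_filter, Finset.sum_const, nsmul_eq_mul, mul_assoc]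
  simp_rw [key]
  refine tendsto_tsum_of_dominated_convergence (bound := fun k => ‖γ k‖) hγ.norm ?_ ?_
  · intro k
    simpa using (tendsto_overlap_count k).mul_const (γ k)
  · refine Eventually.of_forall fun n k => ?_
    have h3 : ((Finset.Icc (1 : ℤ) n).filter
      (fun i => i + k ∈ Finset.Icc (1 : ℤ) n)).card ≤ n := by
      refine (Finset.card_filter_le _ _).trans (by simp)
    have h4 : (n : ℝ)⁻¹ * ((Finset.Icc (1 : ℤ) n).filter
      (fun i => i + k ∈ Finset.Icc (1 : ℤ) n)).card ≤ 1 := by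
      rcases Nat.eq_zero_or_pos n with rfl | hn
      · simp
      · have hn' : (0 : ℝ) < n := by exact_mod_cast hn
        rw [inv_mul_le_one₀ hn']
        exact_mod_cast h3
    rw [norm_mul, Real.norm_eq_abs, abs_of_nonneg (by positivity)]
    exact mul_le_of_le_one_left (norm_nonneg _) h4

lemma MixBound.summable_cov {P : Measure Ω} [IsProbabilityMeasure P] {X : ℤ → Ω → E} {a c : ℝ}
    (h : MixBound P X a c) (hmeas : ∀ i, Measurable (X i)) (hstat : StrictlyStationary P X)
    {φ ψ : E → ℝ} (hφ : Measurable φ)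
    (hψ : Measurable ψ) (hφ1 : ∀ x, |φ x| ≤ 1) (hψ1 : ∀ x, |ψ x| ≤ 1) :
    Summable fun k : ℤ => ∫ ω, φ (X 0 ω) * ψ (X k ω) ∂P
      - (∫ ω, φ (X 0 ω) ∂P) * ∫ ω, ψ (X 0 ω) ∂P := by
  refine Summable.of_norm_bounded (g := fun k : ℤ => 4 * c * a ^ k.natAbs)
    ((summable_pow_natAbs h.1.le h.2.1).mul_left _) fun k => ?_
  have := h.abs_cov_le hmeas hφ hψ hφ1 hψ1 0 k
  rw [hstat.integral_one hmeas hψ k, sub_zero] at this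
  rw [Real.norm_eq_abs]; linarith

/-- Limit of the covariance of normalised partial sums. -/
lemma tendsto_cov_partial_sums {P : Measure Ω} [IsProbabilityMeasure P] {X : ℤ → Ω → E}
    (hmeas : ∀ i, Measurable (X i)) (hstat : StrictlyStationary P X) (hmix : ExpAlphaMixing P X)
    {φ ψ : E → ℝ} (hφ : Measurable φ)
    (hψ : Measurable ψ) (hφ1 : ∀ x, |φ x| ≤ 1) (hψ1 : ∀ x, |ψ x| ≤ 1) :
    Tendsto (fun n : ℕ => (n : ℝ)⁻¹ * ∫ ω,
      (∑ i ∈ Finset.Icc (1 : ℤ) n, (φ (X i ω) - ∫ ω', φ (X 0 ω') ∂P)) *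
      (∑ i ∈ Finset.Icc (1 : ℤ) n, (ψ (X i ω) - ∫ ω', ψ (X 0 ω') ∂P)) ∂P) atTop
      (nhds (∑' k : ℤ, (∫ ω, φ (X 0 ω) * ψ (X k ω) ∂P
        - (∫ ω, φ (X 0 ω) ∂P) * ∫ ω, ψ (X 0 ω) ∂P))) := by
  obtain ⟨a, c, hac⟩ := hmix.exists_mixBound
  refine (tendsto_cesaro_of_summable (hac.summable_cov hmeas hstat hφ hψ hφ1 hψ1)).congr fun n => ?_
  congr 1
  have bi : ∀ {φ : E → ℝ}, Measurable φ → (∀ x, |φ x| ≤ 1) → ∀ i,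
      Integrable (fun ω => φ (X i ω)) P := fun hm hb i =>
    integrable_of_abs_le (hm.comp (hmeas i)) fun _ => hb _
  have hij : ∀ i j, Integrable (fun ω => φ (X i ω) * ψ (X j ω)) P := fun i j =>
    integrable_of_abs_le (M := 1) ((hφ.comp (hmeas i)).mul (hψ.comp (hmeas j))) fun _ => by
      rw [abs_mul]; exact mul_le_one₀ (hφ1 _) (abs_nonneg _) (hψ1 _)
  rw [integral_sum_mul_sum (f := fun i ω => φ (X i ω) - ∫ ω', φ (X 0 ω') ∂P)
    (g := fun i ω => ψ (X i ω) - ∫ ω', ψ (X 0 ω') ∂P)]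
  · refine Finset.sum_congr rfl fun i _ => Finset.sum_congr rfl fun j _ => ?_
    rw [integral_centered_mul (bi hφ hφ1 i) (bi hψ hψ1 j) (hij i j)
      (hstat.integral_one hmeas hφ i) (hstat.integral_one hmeas hψ j),
      hstat.integral_two hmeas hφ hψ i j]
  · intro i j
    have e : ∀ ω, (φ (X i ω) - ∫ ω', φ (X 0 ω') ∂P) * (ψ (X j ω) - ∫ ω', ψ (X 0 ω') ∂P)
      = φ (X i ω) * ψ (X j ω) - φ (X i ω) * (∫ ω', ψ (X 0 ω') ∂P)
        - (∫ ω', φ (X 0 ω') ∂P) * ψ (X j ω)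
        + (∫ ω', φ (X 0 ω') ∂P) * (∫ ω', ψ (X 0 ω') ∂P) := fun ω => by ring
    simp_rw [e]
    exact (((hij i j).sub ((bi hφ hφ1 i).mul_const _)).sub ((bi hψ hψ1 j).const_mul _)).add
      (integrable_const _)

end

/-! ### Block sums -/

section

/-- Sum of `φ (X i)` over the `p` consecutive indices following `s`. -/
def blockSum (φ : E → ℝ) (X : ℤ → Ω → E) (p s : ℕ) (ω : Ω) : ℝ :=
  ∑ r ∈ Finset.range p, φ (X ((s : ℤ) + 1 + (r : ℤ)) ω)

lemma measurable_blockSum {X : ℤ → Ω → E} (hmeas : ∀ i, Measurable (X i)) {φ : E → ℝ}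
    (hφ : Measurable φ) (p s : ℕ) : Measurable (blockSum φ X p s) :=
  Finset.measurable_fun_sum _ fun _ _ => hφ.comp (hmeas _)

lemma measurable_blockSum_mixSigma {X : ℤ → Ω → E} {φ : E → ℝ} (hφ : Measurable φ) {p s : ℕ}
    {S : Set ℤ} (hS : ∀ r : ℕ, r < p → (s : ℤ) + 1 + r ∈ S) :
    Measurable[mixSigma X S] (blockSum φ X p s) :=
  Finset.measurable_fun_sum _ fun r hr =>
    hφ.comp (measurable_mixSigma X (hS r (Finset.mem_range.1 hr)))

lemma abs_blockSum_le {X : ℤ → Ω → E} {φ : E → ℝ} (hφ1 : ∀ x, |φ x| ≤ 1) (p s : ℕ) (ω : Ω) :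
    |blockSum φ X p s ω| ≤ p := by
  refine (Finset.abs_sum_le_sum_abs _ _).trans ?_
  refine (Finset.sum_le_sum fun r _ => hφ1 _).trans ?_
  simp

lemma norm_prod_integral_sub_pow_le {P : Measure Ω} [IsProbabilityMeasure P] {X : ℤ → Ω → E}
    (hmeas : ∀ i, Measurable (X i)) (hstat : StrictlyStationary P X) {a c : ℝ}
    (hac : MixBound P X a c) {φ : E → ℝ} (hφ : Measurable φ) (p q : ℕ) (τ : ℝ) (m : ℕ) :
    ‖∫ ω, ∏ j ∈ Finset.range m,
          Complex.exp (Complex.I * ((τ * blockSum φ X p (j * (p + q)) ω : ℝ) : ℂ)) ∂P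
        - (∫ ω, Complex.exp (Complex.I * ((τ * blockSum φ X p 0 ω : ℝ) : ℂ)) ∂P) ^ m‖
      ≤ m * (16 * (c * a ^ q)) := by
  have hexp : Measurable fun x : ℝ => Complex.exp (Complex.I * ((τ * x : ℝ) : ℂ)) := by fun_prop
  have hshift : ∀ s : ℕ, ∫ ω, Complex.exp (Complex.I * ((τ * blockSum φ X p s ω : ℝ) : ℂ)) ∂P
      = ∫ ω, Complex.exp (Complex.I * ((τ * blockSum φ X p 0 ω : ℝ) : ℂ)) ∂P := by
    intro s
    have := hstat.integral_shift hmeas (fun r : Fin p => (1 : ℤ) + (r : ℤ)) (s : ℤ)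
      (F := fun x : Fin p → E => Complex.exp (Complex.I * ((τ * ∑ r, φ (x r) : ℝ) : ℂ)))
      (hexp.comp (Finset.measurable_fun_sum _ fun r _ => hφ.comp (measurable_pi_apply r)))
    have hb : ∀ (s : ℕ) ω, blockSum φ X p s ω = ∑ r : Fin p, φ (X (1 + (r : ℤ) + s) ω) := by
      intro s ω
      rw [blockSum, Finset.sum_range]
      refine Finset.sum_congr rfl fun r _ => ?_
      congr 2; ring
    simp_rw [hb]
    simpa using this
  have hnorm : ∀ x : ℝ, ‖Complex.exp (Complex.I * (x : ℂ))‖ ≤ 1 := fun x =>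
    (Complex.norm_exp_I_mul_ofReal x).le
  induction m with
  | zero => simp
  | succ m ih =>
    have hprodn : ∀ ω, ‖∏ j ∈ Finset.range m,
        Complex.exp (Complex.I * ((τ * blockSum φ X p (j * (p + q)) ω : ℝ) : ℂ))‖ ≤ 1 := by
      intro ω
      rw [norm_prod]
      exact Finset.prod_le_one (fun _ _ => norm_nonneg _) fun _ _ => hnorm _
    set N : ℤ := (m * (p + q) : ℕ) - (q : ℤ) with hN
    have key := norm_cov_le_of_bounded P (mixSigma_le hmeas (Iic N))
      (mixSigma_le hmeas (Ici (N + (q : ℤ)))) (hac.2.2.2 N q)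
      (f := fun ω => ∏ j ∈ Finset.range m,
        Complex.exp (Complex.I * ((τ * blockSum φ X p (j * (p + q)) ω : ℝ) : ℂ)))
      (g := fun ω => Complex.exp (Complex.I * ((τ * blockSum φ X p (m * (p + q)) ω : ℝ) : ℂ)))
      (by
        refine Finset.measurable_fun_prod _ fun j hj => hexp.comp ?_
        refine measurable_blockSum_mixSigma hφ fun r hr => mem_Iic.2 ?_
        have h1 : (j + 1) * (p + q) ≤ m * (p + q) :=
          Nat.mul_le_mul_right _ (Finset.mem_range.1 hj)
        have h2 : (j + 1) * (p + q) = j * (p + q) + (p + q) := by ring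
        omega)
      (hexp.comp (measurable_blockSum_mixSigma hφ fun r hr => mem_Ici.2 (by omega)))
      hprodn (fun _ => hnorm _)
    simp_rw [Finset.prod_range_succ]
    set F := ∫ ω, Complex.exp (Complex.I * ((τ * blockSum φ X p 0 ω : ℝ) : ℂ)) ∂P with hF
    have hF1 : ‖F‖ ≤ 1 := by
      refine (norm_integral_le_of_norm_le_const (ae_of_all _ fun ω => hnorm _)).trans ?_
      simp
    rw [hshift] at key
    set G := ∫ ω, ∏ j ∈ Finset.range m,
        Complex.exp (Complex.I * ((τ * blockSum φ X p (j * (p + q)) ω : ℝ) : ℂ)) ∂P with hG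
    set H := ∫ ω, (∏ j ∈ Finset.range m,
        Complex.exp (Complex.I * ((τ * blockSum φ X p (j * (p + q)) ω : ℝ) : ℂ))) *
        Complex.exp (Complex.I * ((τ * blockSum φ X p (m * (p + q)) ω : ℝ) : ℂ)) ∂P with hH
    calc ‖H - F ^ (m + 1)‖ = ‖(H - G * F) + (G - F ^ m) * F‖ := by congr 1; ring
      _ ≤ ‖H - G * F‖ + ‖(G - F ^ m)‖ * ‖F‖ := (norm_add_le _ _).trans (by rw [norm_mul])
      _ ≤ 16 * (c * a ^ q) + m * (16 * (c * a ^ q)) * 1 := by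
          gcongr
          exact (norm_nonneg _).trans ih
      _ = _ := by push_cast; ring

lemma norm_integral_exp_sub_le {P : Measure Ω} [IsProbabilityMeasure P] {B : Ω → ℝ}
    (hB : Measurable B) {M τ : ℝ} (hM : ∀ ω, |B ω| ≤ M) (hτ : |τ| * M ≤ 1)
    (h0 : ∫ ω, B ω ∂P = 0) :
    ‖∫ ω, Complex.exp (Complex.I * ((τ * B ω : ℝ) : ℂ)) ∂P
        - (Real.exp (-(τ ^ 2 * (∫ ω, B ω ^ 2 ∂P) / 2)) : ℝ)‖
      ≤ |τ| ^ 3 * M * ∫ ω, B ω ^ 2 ∂P + (τ ^ 2 * (∫ ω, B ω ^ 2 ∂P) / 2) ^ 2 := by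
  obtain ⟨ω₀⟩ : Nonempty Ω := P.nonempty_of_neZero
  have hM0 : 0 ≤ M := (abs_nonneg _).trans (hM ω₀)
  have hB2 : ∀ ω, |B ω ^ 2| ≤ M ^ 2 := fun ω => by
    rw [abs_pow]; exact pow_le_pow_left₀ (abs_nonneg _) (hM ω) 2
  have iB := integrable_of_abs_le (P := P) hB hM
  have iB2 := integrable_of_abs_le (P := P) (hB.pow_const 2) hB2
  set V := ∫ ω, B ω ^ 2 ∂P with hV
  have hV0 : 0 ≤ V := integral_nonneg fun ω => sq_nonneg _
  have hVM : V ≤ M ^ 2 := by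
    calc V ≤ ∫ _, M ^ 2 ∂P := integral_mono iB2 (integrable_const _) fun ω =>
            (le_abs_self _).trans (hB2 ω)
      _ = _ := by simp
  have hpt : ∀ ω, ‖Complex.exp (Complex.I * ((τ * B ω : ℝ) : ℂ))
      - (1 + Complex.I * ((τ * B ω : ℝ) : ℂ) - ((τ ^ 2 * B ω ^ 2 / 2 : ℝ) : ℂ))‖
      ≤ |τ| ^ 3 * M * B ω ^ 2 := by
    intro ω
    have hn : ‖Complex.I * ((τ * B ω : ℝ) : ℂ)‖ = |τ| * |B ω| := by
      rw [norm_mul, Complex.norm_I, one_mul, Complex.norm_real, Real.norm_eq_abs, abs_mul]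
    have h1 : ‖Complex.I * ((τ * B ω : ℝ) : ℂ)‖ ≤ 1 := by
      rw [hn]; exact (mul_le_mul_of_nonneg_left (hM ω) (abs_nonneg _)).trans hτ
    have := Complex.exp_bound h1 (n := 3) (by norm_num)
    rw [hn] at this
    simp only [Finset.sum_range_succ, Finset.sum_range_zero, Nat.factorial] at this
    have e : (0 : ℂ) + (Complex.I * ((τ * B ω : ℝ) : ℂ)) ^ 0 / ((1 : ℕ) : ℂ)
        + (Complex.I * ((τ * B ω : ℝ) : ℂ)) ^ 1 / (((0 + 1) * 1 : ℕ) : ℂ)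
        + (Complex.I * ((τ * B ω : ℝ) : ℂ)) ^ 2 / (((1 + 1) * ((0 + 1) * 1) : ℕ) : ℂ)
        = 1 + Complex.I * ((τ * B ω : ℝ) : ℂ) - ((τ ^ 2 * B ω ^ 2 / 2 : ℝ) : ℂ) := by
      push_cast
      rw [mul_pow Complex.I _ 2, Complex.I_sq]; ring
    rw [e] at this
    refine this.trans ?_
    have h3 : |B ω| ^ 3 ≤ M * B ω ^ 2 := by
      rw [← sq_abs (B ω)]
      nlinarith [hM ω, sq_nonneg |B ω|]
    calc (|τ| * |B ω|) ^ 3 * _ ≤ (|τ| * |B ω|) ^ 3 * 1 := by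
            gcongr; norm_num
      _ = |τ| ^ 3 * |B ω| ^ 3 := by ring
      _ ≤ |τ| ^ 3 * (M * B ω ^ 2) := by gcongr
      _ = _ := by ring
  have iexp : Integrable (fun ω => Complex.exp (Complex.I * ((τ * B ω : ℝ) : ℂ))) P :=
    Integrable.of_bound (by fun_prop) 1
      (ae_of_all _ fun ω => (Complex.norm_exp_I_mul_ofReal _).le)
  have i1 : Integrable (fun ω => Complex.I * ((τ * B ω : ℝ) : ℂ)) P :=
    ((iB.const_mul τ).ofReal).const_mul _
  have i2 : Integrable (fun ω => ((τ ^ 2 * B ω ^ 2 / 2 : ℝ) : ℂ)) P :=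
    ((iB2.const_mul (τ ^ 2)).div_const 2).ofReal
  have i12 : Integrable (fun ω => 1 + Complex.I * ((τ * B ω : ℝ) : ℂ)) P :=
    (integrable_const _).add i1
  have i3 : Integrable (fun ω => 1 + Complex.I * ((τ * B ω : ℝ) : ℂ)
      - ((τ ^ 2 * B ω ^ 2 / 2 : ℝ) : ℂ)) P := i12.sub i2
  have hint : ∫ ω, (1 + Complex.I * ((τ * B ω : ℝ) : ℂ) - ((τ ^ 2 * B ω ^ 2 / 2 : ℝ) : ℂ)) ∂P
      = ((1 - τ ^ 2 * V / 2 : ℝ) : ℂ) := by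
    have e1 : ∫ ω, Complex.I * ((τ * B ω : ℝ) : ℂ) ∂P = 0 := by
      rw [integral_const_mul, integral_complex_ofReal, integral_const_mul, h0]; simp
    have e2 : ∫ ω, ((τ ^ 2 * B ω ^ 2 / 2 : ℝ) : ℂ) ∂P = ((τ ^ 2 * V / 2 : ℝ) : ℂ) := by
      rw [integral_complex_ofReal, integral_div, integral_const_mul]
    rw [integral_sub i12 i2, integral_add (integrable_const _) i1, e1, e2]
    simp
  have hA : ‖∫ ω, Complex.exp (Complex.I * ((τ * B ω : ℝ) : ℂ)) ∂P - ((1 - τ ^ 2 * V / 2 : ℝ) : ℂ)‖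
      ≤ |τ| ^ 3 * M * V := by
    rw [← hint, ← integral_sub iexp i3]
    refine (norm_integral_le_of_norm_le (iB2.const_mul (|τ| ^ 3 * M)) (ae_of_all _ hpt)).trans ?_
    rw [integral_const_mul]
  set v := τ ^ 2 * V / 2 with hv
  have hv0 : 0 ≤ v := by positivity
  have hv1 : v ≤ 1 := by
    have : τ ^ 2 * V ≤ (|τ| * M) ^ 2 := by
      rw [mul_pow, sq_abs]; gcongr
    have : (|τ| * M) ^ 2 ≤ 1 := pow_le_one₀ (by positivity) hτ
    rw [hv]; linarith
  have hB' : ‖((1 - v : ℝ) : ℂ) - (Real.exp (-v) : ℝ)‖ ≤ v ^ 2 := by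
    rw [← Complex.ofReal_sub, Complex.norm_real, Real.norm_eq_abs, abs_sub_comm]
    have := Real.abs_exp_sub_one_sub_id_le (x := -v) (by rw [abs_neg, abs_of_nonneg hv0]; exact hv1)
    convert this using 1
    · congr 1; ring
    · ring
  exact (norm_sub_le_norm_sub_add_norm_sub _ _ _).trans (add_le_add hA hB')

lemma norm_pow_sub_pow_le_mul {z w : ℂ} (hz : ‖z‖ ≤ 1) (hw : ‖w‖ ≤ 1) (k : ℕ) :
    ‖z ^ k - w ^ k‖ ≤ k * ‖z - w‖ := by
  induction k with
  | zero => simp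
  | succ k ih =>
    calc ‖z ^ (k + 1) - w ^ (k + 1)‖ = ‖(z ^ k - w ^ k) * z + w ^ k * (z - w)‖ := by
          congr 1; ring
      _ ≤ ‖z ^ k - w ^ k‖ * ‖z‖ + ‖w‖ ^ k * ‖z - w‖ := by
          refine (norm_add_le _ _).trans ?_
          rw [norm_mul, norm_mul, norm_pow]
      _ ≤ k * ‖z - w‖ * 1 + 1 * ‖z - w‖ := by
          gcongr; exact pow_le_one₀ (norm_nonneg _) hw
      _ = _ := by push_cast; ring

end

/-! ### Comparison of characteristic functions with independent blocks -/

section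

lemma integral_abs_le_sqrt {P : Measure Ω} [IsProbabilityMeasure P] {Z : Ω → ℝ}
    (hZ : Integrable Z P) (hZ2 : Integrable (fun ω => Z ω ^ 2) P) :
    ∫ ω, |Z ω| ∂P ≤ √(∫ ω, Z ω ^ 2 ∂P) := by
  apply Real.le_sqrt_of_sq_le
  set m := ∫ ω, |Z ω| ∂P with hm
  have h : 0 ≤ ∫ ω, (|Z ω| - m) ^ 2 ∂P := integral_nonneg fun ω => sq_nonneg _
  have e : ∀ ω, (|Z ω| - m) ^ 2 = Z ω ^ 2 - 2 * m * |Z ω| + m ^ 2 := fun ω => by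
    rw [← sq_abs (Z ω)]; ring
  have i1 : Integrable (fun ω => Z ω ^ 2 - 2 * m * |Z ω|) P := hZ2.sub (hZ.abs.const_mul _)
  simp_rw [e] at h
  rw [integral_add i1 (integrable_const _), integral_sub hZ2 (hZ.abs.const_mul _),
    integral_const_mul, ← hm] at h
  simp at h
  nlinarith

/-- The blocking estimate behind the central limit theorem. -/
lemma norm_charFun_sub_le {P : Measure Ω} [IsProbabilityMeasure P] {X : ℤ → Ω → E}
    (hmeas : ∀ i, Measurable (X i)) (hstat : StrictlyStationary P X) {a c : ℝ}
    (hac : MixBound P X a c) {φ : E → ℝ} (hφ : Measurable φ) (hφ1 : ∀ x, |φ x| ≤ 1)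
    (h0 : ∫ ω, φ (X 0 ω) ∂P = 0) {C : ℝ}
    (hC : ∀ I : Finset ℤ, ∫ ω, (∑ i ∈ I, φ (X i ω)) ^ 2 ∂P ≤ C * I.card)
    (n p q k : ℕ) (hl : 0 < p + q) (hk : k * (p + q) ≤ n) (τ : ℝ) (hτ : |τ| * p ≤ 1) :
    ‖∫ ω, Complex.exp (Complex.I * ((τ * ∑ i ∈ Finset.Icc (1 : ℤ) n, φ (X i ω) : ℝ) : ℂ)) ∂P
        - (Real.exp (-(k * (τ ^ 2 * (∫ ω, blockSum φ X p 0 ω ^ 2 ∂P) / 2))) : ℝ)‖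
      ≤ |τ| * √(C * (n - k * p)) + k * (16 * (c * a ^ q))
        + k * (|τ| ^ 3 * p * (∫ ω, blockSum φ X p 0 ω ^ 2 ∂P)
          + (τ ^ 2 * (∫ ω, blockSum φ X p 0 ω ^ 2 ∂P) / 2) ^ 2) := by
  set V := ∫ ω, blockSum φ X p 0 ω ^ 2 ∂P with hV
  set f : ℕ × ℕ → ℤ := fun z => ((z.1 * (p + q) + z.2 : ℕ) : ℤ) + 1 with hf
  set R := Finset.range k ×ˢ Finset.range p with hR
  have hinj : Set.InjOn f R := by
    rintro ⟨j, r⟩ h1 ⟨j', r'⟩ h2 h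
    simp only [hR, Finset.coe_product, Finset.coe_range, Set.mem_prod, Set.mem_Iio] at h1 h2
    have h' : j * (p + q) + r = j' * (p + q) + r' := by
      simp only [hf] at h; omega
    have e1 : (j * (p + q) + r) / (p + q) = j := by
      rw [mul_comm, Nat.mul_add_div hl, Nat.div_eq_of_lt (by omega)]; simp
    have e2 : (j' * (p + q) + r') / (p + q) = j' := by
      rw [mul_comm, Nat.mul_add_div hl, Nat.div_eq_of_lt (by omega)]; simp
    have hj : j = j' := by rw [← e1, h', e2]
    subst hj
    simpa using h'
  set T := R.image f with hT
  have hTsub : T ⊆ Finset.Icc (1 : ℤ) n := by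
    intro i hi
    obtain ⟨⟨j, r⟩, hz, rfl⟩ := Finset.mem_image.1 hi
    simp only [hR, Finset.mem_product, Finset.mem_range] at hz
    have : (j + 1) * (p + q) ≤ k * (p + q) := Nat.mul_le_mul_right _ hz.1
    have h2 : (j + 1) * (p + q) = j * (p + q) + (p + q) := by ring
    simp only [hf, Finset.mem_Icc]
    omega
  have hTcard : T.card = k * p := by
    rw [hT, Finset.card_image_of_injOn hinj]; simp [hR]
  have hTsum : ∀ ω, ∑ i ∈ T, φ (X i ω) = ∑ j ∈ Finset.range k, blockSum φ X p (j * (p + q)) ω := by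
    intro ω
    rw [hT, Finset.sum_image hinj, hR, Finset.sum_product]
    refine Finset.sum_congr rfl fun j _ => Finset.sum_congr rfl fun r _ => ?_
    simp only [hf]; congr 2; push_cast; ring
  set D := Finset.Icc (1 : ℤ) n \ T with hD
  have hDcard : (D.card : ℝ) = n - k * p := by
    have := Finset.card_sdiff_add_card_eq_card hTsub
    rw [← hD, hTcard] at this
    simp only [Int.card_Icc] at this
    have h3 : D.card + k * p = n := by omega
    rw [← h3]; push_cast; ring
  have hsplit : ∀ ω, ∑ i ∈ Finset.Icc (1 : ℤ) n, φ (X i ω)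
      = ∑ i ∈ D, φ (X i ω) + ∑ i ∈ T, φ (X i ω) := fun ω => (Finset.sum_sdiff hTsub).symm
  have hsm : ∀ I : Finset ℤ, Measurable fun ω => ∑ i ∈ I, φ (X i ω) := fun I =>
    Finset.measurable_fun_sum _ fun i _ => hφ.comp (hmeas i)
  have hsb : ∀ (I : Finset ℤ) ω, |∑ i ∈ I, φ (X i ω)| ≤ I.card := fun I ω => by
    refine (Finset.abs_sum_le_sum_abs _ _).trans ((Finset.sum_le_sum fun r _ => hφ1 _).trans ?_)
    simp
  have hexp : Measurable fun x : ℝ => Complex.exp (Complex.I * ((τ * x : ℝ) : ℂ)) := by fun_prop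
  have iexp : ∀ {g : Ω → ℝ}, Measurable g →
      Integrable (fun ω => Complex.exp (Complex.I * ((τ * g ω : ℝ) : ℂ))) P := fun hg =>
    Integrable.of_bound (hexp.comp hg).aestronglyMeasurable 1
      (ae_of_all _ fun ω => (Complex.norm_exp_I_mul_ofReal _).le)
  have step1 : ‖∫ ω, Complex.exp (Complex.I * ((τ * ∑ i ∈ Finset.Icc (1 : ℤ) n, φ (X i ω) : ℝ) : ℂ)) ∂P
      - ∫ ω, Complex.exp (Complex.I * ((τ * ∑ i ∈ T, φ (X i ω) : ℝ) : ℂ)) ∂P‖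
      ≤ |τ| * √(C * (n - k * p)) := by
    rw [← integral_sub (iexp (hsm _)) (iexp (hsm _))]
    have hDi := integrable_of_abs_le (P := P) (hsm D) (hsb D)
    have hDi2 : Integrable (fun ω => (∑ i ∈ D, φ (X i ω)) ^ 2) P :=
      integrable_of_abs_le (M := (D.card : ℝ) ^ 2) ((hsm D).pow_const 2) fun ω => by
        rw [abs_pow]; exact pow_le_pow_left₀ (abs_nonneg _) (hsb D ω) 2
    refine (norm_integral_le_of_norm_le (hDi.abs.const_mul |τ|) (ae_of_all _ fun ω => ?_)).trans ?_
    · rw [hsplit ω]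
      have e : Complex.exp (Complex.I * ((τ * (∑ i ∈ D, φ (X i ω) + ∑ i ∈ T, φ (X i ω)) : ℝ) : ℂ))
          - Complex.exp (Complex.I * ((τ * ∑ i ∈ T, φ (X i ω) : ℝ) : ℂ))
          = (Complex.exp (Complex.I * ((τ * ∑ i ∈ D, φ (X i ω) : ℝ) : ℂ)) - 1)
            * Complex.exp (Complex.I * ((τ * ∑ i ∈ T, φ (X i ω) : ℝ) : ℂ)) := by
        rw [sub_mul, one_mul, ← Complex.exp_add]; congr 2; push_cast; ring
      rw [e, norm_mul, Complex.norm_exp_I_mul_ofReal, mul_one]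
      refine Real.norm_exp_I_mul_ofReal_sub_one_le.trans ?_
      rw [Real.norm_eq_abs, abs_mul]
    · rw [integral_const_mul]
      gcongr
      refine (integral_abs_le_sqrt hDi hDi2).trans (Real.sqrt_le_sqrt ?_)
      rw [← hDcard]; exact hC D
  have step2 := norm_prod_integral_sub_pow_le hmeas hstat hac hφ p q τ k
  have hprod : ∀ ω, Complex.exp (Complex.I * ((τ * ∑ i ∈ T, φ (X i ω) : ℝ) : ℂ))
      = ∏ j ∈ Finset.range k,
          Complex.exp (Complex.I * ((τ * blockSum φ X p (j * (p + q)) ω : ℝ) : ℂ)) := by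
    intro ω
    rw [hTsum, ← Complex.exp_sum]
    congr 1
    push_cast
    rw [Finset.mul_sum, Finset.mul_sum]
  simp_rw [← hprod] at step2
  have hB0 : ∫ ω, blockSum φ X p 0 ω ∂P = 0 := by
    unfold blockSum
    rw [integral_finsetSum (f := fun (r : ℕ) ω => φ (X (((0 : ℕ) : ℤ) + 1 + (r : ℤ)) ω)) _ fun i _ =>
      integrable_of_abs_le (hφ.comp (hmeas _)) fun _ => hφ1 _]
    refine Finset.sum_eq_zero fun r _ => ?_
    rw [hstat.integral_one hmeas hφ, h0]
  have step3 := norm_integral_exp_sub_le (P := P) (measurable_blockSum hmeas hφ p 0)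
    (abs_blockSum_le hφ1 p 0) hτ hB0
  rw [← hV] at step3
  set F := ∫ ω, Complex.exp (Complex.I * ((τ * blockSum φ X p 0 ω : ℝ) : ℂ)) ∂P
  have hF1 : ‖F‖ ≤ 1 := by
    refine (norm_integral_le_of_norm_le_const
      (ae_of_all _ fun ω => (Complex.norm_exp_I_mul_ofReal _).le)).trans ?_
    simp
  have hV0 : 0 ≤ V := integral_nonneg fun ω => sq_nonneg _
  have hw : ‖((Real.exp (-(τ ^ 2 * V / 2)) : ℝ) : ℂ)‖ ≤ 1 := by
    rw [Complex.norm_real, Real.norm_eq_abs, abs_of_pos (Real.exp_pos _), Real.exp_le_one_iff]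
    have : 0 ≤ τ ^ 2 * V / 2 := by positivity
    linarith
  have step4 := (norm_pow_sub_pow_le_mul hF1 hw k).trans
    (mul_le_mul_of_nonneg_left step3 (Nat.cast_nonneg k))
  have epow : ((Real.exp (-(τ ^ 2 * V / 2)) : ℝ) : ℂ) ^ k
      = ((Real.exp (-(k * (τ ^ 2 * V / 2))) : ℝ) : ℂ) := by
    rw [← Complex.ofReal_pow, ← Real.exp_nat_mul]; congr 2; ring
  rw [epow] at step4
  refine (norm_sub_le_norm_sub_add_norm_sub _ _ _).trans (add_le_add ?_ step4)
  exact (norm_sub_le_norm_sub_add_norm_sub _ _ _).trans (add_le_add step1 step2)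

end

/-! ### A central limit theorem for bounded functions of a mixing sequence -/

section

lemma blockSum_zero_eq (φ : E → ℝ) (X : ℤ → Ω → E) (p : ℕ) (ω : Ω) :
    blockSum φ X p 0 ω = ∑ i ∈ Finset.Icc (1 : ℤ) p, φ (X i ω) := by
  unfold blockSum
  refine Finset.sum_bij (fun r _ => ((r : ℕ) : ℤ) + 1) ?_ ?_ ?_ ?_
  · intro r hr; simp only [Finset.mem_range, Finset.mem_Icc] at hr ⊢; omega
  · intro r _ r' _ h; omega
  · intro i hi
    simp only [Finset.mem_Icc] at hi
    refine ⟨(i - 1).toNat, ?_, ?_⟩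
    · simp only [Finset.mem_range]; omega
    · omega
  · intro r _; congr 2; push_cast; ring

lemma tendsto_natSqrt : Tendsto Nat.sqrt atTop atTop :=
  tendsto_atTop.2 fun b => (eventually_ge_atTop (b * b)).mono fun _ h => Nat.le_sqrt.2 h

/-- Elementary bookkeeping for the block lengths `p = Q ^ 2`, gap `Q` and `Q ^ 8 ≤ n < (Q + 1) ^ 8`. -/
lemma block_lengths {n Q : ℕ} (hQ : 1 ≤ Q) (h8 : Q ^ 8 ≤ n) :
    (n : ℝ) - (n / (Q ^ 2 + Q) : ℕ) * (Q ^ 2 : ℕ) ≤ 3 * n / Q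
      ∧ ((n / (Q ^ 2 + Q) : ℕ) : ℝ) * (Q ^ 2 : ℕ) ≤ n := by
  set k := n / (Q ^ 2 + Q) with hk
  have hkl : k * (Q ^ 2 + Q) ≤ n := Nat.div_mul_le_self _ _
  have hlt : n < k * (Q ^ 2 + Q) + (Q ^ 2 + Q) := by
    have := Nat.lt_div_mul_add (a := n) (b := Q ^ 2 + Q) (by positivity)
    rwa [← hk] at this
  have hQ' : (1 : ℝ) ≤ Q := by exact_mod_cast hQ
  have h8' : (Q : ℝ) ^ 8 ≤ n := by exact_mod_cast h8
  have hkl' : (k : ℝ) * (Q ^ 2 + Q) ≤ n := by exact_mod_cast hkl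
  have hlt' : (n : ℝ) < k * (Q ^ 2 + Q) + (Q ^ 2 + Q) := by exact_mod_cast hlt
  have hk0 : (0 : ℝ) ≤ k := Nat.cast_nonneg k
  push_cast
  constructor
  · rw [le_div_iff₀ (by linarith)]
    have h3 : (Q : ℝ) ^ 3 ≤ n := (pow_le_pow_right₀ hQ' (by norm_num)).trans h8'
    have h2 : (Q : ℝ) ^ 2 ≤ Q ^ 3 := pow_le_pow_right₀ hQ' (by norm_num)
    nlinarith
  · nlinarith

/-- Central limit theorem for bounded functionals of an exponentially mixing stationary sequence,
at the level of characteristic functions. -/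
lemma tendsto_charFun_of_unit {P : Measure Ω} [IsProbabilityMeasure P] {X : ℤ → Ω → E}
    (hmeas : ∀ i, Measurable (X i)) (hstat : StrictlyStationary P X) (hmix : ExpAlphaMixing P X)
    {φ : E → ℝ} (hφ : Measurable φ) (hφ1 : ∀ x, |φ x| ≤ 1)
    (h0 : ∫ ω, φ (X 0 ω) ∂P = 0) {σ2 : ℝ}
    (hσ : Tendsto (fun n : ℕ => (n : ℝ)⁻¹ * ∫ ω, (∑ i ∈ Finset.Icc (1 : ℤ) n, φ (X i ω)) ^ 2 ∂P)
      atTop (nhds σ2)) (t : ℝ) :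
    Tendsto (fun n : ℕ => ∫ ω, Complex.exp (Complex.I *
      ((t / √n * ∑ i ∈ Finset.Icc (1 : ℤ) n, φ (X i ω) : ℝ) : ℂ)) ∂P) atTop
      (nhds ((Real.exp (-(t ^ 2 * σ2 / 2)) : ℝ) : ℂ)) := by
  obtain ⟨a, c, hac⟩ := hmix.exists_mixBound
  obtain ⟨C, hC0, hCb⟩ := exists_variance_bound hmeas hstat hmix (κ := 1 / 4) (by norm_num)
    (by norm_num)
  have hC : ∀ I : Finset ℤ, ∫ ω, (∑ i ∈ I, φ (X i ω)) ^ 2 ∂P ≤ C * I.card := by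
    intro I
    have := hCb φ hφ hφ1 I
    simp only [h0, sub_zero] at this
    refine this.trans (mul_le_of_le_one_right (by positivity)
      (Real.rpow_le_one (integral_nonneg fun _ => abs_nonneg _) ?_ (by norm_num)))
    calc ∫ ω, |φ (X 0 ω)| ∂P ≤ ∫ _, (1 : ℝ) ∂P :=
          integral_mono (integrable_of_abs_le (hφ.comp (hmeas 0)) fun _ => hφ1 _).abs
            (integrable_const _) fun ω => hφ1 _
      _ = 1 := by simp
  set Q : ℕ → ℕ := fun n => Nat.sqrt (Nat.sqrt (Nat.sqrt n)) with hQdef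
  have hQ : Tendsto Q atTop atTop := tendsto_natSqrt.comp (tendsto_natSqrt.comp tendsto_natSqrt)
  have hQ8 : ∀ n, Q n ^ 8 ≤ n := by
    intro n
    calc Q n ^ 8 = ((Q n ^ 2) ^ 2) ^ 2 := by ring
      _ ≤ ((Nat.sqrt (Nat.sqrt n)) ^ 2) ^ 2 := by gcongr; exact Nat.sqrt_le' _
      _ ≤ (Nat.sqrt n) ^ 2 := by gcongr; exact Nat.sqrt_le' _
      _ ≤ n := Nat.sqrt_le' _
  have hQ8' : ∀ n, n ≤ (Q n + 1) ^ 8 := by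
    intro n
    have h : ∀ m : ℕ, m + 1 ≤ (Nat.sqrt m + 1) ^ 2 := fun m => Nat.lt_succ_sqrt' m
    calc n ≤ (Nat.sqrt n + 1) ^ 2 := (Nat.le_succ _).trans (h n)
      _ ≤ ((Nat.sqrt (Nat.sqrt n) + 1) ^ 2) ^ 2 := by gcongr; exact h _
      _ ≤ (((Q n + 1) ^ 2) ^ 2) ^ 2 := by gcongr; exact h _
      _ = _ := by ring
  set V : ℕ → ℝ := fun n => ∫ ω, blockSum φ X (Q n ^ 2) 0 ω ^ 2 ∂P with hV
  set k : ℕ → ℕ := fun n => n / (Q n ^ 2 + Q n) with hk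
  have hV0 : ∀ n, 0 ≤ V n := fun n => integral_nonneg fun ω => sq_nonneg _
  have hVC : ∀ n, V n ≤ C * (Q n : ℝ) ^ 2 := by
    intro n
    simp only [hV, blockSum_zero_eq]
    refine (hC _).trans (le_of_eq ?_)
    rw [Int.card_Icc, show (((Q n ^ 2 : ℕ) : ℤ) + 1 - 1).toNat = Q n ^ 2 by omega]
    push_cast; ring
  have hQR : Tendsto (fun n => (Q n : ℝ)) atTop atTop := tendsto_natCast_atTop_atTop.comp hQ
  have hQinv : Tendsto (fun n => ((Q n : ℝ))⁻¹) atTop (nhds 0) := tendsto_inv_atTop_zero.comp hQR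
  have hVlim : Tendsto (fun n => ((Q n : ℝ) ^ 2)⁻¹ * V n) atTop (nhds σ2) := by
    have h2 : Tendsto (fun n => Q n ^ 2) atTop atTop :=
      (tendsto_pow_atTop (by norm_num)).comp hQ
    refine (hσ.comp h2).congr fun n => ?_
    simp [hV, blockSum_zero_eq]
  have hbig : ∀ᶠ n in atTop, 1 ≤ Q n ∧ |t| ≤ (Q n : ℝ) := by
    filter_upwards [hQ.eventually_ge_atTop 1, hQR.eventually_ge_atTop |t|] with n h1 h2
    exact ⟨h1, h2⟩
  have hkp : Tendsto (fun n : ℕ => (k n : ℝ) * (Q n : ℝ) ^ 2 / n) atTop (nhds 1) := by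
    have hlow : Tendsto (fun n => 1 - 3 * ((Q n : ℝ))⁻¹) atTop (nhds 1) := by
      simpa using (hQinv.const_mul 3).const_sub 1
    refine tendsto_of_tendsto_of_tendsto_of_le_of_le' hlow tendsto_const_nhds ?_ ?_
    · filter_upwards [hbig, eventually_gt_atTop 0] with n hn hn0
      have hn0' : (0 : ℝ) < n := by exact_mod_cast hn0
      have := (block_lengths hn.1 (hQ8 n)).1
      push_cast at this
      rw [le_div_iff₀ hn0']
      have e : 3 * (n : ℝ) / Q n = 3 * (Q n : ℝ)⁻¹ * n := by rw [div_eq_mul_inv]; ring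
      rw [e] at this
      simp only [hk]; linarith
    · filter_upwards [hbig, eventually_gt_atTop 0] with n hn hn0
      have hn0' : (0 : ℝ) < n := by exact_mod_cast hn0
      have := (block_lengths hn.1 (hQ8 n)).2
      push_cast at this
      rw [div_le_one hn0']
      exact this
  have hkv : Tendsto (fun n : ℕ => (k n : ℝ) * ((t / √n) ^ 2 * V n / 2)) atTop
      (nhds (t ^ 2 * σ2 / 2)) := by
    have := ((hVlim.mul hkp).const_mul (t ^ 2 / 2))
    rw [mul_one] at this
    refine (this.congr' ?_).trans (by rw [show t ^ 2 / 2 * σ2 = t ^ 2 * σ2 / 2 by ring])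
    filter_upwards [hbig, eventually_gt_atTop 0] with n hn hn0
    have hn0' : (0 : ℝ) < n := by exact_mod_cast hn0
    have hQ0 : (0 : ℝ) < Q n := by exact_mod_cast hn.1
    rw [div_pow, Real.sq_sqrt hn0'.le]
    field_simp
  have hmain : Tendsto (fun n : ℕ => ‖∫ ω, Complex.exp (Complex.I *
      ((t / √n * ∑ i ∈ Finset.Icc (1 : ℤ) n, φ (X i ω) : ℝ) : ℂ)) ∂P
      - ((Real.exp (-(k n * ((t / √n) ^ 2 * V n / 2))) : ℝ) : ℂ)‖) atTop (nhds 0) := by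
    have hb1 : Tendsto (fun n => |t| * √(3 * C * (Q n : ℝ)⁻¹)) atTop (nhds 0) := by
      have := ((hQinv.const_mul (3 * C)).sqrt).const_mul |t|
      simpa using this
    have hb2 : Tendsto (fun n => ((Q n + 1 : ℕ) : ℝ) ^ 8 * a ^ (Q n + 1) * (16 * c / a)) atTop
        (nhds 0) := by
      have h := tendsto_pow_const_mul_const_pow_of_lt_one 8 hac.1.le hac.2.1
      have h' := (h.comp ((tendsto_add_atTop_nat 1).comp hQ)).mul_const (16 * c / a)
      simpa [Function.comp_def] using h'
    have hb3 : Tendsto (fun n => |t| ^ 3 * C * (Q n : ℝ)⁻¹ + (t ^ 2 * C / 2) ^ 2 * (Q n : ℝ)⁻¹)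
        atTop (nhds 0) := by
      simpa using (hQinv.const_mul (|t| ^ 3 * C)).add (hQinv.const_mul ((t ^ 2 * C / 2) ^ 2))
    have hb := (hb1.add hb2).add hb3
    simp only [add_zero] at hb
    refine squeeze_zero' (Eventually.of_forall fun n => norm_nonneg _) ?_ hb
    filter_upwards [hbig, eventually_gt_atTop 0] with n hn hn0
    have hn0' : (0 : ℝ) < n := by exact_mod_cast hn0
    have hQ1 : (1 : ℝ) ≤ Q n := by exact_mod_cast hn.1
    have hQ0 : (0 : ℝ) < Q n := by linarith
    have h8 : (Q n : ℝ) ^ 8 ≤ n := by exact_mod_cast hQ8 n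
    have hs4 : (Q n : ℝ) ^ 4 ≤ √n := by
      apply Real.le_sqrt_of_sq_le; calc _ = (Q n : ℝ) ^ 8 := by ring
        _ ≤ _ := h8
    have hs0 : 0 < √(n : ℝ) := Real.sqrt_pos.2 hn0'
    have hs2 : √(n : ℝ) ^ 2 = n := Real.sq_sqrt hn0'.le
    have hs3 : (Q n : ℝ) ^ 3 ≤ √n := (pow_le_pow_right₀ hQ1 (by norm_num)).trans hs4
    obtain ⟨hl1, hl2⟩ := block_lengths hn.1 (hQ8 n)
    have habs : |t / √n| = |t| / √n := by rw [abs_div, abs_of_pos hs0]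
    have := norm_charFun_sub_le hmeas hstat hac hφ hφ1 h0 hC n (Q n ^ 2) (Q n) (k n)
      (by have := hn.1; positivity) (Nat.div_mul_le_self _ _) (t / √n) (by
        rw [habs, div_mul_eq_mul_div, div_le_one hs0]
        push_cast
        calc |t| * (Q n : ℝ) ^ 2 ≤ Q n * (Q n : ℝ) ^ 2 := by gcongr; exact hn.2
          _ = (Q n : ℝ) ^ 3 := by ring
          _ ≤ _ := hs3)
    refine this.trans ?_
    have hk0 : (0 : ℝ) ≤ k n := Nat.cast_nonneg _
    push_cast at hl1 hl2 ⊢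
    have hkV : (k n : ℝ) * V n ≤ C * n := by
      calc (k n : ℝ) * V n ≤ k n * (C * (Q n : ℝ) ^ 2) := by gcongr; exact hVC n
        _ = C * (k n * (Q n : ℝ) ^ 2) := by ring
        _ ≤ _ := by gcongr
    refine add_le_add (add_le_add ?_ ?_) ?_
    · rw [habs, div_mul_eq_mul_div, div_le_iff₀ hs0, mul_assoc, ← Real.sqrt_mul (by positivity)]
      refine mul_le_mul_of_nonneg_left (Real.sqrt_le_sqrt ?_) (abs_nonneg _)
      calc C * ((n : ℝ) - k n * (Q n : ℝ) ^ 2) ≤ C * (3 * n / Q n) := by gcongr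
        _ = _ := by ring
    · have h1 : (k n : ℝ) ≤ ((Q n : ℝ) + 1) ^ 8 := by
        have : k n ≤ (Q n + 1) ^ 8 := (Nat.div_le_self _ _).trans (hQ8' n)
        exact_mod_cast this
      have ha := hac.1
      have hc := hac.2.2.1
      calc (k n : ℝ) * (16 * (c * a ^ Q n)) ≤ ((Q n : ℝ) + 1) ^ 8 * (16 * (c * a ^ Q n)) := by
            gcongr
        _ = _ := by push_cast; rw [pow_succ a (Q n)]; field_simp
    · rw [mul_add, habs]
      change _ * (_ * _ * V n) + _ * (_ * V n / 2) ^ 2 ≤ _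
      refine add_le_add ?_ ?_
      · calc (k n : ℝ) * ((|t| / √n) ^ 3 * (Q n : ℝ) ^ 2 * V n)
            = (|t| / √n) ^ 3 * (Q n : ℝ) ^ 2 * (k n * V n) := by ring
          _ ≤ (|t| / √n) ^ 3 * (Q n : ℝ) ^ 2 * (C * n) := by gcongr
          _ = |t| ^ 3 * C * ((Q n : ℝ) ^ 2 / √n) := by
              rw [div_pow, show √(n : ℝ) ^ 3 = n * √n by rw [pow_succ, hs2]]
              field_simp
          _ ≤ |t| ^ 3 * C * (Q n : ℝ)⁻¹ := by
              gcongr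
              rw [div_le_iff₀ hs0, ← div_eq_inv_mul, le_div_iff₀ hQ0]
              calc _ = (Q n : ℝ) ^ 3 := by ring
                _ ≤ _ := hs3
      · rw [div_pow t, hs2]
        have hv1 : k n * (t ^ 2 / n * V n / 2) ≤ t ^ 2 * C / 2 := by
          calc k n * (t ^ 2 / n * V n / 2) = t ^ 2 / n / 2 * (k n * V n) := by ring
            _ ≤ t ^ 2 / n / 2 * (C * n) := by gcongr
            _ = _ := by field_simp
        have hv2 : t ^ 2 / n * V n / 2 ≤ t ^ 2 * C / 2 * (Q n : ℝ)⁻¹ := by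
          calc t ^ 2 / n * V n / 2 ≤ t ^ 2 / n * (C * (Q n : ℝ) ^ 2) / 2 := by gcongr; exact hVC n
            _ = t ^ 2 * C / 2 * ((Q n : ℝ) ^ 2 / n) := by ring
            _ ≤ _ := by
              gcongr
              rw [div_le_iff₀ hn0', ← div_eq_inv_mul, le_div_iff₀ hQ0]
              calc _ = (Q n : ℝ) ^ 3 := by ring
                _ ≤ (Q n : ℝ) ^ 8 := pow_le_pow_right₀ hQ1 (by norm_num)
                _ ≤ _ := h8
        have hvn := hV0 n
        calc (k n : ℝ) * (t ^ 2 / n * V n / 2) ^ 2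
            = (k n * (t ^ 2 / n * V n / 2)) * (t ^ 2 / n * V n / 2) := by ring
          _ ≤ (t ^ 2 * C / 2) * (t ^ 2 * C / 2 * (Q n : ℝ)⁻¹) := by gcongr
          _ = _ := by ring
  have h2 : Tendsto (fun n : ℕ => ((Real.exp (-(k n * ((t / √n) ^ 2 * V n / 2))) : ℝ) : ℂ)) atTop
      (nhds ((Real.exp (-(t ^ 2 * σ2 / 2)) : ℝ) : ℂ)) :=
    (Complex.continuous_ofReal.tendsto _).comp ((Real.continuous_exp.tendsto _).comp hkv.neg)
  have := (tendsto_zero_iff_norm_tendsto_zero.2 hmain).add h2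
  simpa using this

lemma tendsto_charFun_of_bounded {P : Measure Ω} [IsProbabilityMeasure P] {X : ℤ → Ω → E}
    (hmeas : ∀ i, Measurable (X i)) (hstat : StrictlyStationary P X) (hmix : ExpAlphaMixing P X)
    {φ : E → ℝ} (hφ : Measurable φ) {M : ℝ} (hM : 0 < M) (hφ1 : ∀ x, |φ x| ≤ M)
    (h0 : ∫ ω, φ (X 0 ω) ∂P = 0) {σ2 : ℝ}
    (hσ : Tendsto (fun n : ℕ => (n : ℝ)⁻¹ * ∫ ω, (∑ i ∈ Finset.Icc (1 : ℤ) n, φ (X i ω)) ^ 2 ∂P)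
      atTop (nhds σ2)) (t : ℝ) :
    Tendsto (fun n : ℕ => ∫ ω, Complex.exp (Complex.I *
      ((t / √n * ∑ i ∈ Finset.Icc (1 : ℤ) n, φ (X i ω) : ℝ) : ℂ)) ∂P) atTop
      (nhds ((Real.exp (-(t ^ 2 * σ2 / 2)) : ℝ) : ℂ)) := by
  have := tendsto_charFun_of_unit hmeas hstat hmix (φ := fun x => φ x / M) (hφ.div_const M)
    (fun x => by rw [abs_div, abs_of_pos hM, div_le_one hM]; exact hφ1 x)
    (by rw [integral_div, h0, zero_div]) (σ2 := σ2 / M ^ 2) (by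
      refine (hσ.div_const (M ^ 2)).congr fun n => ?_
      simp_rw [← Finset.sum_div, div_pow]
      rw [integral_div, mul_div_assoc]) (t * M)
  have e : (t * M) ^ 2 * (σ2 / M ^ 2) / 2 = t ^ 2 * σ2 / 2 := by field_simp
  rw [e] at this
  refine this.congr fun n => ?_
  congr 1; ext ω; congr 3
  rw [← Finset.sum_div]
  field_simp

end

/-! ### Reduction to uniform margins -/

section

lemma ExpAlphaMixing.comp {E' : Type*} [MeasurableSpace E'] {P : Measure Ω} [IsProbabilityMeasure P]
    {X : ℤ → Ω → E} (h : ExpAlphaMixing P X) {f : E → E'} (hf : Measurable f) :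
    ExpAlphaMixing P (fun i ω => f (X i ω)) := by
  obtain ⟨a, ha, c, hc, hb⟩ := h.exists_bound
  refine ⟨a, ha, c, fun k _ => ?_⟩
  have hle : ∀ S : Set ℤ, mixSigma (fun i ω => f (X i ω)) S ≤ mixSigma X S := fun S =>
    iSup₂_mono fun i _ => by
      change MeasurableSpace.comap (f ∘ X i) _ ≤ _
      rw [← MeasurableSpace.comap_comp]
      exact MeasurableSpace.comap_mono hf.comap_le
  refine Real.sSup_le ?_ (mul_nonneg hc.le (pow_nonneg ha.1.le k))
  rintro r ⟨i, A, B, hA, hB, rfl⟩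
  exact hb i k A B (hle _ A hA) (hle _ B hB)

lemma StrictlyStationary.comp {E' : Type*} [MeasurableSpace E'] {P : Measure Ω}
    {X : ℤ → Ω → E} (h : StrictlyStationary P X) (hmeas : ∀ i, Measurable (X i)) {f : E → E'}
    (hf : Measurable f) : StrictlyStationary P (fun i ω => f (X i ω)) := by
  intro m idx k
  have hF : Measurable fun (x : Fin m → E) p => f (x p) :=
    measurable_pi_lambda _ fun p => hf.comp (measurable_pi_apply p)
  have h1 : Measurable fun ω (p : Fin m) => X (idx p + k) ω :=
    measurable_pi_lambda _ fun p => hmeas _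
  have h2 : Measurable fun ω (p : Fin m) => X (idx p) ω := measurable_pi_lambda _ fun p => hmeas _
  have := congrArg (Measure.map fun (x : Fin m → E) p => f (x p)) (h m idx k)
  rw [Measure.map_map hF h1, Measure.map_map hF h2] at this
  exact this

lemma StrictlyStationary.measure_one {P : Measure Ω} {X : ℤ → Ω → E}
    (h : StrictlyStationary P X) (hmeas : ∀ i, Measurable (X i)) {A : Set E}
    (hA : MeasurableSet A) (i : ℤ) : P (X i ⁻¹' A) = P (X 0 ⁻¹' A) := by
  have := h 1 (fun _ => 0) i
  simp only [zero_add] at this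
  have h1 : ∀ i : ℤ, Measurable fun ω (_ : Fin 1) => X i ω :=
    fun i => measurable_pi_lambda _ fun p => hmeas _
  have hB : MeasurableSet {x : Fin 1 → E | x 0 ∈ A} := measurable_pi_apply 0 hA
  have := congrArg (fun μ => μ {x : Fin 1 → E | x 0 ∈ A}) this
  simp only [Measure.map_apply (h1 _) hB] at this
  exact this

variable {P : Measure Ω} [IsProbabilityMeasure P] {X : ℤ → Ω → Fin d → ℝ}

lemma margF_mono (P : Measure Ω) [IsProbabilityMeasure P] (X : ℤ → Ω → Fin d → ℝ) (j : Fin d) :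
    Monotone (margF P X j) := fun x y hxy =>
  measureReal_mono fun ω (h : X 0 ω j ≤ x) => h.trans hxy

lemma margF_mem (P : Measure Ω) [IsProbabilityMeasure P] (X : ℤ → Ω → Fin d → ℝ) (j : Fin d)
    (x : ℝ) : margF P X j x ∈ Icc (0 : ℝ) 1 :=
  ⟨ENNReal.toReal_nonneg, measureReal_le_one⟩

lemma margF_tendsto_atTop (hmeas : ∀ i, Measurable (X i)) (j : Fin d) :
    Tendsto (margF P X j) atTop (nhds 1) := by
  have h := tendsto_measure_iUnion_atTop (μ := P) (s := fun x : ℝ => {ω | X 0 ω j ≤ x})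
    fun x y hxy ω (h : X 0 ω j ≤ x) => h.trans hxy
  have e : (⋃ x : ℝ, {ω | X 0 ω j ≤ x}) = univ :=
    eq_univ_of_forall fun ω => mem_iUnion.2 ⟨X 0 ω j, le_refl (X 0 ω j)⟩
  rw [e, measure_univ] at h
  have := (ENNReal.tendsto_toReal ENNReal.one_ne_top).comp h
  rw [ENNReal.toReal_one] at this
  exact this

lemma margF_tendsto_atBot (hmeas : ∀ i, Measurable (X i)) (j : Fin d) :
    Tendsto (margF P X j) atBot (nhds 0) := by
  have h := tendsto_measure_iInter_atBot (μ := P) (s := fun x : ℝ => {ω | X 0 ω j ≤ x})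
    (fun x => (measurableSet_le ((measurable_pi_apply j).comp (hmeas 0))
      measurable_const).nullMeasurableSet)
    (fun x y hxy ω (h : X 0 ω j ≤ x) => h.trans hxy) ⟨0, measure_ne_top _ _⟩
  have e : (⋂ x : ℝ, {ω | X 0 ω j ≤ x}) = ∅ := by
    refine eq_empty_of_forall_notMem fun ω hω => ?_
    have := mem_iInter.1 hω (X 0 ω j - 1)
    simp only [mem_ofPred_eq] at this
    linarith
  rw [e, measure_empty] at h
  have := (ENNReal.tendsto_toReal ENNReal.zero_ne_top).comp h
  rw [ENNReal.toReal_zero] at this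
  exact this

lemma exists_margF_eq (hmeas : ∀ i, Measurable (X i)) {j : Fin d} (hcont : Continuous (margF P X j))
    {s : ℝ} (hs : s ∈ Ioo (0 : ℝ) 1) : ∃ x, margF P X j x = s := by
  have h0 := ((margF_tendsto_atBot (P := P) hmeas j).eventually_lt_const hs.1).exists
  have h1 := ((margF_tendsto_atTop (P := P) hmeas j).eventually_const_lt hs.2).exists
  obtain ⟨x, hx⟩ := h0
  obtain ⟨y, hy⟩ := h1
  exact mem_range_of_exists_le_of_exists_ge hcont ⟨x, hx.le⟩ ⟨y, hy.le⟩

/-- Probability integral transform. -/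
lemma prob_margF_le (hmeas : ∀ i, Measurable (X i)) {j : Fin d} (hcont : Continuous (margF P X j))
    {s : ℝ} (hs : s ∈ Icc (0 : ℝ) 1) : P.real {ω | Uv P X 0 ω j ≤ s} = s := by
  have hup : ∀ s s', s < s' → s' ∈ Ioo (0 : ℝ) 1 → P.real {ω | Uv P X 0 ω j ≤ s} ≤ s' := by
    intro s s' hss hs'
    obtain ⟨x, hx⟩ := exists_margF_eq hmeas hcont hs'
    calc P.real {ω | Uv P X 0 ω j ≤ s} ≤ P.real {ω | X 0 ω j ≤ x} := by
          refine measureReal_mono fun ω (h : margF P X j (X 0 ω j) ≤ s) => ?_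
          by_contra hlt
          have := margF_mono P X j (not_le.1 hlt).le
          linarith
      _ = s' := hx
  have hup' : ∀ s ∈ Ico (0 : ℝ) 1, P.real {ω | Uv P X 0 ω j ≤ s} ≤ s := by
    intro s hs
    refine le_of_forall_gt_imp_ge_of_dense fun s' hs' => ?_
    rcases lt_or_ge s' 1 with h | h
    · exact hup s s' hs' ⟨hs.1.trans_lt hs', h⟩
    · exact measureReal_le_one.trans h
  rcases hs.2.lt_or_eq with h1 | rfl
  · refine le_antisymm (hup' s ⟨hs.1, h1⟩) ?_
    rcases hs.1.lt_or_eq with h0 | rfl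
    · obtain ⟨x, hx⟩ := exists_margF_eq hmeas hcont ⟨h0, h1⟩
      calc s = P.real {ω | X 0 ω j ≤ x} := hx.symm
        _ ≤ _ := measureReal_mono fun ω (h : X 0 ω j ≤ x) => (margF_mono P X j h).trans hx.le
    · exact measureReal_nonneg
  · have : {ω | Uv P X 0 ω j ≤ 1} = univ := eq_univ_of_forall fun ω => (margF_mem P X j _).2
    rw [this]; simp

/-- A stationary, exponentially mixing sequence with uniform margins on the unit cube. -/
structure UnifSeq (P : Measure Ω) (U : ℤ → Ω → Fin d → ℝ) : Prop where
  meas : ∀ i, Measurable (U i)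
  stat : StrictlyStationary P U
  mix : ExpAlphaMixing P U
  mem : ∀ i ω j, U i ω j ∈ Icc (0 : ℝ) 1
  unif : ∀ j, ∀ s ∈ Icc (0 : ℝ) 1, P.real {ω | U 0 ω j ≤ s} = s

lemma unifSeq_Uv (hmeas : ∀ i, Measurable (X i)) (hstat : StrictlyStationary P X)
    (hmix : ExpAlphaMixing P X) (hcont : ∀ j, Continuous (margF P X j)) :
    UnifSeq P (Uv P X) := by
  have hf : Measurable fun (x : Fin d → ℝ) j => margF P X j (x j) :=
    measurable_pi_lambda _ fun j => (hcont j).measurable.comp (measurable_pi_apply j)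
  have h2 := hstat.comp hmeas (f := fun (x : Fin d → ℝ) j => margF P X j (x j)) hf
  have h3 := hmix.comp (f := fun (x : Fin d → ℝ) j => margF P X j (x j)) hf
  exact
    { meas := fun i => hf.comp (hmeas i)
      stat := h2
      mix := h3
      mem := fun i ω j => margF_mem P X j _
      unif := fun j s hs => prob_margF_le hmeas (hcont j) hs }

lemma UnifSeq.Uv_eq (h : UnifSeq P X) : Uv P X = X := by
  ext i ω j
  exact h.unif j _ (h.mem i ω j)

/-- Almost surely the order of the observations is that of their probability transforms. -/
lemma ae_le_iff_Uv_le (hmeas : ∀ i, Measurable (X i)) (hstat : StrictlyStationary P X)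
    (hcont : ∀ j, Continuous (margF P X j)) :
    ∀ᵐ ω ∂P, ∀ (i k : ℤ) (j : Fin d), X k ω j ≤ X i ω j ↔ Uv P X k ω j ≤ Uv P X i ω j := by
  have key : ∀ᵐ ω ∂P, ∀ (k : ℤ) (j : Fin d) (r : ℚ),
      ¬ ((r : ℝ) < X k ω j ∧ margF P X j (X k ω j) ≤ margF P X j r) := by
    refine ae_all_iff.2 fun k => ae_all_iff.2 fun j => ae_all_iff.2 fun r => ?_
    have hA : MeasurableSet {x : Fin d → ℝ | (r : ℝ) < x j ∧ margF P X j (x j) ≤ margF P X j r} :=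
      (measurableSet_lt measurable_const (measurable_pi_apply j)).inter
        (measurableSet_le ((hcont j).measurable.comp (measurable_pi_apply j)) measurable_const)
    rw [ae_iff]
    simp only [not_not]
    have e := hstat.measure_one hmeas hA k
    simp only [preimage_ofPred_eq] at e
    rw [e]
    have hsub : {ω | X 0 ω j ≤ r} ⊆ {ω | Uv P X 0 ω j ≤ margF P X j r} := fun ω h =>
      margF_mono P X j h
    have hmr : MeasurableSet {ω | X 0 ω j ≤ r} :=
      measurableSet_le ((measurable_pi_apply j).comp (hmeas 0)) measurable_const
    have hd := measureReal_sdiff (μ := P) hsub hmr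
    rw [prob_margF_le hmeas (hcont j) (margF_mem P X j r)] at hd
    have h0 : P.real ({ω | Uv P X 0 ω j ≤ margF P X j r} \ {ω | X 0 ω j ≤ r}) = 0 := by
      rw [hd]; exact sub_self _
    rw [measureReal_eq_zero_iff] at h0
    refine measure_mono_null (fun ω hω => ?_) h0
    exact ⟨hω.2, not_le.2 hω.1⟩
  filter_upwards [key] with ω hω i k j
  refine ⟨fun h => margF_mono P X j h, fun h => ?_⟩
  by_contra hlt
  obtain ⟨r, hr1, hr2⟩ := exists_rat_btwn (not_le.1 hlt)
  exact hω k j r ⟨hr2, h.trans (margF_mono P X j hr1.le)⟩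

lemma ae_pseudoObs_eq (hmeas : ∀ i, Measurable (X i)) (hstat : StrictlyStationary P X)
    (hcont : ∀ j, Continuous (margF P X j)) :
    ∀ᵐ ω ∂P, ∀ (n : ℕ) (i : ℤ), pseudoObs X n i ω = pseudoObs (Uv P X) n i ω := by
  filter_upwards [ae_le_iff_Uv_le hmeas hstat hcont] with ω hω n i
  ext j
  unfold pseudoObs empCdfX
  congr 2
  refine Finset.sum_congr rfl fun k _ => ?_
  unfold indic
  simp only [indicator, mem_ofPred_eq, hω i k j]

end

/-! ### Regularity of the copula derivatives -/

section

variable {P : Measure Ω} [IsProbabilityMeasure P]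

namespace UnifSeq

section general
variable {U : ℤ → Ω → Fin d → ℝ} (h : UnifSeq P U)
include h

lemma margF_eq (j : Fin d) (s : ℝ) : P.real {ω | U 0 ω j ≤ s} = max 0 (min 1 s) := by
  change margF P U j s = _
  rcases lt_or_ge s 0 with h0 | h0
  · rw [min_eq_right (by linarith), max_eq_left h0.le]
    refine le_antisymm ?_ (margF_mem P U j s).1
    exact (margF_mono P U j h0.le).trans (h.unif j 0 (by simp)).le
  · rw [max_eq_right (le_min zero_le_one h0)]
    rcases le_total 1 s with h1 | h1
    · rw [min_eq_left h1]
      refine le_antisymm (margF_mem P U j s).2 ?_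
      exact (h.unif j 1 (by simp)).symm.le.trans (margF_mono P U j h1)
    · rw [min_eq_right h1]; exact h.unif j s ⟨h0, h1⟩

lemma meas_coord (i : ℤ) (j : Fin d) : Measurable fun ω => U i ω j :=
  (measurable_pi_apply j).comp (h.meas i)

lemma prob_Ioc_le (j : Fin d) {s t : ℝ} (hst : s ≤ t) :
    P.real {ω | s < U 0 ω j ∧ U 0 ω j ≤ t} ≤ t - s := by
  have e : {ω | s < U 0 ω j ∧ U 0 ω j ≤ t} = {ω | U 0 ω j ≤ t} \ {ω | U 0 ω j ≤ s} := by
    ext ω; simp [and_comm]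
  have hsub : {ω | U 0 ω j ≤ s} ⊆ {ω | U 0 ω j ≤ t} := fun ω hω => le_trans hω hst
  rw [e, measureReal_sdiff hsub
    (measurableSet_le (h.meas_coord 0 j) measurable_const), h.margF_eq, h.margF_eq]
  rcases max_cases 0 (min 1 t) with h1 | h1 <;> rcases max_cases 0 (min 1 s) with h2 | h2 <;>
  rcases min_cases 1 t with h3 | h3 <;> rcases min_cases 1 s with h4 | h4 <;> linarith

lemma prob_eq (j : Fin d) (s : ℝ) : P {ω | U 0 ω j = s} = 0 := by
  rw [← measureReal_eq_zero_iff]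
  refine le_antisymm (le_of_forall_pos_le_add fun ε hε => ?_) measureReal_nonneg
  calc P.real {ω | U 0 ω j = s} ≤ P.real {ω | s - ε < U 0 ω j ∧ U 0 ω j ≤ s} :=
        measureReal_mono fun ω (hω : U 0 ω j = s) => ⟨by linarith, hω.le⟩
    _ ≤ 0 + ε := by have := h.prob_Ioc_le j (show s - ε ≤ s by linarith); linarith

lemma ae_ne (i : ℤ) (j : Fin d) (s : ℝ) : ∀ᵐ ω ∂P, U i ω j ≠ s := by
  rw [ae_iff]
  simp only [not_not]
  have hA : MeasurableSet {x : Fin d → ℝ | x j = s} :=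
    measurableSet_eq_fun (measurable_pi_apply j) measurable_const
  have := h.stat.measure_one h.meas hA i
  rw [preimage_ofPred_eq, preimage_ofPred_eq, h.prob_eq] at this
  exact this

lemma prob_lt (j : Fin d) {s : ℝ} (hs : s ∈ Icc (0 : ℝ) 1) : P.real {ω | U 0 ω j < s} = s := by
  conv_rhs => rw [← h.unif j s hs]
  refine measureReal_congr ?_
  filter_upwards [h.ae_ne 0 j s] with ω hω
  exact propext ⟨fun hh => le_of_lt hh, fun hh => lt_of_le_of_ne hh hω⟩

lemma cop_eq (u : Fin d → ℝ) : cop P U u = P.real {ω | ∀ j, U 0 ω j ≤ u j} := by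
  unfold cop; rw [h.Uv_eq]; rfl

lemma cop_eq_lt (u : Fin d → ℝ) : cop P U u = P.real {ω | ∀ j, U 0 ω j < u j} := by
  rw [h.cop_eq]
  refine measureReal_congr ?_
  filter_upwards [ae_all_iff.2 fun j => h.ae_ne 0 j (u j)] with ω hω
  exact propext ⟨fun hh j => lt_of_le_of_ne (hh j) (hω j), fun hh j => (hh j).le⟩

end general

variable {U : ℤ → Ω → Fin 2 → ℝ}

lemma fin2_cases {j k : Fin 2} (hjk : j ≠ k) (i : Fin 2) : i = j ∨ i = k := by omega

section
variable (h : UnifSeq P U) {j k : Fin 2} (hjk : j ≠ k)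
include h hjk

lemma cop_sub (u : Fin 2 → ℝ) {s t : ℝ} (hst : s ≤ t) :
    cop P U (Function.update u k t) - cop P U (Function.update u k s) =
      P.real {ω | U 0 ω j ≤ u j ∧ s < U 0 ω k ∧ U 0 ω k ≤ t} := by
  have e : ∀ r, cop P U (Function.update u k r) = P.real {ω | U 0 ω j ≤ u j ∧ U 0 ω k ≤ r} := by
    intro r
    rw [h.cop_eq]
    congr 1; ext ω
    simp only [mem_ofPred_eq]
    refine ⟨fun hh => ⟨by simpa [hjk] using hh j, by simpa using hh k⟩, fun hh i => ?_⟩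
    rcases fin2_cases hjk i with rfl | rfl
    · simpa [hjk] using hh.1
    · simpa using hh.2
  rw [e, e, ← measureReal_sdiff]
  · congr 1; ext ω
    simp only [Set.mem_sdiff, mem_ofPred_eq, not_and, not_le]; tauto
  · exact fun ω hω => ⟨hω.1, hω.2.trans hst⟩
  · exact (measurableSet_le (h.meas_coord 0 j) measurable_const).inter
      (measurableSet_le (h.meas_coord 0 k) measurable_const)

lemma cop_compl (u : Fin 2 → ℝ) {s t : ℝ} (hs : 0 ≤ s) (hst : s ≤ t) (ht : t ≤ 1) :
    (t - s) - (cop P U (Function.update u k t) - cop P U (Function.update u k s)) =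
      P.real {ω | u j < U 0 ω j ∧ s < U 0 ω k ∧ U 0 ω k ≤ t} := by
  rw [h.cop_sub hjk u hst]
  have hms : MeasurableSet {ω | s < U 0 ω k ∧ U 0 ω k ≤ t} :=
    (measurableSet_lt measurable_const (h.meas_coord 0 k)).inter
      (measurableSet_le (h.meas_coord 0 k) measurable_const)
  have e1 : P.real {ω | s < U 0 ω k ∧ U 0 ω k ≤ t} = t - s := by
    have e : {ω | s < U 0 ω k ∧ U 0 ω k ≤ t} = {ω | U 0 ω k ≤ t} \ {ω | U 0 ω k ≤ s} := by
      ext ω; simp [and_comm]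
    have hsub : {ω | U 0 ω k ≤ s} ⊆ {ω | U 0 ω k ≤ t} := fun ω hω => le_trans hω hst
    rw [e, measureReal_sdiff hsub
      (measurableSet_le (h.meas_coord 0 k) measurable_const), h.unif k t ⟨hs.trans hst, ht⟩,
      h.unif k s ⟨hs, hst.trans ht⟩]
  rw [← e1, ← measureReal_sdiff]
  · congr 1; ext ω
    simp only [Set.mem_sdiff, mem_ofPred_eq, not_and, not_le]; grind
  · exact fun ω hω => hω.2
  · exact (measurableSet_le (h.meas_coord 0 j) measurable_const).inter hms

lemma cop_update_mono (u : Fin 2 → ℝ) : Monotone fun t => cop P U (Function.update u k t) := by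
  intro s t hst
  have := h.cop_sub hjk u hst
  have h0 : 0 ≤ P.real {ω | U 0 ω j ≤ u j ∧ s < U 0 ω k ∧ U 0 ω k ≤ t} := measureReal_nonneg
  simp only; linarith

lemma cop_update_sub_le (u : Fin 2 → ℝ) {s t : ℝ} (hst : s ≤ t) :
    cop P U (Function.update u k t) - cop P U (Function.update u k s) ≤ t - s := by
  rw [h.cop_sub hjk u hst]
  exact (measureReal_mono fun ω hω => hω.2).trans (h.prob_Ioc_le k hst)

lemma Cdot_mem (hC : Condition21 (cop P U)) {u : Fin 2 → ℝ} (hu : u ∈ VV 2 k) :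
    Cdot (cop P U) k u ∈ Icc (0 : ℝ) 1 := by
  have hd := hC.1 k u hu
  constructor
  · rw [← hd.deriv]; exact Monotone.deriv_nonneg (h.cop_update_mono hjk u)
  · have hm : Monotone fun t => t - cop P U (Function.update u k t) := by
      intro s t hst
      have := h.cop_update_sub_le hjk u hst
      simp only; linarith
    have h2 := (hasDerivAt_id (u k)).sub hd
    have : 0 ≤ deriv (fun t => t - cop P U (Function.update u k t)) (u k) := hm.deriv_nonneg
    have e : deriv (fun t => t - cop P U (Function.update u k t)) (u k) = 1 - Cdot (cop P U) k u :=
      h2.deriv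
    linarith

lemma Cdot_update_zero (hC : Condition21 (cop P U)) {u : Fin 2 → ℝ} (hu : u ∈ VV 2 k)
    (hj : u j = 0) : Cdot (cop P U) k u = 0 := by
  have hd := hC.1 k u hu
  have e : (fun t => cop P U (Function.update u k t)) = fun _ => 0 := by
    ext t
    rw [h.cop_eq]
    refine le_antisymm ?_ measureReal_nonneg
    rw [← h.unif j 0 (by simp)]
    exact measureReal_mono fun ω hω => by simpa [hjk, hj] using hω j
  rw [e] at hd
  exact hd.unique (hasDerivAt_const _ _)

lemma Cdot_update_one (hC : Condition21 (cop P U)) {u : Fin 2 → ℝ} (hu : u ∈ VV 2 k)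
    (hj : u j = 1) : Cdot (cop P U) k u = 1 := by
  have hd := hC.1 k u hu
  have e : (fun t => cop P U (Function.update u k t)) =ᶠ[nhds (u k)] fun t => t := by
    filter_upwards [Ioo_mem_nhds hu.2.1 hu.2.2] with t ht
    rw [h.cop_eq, ← h.unif k t ⟨ht.1.le, ht.2.le⟩]
    congr 1; ext ω
    rw [h.unif k t ⟨ht.1.le, ht.2.le⟩]
    refine ⟨fun hω => by simpa using hω k, fun hω i => ?_⟩
    rcases fin2_cases hjk i with rfl | rfl
    · simpa [hjk, hj] using (h.mem 0 ω i).2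
    · simpa using hω
  exact hd.unique ((hasDerivAt_id (u k)).congr_of_eventuallyEq e)

end

lemma update_mem_VV {j k : Fin 2} (hjk : j ≠ k) {u : Fin 2 → ℝ} (hu : u ∈ VV 2 k) {r : ℝ}
    (hr : r ∈ Icc (0 : ℝ) 1) : Function.update u j r ∈ VV 2 k := by
  refine ⟨fun i => ?_, by simpa [hjk.symm] using hu.2⟩
  rcases eq_or_ne i j with rfl | hi
  · simpa using hr
  · simpa [hi] using hu.1 i

omit [IsProbabilityMeasure P] in
lemma exists_Cdot_lipschitz (hC : Condition21 (cop P U)) : ∃ K : ℝ, 0 < K ∧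
    ∀ {j k : Fin 2}, j ≠ k → ∀ u ∈ VV 2 k, ∀ s ∈ Icc (0 : ℝ) 1, ∀ t ∈ Icc (0 : ℝ) 1, s ≤ t →
      |Cdot (cop P U) k (Function.update u j t) - Cdot (cop P U) k (Function.update u j s)| ≤
        K * (t - s) / (u k * (1 - u k)) := by
  obtain ⟨_, hcont, Cdd, hder, -, K, hK, hb⟩ := hC
  refine ⟨K, hK, fun {j k} hjk u hu s hs t ht hst => ?_⟩
  have hpos : 0 < u k * (1 - u k) := mul_pos hu.2.1 (by linarith [hu.2.2])
  rcases hst.eq_or_lt with rfl | hst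
  · simp
  have hupd : Continuous fun r : ℝ => Function.update u j r := by fun_prop
  obtain ⟨ξ, hξ, he⟩ := exists_hasDerivAt_eq_slope
    (fun r => Cdot (cop P U) k (Function.update u j r))
    (fun r => Cdd j k (Function.update u j r)) hst
    ((hcont k).comp hupd.continuousOn fun r hr =>
      update_mem_VV hjk hu ⟨hs.1.trans hr.1, hr.2.trans ht.2⟩)
    (fun r hr => by
      have hr0 : 0 < r := hs.1.trans_lt hr.1
      have hr1 : r < 1 := hr.2.trans_le ht.2
      have hk := update_mem_VV hjk hu ⟨hr0.le, hr1.le⟩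
      have := hder j k (Function.update u j r) ⟨⟨hk.1, by simpa using ⟨hr0, hr1⟩⟩, hk⟩
      simpa using this)
  have hr0 : 0 < ξ := hs.1.trans_lt hξ.1
  have hr1 : ξ < 1 := hξ.2.trans_le ht.2
  have hk := update_mem_VV hjk hu ⟨hr0.le, hr1.le⟩
  have hb' := (hb j k (Function.update u j ξ) ⟨⟨hk.1, by simpa using ⟨hr0, hr1⟩⟩, hk⟩).trans
    (mul_le_mul_of_nonneg_left (min_le_right _ _) hK.le)
  rw [he] at hb'
  simp only [Function.update_of_ne hjk.symm] at hb'
  rw [abs_div, abs_of_pos (sub_pos.2 hst), div_le_iff₀ (sub_pos.2 hst)] at hb'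
  calc _ ≤ _ := hb'
    _ = _ := by ring

/-- The copula is smooth, with first-order derivatives controlled near the boundary. -/
structure CopReg (P : Measure Ω) (U : ℤ → Ω → Fin 2 → ℝ) (K : ℝ) : Prop where
  pos : 0 < K
  lip : ∀ {j k : Fin 2}, j ≠ k → ∀ u ∈ VV 2 k, ∀ s ∈ Icc (0 : ℝ) 1, ∀ t ∈ Icc (0 : ℝ) 1, s ≤ t →
      |Cdot (cop P U) k (Function.update u j t) - Cdot (cop P U) k (Function.update u j s)| ≤
        K * (t - s) / (u k * (1 - u k))
  le : ∀ {j k : Fin 2}, j ≠ k → ∀ u ∈ VV 2 k,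
      Cdot (cop P U) k u ≤ K * u j / (u k * (1 - u k))
  one_sub_le : ∀ {j k : Fin 2}, j ≠ k → ∀ u ∈ VV 2 k,
      1 - Cdot (cop P U) k u ≤ K * (1 - u j) / (u k * (1 - u k))
  mem : ∀ (k : Fin 2), ∀ u ∈ VV 2 k, Cdot (cop P U) k u ∈ Icc (0 : ℝ) 1
  deriv : ∀ k : Fin 2, ∀ u ∈ VV 2 k,
    HasDerivAt (fun t => cop P U (Function.update u k t)) (Cdot (cop P U) k u) (u k)
  cont : ∀ k : Fin 2, ContinuousOn (Cdot (cop P U) k) (VV 2 k)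

lemma exists_copReg (h : UnifSeq P U) (hC : Condition21 (cop P U)) : ∃ K, CopReg P U K := by
  obtain ⟨K, hK, hl⟩ := exists_Cdot_lipschitz hC
  refine ⟨K, hK, hl, fun {j k} hjk u hu => ?_, fun {j k} hjk u hu => ?_, fun k u hu => ?_,
    hC.1, hC.2.1⟩
  · have := hl hjk u hu 0 (by simp) (u j) (hu.1 j) (hu.1 j).1
    rw [Function.update_eq_self, h.Cdot_update_zero hjk hC (update_mem_VV hjk hu (by simp))
      (by simp), sub_zero, sub_zero] at this
    exact (le_abs_self _).trans this
  · have := hl hjk u hu (u j) (hu.1 j) 1 (by simp) (hu.1 j).2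
    rw [Function.update_eq_self, h.Cdot_update_one hjk hC (update_mem_VV hjk hu (by simp))
      (by simp)] at this
    exact (le_abs_self _).trans this
  · rcases eq_or_ne k 0 with rfl | hk
    · exact h.Cdot_mem (j := 1) (by decide) hC hu
    · exact h.Cdot_mem hk.symm hC hu

section
variable (h : UnifSeq P U) {K : ℝ} (hR : CopReg P U K) {j k : Fin 2} (hjk : j ≠ k)
include h hR hjk

lemma exists_slope {u : Fin 2 → ℝ} (hu : ∀ i, u i ∈ Icc (0 : ℝ) 1) {s t : ℝ}
    (hs : 0 < s) (hst : s < t) (ht : t < 1) : ∃ ξ ∈ Ioo s t, Function.update u k ξ ∈ VV 2 k ∧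
      cop P U (Function.update u k t) - cop P U (Function.update u k s) =
        (t - s) * Cdot (cop P U) k (Function.update u k ξ) := by
  have hV : ∀ r, 0 < r → r < 1 → Function.update u k r ∈ VV 2 k := fun r h0 h1 => by
    refine ⟨fun i => ?_, by simpa using ⟨h0, h1⟩⟩
    rcases eq_or_ne i k with rfl | hi
    · simpa using ⟨h0.le, h1.le⟩
    · simpa [hi] using hu i
  have hd : ∀ r, 0 < r → r < 1 → HasDerivAt (fun r => cop P U (Function.update u k r))
      (Cdot (cop P U) k (Function.update u k r)) r := fun r h0 h1 => by
    simpa using hR.deriv k _ (hV r h0 h1)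
  obtain ⟨ξ, hξ, he⟩ := exists_hasDerivAt_eq_slope _ _ hst
    (fun r hr => (hd r (hs.trans_le hr.1) (hr.2.trans_lt ht)).continuousAt.continuousWithinAt)
    (fun r hr => hd r (hs.trans hr.1) (hr.2.trans ht))
  refine ⟨ξ, hξ, hV _ (hs.trans hξ.1) (hξ.2.trans ht), ?_⟩
  rw [he, mul_div_cancel₀ _ (sub_pos.2 hst).ne']

lemma prob_strip_le {u : Fin 2 → ℝ} (hu : ∀ i, u i ∈ Icc (0 : ℝ) 1) {q s t : ℝ} (hq : 0 < q)
    (hs : q / 2 ≤ s) (hst : s < t) (ht : t ≤ 1 - q / 2) :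
    P.real {ω | U 0 ω j < u j ∧ s ≤ U 0 ω k ∧ U 0 ω k < t} ≤ (t - s) * (4 * K * u j / q) ∧
    P.real {ω | u j ≤ U 0 ω j ∧ s ≤ U 0 ω k ∧ U 0 ω k < t} ≤ (t - s) * (4 * K * (1 - u j) / q) := by
  obtain ⟨ξ, hξ, hV, he⟩ := h.exists_slope hR hjk hu (s := s) (t := t) (by linarith) hst
    (by linarith)
  have hK := hR.pos
  have hden : q / 4 ≤ ξ * (1 - ξ) := by
    rcases le_total ξ (1/2) with h1 | h1 <;> nlinarith [hξ.1, hξ.2]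
  have hk : (Function.update u k ξ) k = ξ := by simp
  have hj : (Function.update u k ξ) j = u j := by simp [hjk]
  have hne : ∀ᵐ ω ∂P, (U 0 ω k ≠ s ∧ U 0 ω k ≠ t) ∧ U 0 ω j ≠ u j :=
    ((h.ae_ne 0 k s).and (h.ae_ne 0 k t)).and (h.ae_ne 0 j (u j))
  constructor
  · have e : P.real {ω | U 0 ω j < u j ∧ s ≤ U 0 ω k ∧ U 0 ω k < t} =
        P.real {ω | U 0 ω j ≤ u j ∧ s < U 0 ω k ∧ U 0 ω k ≤ t} := by
      refine measureReal_congr ?_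
      filter_upwards [hne] with ω hω
      refine propext ⟨fun hh => ⟨hh.1.le, lt_of_le_of_ne hh.2.1 hω.1.1.symm, hh.2.2.le⟩,
        fun hh => ⟨lt_of_le_of_ne hh.1 hω.2, hh.2.1.le, lt_of_le_of_ne hh.2.2 hω.1.2⟩⟩
    rw [e, ← h.cop_sub hjk u hst.le, he]
    refine mul_le_mul_of_nonneg_left ((hR.le hjk _ hV).trans ?_) (by linarith)
    rw [hk, hj, show 4 * K * u j / q = K * u j / (q / 4) by field_simp]
    exact div_le_div_of_nonneg_left (mul_nonneg hK.le (hu j).1) (by linarith) hden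
  · have e : P.real {ω | u j ≤ U 0 ω j ∧ s ≤ U 0 ω k ∧ U 0 ω k < t} =
        P.real {ω | u j < U 0 ω j ∧ s < U 0 ω k ∧ U 0 ω k ≤ t} := by
      refine measureReal_congr ?_
      filter_upwards [hne] with ω hω
      refine propext ⟨fun hh => ⟨lt_of_le_of_ne hh.1 hω.2.symm,
        lt_of_le_of_ne hh.2.1 hω.1.1.symm, hh.2.2.le⟩,
        fun hh => ⟨hh.1.le, hh.2.1.le, lt_of_le_of_ne hh.2.2 hω.1.2⟩⟩
    rw [e, ← h.cop_compl hjk u (by linarith) hst.le (by linarith), he, ← mul_one_sub]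
    refine mul_le_mul_of_nonneg_left ((hR.one_sub_le hjk _ hV).trans ?_) (by linarith)
    rw [hk, hj, show 4 * K * (1 - u j) / q = K * (1 - u j) / (q / 4) by field_simp]
    exact div_le_div_of_nonneg_left (mul_nonneg hK.le (by linarith [(hu j).2])) (by linarith) hden

lemma prob_box_le {u : Fin 2 → ℝ} (hu : ∀ i, u i ∈ Icc (0 : ℝ) 1) {q s t s' t' : ℝ} (hq : 0 < q)
    (hs : q / 2 ≤ s) (hst : s < t) (ht : t ≤ 1 - q / 2) (hs' : 0 ≤ s') (hst' : s' ≤ t')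
    (ht' : t' ≤ 1) :
    P.real {ω | (s' ≤ U 0 ω j ∧ U 0 ω j < t') ∧ s ≤ U 0 ω k ∧ U 0 ω k < t} ≤
      (t - s) * (4 * K * (t' - s') / q) := by
  have hK := hR.pos
  have hs0 : 0 < s := by linarith
  have ht1 : t < 1 := by linarith
  have hV : ∀ y ∈ Icc (0 : ℝ) 1, ∀ r, 0 < r → r < 1 →
      Function.update (Function.update u j y) k r ∈ VV 2 k := fun y hy r h0 h1 => by
    refine ⟨fun i => ?_, by simpa using ⟨h0, h1⟩⟩
    rcases fin2_cases hjk i with rfl | rfl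
    · simpa [hjk] using hy
    · simpa using ⟨h0.le, h1.le⟩
  have hd : ∀ y ∈ Icc (0 : ℝ) 1, ∀ r, 0 < r → r < 1 →
      HasDerivAt (fun r => cop P U (Function.update (Function.update u j y) k r))
      (Cdot (cop P U) k (Function.update (Function.update u j y) k r)) r := fun y hy r h0 h1 => by
    simpa using hR.deriv k _ (hV y hy r h0 h1)
  have hy1 : t' ∈ Icc (0 : ℝ) 1 := ⟨hs'.trans hst', ht'⟩
  have hy0 : s' ∈ Icc (0 : ℝ) 1 := ⟨hs', hst'.trans ht'⟩
  have hd2 := fun (r : ℝ) (h0 : 0 < r) (h1 : r < 1) =>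
    (hd t' hy1 r h0 h1).sub (hd s' hy0 r h0 h1)
  obtain ⟨ξ, hξ, he⟩ := exists_hasDerivAt_eq_slope _ _ hst
    (fun r hr => (hd2 r (hs0.trans_le hr.1) (hr.2.trans_lt ht1)).continuousAt.continuousWithinAt)
    (fun r hr => hd2 r (hs0.trans hr.1) (hr.2.trans ht1))
  have hden : q / 4 ≤ ξ * (1 - ξ) := by
    rcases le_total ξ (1/2) with h1 | h1 <;> nlinarith [hξ.1, hξ.2]
  have hlip := (le_abs_self _).trans (hR.lip hjk (Function.update u k ξ)
    (by simpa [Function.update_comm hjk] using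
      (hV _ (hu j) ξ (hs0.trans hξ.1) (hξ.2.trans ht1))) s' hy0 t' hy1 hst')
  simp only [Function.update_self] at hlip
  rw [Function.update_comm hjk.symm, Function.update_comm hjk.symm, he] at hlip
  have hlip' := hlip.trans (div_le_div_of_nonneg_left
    (mul_nonneg hK.le (sub_nonneg.2 hst')) (by linarith) hden)
  rw [div_le_iff₀ (sub_pos.2 hst)] at hlip'
  have hms : MeasurableSet {ω | U 0 ω j ≤ s' ∧ s < U 0 ω k ∧ U 0 ω k ≤ t} :=
    (measurableSet_le (h.meas_coord 0 j) measurable_const).inter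
      ((measurableSet_lt measurable_const (h.meas_coord 0 k)).inter
      (measurableSet_le (h.meas_coord 0 k) measurable_const))
  have e1 := h.cop_sub hjk (Function.update u j t') hst.le
  have e0 := h.cop_sub hjk (Function.update u j s') hst.le
  simp only [Function.update_self] at e1 e0
  have hsub : {ω | U 0 ω j ≤ s' ∧ s < U 0 ω k ∧ U 0 ω k ≤ t} ⊆
      {ω | U 0 ω j ≤ t' ∧ s < U 0 ω k ∧ U 0 ω k ≤ t} := fun ω hω => ⟨hω.1.trans hst', hω.2⟩
  have hdiff := measureReal_sdiff (μ := P) hsub hms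
  calc P.real {ω | (s' ≤ U 0 ω j ∧ U 0 ω j < t') ∧ s ≤ U 0 ω k ∧ U 0 ω k < t}
      ≤ P.real ({ω | U 0 ω j ≤ t' ∧ s < U 0 ω k ∧ U 0 ω k ≤ t} \
        {ω | U 0 ω j ≤ s' ∧ s < U 0 ω k ∧ U 0 ω k ≤ t}) := by
        refine ENNReal.toReal_mono (measure_ne_top _ _) (measure_mono_ae ?_)
        filter_upwards [h.ae_ne 0 k s, h.ae_ne 0 j s'] with ω h1 h2 hω
        exact ⟨⟨hω.1.2.le, lt_of_le_of_ne hω.2.1 h1.symm, hω.2.2.le⟩,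
          fun hh => h2 (le_antisymm hh.1 hω.1.1)⟩
    _ ≤ K * (t' - s') / (q / 4) * (t - s) := by
        rw [hdiff, ← e1, ← e0]
        simp only [Pi.sub_apply] at hlip'
        linarith
    _ = _ := by field_simp

end
end UnifSeq

end

/-! ### Ranks and empirical quantiles -/

section

/-- The indicator of `x < s`. -/
def lt01 (x s : ℝ) : ℝ := if x < s then 1 else 0

lemma lt01_nonneg (x s : ℝ) : 0 ≤ lt01 x s := by unfold lt01; split_ifs <;> norm_num
lemma lt01_le_one (x s : ℝ) : lt01 x s ≤ 1 := by unfold lt01; split_ifs <;> norm_num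
lemma abs_lt01_sub_le (x y s t : ℝ) : |lt01 x s - lt01 y t| ≤ 1 := by
  unfold lt01; split_ifs <;> norm_num

lemma sum_lt01 (F : Finset ℤ) (v : ℤ → ℝ) (s : ℝ) :
    ∑ i ∈ F, lt01 (v i) s = ((F.filter fun i => v i < s).card : ℝ) := by
  unfold lt01; rw [Finset.sum_ite]; simp

/-- Rescaled ranks. -/
def rk (n : ℕ) (v : ℤ → ℝ) (i : ℤ) : ℝ :=
  (((Finset.Icc (1 : ℤ) n).filter fun k => v k ≤ v i).card : ℝ) / (n + 1)

lemma pseudoObs_eq_rk (U : ℤ → Ω → Fin d → ℝ) (n : ℕ) (i : ℤ) (ω : Ω) (j : Fin d) :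
    pseudoObs U n i ω j = rk n (fun k => U k ω j) i := by
  unfold pseudoObs empCdfX rk indic
  simp only [indicator, mem_ofPred_eq]
  rw [Finset.sum_ite, Finset.sum_const_zero, add_zero, Finset.sum_const, nsmul_eq_mul, mul_one]
  rcases Nat.eq_zero_or_pos n with rfl | hn
  · simp
  · field_simp

section ranks
variable (n : ℕ) (v : ℤ → ℝ)

lemma rk_mono {i k : ℤ} (h : v i ≤ v k) : rk n v i ≤ rk n v k := by
  unfold rk
  gcongr

lemma lt_rk_iff (i : ℤ) (s : ℝ) : rk n v i < s ↔
    (((Finset.Icc (1 : ℤ) n).filter fun k => v k ≤ v i).card : ℝ) < s * (n + 1) := by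
  unfold rk; rw [div_lt_iff₀ (by positivity)]

lemma sum_rk_lt_le {s : ℝ} (hs : 0 ≤ s) :
    ∑ i ∈ Finset.Icc (1 : ℤ) n, lt01 (rk n v i) s ≤ s * (n + 1) := by
  rw [sum_lt01]
  rcases ((Finset.Icc (1 : ℤ) n).filter fun i => rk n v i < s).eq_empty_or_nonempty with h0 | h0
  · rw [h0]; simp; positivity
  · obtain ⟨i, hi, hmax⟩ := Finset.exists_max_image _ v h0
    have hlt := (lt_rk_iff n v i s).1 (Finset.mem_filter.1 hi).2
    refine le_trans ?_ hlt.le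
    norm_cast
    refine Finset.card_le_card fun k hk => ?_
    exact Finset.mem_filter.2 ⟨(Finset.mem_filter.1 hk).1, hmax k hk⟩

lemma le_sum_rk_lt {s m : ℝ} (hs : s ≤ 1) (hm : 1 ≤ m)
    (htie : ∀ i ∈ Finset.Icc (1 : ℤ) n,
      (((Finset.Icc (1 : ℤ) n).filter fun k => v k = v i).card : ℝ) ≤ m) :
    s * (n + 1) - m ≤ ∑ i ∈ Finset.Icc (1 : ℤ) n, lt01 (rk n v i) s := by
  rw [sum_lt01]
  rcases ((Finset.Icc (1 : ℤ) n).filter fun i => ¬ rk n v i < s).eq_empty_or_nonempty with h0 | h0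
  · have : (Finset.Icc (1 : ℤ) n).filter (fun i => rk n v i < s) = Finset.Icc (1 : ℤ) n := by
      refine Finset.filter_true_of_mem fun i hi => ?_
      by_contra hc
      have : i ∈ (Finset.Icc (1 : ℤ) n).filter fun i => ¬ rk n v i < s :=
        Finset.mem_filter.2 ⟨hi, hc⟩
      rw [h0] at this
      simp at this
    rw [this]
    simp only [Int.card_Icc, add_sub_cancel_right, Int.toNat_natCast]
    nlinarith [(Nat.cast_nonneg n : (0 : ℝ) ≤ n)]
  · obtain ⟨i, hi, hmin⟩ := Finset.exists_min_image _ v h0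
    obtain ⟨hi1, hi2⟩ := Finset.mem_filter.1 hi
    rw [lt_rk_iff, not_lt] at hi2
    have hsub : ((Finset.Icc (1 : ℤ) n).filter fun k => v k ≤ v i) ⊆
        ((Finset.Icc (1 : ℤ) n).filter fun i => rk n v i < s) ∪
        ((Finset.Icc (1 : ℤ) n).filter fun k => v k = v i) := by
      intro k hk
      obtain ⟨hk1, hk2⟩ := Finset.mem_filter.1 hk
      rw [Finset.mem_union, Finset.mem_filter, Finset.mem_filter]
      by_cases hc : rk n v k < s
      · exact Or.inl ⟨hk1, hc⟩
      · exact Or.inr ⟨hk1, le_antisymm hk2 (hmin k (Finset.mem_filter.2 ⟨hk1, hc⟩))⟩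
    have h2 : (((Finset.Icc (1 : ℤ) n).filter fun k => v k ≤ v i).card : ℝ) ≤
        (((Finset.Icc (1 : ℤ) n).filter fun i => rk n v i < s).card : ℝ) +
        (((Finset.Icc (1 : ℤ) n).filter fun k => v k = v i).card : ℝ) := by
      exact_mod_cast (Finset.card_le_card hsub).trans (Finset.card_union_le _ _)
    have := htie i hi1
    linarith

lemma sum_abs_lt01_sub (F : Finset ℤ) (s t : ℝ) :
    ∑ i ∈ F, |lt01 (rk n v i) s - lt01 (v i) t| =
      |∑ i ∈ F, (lt01 (rk n v i) s - lt01 (v i) t)| := by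
  by_cases hex : ∃ i, rk n v i < s ∧ t ≤ v i
  · obtain ⟨i, h1, h2⟩ := hex
    have hp : ∀ k, 0 ≤ lt01 (rk n v k) s - lt01 (v k) t := by
      intro k
      unfold lt01
      by_cases hk : v k < t
      · rw [if_pos hk, if_pos ((rk_mono n v (hk.le.trans h2)).trans_lt h1)]; simp
      · rw [if_neg hk]; split_ifs <;> simp
    rw [abs_of_nonneg (Finset.sum_nonneg fun k _ => hp k)]
    exact Finset.sum_congr rfl fun k _ => abs_of_nonneg (hp k)
  · push Not at hex
    have hp : ∀ k, lt01 (rk n v k) s - lt01 (v k) t ≤ 0 := by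
      intro k
      unfold lt01
      by_cases hk : rk n v k < s
      · rw [if_pos hk, if_pos (hex k hk)]; simp
      · rw [if_neg hk]; split_ifs <;> simp
    rw [abs_of_nonpos (Finset.sum_nonpos fun k _ => hp k), ← Finset.sum_neg_distrib]
    exact Finset.sum_congr rfl fun k _ => abs_of_nonpos (hp k)

lemma sum_lt01_lt_of_rk_lt {i : ℤ} {s t : ℝ} (h1 : rk n v i < s) (h2 : t ≤ v i) :
    ∑ k ∈ Finset.Icc (1 : ℤ) n, lt01 (v k) t < s * (n + 1) := by
  rw [sum_lt01]
  refine lt_of_le_of_lt ?_ ((lt_rk_iff n v i s).1 h1)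
  norm_cast
  refine Finset.card_le_card fun k hk => ?_
  have := Finset.mem_filter.1 hk
  exact Finset.mem_filter.2 ⟨this.1, this.2.le.trans h2⟩

lemma le_sum_lt01_of_le_rk {i : ℤ} {s t : ℝ} (h1 : s ≤ rk n v i) (h2 : v i < t) :
    s * (n + 1) ≤ ∑ k ∈ Finset.Icc (1 : ℤ) n, lt01 (v k) t := by
  rw [sum_lt01]
  rw [← not_lt, lt_rk_iff, not_lt] at h1
  refine h1.trans ?_
  norm_cast
  refine Finset.card_le_card fun k hk => ?_
  have := Finset.mem_filter.1 hk
  exact Finset.mem_filter.2 ⟨this.1, this.2.trans_lt h2⟩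

lemma rk_mem {i : ℤ} (hi : i ∈ Finset.Icc (1 : ℤ) n) :
    1 / ((n : ℝ) + 1) ≤ rk n v i ∧ rk n v i ≤ n / ((n : ℝ) + 1) := by
  unfold rk
  constructor
  · gcongr
    have : 0 < ((Finset.Icc (1 : ℤ) n).filter fun k => v k ≤ v i).card :=
      Finset.card_pos.2 ⟨i, Finset.mem_filter.2 ⟨hi, le_rfl⟩⟩
    exact_mod_cast this
  · gcongr
    refine (Finset.card_filter_le _ _).trans ?_
    simp

end ranks

/-- Ties among the first `n` observations only occur at time distance less than `L`. -/
def Good (U : ℤ → Ω → Fin d → ℝ) (n L : ℕ) : Set Ω :=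
  {ω | ∀ j : Fin d, ∀ i ∈ Finset.Icc (1 : ℤ) n, ∀ k ∈ Finset.Icc (1 : ℤ) n,
    (L : ℤ) ≤ k - i → U i ω j ≠ U k ω j}

lemma Good.card_tie_le {U : ℤ → Ω → Fin d → ℝ} {n L : ℕ} {ω : Ω} (h : ω ∈ Good U n L)
    (j : Fin d) {i : ℤ} (hi : i ∈ Finset.Icc (1 : ℤ) n) :
    ((Finset.Icc (1 : ℤ) n).filter fun k => U k ω j = U i ω j).card ≤ L := by
  have hne : ((Finset.Icc (1 : ℤ) n).filter fun k => U k ω j = U i ω j).Nonempty :=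
    ⟨i, Finset.mem_filter.2 ⟨hi, rfl⟩⟩
  set k0 := Finset.min' _ hne with hk0
  have hk0m := Finset.mem_filter.1 (Finset.min'_mem _ hne)
  have hsub : ((Finset.Icc (1 : ℤ) n).filter fun k => U k ω j = U i ω j) ⊆
      Finset.Ico k0 (k0 + L) := by
    intro k hk
    have hkm := Finset.mem_filter.1 hk
    rw [Finset.mem_Ico]
    refine ⟨Finset.min'_le _ _ hk, ?_⟩
    by_contra hc
    exact h j k0 hk0m.1 k hkm.1 (by linarith) (hk0m.2.trans hkm.2.symm)
  exact (Finset.card_le_card hsub).trans (by simp)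

/-- One-dimensional empirical process of the observations. -/
def al (U : ℤ → Ω → Fin d → ℝ) (n : ℕ) (j : Fin d) (s : ℝ) (ω : Ω) : ℝ :=
  (Real.sqrt n)⁻¹ * ∑ i ∈ Finset.Icc (1 : ℤ) n, (lt01 (U i ω j) s - s)

/-- One-dimensional empirical process of the pseudo-observations. -/
def ta (U : ℤ → Ω → Fin d → ℝ) (n : ℕ) (j : Fin d) (s : ℝ) (ω : Ω) : ℝ :=
  (Real.sqrt n)⁻¹ * ∑ i ∈ Finset.Icc (1 : ℤ) n, (lt01 (pseudoObs U n i ω j) s - s)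

/-- Normalized number of indices whose position relative to `s` changes under ranking. -/
def TT (U : ℤ → Ω → Fin d → ℝ) (n : ℕ) (j : Fin d) (s : ℝ) (ω : Ω) : ℝ :=
  (Real.sqrt n)⁻¹ * ∑ i ∈ Finset.Icc (1 : ℤ) n, |lt01 (pseudoObs U n i ω j) s - lt01 (U i ω j) s|

lemma TT_eq (U : ℤ → Ω → Fin d → ℝ) (n : ℕ) (j : Fin d) (s : ℝ) (ω : Ω) :
    TT U n j s ω = |ta U n j s ω - al U n j s ω| := by
  unfold TT ta al
  simp only [pseudoObs_eq_rk]
  rw [sum_abs_lt01_sub n (fun k => U k ω j), ← mul_sub, ← Finset.sum_sub_distrib, abs_mul,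
    abs_of_nonneg (inv_nonneg.2 (Real.sqrt_nonneg _))]
  simp

lemma TT_nonneg (U : ℤ → Ω → Fin d → ℝ) (n : ℕ) (j : Fin d) (s : ℝ) (ω : Ω) :
    0 ≤ TT U n j s ω := by rw [TT_eq]; exact abs_nonneg _

lemma TT_le (U : ℤ → Ω → Fin d → ℝ) (n : ℕ) (j : Fin d) (s : ℝ) (ω : Ω) :
    TT U n j s ω ≤ |al U n j s ω| + |ta U n j s ω| := by
  rw [TT_eq, add_comm]; exact abs_sub _ _

lemma abs_sum_pseudoObs_le {U : ℤ → Ω → Fin d → ℝ} {n L : ℕ} (hL : 1 ≤ L) {ω : Ω}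
    (h : ω ∈ Good U n L) (j : Fin d) {s : ℝ} (hs : s ∈ Icc (0 : ℝ) 1) :
    |∑ i ∈ Finset.Icc (1 : ℤ) n, (lt01 (pseudoObs U n i ω j) s - s)| ≤ L := by
  simp only [pseudoObs_eq_rk, Finset.sum_sub_distrib, Finset.sum_const, Int.card_Icc,
    add_sub_cancel_right, Int.toNat_natCast, nsmul_eq_mul]
  have h1 := sum_rk_lt_le n (fun k => U k ω j) hs.1
  have hL' : (1 : ℝ) ≤ L := by exact_mod_cast hL
  have h2 := le_sum_rk_lt n (fun k => U k ω j) hs.2 hL'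
    fun i hi => by exact_mod_cast Good.card_tie_le h j hi
  have := hs.1
  have := hs.2
  rw [abs_le]; constructor <;> nlinarith

lemma abs_ta_le {U : ℤ → Ω → Fin d → ℝ} {n L : ℕ} (hL : 1 ≤ L) {ω : Ω} (h : ω ∈ Good U n L)
    (j : Fin d) {s : ℝ} (hs : s ∈ Icc (0 : ℝ) 1) : |ta U n j s ω| ≤ (Real.sqrt n)⁻¹ * L := by
  unfold ta
  rw [abs_mul, abs_of_nonneg (inv_nonneg.2 (Real.sqrt_nonneg _))]
  exact mul_le_mul_of_nonneg_left (abs_sum_pseudoObs_le hL h j hs)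
    (inv_nonneg.2 (Real.sqrt_nonneg _))

/-- If an indicator changes at distance more than `x` from `s` under ranking, the empirical
process is large at `s - x` or `s + x`. -/
lemma large_al_of_far {U : ℤ → Ω → Fin d → ℝ} {n : ℕ} (hn : 0 < n)
    (hU : ∀ i ω j, U i ω j ∈ Icc (0 : ℝ) 1) {ω : Ω} {j : Fin d} {i : ℤ} {s x : ℝ}
    (hs : s ∈ Icc (0 : ℝ) 1)
    (hne : lt01 (pseudoObs U n i ω j) s - lt01 (U i ω j) s ≠ 0)
    (hfar : ¬ (s - x ≤ U i ω j ∧ U i ω j < s + x)) (hx : 0 ≤ x) :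
    Real.sqrt n * x - (Real.sqrt n)⁻¹ ≤ |al U n j (s + x) ω| ∨
      Real.sqrt n * x - (Real.sqrt n)⁻¹ ≤ |al U n j (s - x) ω| := by
  have hr : 0 < Real.sqrt n := Real.sqrt_pos.2 (by exact_mod_cast hn)
  have hrr : Real.sqrt n * Real.sqrt n = n := Real.mul_self_sqrt (by positivity)
  have hal : ∀ t, al U n j t ω =
      (Real.sqrt n)⁻¹ * (∑ i ∈ Finset.Icc (1 : ℤ) n, lt01 (U i ω j) t - n * t) := by
    intro t; unfold al
    simp [Finset.sum_sub_distrib]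
  rw [pseudoObs_eq_rk] at hne
  have h01 : (rk n (fun k => U k ω j) i < s ∧ s ≤ U i ω j) ∨
      (s ≤ rk n (fun k => U k ω j) i ∧ U i ω j < s) := by
    unfold lt01 at hne
    by_contra hc
    push Not at hc
    rcases lt_or_ge (rk n (fun k => U k ω j) i) s with h1 | h1
    · rw [if_pos h1, if_pos (hc.1 h1)] at hne; simp at hne
    · rw [if_neg (not_lt.2 h1), if_neg (not_lt.2 (hc.2 h1))] at hne; simp at hne
  have hinv : (Real.sqrt n)⁻¹ * (n * x) = Real.sqrt n * x := by
    calc (Real.sqrt n)⁻¹ * (n * x) = (Real.sqrt n)⁻¹ * (Real.sqrt n * Real.sqrt n * x) := by rw [hrr]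
      _ = _ := by field_simp
  have hinv0 : 0 ≤ (Real.sqrt n)⁻¹ := inv_nonneg.2 hr.le
  rcases h01 with ⟨h1, h2⟩ | ⟨h1, h2⟩
  · left
    have h3 : s + x ≤ U i ω j := by
      by_contra hc; exact hfar ⟨by linarith, not_le.1 hc⟩
    have h4 := sum_lt01_lt_of_rk_lt n (fun k => U k ω j) h1 h3
    refine le_trans ?_ (neg_le_abs _)
    rw [hal, ← hinv]
    have : (Real.sqrt n)⁻¹ * (∑ i ∈ Finset.Icc (1 : ℤ) n, lt01 (U i ω j) (s + x) - n * (s + x)) ≤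
      (Real.sqrt n)⁻¹ * (1 - n * x) := by
      refine mul_le_mul_of_nonneg_left ?_ hinv0
      nlinarith [hs.2]
    linarith
  · right
    have h3 : U i ω j < s - x := by
      by_contra hc; exact hfar ⟨not_lt.1 hc, by linarith⟩
    have h4 := le_sum_lt01_of_le_rk n (fun k => U k ω j) h1 h3
    refine le_trans ?_ (le_abs_self _)
    rw [hal, ← hinv]
    have : (Real.sqrt n)⁻¹ * (n * x) ≤
      (Real.sqrt n)⁻¹ * (∑ i ∈ Finset.Icc (1 : ℤ) n, lt01 (U i ω j) (s - x) - n * (s - x)) := by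
      refine mul_le_mul_of_nonneg_left ?_ hinv0
      nlinarith [hs.1]
    linarith

end

/-! ### Ties -/

section

lemma measurableSet_mixSigma (X : ℤ → Ω → E) {S : Set ℤ} {i : ℤ} (hi : i ∈ S) {A : Set E}
    (hA : MeasurableSet A) : MeasurableSet[mixSigma X S] (X i ⁻¹' A) := by
  have hle : MeasurableSpace.comap (X i) inferInstance ≤ mixSigma X S :=
    le_iSup₂_of_le (f := fun i (_ : i ∈ S) => MeasurableSpace.comap (X i) inferInstance) i hi le_rfl
  exact hle _ ⟨A, hA, rfl⟩

variable {P : Measure Ω} [IsProbabilityMeasure P] {U : ℤ → Ω → Fin d → ℝ}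

lemma UnifSeq.exists_tie_bound (h : UnifSeq P U) : ∃ a ∈ Ioo (0 : ℝ) 1, ∃ c : ℝ, 0 < c ∧
    ∀ (j : Fin d) (i k : ℤ) (L N : ℕ), 0 < N → (L : ℤ) ≤ k - i →
      P.real {ω | U i ω j = U k ω j} ≤ (N : ℝ)⁻¹ + N * (c * a ^ L) := by
  obtain ⟨a, ha, c, hc, hb⟩ := h.mix.exists_bound
  refine ⟨a, ha, c, hc, fun j i k L N hN hik => ?_⟩
  have hN' : (0 : ℝ) < N := by exact_mod_cast hN
  let A : ℕ → Set (Fin d → ℝ) := fun m => {x | (m : ℝ) / N ≤ x j ∧ x j ≤ (m + 1) / N}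
  have hA : ∀ m, MeasurableSet (A m) := fun m =>
    (measurableSet_le measurable_const (measurable_pi_apply j)).inter
      (measurableSet_le (measurable_pi_apply j) measurable_const)
  have hPA : ∀ (i : ℤ) m, P.real (U i ⁻¹' A m) ≤ (N : ℝ)⁻¹ := by
    intro i m
    have e : P.real (U i ⁻¹' A m) = P.real (U 0 ⁻¹' A m) := by
      unfold Measure.real; rw [h.stat.measure_one h.meas (hA m) i]
    rw [e]
    calc P.real (U 0 ⁻¹' A m)
        ≤ P.real {ω | (m : ℝ) / N < U 0 ω j ∧ U 0 ω j ≤ (m + 1) / N} := by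
          refine ENNReal.toReal_mono (measure_ne_top _ _) (measure_mono_ae ?_)
          filter_upwards [h.ae_ne 0 j ((m : ℝ) / N)] with ω h1 hω
          exact ⟨lt_of_le_of_ne hω.1 h1.symm, hω.2⟩
      _ ≤ ((m : ℝ) + 1) / N - m / N := h.prob_Ioc_le j (by gcongr; linarith)
      _ = (N : ℝ)⁻¹ := by field_simp; ring
  have hsub : {ω | U i ω j = U k ω j} ⊆
      ⋃ m ∈ Finset.range N, (U i ⁻¹' A m ∩ U k ⁻¹' A m) := by
    intro ω (hω : U i ω j = U k ω j)
    have hcell : ∃ m ∈ Finset.range N, U i ω ∈ A m := by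
      obtain ⟨h0, h1⟩ := h.mem i ω j
      rcases h1.lt_or_eq with h1 | h1
      · refine ⟨⌊N * U i ω j⌋₊, ?_, ?_, ?_⟩
        · rw [Finset.mem_range, Nat.floor_lt (by positivity)]
          nlinarith
        · rw [div_le_iff₀ hN', mul_comm (U i ω j)]; exact Nat.floor_le (by positivity)
        · rw [le_div_iff₀ hN', mul_comm (U i ω j)]; exact (Nat.lt_floor_add_one _).le
      · refine ⟨N - 1, by rw [Finset.mem_range]; omega, ?_, ?_⟩
        · rw [h1, div_le_one hN']; exact_mod_cast Nat.sub_le _ _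
        · rw [h1, Nat.cast_sub (by omega)]; simp [hN'.ne']
    obtain ⟨m, hm, hm2⟩ := hcell
    refine mem_iUnion₂.2 ⟨m, hm, hm2, ?_⟩
    change _ ≤ U k ω j ∧ U k ω j ≤ _
    rw [← hω]; exact hm2
  calc P.real {ω | U i ω j = U k ω j}
      ≤ P.real (⋃ m ∈ Finset.range N, (U i ⁻¹' A m ∩ U k ⁻¹' A m)) := measureReal_mono hsub (measure_ne_top _ _)
    _ ≤ ∑ m ∈ Finset.range N, P.real (U i ⁻¹' A m ∩ U k ⁻¹' A m) :=
        measureReal_biUnion_finset_le _ _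
    _ ≤ ∑ m ∈ Finset.range N, ((N : ℝ)⁻¹ * (N : ℝ)⁻¹ + c * a ^ L) := by
        refine Finset.sum_le_sum fun m _ => ?_
        have h1 := hb i L _ _ (measurableSet_mixSigma U (mem_Iic.2 (le_refl i)) (hA m))
          (measurableSet_mixSigma U (show k ∈ Ici (i + (L : ℤ)) by
            rw [mem_Ici]; linarith) (hA m))
        have h2 : P.real (U i ⁻¹' A m) * P.real (U k ⁻¹' A m) ≤ (N : ℝ)⁻¹ * (N : ℝ)⁻¹ :=
          mul_le_mul (hPA i m) (hPA k m) measureReal_nonneg (by positivity)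
        linarith [(abs_le.1 h1).2]
    _ = (N : ℝ)⁻¹ + N * (c * a ^ L) := by
        rw [Finset.sum_const, Finset.card_range, nsmul_eq_mul]; field_simp

lemma measurableSet_Good (hm : ∀ i, Measurable (U i)) (n L : ℕ) : MeasurableSet (Good U n L) := by
  have hm' : ∀ i j, Measurable fun ω => U i ω j := fun i j => (measurable_pi_apply j).comp (hm i)
  have : Good U n L = ⋂ j : Fin d, ⋂ i ∈ Finset.Icc (1 : ℤ) n, ⋂ k ∈ Finset.Icc (1 : ℤ) n,
      {ω | (L : ℤ) ≤ k - i → U i ω j ≠ U k ω j} := by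
    ext ω; simp only [Good, mem_ofPred_eq, mem_iInter]
  rw [this]
  refine MeasurableSet.iInter fun j => Finset.measurableSet_biInter _ fun i _ =>
    Finset.measurableSet_biInter _ fun k _ => ?_
  by_cases hL : (L : ℤ) ≤ k - i
  · simp only [hL, true_imp_iff]
    exact (measurableSet_eq_fun (hm' i j) (hm' k j)).compl
  · simp [hL]

lemma UnifSeq.exists_good_bound (h : UnifSeq P U) : ∃ a ∈ Ioo (0 : ℝ) 1, ∃ c : ℝ, 0 < c ∧
    ∀ n L N : ℕ, 0 < N →
      P.real (Good U n L)ᶜ ≤ d * (n * (n * ((N : ℝ)⁻¹ + N * (c * a ^ L)))) := by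
  obtain ⟨a, ha, c, hc, hb⟩ := h.exists_tie_bound
  refine ⟨a, ha, c, hc, fun n L N hN => ?_⟩
  have hsub : (Good U n L)ᶜ ⊆ ⋃ j ∈ (Finset.univ : Finset (Fin d)), ⋃ i ∈ Finset.Icc (1 : ℤ) n,
      ⋃ k ∈ Finset.Icc (1 : ℤ) n, {ω | (L : ℤ) ≤ k - i ∧ U i ω j = U k ω j} := by
    intro ω hω
    simp only [Good, mem_compl_iff, mem_ofPred_eq] at hω
    push Not at hω
    obtain ⟨j, i, hi, k, hk, h1, h2⟩ := hω
    simp only [mem_iUnion]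
    exact ⟨j, Finset.mem_univ j, i, hi, k, hk, h1, h2⟩
  have hpos : 0 ≤ (N : ℝ)⁻¹ + N * (c * a ^ L) := by
    have := ha.1; positivity
  refine (measureReal_mono hsub (measure_ne_top _ _)).trans ((measureReal_biUnion_finset_le _ _).trans ?_)
  refine (Finset.sum_le_card_nsmul _ _ (n * (n * ((N : ℝ)⁻¹ + N * (c * a ^ L)))) fun j _ => ?_).trans
    (by simp [mul_add])
  refine (measureReal_biUnion_finset_le _ _).trans ?_
  refine (Finset.sum_le_card_nsmul _ _ (n * ((N : ℝ)⁻¹ + N * (c * a ^ L))) fun i _ => ?_).trans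
    (by simp [mul_add])
  refine (measureReal_biUnion_finset_le _ _).trans ?_
  refine (Finset.sum_le_card_nsmul _ _ ((N : ℝ)⁻¹ + N * (c * a ^ L)) fun k _ => ?_).trans
    (by simp [mul_add])
  by_cases hL : (L : ℤ) ≤ k - i
  · refine (measureReal_mono fun ω hω => hω.2).trans (hb j i k L N hN hL)
  · simpa [hL] using hpos

/-- Admissible time distance of ties among `n` observations. -/
def tieLen (κ : ℝ) (n : ℕ) : ℕ := ⌊(n : ℝ) ^ (1 / 2 - κ)⌋₊

lemma one_le_tieLen {κ : ℝ} (hκ : κ < 1 / 2) {n : ℕ} (hn : 0 < n) : 1 ≤ tieLen κ n := by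
  unfold tieLen
  rw [Nat.one_le_floor_iff]
  exact Real.one_le_rpow (by exact_mod_cast hn) (by linarith)

lemma tieLen_le (κ : ℝ) {n : ℕ} (hn : 0 < n) :
    (Real.sqrt n)⁻¹ * tieLen κ n ≤ (n : ℝ) ^ (-κ) := by
  have hn' : (0 : ℝ) < n := by exact_mod_cast hn
  rw [Real.sqrt_eq_rpow, ← Real.rpow_neg hn'.le]
  calc (n : ℝ) ^ (-(1 / 2) : ℝ) * tieLen κ n ≤ (n : ℝ) ^ (-(1 / 2) : ℝ) * (n : ℝ) ^ (1 / 2 - κ) := by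
        gcongr
        exact Nat.floor_le (by positivity)
    _ = (n : ℝ) ^ (-κ) := by rw [← Real.rpow_add hn']; congr 1; ring

lemma UnifSeq.tendsto_good (h : UnifSeq P U) {κ : ℝ} (hκ : κ < 1 / 2) :
    Tendsto (fun n => P.real (Good U n (tieLen κ n))ᶜ) atTop (nhds 0) := by
  obtain ⟨a, ha, c, hc, hb⟩ := h.exists_good_bound
  set ρ := 1 / 2 - κ with hρ
  have hρ0 : 0 < ρ := by rw [hρ]; linarith
  have ha0 := ha.1
  have hlog : 0 < - Real.log a := neg_pos.2 (Real.log_neg ha.1 ha.2)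
  have hy : Tendsto (fun n : ℕ => (n : ℝ) ^ ρ) atTop atTop :=
    (tendsto_rpow_atTop hρ0).comp tendsto_natCast_atTop_atTop
  have ht := (tendsto_rpow_mul_exp_neg_mul_atTop_nhds_zero (5 / ρ) (- Real.log a) hlog).comp hy
  have hlim : Tendsto (fun n : ℕ => d * ((n : ℝ)⁻¹ + c * a⁻¹ *
      (((n : ℝ) ^ ρ) ^ (5 / ρ) * Real.exp (-(-Real.log a) * (n : ℝ) ^ ρ)))) atTop (nhds 0) := by
    have := (tendsto_inv_atTop_nhds_zero_nat (𝕜 := ℝ)).add (ht.const_mul (c * a⁻¹))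
    simpa using this.const_mul (d : ℝ)
  refine squeeze_zero' (Eventually.of_forall fun n => measureReal_nonneg) ?_ hlim
  filter_upwards [eventually_gt_atTop 0] with n hn
  have hn' : (0 : ℝ) < n := by exact_mod_cast hn
  refine (hb n (tieLen κ n) (n ^ 3) (by positivity)).trans ?_
  refine mul_le_mul_of_nonneg_left ?_ (Nat.cast_nonneg d)
  have hapow : a ^ tieLen κ n ≤ a⁻¹ * Real.exp (-(-Real.log a) * (n : ℝ) ^ ρ) := by
    rw [← Real.rpow_natCast, neg_neg, ← Real.rpow_def_of_pos ha0, ← Real.rpow_neg_one a,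
      ← Real.rpow_add ha0]
    refine Real.rpow_le_rpow_of_exponent_ge ha0 ha.2.le ?_
    have := (Nat.lt_floor_add_one ((n : ℝ) ^ ρ)).le
    unfold tieLen
    linarith
  have e5 : ((n : ℝ) ^ ρ) ^ (5 / ρ) = (n : ℝ) ^ 5 := by
    rw [← Real.rpow_mul hn'.le, mul_div_cancel₀ _ hρ0.ne']; norm_cast
  rw [e5]
  push_cast
  calc (n : ℝ) * (n * (((n : ℝ) ^ 3)⁻¹ + (n : ℝ) ^ 3 * (c * a ^ tieLen κ n)))
      = (n : ℝ)⁻¹ + c * (n : ℝ) ^ 5 * a ^ tieLen κ n := by field_simp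
    _ ≤ (n : ℝ)⁻¹ + c * (n : ℝ) ^ 5 * (a⁻¹ * Real.exp (-(-Real.log a) * (n : ℝ) ^ ρ)) := by gcongr
    _ = _ := by ring

end

/-! ### Moment bounds for the marginal empirical processes -/

section

lemma Measurable.lt01_const {α : Type*} [MeasurableSpace α] {f : α → ℝ} (hf : Measurable f) (s : ℝ) :
    Measurable fun a => lt01 (f a) s :=
  Measurable.ite (measurableSet_lt hf measurable_const) measurable_const measurable_const

lemma measurable_pseudoObs {U : ℤ → Ω → Fin d → ℝ} (hm : ∀ i, Measurable (U i)) (n : ℕ) (i : ℤ)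
    (j : Fin d) : Measurable fun ω => pseudoObs U n i ω j := by
  have hm' : ∀ i j, Measurable fun ω => U i ω j := fun i j => (measurable_pi_apply j).comp (hm i)
  have : (fun ω => pseudoObs U n i ω j) = fun ω => (n : ℝ) / (n + 1) * ((n : ℝ)⁻¹ *
      ∑ k ∈ Finset.Icc (1 : ℤ) n, if U k ω j ≤ U i ω j then (1 : ℝ) else 0) := by
    ext ω
    unfold pseudoObs empCdfX indic
    simp only [indicator, mem_ofPred_eq]
  rw [this]
  refine (Measurable.const_mul (Finset.measurable_fun_sum _ fun k _ => ?_) _).const_mul _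
  exact Measurable.ite (measurableSet_le (hm' k j) (hm' i j)) measurable_const measurable_const

variable {P : Measure Ω} [IsProbabilityMeasure P]

/-- The empirical process indexed by functions. -/
def emp (P : Measure Ω) (U : ℤ → Ω → E) (n : ℕ) (φ : E → ℝ) (ω : Ω) : ℝ :=
  (Real.sqrt n)⁻¹ * ∑ i ∈ Finset.Icc (1 : ℤ) n, (φ (U i ω) - ∫ ω', φ (U 0 ω') ∂P)

lemma measurable_emp {U : ℤ → Ω → E} (hm : ∀ i, Measurable (U i)) (n : ℕ) {φ : E → ℝ}
    (hφ : Measurable φ) : Measurable (emp P U n φ) :=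
  (Finset.measurable_fun_sum _ fun i _ => (hφ.comp (hm i)).sub_const _).const_mul _

lemma abs_integral_le_one {φ : Ω → ℝ} {M : ℝ} (hφ1 : ∀ x, |φ x| ≤ M) :
    |∫ ω, φ ω ∂P| ≤ M := by
  have := norm_integral_le_of_norm_le_const (μ := P) (f := φ) (C := M) (ae_of_all _ fun x => hφ1 x)
  simpa using this

lemma abs_emp_le (U : ℤ → Ω → E) (n : ℕ) {φ : E → ℝ} {M : ℝ} (hφ1 : ∀ x, |φ x| ≤ M) (ω : Ω) :
    |emp P U n φ ω| ≤ (Real.sqrt n)⁻¹ * (n * (2 * M)) := by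
  unfold emp
  rw [abs_mul, abs_of_nonneg (inv_nonneg.2 (Real.sqrt_nonneg _))]
  refine mul_le_mul_of_nonneg_left ?_ (inv_nonneg.2 (Real.sqrt_nonneg _))
  refine (Finset.abs_sum_le_sum_abs _ _).trans ((Finset.sum_le_card_nsmul _ _ (2 * M)
    fun i _ => ?_).trans (by simp))
  refine (abs_sub _ _).trans ?_
  have := abs_integral_le_one (P := P) (φ := fun ω => φ (U 0 ω)) fun x => hφ1 _
  linarith [hφ1 (U i ω)]

/-- Second moments of the empirical process are controlled by a power of the mean. -/
def EmpBound (P : Measure Ω) (U : ℤ → Ω → E) (κ C : ℝ) : Prop :=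
  0 < C ∧ ∀ φ : E → ℝ, Measurable φ → (∀ x, |φ x| ≤ 1) → ∀ n : ℕ, 0 < n →
    ∫ ω, emp P U n φ ω ^ 2 ∂P ≤ C * (∫ ω, |φ (U 0 ω)| ∂P) ^ (2 * κ)

lemma UnifSeq.exists_empBound {U : ℤ → Ω → Fin d → ℝ} (h : UnifSeq P U) {κ : ℝ} (hκ0 : 0 < κ)
    (hκ : κ < 1 / 2) : ∃ C, EmpBound P U κ C := by
  obtain ⟨C, hC, hb⟩ := exists_variance_bound h.meas h.stat h.mix hκ0 hκ
  refine ⟨C, hC, fun φ hφ hφ1 n hn => ?_⟩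
  have := hb φ hφ hφ1 (Finset.Icc (1 : ℤ) n)
  have hn' : (0 : ℝ) < n := by exact_mod_cast hn
  simp only [emp, mul_pow, inv_pow, Real.sq_sqrt hn'.le]
  rw [integral_const_mul]
  calc (n : ℝ)⁻¹ * _ ≤ (n : ℝ)⁻¹ * _ := mul_le_mul_of_nonneg_left this (by positivity)
    _ = _ := by
      simp only [Int.card_Icc, add_sub_cancel_right, Int.toNat_natCast]
      field_simp

lemma UnifSeq.integral_lt01 {U : ℤ → Ω → Fin d → ℝ} (h : UnifSeq P U) (j : Fin d) {s : ℝ}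
    (hs : s ∈ Icc (0 : ℝ) 1) : ∫ ω, lt01 (U 0 ω j) s ∂P = s := by
  have : (fun ω => lt01 (U 0 ω j) s) = {ω | U 0 ω j < s}.indicator 1 := by
    ext ω; simp [lt01, indicator]
  rw [this, integral_indicator_one (measurableSet_lt (h.meas_coord 0 j) measurable_const),
    h.prob_lt j hs]

lemma UnifSeq.al_eq {U : ℤ → Ω → Fin d → ℝ} (h : UnifSeq P U) (n : ℕ) (j : Fin d) {s : ℝ}
    (hs : s ∈ Icc (0 : ℝ) 1) : al U n j s = emp P U n (fun x => lt01 (x j) s) := by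
  ext ω
  unfold al emp
  rw [h.integral_lt01 j hs]

lemma measurable_lt01_coord (j : Fin d) (s : ℝ) : Measurable fun x : Fin d → ℝ => lt01 (x j) s :=
  Measurable.lt01_const (measurable_pi_apply j) s

lemma abs_lt01_le (x s : ℝ) : |lt01 x s| ≤ 1 := by
  rw [abs_of_nonneg (lt01_nonneg x s)]; exact lt01_le_one x s

lemma integrable_emp_sq {U : ℤ → Ω → E} (hm : ∀ i, Measurable (U i)) (n : ℕ) {φ : E → ℝ} {M : ℝ}
    (hφ : Measurable φ) (hφ1 : ∀ x, |φ x| ≤ M) : Integrable (fun ω => emp P U n φ ω ^ 2) P :=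
  integrable_of_abs_le ((measurable_emp hm n hφ).pow_const 2) fun ω => by
    rw [abs_pow]; exact pow_le_pow_left₀ (abs_nonneg _) (abs_emp_le U n hφ1 ω) 2

lemma integrable_emp {U : ℤ → Ω → E} (hm : ∀ i, Measurable (U i)) (n : ℕ) {φ : E → ℝ} {M : ℝ}
    (hφ : Measurable φ) (hφ1 : ∀ x, |φ x| ≤ M) : Integrable (emp P U n φ) P :=
  integrable_of_abs_le (measurable_emp hm n hφ) fun ω => abs_emp_le U n hφ1 ω

lemma UnifSeq.integral_al_sq_le {U : ℤ → Ω → Fin d → ℝ} (h : UnifSeq P U) {κ C : ℝ}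
    (hB : EmpBound P U κ C) {n : ℕ} (hn : 0 < n) (j : Fin d) {s : ℝ} (hs : s ∈ Icc (0 : ℝ) 1) :
    ∫ ω, al U n j s ω ^ 2 ∂P ≤ C * (min s (1 - s)) ^ (2 * κ) := by
  rw [h.al_eq n j hs]
  rcases min_cases s (1 - s) with ⟨hq, -⟩ | ⟨hq, -⟩
  · have := hB.2 _ (measurable_lt01_coord j s) (fun x => abs_lt01_le _ _) n hn
    simp only [abs_of_nonneg (lt01_nonneg _ _)] at this
    rw [h.integral_lt01 j hs] at this
    rwa [hq]
  · have hb1 : ∀ x : Fin d → ℝ, |1 - lt01 (x j) s| ≤ 1 := fun x => by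
      have h0 := lt01_nonneg (x j) s
      have h1 := lt01_le_one (x j) s
      rw [abs_of_nonneg (by linarith)]; linarith
    have := hB.2 (fun x => 1 - lt01 (x j) s) ((measurable_lt01_coord j s).const_sub 1) hb1 n hn
    have hi : Integrable (fun ω => lt01 (U 0 ω j) s) P :=
      integrable_of_abs_le (Measurable.lt01_const (h.meas_coord 0 j) s) fun ω => abs_lt01_le _ _
    have e1 : ∫ ω, (1 - lt01 (U 0 ω j) s) ∂P = 1 - s := by
      rw [integral_sub (integrable_const _) hi, h.integral_lt01 j hs]; simp
    have e2 : ∀ ω, |1 - lt01 (U 0 ω j) s| = 1 - lt01 (U 0 ω j) s := fun ω => by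
      rw [abs_of_nonneg]; linarith [lt01_le_one (U 0 ω j) s]
    simp only [e2] at this
    rw [e1] at this
    rw [hq]
    refine le_of_eq_of_le (integral_congr_ae (ae_of_all _ fun ω => ?_)) this
    simp only [emp]
    rw [e1, h.integral_lt01 j hs, ← neg_sq, ← mul_neg, ← Finset.sum_neg_distrib]
    congr 2
    refine Finset.sum_congr rfl fun i _ => by ring

lemma integrable_al_sq {U : ℤ → Ω → Fin d → ℝ} (h : UnifSeq P U) (n : ℕ) (j : Fin d) {s : ℝ}
    (hs : s ∈ Icc (0 : ℝ) 1) : Integrable (fun ω => al U n j s ω ^ 2) P := by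
  rw [h.al_eq n j hs]
  exact integrable_emp_sq h.meas n (measurable_lt01_coord j s) fun x => abs_lt01_le _ _

lemma integrable_al {U : ℤ → Ω → Fin d → ℝ} (h : UnifSeq P U) (n : ℕ) (j : Fin d) {s : ℝ}
    (hs : s ∈ Icc (0 : ℝ) 1) : Integrable (al U n j s) P := by
  rw [h.al_eq n j hs]
  exact integrable_emp h.meas n (measurable_lt01_coord j s) fun x => abs_lt01_le _ _

lemma sqrt_mul_rpow_le {C q κ : ℝ} (hC : 0 < C) (hq : 0 ≤ q) :
    √(C * q ^ (2 * κ)) = √C * q ^ κ := by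
  rw [Real.sqrt_mul hC.le, Real.sqrt_eq_rpow (q ^ (2 * κ)), ← Real.rpow_mul hq]
  congr 2; ring

lemma UnifSeq.integral_abs_al_le {U : ℤ → Ω → Fin d → ℝ} (h : UnifSeq P U) {κ C : ℝ}
    (hB : EmpBound P U κ C) {n : ℕ} (hn : 0 < n) (j : Fin d) {s : ℝ} (hs : s ∈ Icc (0 : ℝ) 1) :
    ∫ ω, |al U n j s ω| ∂P ≤ √C * (min s (1 - s)) ^ κ := by
  rw [← sqrt_mul_rpow_le hB.1 (le_min hs.1 (by linarith [hs.2]))]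
  exact (integral_abs_le_sqrt (integrable_al h n j hs) (integrable_al_sq h n j hs)).trans
    (Real.sqrt_le_sqrt (h.integral_al_sq_le hB hn j hs))

omit [IsProbabilityMeasure P] in
lemma setIntegral_le_integral_of_le {G : Set Ω} (hG : MeasurableSet G) {f g : Ω → ℝ}
    (hg : Integrable g P) (hg0 : ∀ ω, 0 ≤ g ω) (hf0 : ∀ ω, 0 ≤ f ω) (hfg : ∀ ω ∈ G, f ω ≤ g ω) :
    ∫ ω in G, f ω ∂P ≤ ∫ ω, g ω ∂P :=
  (integral_mono_of_nonneg (ae_of_all _ hf0) hg.integrableOn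
    (ae_restrict_of_forall_mem hG hfg)).trans (setIntegral_le_integral hg (ae_of_all _ hg0))

end

/-! ### Moment bounds for empirical measures of small sets -/

section

variable {P : Measure Ω} [IsProbabilityMeasure P]

lemma indic_nonneg {α : Type*} (A : Set α) (x : α) : 0 ≤ indic A x := by
  unfold indic; exact indicator_nonneg (fun _ _ => zero_le_one) x

lemma indic_le_one {α : Type*} (A : Set α) (x : α) : indic A x ≤ 1 := by
  unfold indic; exact indicator_le_self' (fun _ _ => zero_le_one) x

lemma abs_indic_le {α : Type*} (A : Set α) (x : α) : |indic A x| ≤ 1 := by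
  rw [abs_of_nonneg (indic_nonneg A x)]; exact indic_le_one A x

lemma measurable_indic {α : Type*} [MeasurableSpace α] {A : Set α} (hA : MeasurableSet A) :
    Measurable (indic A) := by
  unfold indic; exact measurable_const.indicator hA

/-- Normalized number of observations in a set. -/
def cnt (U : ℤ → Ω → E) (n : ℕ) (A : Set E) (ω : Ω) : ℝ :=
  (Real.sqrt n)⁻¹ * ∑ i ∈ Finset.Icc (1 : ℤ) n, indic A (U i ω)

omit [MeasurableSpace Ω] [MeasurableSpace E] in
lemma cnt_nonneg (U : ℤ → Ω → E) (n : ℕ) (A : Set E) (ω : Ω) : 0 ≤ cnt U n A ω :=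
  mul_nonneg (inv_nonneg.2 (Real.sqrt_nonneg _)) (Finset.sum_nonneg fun _ _ => indic_nonneg _ _)

lemma UnifSeq.integral_indic {U : ℤ → Ω → Fin d → ℝ} (h : UnifSeq P U) {A : Set (Fin d → ℝ)}
    (hA : MeasurableSet A) (i : ℤ) : ∫ ω, indic A (U i ω) ∂P = P.real {ω | U 0 ω ∈ A} := by
  have : (fun ω => indic A (U i ω)) = (U i ⁻¹' A).indicator 1 := by
    ext ω; by_cases hc : U i ω ∈ A <;> simp [indic, indicator, hc]
  rw [this, integral_indicator_one (h.meas i hA)]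
  exact congrArg ENNReal.toReal (h.stat.measure_one h.meas hA i)

lemma integrable_indic {U : ℤ → Ω → E} (hm : ∀ i, Measurable (U i)) {A : Set E}
    (hA : MeasurableSet A) (i : ℤ) : Integrable (fun ω => indic A (U i ω)) P :=
  integrable_of_abs_le ((measurable_indic hA).comp (hm i)) fun _ => abs_indic_le _ _

lemma integrable_cnt {U : ℤ → Ω → E} (hm : ∀ i, Measurable (U i)) (n : ℕ) {A : Set E}
    (hA : MeasurableSet A) : Integrable (cnt U n A) P :=
  (integrable_finsetSum _ fun i _ => integrable_indic hm hA i).const_mul _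

lemma UnifSeq.integral_cnt {U : ℤ → Ω → Fin d → ℝ} (h : UnifSeq P U) (n : ℕ)
    {A : Set (Fin d → ℝ)} (hA : MeasurableSet A) :
    ∫ ω, cnt U n A ω ∂P = Real.sqrt n * P.real {ω | U 0 ω ∈ A} := by
  unfold cnt
  rw [integral_const_mul, integral_finsetSum (f := fun i ω => indic A (U i ω)) _
    fun i _ => integrable_indic h.meas hA i]
  simp only [h.integral_indic hA, Finset.sum_const, Int.card_Icc, add_sub_cancel_right,
    Int.toNat_natCast, nsmul_eq_mul]
  rw [← mul_assoc]
  congr 1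
  rcases Nat.eq_zero_or_pos n with rfl | hn
  · simp
  · have hr : 0 < Real.sqrt n := Real.sqrt_pos.2 (by exact_mod_cast hn)
    rw [inv_mul_eq_div, div_eq_iff hr.ne', Real.mul_self_sqrt (by positivity)]

/-- Normalized number of indices in `A` whose `k`-th coordinate changes side of `s`. -/
def SA (U : ℤ → Ω → Fin d → ℝ) (n : ℕ) (A : Set (Fin d → ℝ)) (k : Fin d) (s : ℝ) (ω : Ω) : ℝ :=
  (Real.sqrt n)⁻¹ * ∑ i ∈ Finset.Icc (1 : ℤ) n,
    indic A (U i ω) * |lt01 (pseudoObs U n i ω k) s - lt01 (U i ω k) s|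

lemma SA_nonneg (U : ℤ → Ω → Fin d → ℝ) (n : ℕ) (A : Set (Fin d → ℝ)) (k : Fin d) (s : ℝ) (ω : Ω) :
    0 ≤ SA U n A k s ω :=
  mul_nonneg (inv_nonneg.2 (Real.sqrt_nonneg _)) (Finset.sum_nonneg fun _ _ =>
    mul_nonneg (indic_nonneg _ _) (abs_nonneg _))

lemma SA_le_cnt (U : ℤ → Ω → Fin d → ℝ) (n : ℕ) (A : Set (Fin d → ℝ)) (k : Fin d) (s : ℝ) (ω : Ω) :
    SA U n A k s ω ≤ cnt U n A ω := by
  refine mul_le_mul_of_nonneg_left (Finset.sum_le_sum fun i _ => ?_)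
    (inv_nonneg.2 (Real.sqrt_nonneg _))
  exact mul_le_of_le_one_right (indic_nonneg _ _) (abs_lt01_sub_le _ _ _ _)

lemma SA_le_strip {U : ℤ → Ω → Fin d → ℝ} (hU : ∀ i ω j, U i ω j ∈ Icc (0 : ℝ) 1) {n : ℕ}
    (hn : 0 < n) (A : Set (Fin d → ℝ)) (k : Fin d) {s x h : ℝ} (hs : s ∈ Icc (0 : ℝ) 1)
    (hx : 0 ≤ x) (hh : 0 < h) (hxh : h / 2 ≤ Real.sqrt n * x - (Real.sqrt n)⁻¹) (ω : Ω) :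
    SA U n A k s ω ≤ cnt U n {y | y ∈ A ∧ s - x ≤ y k ∧ y k < s + x} ω +
      2 / h * (TT U n k s ω * (|al U n k (s + x) ω| + |al U n k (s - x) ω|)) := by
  set a := |al U n k (s + x) ω| with ha
  set b := |al U n k (s - x) ω| with hb
  have ha0 : 0 ≤ a := abs_nonneg _
  have hb0 : 0 ≤ b := abs_nonneg _
  have e : 2 / h * (TT U n k s ω * (a + b)) = (Real.sqrt n)⁻¹ * ∑ i ∈ Finset.Icc (1 : ℤ) n,
      |lt01 (pseudoObs U n i ω k) s - lt01 (U i ω k) s| * (2 / h * (a + b)) := by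
    unfold TT; rw [← Finset.sum_mul]; ring
  rw [e, cnt, SA, ← mul_add, ← Finset.sum_add_distrib]
  refine mul_le_mul_of_nonneg_left (Finset.sum_le_sum fun i _ => ?_)
    (inv_nonneg.2 (Real.sqrt_nonneg _))
  have hpos : 0 ≤ 2 / h * (a + b) := by positivity
  have hd1 := abs_lt01_sub_le (pseudoObs U n i ω k) (U i ω k) s s
  have hd0 := abs_nonneg (lt01 (pseudoObs U n i ω k) s - lt01 (U i ω k) s)
  by_cases hne : lt01 (pseudoObs U n i ω k) s - lt01 (U i ω k) s = 0
  · rw [hne, abs_zero, mul_zero, zero_mul, add_zero]; exact indic_nonneg _ _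
  by_cases hfar : s - x ≤ U i ω k ∧ U i ω k < s + x
  · have : indic A (U i ω) = indic {y | y ∈ A ∧ s - x ≤ y k ∧ y k < s + x} (U i ω) := by
      have hx' : s ≤ U i ω k + x := by linarith [hfar.1]
      unfold indic; by_cases hc : U i ω ∈ A <;> simp [indicator, hfar.2, hx', hc]
    rw [← this]
    have := mul_le_of_le_one_right (indic_nonneg A (U i ω)) hd1
    have := mul_nonneg hd0 hpos
    linarith
  · have h1 : 1 ≤ 2 / h * (a + b) := by
      rw [div_mul_eq_mul_div, le_div_iff₀ hh]
      rcases large_al_of_far hn hU hs hne hfar hx with h1 | h1 <;> linarith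
    have := mul_le_mul_of_nonneg_right (indic_le_one A (U i ω)) hd0
    have := indic_nonneg {y | y ∈ A ∧ s - x ≤ y k ∧ y k < s + x} (U i ω)
    nlinarith

lemma ta_le_three_mul {n : ℕ} (hn : 0 < n) {p κ : ℝ} (hp : 1 / ((n : ℝ) + 2) ≤ p) (hκ0 : 0 < κ)
    (hκ : κ < 1 / 2) : (n : ℝ) ^ (-κ) ≤ 3 * p ^ κ := by
  have hn' : (1 : ℝ) ≤ n := by exact_mod_cast hn
  have hp0 : 0 < p := lt_of_lt_of_le (by positivity) hp
  rw [div_le_iff₀ (by positivity)] at hp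
  calc (n : ℝ) ^ (-κ) = ((n : ℝ)⁻¹) ^ κ := by rw [Real.rpow_neg (by positivity), Real.inv_rpow (by positivity)]
    _ ≤ (3 * p) ^ κ := by
        refine Real.rpow_le_rpow (by positivity) ?_ hκ0.le
        rw [inv_le_iff_one_le_mul₀ (by positivity)]
        nlinarith
    _ = 3 ^ κ * p ^ κ := Real.mul_rpow (by norm_num) hp0.le
    _ ≤ 3 * p ^ κ := by
        gcongr
        calc (3 : ℝ) ^ κ ≤ 3 ^ (1 : ℝ) := Real.rpow_le_rpow_of_exponent_le (by norm_num) (by linarith)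
          _ = 3 := by simp

lemma UnifSeq.TT_le_of_good {U : ℤ → Ω → Fin d → ℝ} {κ : ℝ} (hκ : κ < 1 / 2) {n : ℕ} (hn : 0 < n)
    {ω : Ω} (hω : ω ∈ Good U n (tieLen κ n)) (j : Fin d) {s : ℝ} (hs : s ∈ Icc (0 : ℝ) 1) :
    TT U n j s ω ≤ |al U n j s ω| + (n : ℝ) ^ (-κ) :=
  (TT_le U n j s ω).trans (add_le_add_right
    ((abs_ta_le (one_le_tieLen hκ hn) hω j hs).trans (tieLen_le κ hn)) _)

lemma UnifSeq.integral_al_sq_near_le {U : ℤ → Ω → Fin d → ℝ} (h : UnifSeq P U) {κ C : ℝ}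
    (hB : EmpBound P U κ C) (hκ0 : 0 < κ) (hκ : κ < 1 / 2) {n : ℕ} (hn : 0 < n) (j : Fin d)
    {s q : ℝ} (hs : s ∈ Icc (0 : ℝ) 1) (hq : 0 < q) (hsq : min s (1 - s) ≤ 3 / 2 * q) :
    ∫ ω, al U n j s ω ^ 2 ∂P ≤ 2 * C * q ^ (2 * κ) := by
  have hC := hB.1
  refine (h.integral_al_sq_le hB hn j hs).trans ?_
  calc C * (min s (1 - s)) ^ (2 * κ) ≤ C * (3 / 2 * q) ^ (2 * κ) := by
        gcongr
        exact le_min hs.1 (by linarith [hs.2])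
    _ = C * ((3 / 2) ^ (2 * κ) * q ^ (2 * κ)) := by rw [Real.mul_rpow (by norm_num) hq.le]
    _ ≤ C * (2 * q ^ (2 * κ)) := by
        gcongr
        calc (3 / 2 : ℝ) ^ (2 * κ) ≤ (3 / 2) ^ (1 : ℝ) :=
              Real.rpow_le_rpow_of_exponent_le (by norm_num) (by linarith)
          _ ≤ 2 := by norm_num
    _ = _ := by ring

lemma UnifSeq.integral_SA_le {U : ℤ → Ω → Fin d → ℝ} (h : UnifSeq P U) {κ C K : ℝ}
    (hB : EmpBound P U κ C) (hκ0 : 0 < κ) (hκ : κ < 1 / 2) (hK : 0 < K) {n : ℕ} (hn : 0 < n)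
    (hnκ : 2 * (Real.sqrt n)⁻¹ ≤ ((n : ℝ) + 2) ^ (-κ)) (k : Fin d) {s p : ℝ}
    (hp : 1 / ((n : ℝ) + 2) ≤ p) (hps : p ≤ min s (1 - s)) {A : Set (Fin d → ℝ)}
    (hA : MeasurableSet A) (hAp : P.real {ω | U 0 ω ∈ A} ≤ p)
    (hstrip : ∀ s' t', min s (1 - s) / 2 ≤ s' → s' < t' → t' ≤ 1 - min s (1 - s) / 2 →
      P.real {ω | U 0 ω ∈ A ∧ s' ≤ U 0 ω k ∧ U 0 ω k < t'} ≤
        (t' - s') * (4 * K * p / min s (1 - s))) :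
    ∫ ω in Good U n (tieLen κ n), SA U n A k s ω ∂P ≤ (8 * K + 10 * C + 20) * p ^ κ := by
  have hC := hB.1
  set q := min s (1 - s) with hq
  have hp0 : 0 < p := lt_of_lt_of_le (by positivity) hp
  have hq0 : 0 < q := hp0.trans_le hps
  have hs0 : q ≤ s := min_le_left _ _
  have hs1 : q ≤ 1 - s := min_le_right _ _
  have hs : s ∈ Icc (0 : ℝ) 1 := ⟨by linarith, by linarith⟩
  have hr : 0 < Real.sqrt n := Real.sqrt_pos.2 (by exact_mod_cast hn)
  have hpκ : 0 < p ^ κ := Real.rpow_pos_of_pos hp0 _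
  set t := q * p ^ (κ - 1) with ht
  have hpp : p * p ^ (κ - 1) = p ^ κ := by
    rw [Real.rpow_sub_one hp0.ne']; field_simp
  have ht0 : 0 < t := mul_pos hq0 (Real.rpow_pos_of_pos hp0 _)
  have hpt : p ^ κ ≤ t := by
    rw [← hpp]; exact mul_le_mul_of_nonneg_right hps (Real.rpow_nonneg hp0.le _)
  set x := t / Real.sqrt n with hx
  have hx0 : 0 < x := div_pos ht0 hr
  have hrx : Real.sqrt n * x = t := by rw [hx]; field_simp
  have hGm := measurableSet_Good h.meas n (tieLen κ n)
  rcases le_or_gt x (q / 2) with hxq | hxq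
  · have hxh : t / 2 ≤ Real.sqrt n * x - (Real.sqrt n)⁻¹ := by
      rw [hrx]
      have : ((n : ℝ) + 2) ^ (-κ) ≤ p ^ κ := by
        rw [Real.rpow_neg (by positivity), ← Real.inv_rpow (by positivity)]
        refine Real.rpow_le_rpow (by positivity) ?_ hκ0.le
        rwa [one_div] at hp
      linarith
    have hsp : s + x ∈ Icc (0 : ℝ) 1 := ⟨by linarith, by linarith⟩
    have hsm : s - x ∈ Icc (0 : ℝ) 1 := ⟨by linarith, by linarith⟩
    set B : Set (Fin d → ℝ) := {y | y ∈ A ∧ s - x ≤ y k ∧ y k < s + x} with hBdef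
    have hBm : MeasurableSet B :=
      hA.inter ((measurableSet_le measurable_const (measurable_pi_apply k)).inter
        (measurableSet_lt (measurable_pi_apply k) measurable_const))
    have hi0 := integrable_al_sq h n k hs
    have hip := integrable_al_sq h n k hsp
    have him := integrable_al_sq h n k hsm
    have hic := integrable_cnt (P := P) h.meas n hBm
    have h3 : Integrable (fun ω => al U n k s ω ^ 2 + al U n k (s + x) ω ^ 2) P := hi0.add hip
    have h4 : Integrable (fun ω => al U n k s ω ^ 2 + al U n k (s + x) ω ^ 2 +
      al U n k (s - x) ω ^ 2) P := h3.add him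
    have hsum : Integrable (fun ω => al U n k s ω ^ 2 + al U n k (s + x) ω ^ 2 +
      al U n k (s - x) ω ^ 2 + 9 * q ^ (2 * κ)) P := h4.add (integrable_const _)
    have hle : ∫ ω in Good U n (tieLen κ n), SA U n A k s ω ∂P ≤
        ∫ ω, (cnt U n B ω + 2 / t * (al U n k s ω ^ 2 + al U n k (s + x) ω ^ 2 +
          al U n k (s - x) ω ^ 2 + 9 * q ^ (2 * κ))) ∂P := by
      refine setIntegral_le_integral_of_le hGm (hic.add (hsum.const_mul _)) (fun ω => ?_)
        (fun ω => SA_nonneg _ _ _ _ _ _) fun ω hω => ?_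
      · have := cnt_nonneg U n B ω
        positivity
      · refine (SA_le_strip h.mem hn A k hs hx0.le ht0 hxh ω).trans ?_
        refine add_le_add_right (mul_le_mul_of_nonneg_left ?_ (by positivity)) _
        have h1 := UnifSeq.TT_le_of_good hκ hn hω k hs
        have h2 : (n : ℝ) ^ (-κ) ≤ 3 * q ^ κ := ta_le_three_mul hn (hp.trans hps) hκ0 hκ
        have h3 : q ^ (2 * κ) = q ^ κ * q ^ κ := by rw [← Real.rpow_add hq0]; ring_nf
        rw [h3]
        rw [← sq_abs (al U n k s ω), ← sq_abs (al U n k (s + x) ω), ← sq_abs (al U n k (s - x) ω)]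
        have ha := abs_nonneg (al U n k (s + x) ω)
        have hb := abs_nonneg (al U n k (s - x) ω)
        calc TT U n k s ω * (|al U n k (s + x) ω| + |al U n k (s - x) ω|) ≤
            (|al U n k s ω| + 3 * q ^ κ) * (|al U n k (s + x) ω| + |al U n k (s - x) ω|) := by
              gcongr; linarith
          _ ≤ _ := by
              nlinarith [sq_nonneg (|al U n k s ω| - (|al U n k (s + x) ω| + |al U n k (s - x) ω|)/2),
                sq_nonneg (3 * q ^ κ - (|al U n k (s + x) ω| + |al U n k (s - x) ω|)/2),
                sq_nonneg (|al U n k (s + x) ω| - |al U n k (s - x) ω|)]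
    refine hle.trans ?_
    rw [integral_add hic (hsum.const_mul _), integral_const_mul, h.integral_cnt n hBm,
      integral_add h4 (integrable_const _), integral_add h3 him,
      integral_add hi0 hip, integral_const]
    simp only [probReal_univ, one_smul]
    have b0 : ∫ ω, al U n k s ω ^ 2 ∂P ≤ C * q ^ (2 * κ) := h.integral_al_sq_le hB hn k hs
    have bp := h.integral_al_sq_near_le hB hκ0 hκ hn k hsp hq0 (by
      rcases le_total s (1 - s) with hc | hc
      · have : q = s := min_eq_left hc
        exact (min_le_left _ _).trans (by linarith)
      · have : q = 1 - s := min_eq_right hc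
        exact (min_le_right _ _).trans (by linarith))
    have bm := h.integral_al_sq_near_le hB hκ0 hκ hn k hsm hq0 (by
      rcases le_total s (1 - s) with hc | hc
      · have : q = s := min_eq_left hc
        exact (min_le_left _ _).trans (by linarith)
      · have : q = 1 - s := min_eq_right hc
        exact (min_le_right _ _).trans (by linarith))
    have bB : P.real {ω | U 0 ω ∈ B} ≤ (s + x - (s - x)) * (4 * K * p / q) :=
      hstrip (s - x) (s + x) (by linarith) (by linarith) (by linarith)
    have e1 : Real.sqrt n * P.real {ω | U 0 ω ∈ B} ≤ 8 * K * p ^ κ := by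
      calc Real.sqrt n * P.real {ω | U 0 ω ∈ B} ≤ Real.sqrt n * ((s + x - (s - x)) * (4 * K * p / q)) := by gcongr
        _ = Real.sqrt n * x * (8 * K * p / q) := by ring
        _ = 8 * K * (p * p ^ (κ - 1)) := by rw [hrx, ht]; field_simp
        _ = _ := by rw [hpp]
    have e2 : 2 / t * q ^ (2 * κ) ≤ 2 * p ^ κ := by
      have : q ^ (2 * κ) ≤ t * p ^ κ := by
        calc q ^ (2 * κ) = q * q ^ (2 * κ - 1) := by rw [Real.rpow_sub_one hq0.ne']; field_simp
          _ ≤ q * p ^ (2 * κ - 1) := mul_le_mul_of_nonneg_left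
              (Real.rpow_le_rpow_of_nonpos hp0 hps (by linarith)) hq0.le
          _ = t * p ^ κ := by
              rw [ht, mul_assoc, ← Real.rpow_add hp0]; ring_nf
      rw [div_mul_eq_mul_div, div_le_iff₀ ht0]; linarith
    calc _ ≤ 8 * K * p ^ κ + 2 / t * (C * q ^ (2 * κ) + 2 * C * q ^ (2 * κ) + 2 * C * q ^ (2 * κ) + 9 * q ^ (2 * κ)) := by
          gcongr
      _ = 8 * K * p ^ κ + (5 * C + 9) * (2 / t * q ^ (2 * κ)) := by ring
      _ ≤ 8 * K * p ^ κ + (5 * C + 9) * (2 * p ^ κ) := by gcongr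
      _ ≤ _ := by nlinarith
  · have h1 : Real.sqrt n * p ≤ 2 * p ^ κ := by
      rw [hx, lt_div_iff₀ hr, ht] at hxq
      have : Real.sqrt n / 2 ≤ p ^ (κ - 1) := by
        by_contra hc
        push Not at hc
        nlinarith
      rw [← hpp]; nlinarith
    calc ∫ ω in Good U n (tieLen κ n), SA U n A k s ω ∂P ≤ ∫ ω, cnt U n A ω ∂P :=
          setIntegral_le_integral_of_le hGm (integrable_cnt h.meas n hA)
            (fun ω => cnt_nonneg _ _ _ _) (fun ω => SA_nonneg _ _ _ _ _ _)
            fun ω _ => SA_le_cnt _ _ _ _ _ _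
      _ = Real.sqrt n * P.real {ω | U 0 ω ∈ A} := h.integral_cnt n hA
      _ ≤ Real.sqrt n * p := by gcongr
      _ ≤ 2 * p ^ κ := h1
      _ ≤ _ := by nlinarith [mul_pos hK hpκ, mul_pos hC hpκ]

end

/-! ### Linearization of the empirical copula -/

section

section pairs
variable {j k : Fin 2} (hjk : j ≠ k)
include hjk

lemma univ_eq_pair : (Finset.univ : Finset (Fin 2)) = {j, k} := by
  ext i; simpa using UnifSeq.fin2_cases hjk i

lemma sum_pair (f : Fin 2 → ℝ) : ∑ i, f i = f j + f k := by
  rw [univ_eq_pair hjk, Finset.sum_pair hjk]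

lemma prod_pair (f : Fin 2 → ℝ) : ∏ i, f i = f j * f k := by
  rw [univ_eq_pair hjk, Finset.prod_pair hjk]

lemma iInf_pair_eq (f : Fin 2 → ℝ) : ⨅ i, f i = min (f j) (f k) := by
  refine le_antisymm (le_min (ciInf_le (Set.finite_range f).bddBelow j)
    (ciInf_le (Set.finite_range f).bddBelow k)) (le_ciInf fun i => ?_)
  rcases UnifSeq.fin2_cases hjk i with rfl | rfl
  · exact min_le_left _ _
  · exact min_le_right _ _

lemma iInf_ne_eq (u : Fin 2 → ℝ) : ⨅ i : {i : Fin 2 // i ≠ j}, u i = u k := by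
  have hu : ∀ i : {i : Fin 2 // i ≠ j}, u i = u k := fun i => by
    rcases UnifSeq.fin2_cases hjk i with h | h
    · exact absurd h i.2
    · rw [h]
  have : Nonempty {i : Fin 2 // i ≠ j} := ⟨⟨k, hjk.symm⟩⟩
  rw [iInf_congr hu, ciInf_const]

lemma g1_eq (u : Fin 2 → ℝ) : g1 u = min (min (u j) (1 - u j)) (min (u k) (1 - u k)) := by
  unfold g1
  rw [iInf_pair_eq hjk, iInf_pair_eq hjk, iInf_ne_eq hjk, iInf_ne_eq hjk.symm]
  simp only [min_comm, min_left_comm, min_assoc]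

end pairs

lemma g1_le (u : Fin 2 → ℝ) (j : Fin 2) : g1 u ≤ min (u j) (1 - u j) := by
  fin_cases j
  · rw [g1_eq (j := 0) (k := 1) (by decide)]; exact min_le_left _ _
  · rw [g1_eq (j := 1) (k := 0) (by decide)]; exact min_le_left _ _

/-- The open unit square. -/
def cube : Set (Fin 2 → ℝ) := {u | ∀ j, 0 < u j ∧ u j < 1}

lemma mem_cube_of_g1_pos {u : Fin 2 → ℝ} (hu : 0 < g1 u) : u ∈ cube := fun j => by
  have := hu.trans_le (g1_le u j)
  rw [lt_min_iff] at this
  exact ⟨this.1, by linarith [this.2]⟩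

lemma g1_pos {u : Fin 2 → ℝ} (hu : u ∈ cube) : 0 < g1 u := by
  rw [g1_eq (j := 0) (k := 1) (by decide)]
  have h0 := hu 0
  have h1 := hu 1
  exact lt_min (lt_min h0.1 (by linarith)) (lt_min h1.1 (by linarith))

lemma mem_VV_of_cube {u : Fin 2 → ℝ} (hu : u ∈ cube) (j : Fin 2) : u ∈ VV 2 j :=
  ⟨fun i => ⟨(hu i).1.le, (hu i).2.le⟩, hu j⟩

lemma mem_Icc_of_cube {u : Fin 2 → ℝ} (hu : u ∈ cube) (j : Fin 2) : u j ∈ Icc (0 : ℝ) 1 :=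
  ⟨(hu j).1.le, (hu j).2.le⟩

variable {P : Measure Ω} [IsProbabilityMeasure P] {U : ℤ → Ω → Fin 2 → ℝ}

/-- The function whose empirical process approximates the empirical copula process. -/
def hf (P : Measure Ω) (U : ℤ → Ω → Fin 2 → ℝ) (u x : Fin 2 → ℝ) : ℝ :=
  (∏ j, lt01 (x j) (u j)) - ∑ j, Cdot (cop P U) j u * lt01 (x j) (u j)

/-- The remainder in the linearization of the empirical copula process. -/
def Rem (P : Measure Ω) (U : ℤ → Ω → Fin 2 → ℝ) (n : ℕ) (u : Fin 2 → ℝ) (ω : Ω) : ℝ :=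
  (Real.sqrt n)⁻¹ * ∑ i ∈ Finset.Icc (1 : ℤ) n,
    ((∏ j, lt01 (pseudoObs U n i ω j) (u j)) - cop P U u) - emp P U n (hf P U u) ω

lemma measurable_prod_lt01 (u : Fin 2 → ℝ) :
    Measurable fun x : Fin 2 → ℝ => ∏ j, lt01 (x j) (u j) := by
  simp only [Fin.prod_univ_two]
  exact (measurable_lt01_coord 0 _).mul (measurable_lt01_coord 1 _)

lemma measurable_hf (u : Fin 2 → ℝ) : Measurable (hf P U u) :=
  (measurable_prod_lt01 u).sub (Finset.measurable_fun_sum _ fun j _ =>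
    (measurable_lt01_coord j (u j)).const_mul _)

lemma prod_lt01_mem (x u : Fin 2 → ℝ) : ∏ j, lt01 (x j) (u j) ∈ Icc (0 : ℝ) 1 :=
  ⟨Finset.prod_nonneg fun _ _ => lt01_nonneg _ _,
    Finset.prod_le_one (fun _ _ => lt01_nonneg _ _) fun _ _ => lt01_le_one _ _⟩

lemma UnifSeq.CopReg.abs_hf_le {K : ℝ} (hR : UnifSeq.CopReg P U K) {u : Fin 2 → ℝ} (hu : u ∈ cube)
    (x : Fin 2 → ℝ) : |hf P U u x| ≤ 2 := by
  have h := prod_lt01_mem x u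
  have h2 : ∀ j, 0 ≤ Cdot (cop P U) j u * lt01 (x j) (u j) ∧
      Cdot (cop P U) j u * lt01 (x j) (u j) ≤ 1 := fun j => by
    have hm := hR.mem j u (mem_VV_of_cube hu j)
    exact ⟨mul_nonneg hm.1 (lt01_nonneg _ _), mul_le_one₀ hm.2 (lt01_nonneg _ _) (lt01_le_one _ _)⟩
  unfold hf
  rw [Fin.sum_univ_two]
  have a := h2 0
  have b := h2 1
  rw [abs_le]; constructor <;> linarith [h.1, h.2]

lemma UnifSeq.integral_prod_lt01 (h : UnifSeq P U) (u : Fin 2 → ℝ) :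
    ∫ ω, ∏ j, lt01 (U 0 ω j) (u j) ∂P = cop P U u := by
  have : (fun ω => ∏ j, lt01 (U 0 ω j) (u j)) = {ω | ∀ j, U 0 ω j < u j}.indicator 1 := by
    ext ω
    simp only [Fin.prod_univ_two, lt01, indicator, mem_ofPred_eq, Fin.forall_fin_two]
    by_cases h0 : U 0 ω 0 < u 0 <;> by_cases h1 : U 0 ω 1 < u 1 <;> simp [h0, h1]
  have hm : MeasurableSet {ω | ∀ j, U 0 ω j < u j} := by
    rw [ofPred_forall]
    exact MeasurableSet.iInter fun j => measurableSet_lt (h.meas_coord 0 j) measurable_const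
  rw [this, integral_indicator_one hm, h.cop_eq_lt]

lemma integrable_lt01 {U : ℤ → Ω → Fin d → ℝ} (h : UnifSeq P U) (j : Fin d) (s : ℝ) :
    Integrable (fun ω => lt01 (U 0 ω j) s) P :=
  integrable_of_abs_le (Measurable.lt01_const (h.meas_coord 0 j) s) fun _ => abs_lt01_le _ _

lemma UnifSeq.integral_hf (h : UnifSeq P U) {u : Fin 2 → ℝ} (hu : u ∈ cube) :
    ∫ ω, hf P U u (U 0 ω) ∂P = cop P U u - ∑ j, Cdot (cop P U) j u * u j := by
  unfold hf
  have hi : ∀ j, Integrable (fun ω => Cdot (cop P U) j u * lt01 (U 0 ω j) (u j)) P := fun j =>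
    (integrable_lt01 h j (u j)).const_mul _
  have hp : Integrable (fun ω => ∏ j, lt01 (U 0 ω j) (u j)) P :=
    integrable_of_abs_le (M := 1) ((measurable_prod_lt01 u).comp (h.meas 0)) fun ω => by
      have := prod_lt01_mem (U 0 ω) u
      rw [abs_of_nonneg this.1]; exact this.2
  rw [integral_sub hp (integrable_finsetSum _ fun j _ => hi j), h.integral_prod_lt01,
    integral_finsetSum (f := fun j ω => Cdot (cop P U) j u * lt01 (U 0 ω j) (u j)) _ fun j _ => hi j]
  simp only [integral_const_mul, h.integral_lt01 _ (mem_Icc_of_cube hu _)]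

lemma UnifSeq.Rem_eq (h : UnifSeq P U) {j k : Fin 2} (hjk : j ≠ k) (n : ℕ) {u : Fin 2 → ℝ}
    (hu : u ∈ cube) (ω : Ω) : Rem P U n u ω = (Real.sqrt n)⁻¹ * ∑ i ∈ Finset.Icc (1 : ℤ) n,
      ((lt01 (U i ω k) (u k) - Cdot (cop P U) j u) *
          (lt01 (pseudoObs U n i ω j) (u j) - lt01 (U i ω j) (u j)) +
        (lt01 (U i ω j) (u j) - Cdot (cop P U) k u) *
          (lt01 (pseudoObs U n i ω k) (u k) - lt01 (U i ω k) (u k)) +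
        (lt01 (pseudoObs U n i ω j) (u j) - lt01 (U i ω j) (u j)) *
          (lt01 (pseudoObs U n i ω k) (u k) - lt01 (U i ω k) (u k))) +
      Cdot (cop P U) j u * ta U n j (u j) ω + Cdot (cop P U) k u * ta U n k (u k) ω := by
  unfold Rem emp ta
  rw [h.integral_hf hu]
  unfold hf
  simp only [prod_pair hjk, sum_pair hjk]
  rw [← mul_sub, mul_left_comm _ (Real.sqrt n)⁻¹, mul_left_comm _ (Real.sqrt n)⁻¹, ← mul_add,
    ← mul_add]
  congr 1
  rw [Finset.mul_sum, Finset.mul_sum, ← Finset.sum_sub_distrib, ← Finset.sum_add_distrib,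
    ← Finset.sum_add_distrib]
  refine Finset.sum_congr rfl fun i _ => by ring

lemma measurable_SA {U : ℤ → Ω → Fin d → ℝ} (hm : ∀ i, Measurable (U i)) (n : ℕ)
    {A : Set (Fin d → ℝ)} (hA : MeasurableSet A) (k : Fin d) (s : ℝ) :
    Measurable (SA U n A k s) := by
  refine Measurable.const_mul (Finset.measurable_fun_sum _ fun i _ => ?_) _
  exact ((measurable_indic hA).comp (hm i)).mul
    ((Measurable.lt01_const (measurable_pseudoObs hm n i k) s).sub
      (Measurable.lt01_const ((measurable_pi_apply k).comp (hm i)) s)).abs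

lemma integrable_SA {U : ℤ → Ω → Fin d → ℝ} (hm : ∀ i, Measurable (U i)) (n : ℕ)
    {A : Set (Fin d → ℝ)} (hA : MeasurableSet A) (k : Fin d) (s : ℝ) :
    Integrable (SA U n A k s) P :=
  (integrable_cnt hm n hA).mono' (measurable_SA hm n hA k s).aestronglyMeasurable
    (ae_of_all _ fun ω => by
      rw [Real.norm_eq_abs, abs_of_nonneg (SA_nonneg _ _ _ _ _ _)]; exact SA_le_cnt _ _ _ _ _ _)

lemma UnifSeq.abs_Rem_le (h : UnifSeq P U) {K : ℝ} (hR : UnifSeq.CopReg P U K) {j k : Fin 2}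
    (hjk : j ≠ k) (n : ℕ) {u : Fin 2 → ℝ} (hu : u ∈ cube) {A : Set (Fin 2 → ℝ)} {c : ℝ}
    (hAc : ∀ x : Fin 2 → ℝ, |lt01 (x j) (u j) - Cdot (cop P U) k u| ≤ indic A x + c) (ω : Ω) :
    |Rem P U n u ω| ≤ 2 * TT U n j (u j) ω + SA U n A k (u k) ω + c * TT U n k (u k) ω +
      |ta U n j (u j) ω| + |ta U n k (u k) ω| := by
  have hDj := hR.mem j u (mem_VV_of_cube hu j)
  have hDk := hR.mem k u (mem_VV_of_cube hu k)
  have hr : 0 ≤ (Real.sqrt n)⁻¹ := inv_nonneg.2 (Real.sqrt_nonneg _)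
  rw [h.Rem_eq hjk n hu]
  refine (abs_add_le _ _).trans (add_le_add ((abs_add_le _ _).trans (add_le_add ?_ ?_)) ?_)
  · have e : 2 * TT U n j (u j) ω + SA U n A k (u k) ω + c * TT U n k (u k) ω =
        (Real.sqrt n)⁻¹ * ∑ i ∈ Finset.Icc (1 : ℤ) n,
          (2 * |lt01 (pseudoObs U n i ω j) (u j) - lt01 (U i ω j) (u j)| +
            indic A (U i ω) * |lt01 (pseudoObs U n i ω k) (u k) - lt01 (U i ω k) (u k)| +
            c * |lt01 (pseudoObs U n i ω k) (u k) - lt01 (U i ω k) (u k)|) := by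
      unfold TT SA
      rw [Finset.sum_add_distrib, Finset.sum_add_distrib, ← Finset.mul_sum, ← Finset.mul_sum]
      ring
    rw [e, abs_mul, abs_of_nonneg hr]
    refine mul_le_mul_of_nonneg_left ((Finset.abs_sum_le_sum_abs _ _).trans
      (Finset.sum_le_sum fun i _ => ?_)) hr
    set δj := lt01 (pseudoObs U n i ω j) (u j) - lt01 (U i ω j) (u j)
    set δk := lt01 (pseudoObs U n i ω k) (u k) - lt01 (U i ω k) (u k) with hδk
    have h1 : |δk| ≤ 1 := abs_lt01_sub_le _ _ _ _
    have h2 : |lt01 (U i ω k) (u k) - Cdot (cop P U) j u| ≤ 1 := by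
      have := lt01_nonneg (U i ω k) (u k)
      have := lt01_le_one (U i ω k) (u k)
      rw [abs_le]; constructor <;> linarith [hDj.1, hDj.2]
    have h3 := hAc (U i ω)
    have hj0 := abs_nonneg δj
    have hk0 := abs_nonneg δk
    refine (abs_add_le _ _).trans ((add_le_add_left (abs_add_le _ _) _).trans ?_)
    rw [abs_mul, abs_mul, abs_mul]
    nlinarith
  · rw [abs_mul, abs_of_nonneg hDj.1]; exact mul_le_of_le_one_left (abs_nonneg _) hDj.2
  · rw [abs_mul, abs_of_nonneg hDk.1]; exact mul_le_of_le_one_left (abs_nonneg _) hDk.2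

lemma mul_rpow_le_of_le_one {c y q κ : ℝ} (hc0 : 0 ≤ c) (hc1 : c ≤ 1) (hy : 0 ≤ y) (hq : 0 < q)
    (hcy : c ≤ y / q) (hκ0 : 0 < κ) (hκ : κ < 1) : c * q ^ κ ≤ y ^ κ := by
  have h1 : c ≤ c ^ κ := by
    calc c = c ^ (1 : ℝ) := by simp
      _ ≤ c ^ κ := Real.rpow_le_rpow_of_exponent_ge' hc0 hc1 hκ0.le hκ.le
  calc c * q ^ κ ≤ c ^ κ * q ^ κ := by gcongr
    _ = (c * q) ^ κ := (Real.mul_rpow hc0 hq.le).symm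
    _ ≤ y ^ κ := by
        refine Real.rpow_le_rpow (by positivity) ?_ hκ0.le
        rwa [le_div_iff₀ hq] at hcy

lemma rpow_const_mul_le {a p κ : ℝ} (ha : 0 ≤ a) (hp : 0 ≤ p) (hκ0 : 0 < κ) (hκ : κ < 1) :
    (a * p) ^ κ ≤ (a + 1) * p ^ κ := by
  rw [Real.mul_rpow ha hp]
  gcongr
  calc a ^ κ ≤ (a + 1) ^ κ := Real.rpow_le_rpow ha (by linarith) hκ0.le
    _ ≤ (a + 1) ^ (1 : ℝ) := Real.rpow_le_rpow_of_exponent_le (by linarith) hκ.le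
    _ = a + 1 := by simp

lemma UnifSeq.integral_abs_Rem_le_aux (h : UnifSeq P U) {κ C K : ℝ}
    (hB : EmpBound P U κ C) (hκ0 : 0 < κ) (hκ : κ < 1 / 2) (hR : UnifSeq.CopReg P U K) {j k : Fin 2}
    (hjk : j ≠ k) {n : ℕ} (hn : 0 < n) (hnκ : 2 * (Real.sqrt n)⁻¹ ≤ ((n : ℝ) + 2) ^ (-κ))
    {u : Fin 2 → ℝ} (hu : u ∈ cube) {p : ℝ} (hp : 1 / ((n : ℝ) + 2) ≤ p)
    (hpk : p ≤ min (u k) (1 - u k)) (hpj : min (u j) (1 - u j) = p)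
    {A : Set (Fin 2 → ℝ)} {c : ℝ} (hc : c ∈ Icc (0 : ℝ) 1) (hcp : c ≤ K * p / (u k * (1 - u k)))
    (hAc : ∀ x : Fin 2 → ℝ, |lt01 (x j) (u j) - Cdot (cop P U) k u| ≤ indic A x + c)
    (hA : MeasurableSet A) (hAp : P.real {ω | U 0 ω ∈ A} ≤ p)
    (hstrip : ∀ s' t', min (u k) (1 - u k) / 2 ≤ s' → s' < t' → t' ≤ 1 - min (u k) (1 - u k) / 2 →
      P.real {ω | U 0 ω ∈ A ∧ s' ≤ U 0 ω k ∧ U 0 ω k < t'} ≤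
        (t' - s') * (4 * K * p / min (u k) (1 - u k))) :
    ∫ ω in Good U n (tieLen κ n), |Rem P U n u ω| ∂P ≤
      (8 * K + 10 * C + 20 + (2 * √C + √C * (2 * K + 1) + 15)) * p ^ κ := by
  have hC := hB.1
  have hK := hR.pos
  set G := Good U n (tieLen κ n) with hG
  have hGm : MeasurableSet G := measurableSet_Good h.meas n (tieLen κ n)
  set q := min (u k) (1 - u k) with hq
  have hp0 : 0 < p := lt_of_lt_of_le (by positivity) hp
  have hq0 : 0 < q := hp0.trans_le hpk
  have hpκ : 0 < p ^ κ := Real.rpow_pos_of_pos hp0 _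
  have hui := mem_Icc_of_cube hu
  have hSA := h.integral_SA_le hB hκ0 hκ hK hn hnκ k hp hpk hA hAp hstrip
  have hiS := integrable_SA (P := P) h.meas n hA k (u k)
  have hij := (integrable_al h n j (hui j)).abs
  have hik := (integrable_al h n k (hui k)).abs
  have hrest : Integrable (fun ω => 2 * |al U n j (u j) ω| + c * |al U n k (u k) ω| + 15 * p ^ κ) P :=
    ((hij.const_mul 2).add (hik.const_mul c)).add (integrable_const _)
  have hpt : ∀ ω ∈ G, |Rem P U n u ω| ≤ SA U n A k (u k) ω +
      (2 * |al U n j (u j) ω| + c * |al U n k (u k) ω| + 15 * p ^ κ) := fun ω hω => by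
    have h0 := h.abs_Rem_le hR hjk n hu hAc ω
    have h3 := ta_le_three_mul hn hp hκ0 hκ
    have h1 := UnifSeq.TT_le_of_good hκ hn hω j (hui j)
    have h2 := UnifSeq.TT_le_of_good hκ hn hω k (hui k)
    have h4 := (abs_ta_le (one_le_tieLen hκ hn) hω j (hui j)).trans (tieLen_le κ hn)
    have h5 := (abs_ta_le (one_le_tieLen hκ hn) hω k (hui k)).trans (tieLen_le κ hn)
    have h6 : c * TT U n k (u k) ω ≤ c * |al U n k (u k) ω| + 3 * p ^ κ := by
      calc c * TT U n k (u k) ω ≤ c * (|al U n k (u k) ω| + 3 * p ^ κ) :=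
            mul_le_mul_of_nonneg_left (by linarith) hc.1
        _ ≤ _ := by nlinarith [hc.2]
    linarith
  have hle : ∫ ω in G, |Rem P U n u ω| ∂P ≤ ∫ ω in G, (SA U n A k (u k) ω +
      (2 * |al U n j (u j) ω| + c * |al U n k (u k) ω| + 15 * p ^ κ)) ∂P :=
    integral_mono_of_nonneg (ae_of_all _ fun ω => abs_nonneg _)
      (hiS.add hrest).integrableOn (ae_restrict_of_forall_mem hGm hpt)
  refine hle.trans ?_
  rw [integral_add hiS.integrableOn hrest.integrableOn, add_mul]
  refine add_le_add hSA ((setIntegral_le_integral hrest (ae_of_all _ fun ω => ?_)).trans ?_)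
  · have := hc.1
    simp only [Pi.zero_apply]; positivity
  have hsum : Integrable (fun ω => 2 * |al U n j (u j) ω| + c * |al U n k (u k) ω|) P :=
    (hij.const_mul 2).add (hik.const_mul c)
  rw [integral_add hsum (integrable_const _),
    integral_add (hij.const_mul 2) (hik.const_mul c), integral_const_mul, integral_const_mul,
    integral_const]
  simp only [probReal_univ, one_smul]
  have b1 := h.integral_abs_al_le hB hn j (hui j)
  have b2 := h.integral_abs_al_le hB hn k (hui k)
  rw [hpj] at b1
  rw [← hq] at b2
  have b3 : c * q ^ κ ≤ (2 * K + 1) * p ^ κ := by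
    refine (mul_rpow_le_of_le_one (y := 2 * K * p) hc.1 hc.2 (by positivity) hq0 ?_ hκ0
      (by linarith)).trans (rpow_const_mul_le (by positivity) hp0.le hκ0 (by linarith))
    refine hcp.trans ?_
    have h1 := hu k
    have hqq : q / 2 ≤ u k * (1 - u k) := by
      rcases le_total (u k) (1 - u k) with hh | hh
      · have : q = u k := min_eq_left hh
        nlinarith
      · have : q = 1 - u k := min_eq_right hh
        nlinarith
    rw [div_le_div_iff₀ (mul_pos h1.1 (by linarith)) hq0]
    have : 0 < K * p := by positivity
    nlinarith
  have b4 : c * ∫ ω, |al U n k (u k) ω| ∂P ≤ √C * ((2 * K + 1) * p ^ κ) := by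
    calc _ ≤ c * (√C * q ^ κ) := mul_le_mul_of_nonneg_left b2 hc.1
      _ = √C * (c * q ^ κ) := by ring
      _ ≤ _ := by gcongr
  nlinarith

/-- On the good event the remainder is dominated by a power of the weight function. -/
lemma UnifSeq.exists_integral_abs_Rem_le (h : UnifSeq P U) (hC : Condition21 (cop P U)) {κ : ℝ}
    (hκ0 : 0 < κ) (hκ : κ < 1 / 2) : ∃ C, 0 < C ∧ ∀ n : ℕ, 0 < n →
      2 * (Real.sqrt n)⁻¹ ≤ ((n : ℝ) + 2) ^ (-κ) → ∀ u : Fin 2 → ℝ, 1 / ((n : ℝ) + 2) ≤ g1 u →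
        ∫ ω in Good U n (tieLen κ n), |Rem P U n u ω| ∂P ≤ C * g1 u ^ κ := by
  obtain ⟨C, hB⟩ := h.exists_empBound hκ0 hκ
  obtain ⟨K, hR⟩ := h.exists_copReg hC
  have hC := hB.1
  have hK := hR.pos
  refine ⟨8 * K + 10 * C + 20 + (2 * √C + √C * (2 * K + 1) + 15), by positivity,
    fun n hn hnκ u hu => ?_⟩
  have hg0 : 0 < g1 u := lt_of_lt_of_le (by positivity) hu
  have huc := mem_cube_of_g1_pos hg0
  have hui := mem_Icc_of_cube huc
  obtain ⟨j, k, hjk, hj⟩ : ∃ j k : Fin 2, j ≠ k ∧ min (u j) (1 - u j) = g1 u := by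
    have e := g1_eq (j := 0) (k := 1) (by decide) u
    rcases min_choice (min (u 0) (1 - u 0)) (min (u 1) (1 - u 1)) with hh | hh
    · exact ⟨0, 1, by decide, by rw [e, hh]⟩
    · exact ⟨1, 0, by decide, by rw [e, hh]⟩
  have hk := g1_le u k
  have hVk := mem_VV_of_cube huc k
  have hDk := hR.mem k u hVk
  have hq0 : 0 < min (u k) (1 - u k) := hg0.trans_le hk
  rcases min_choice (u j) (1 - u j) with hh | hh
  · rw [hh] at hj
    refine h.integral_abs_Rem_le_aux hB hκ0 hκ hR hjk hn hnκ huc hu hk (by rw [hh, hj])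
      (A := {x | x j < u j}) (c := Cdot (cop P U) k u) hDk (by rw [← hj]; exact hR.le hjk u hVk)
      (fun x => ?_) (measurableSet_lt (measurable_pi_apply j) measurable_const)
      (by rw [← hj]; exact (h.prob_lt j (hui j)).le) fun s t hs hst ht => ?_
    · refine (abs_sub _ _).trans_eq ?_
      rw [abs_of_nonneg hDk.1, abs_of_nonneg (lt01_nonneg _ _)]
      simp [indic, lt01, indicator]
    · rw [← hj]; exact (h.prob_strip_le hR hjk hui hq0 hs hst ht).1
  · rw [hh] at hj
    have hind : ∀ x : Fin 2 → ℝ, indic {x | u j ≤ x j} x = 1 - lt01 (x j) (u j) := fun x => by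
      by_cases hx : x j < u j
      · simp [indic, lt01, indicator, hx]
      · simp [indic, lt01, indicator, hx, not_lt.1 hx]
    have hAm : MeasurableSet {x : Fin 2 → ℝ | u j ≤ x j} :=
      measurableSet_le measurable_const (measurable_pi_apply j)
    refine h.integral_abs_Rem_le_aux hB hκ0 hκ hR hjk hn hnκ huc hu hk (by rw [hh, hj])
      (A := {x | u j ≤ x j}) (c := 1 - Cdot (cop P U) k u) ⟨by linarith [hDk.2], by linarith [hDk.1]⟩
      (by rw [← hj]; exact hR.one_sub_le hjk u hVk)
      (fun x => ?_) hAm ?_ fun s t hs hst ht => ?_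
    · rw [hind]
      have := lt01_nonneg (x j) (u j)
      have := lt01_le_one (x j) (u j)
      rw [abs_le]; constructor <;> linarith [hDk.1, hDk.2]
    · rw [← h.integral_indic hAm 0]
      simp only [hind]
      rw [integral_sub (integrable_const _) (integrable_lt01 h j (u j)), h.integral_lt01 j (hui j)]
      simp [hj]
    · rw [← hj]; exact (h.prob_strip_le hR hjk hui hq0 hs hst ht).2

end

/-! ### Chaining over a grid -/

section

lemma exists_grid_step (n : ℕ) (v : ℤ → ℝ) {s : ℝ} {σ : ℕ → ℝ} (hσ : Monotone σ) {N : ℕ}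
    (hN : 0 < N) (hlow : ∀ i ∈ Finset.Icc (1 : ℤ) n, v i < σ 0 → rk n v i < s)
    (hup : ∀ i ∈ Finset.Icc (1 : ℤ) n, rk n v i < s → v i < σ N) :
    ∃ m < N, ∀ i ∈ Finset.Icc (1 : ℤ) n, lt01 (v i) (σ m) ≤ lt01 (rk n v i) s ∧
      lt01 (rk n v i) s ≤ lt01 (v i) (σ (m + 1)) := by
  classical
  have key : ∃ m < N, (∀ i ∈ Finset.Icc (1 : ℤ) n, v i < σ m → rk n v i < s) ∧
      ∀ i ∈ Finset.Icc (1 : ℤ) n, rk n v i < s → v i < σ (m + 1) := by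
    by_contra hcon
    push Not at hcon
    have hall : ∀ m ≤ N, ∀ i ∈ Finset.Icc (1 : ℤ) n, v i < σ m → rk n v i < s := by
      intro m
      induction m with
      | zero => exact fun _ => hlow
      | succ m ih =>
        intro hm i hi hv
        by_contra hc
        obtain ⟨i', hi', h1, h2⟩ := hcon m (by omega) (ih (by omega))
        exact hc ((rk_mono n v (hv.le.trans h2)).trans_lt h1)
    obtain ⟨i', hi', h1, h2⟩ := hcon (N - 1) (by omega) (hall (N - 1) (by omega))
    rw [Nat.sub_add_cancel hN] at h2
    exact absurd (hup i' hi' h1) (not_lt.2 h2)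
  obtain ⟨m, hm, h1, h2⟩ := key
  refine ⟨m, hm, fun i hi => ⟨?_, ?_⟩⟩
  · unfold lt01
    by_cases hv : v i < σ m
    · rw [if_pos hv, if_pos (h1 i hi hv)]
    · rw [if_neg hv]; split_ifs <;> norm_num
  · unfold lt01
    by_cases hv : rk n v i < s
    · rw [if_pos hv, if_pos (h2 i hi hv)]
    · rw [if_neg hv]; split_ifs <;> norm_num

/-- Weighted sum of the changes of side of `s` of the `k`-th coordinates under ranking. -/
def QQ (U : ℤ → Ω → Fin d → ℝ) (n : ℕ) (φ : (Fin d → ℝ) → ℝ) (k : Fin d) (s : ℝ) (ω : Ω) : ℝ :=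
  (Real.sqrt n)⁻¹ * ∑ i ∈ Finset.Icc (1 : ℤ) n,
    φ (U i ω) * (lt01 (pseudoObs U n i ω k) s - lt01 (U i ω k) s)

lemma abs_QQ_le_TT {U : ℤ → Ω → Fin d → ℝ} {n : ℕ} {φ : (Fin d → ℝ) → ℝ} (hφ : ∀ x, |φ x| ≤ 1)
    (k : Fin d) (s : ℝ) (ω : Ω) : |QQ U n φ k s ω| ≤ TT U n k s ω := by
  unfold QQ TT
  rw [abs_mul, abs_of_nonneg (inv_nonneg.2 (Real.sqrt_nonneg _))]
  refine mul_le_mul_of_nonneg_left ((Finset.abs_sum_le_sum_abs _ _).trans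
    (Finset.sum_le_sum fun i _ => ?_)) (inv_nonneg.2 (Real.sqrt_nonneg _))
  rw [abs_mul]
  exact mul_le_of_le_one_left (abs_nonneg _) (hφ _)

/-- Normalized sum of a function over the sample. -/
def smn (U : ℤ → Ω → E) (n : ℕ) (φ : E → ℝ) (ω : Ω) : ℝ :=
  (Real.sqrt n)⁻¹ * ∑ i ∈ Finset.Icc (1 : ℤ) n, φ (U i ω)

lemma smn_eq (P : Measure Ω) (U : ℤ → Ω → E) {n : ℕ} (hn : 0 < n) (φ : E → ℝ) (ω : Ω) :
    smn U n φ ω = emp P U n φ ω + Real.sqrt n * ∫ ω', φ (U 0 ω') ∂P := by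
  have hr : 0 < Real.sqrt n := Real.sqrt_pos.2 (by exact_mod_cast hn)
  have hrr : Real.sqrt n * Real.sqrt n = n := Real.mul_self_sqrt (by positivity)
  unfold smn emp
  rw [Finset.sum_sub_distrib, mul_sub]
  simp only [Finset.sum_const, Int.card_Icc, add_sub_cancel_right, Int.toNat_natCast, nsmul_eq_mul]
  have e : (Real.sqrt n)⁻¹ * ((n : ℝ) * ∫ ω', φ (U 0 ω') ∂P) =
      Real.sqrt n * ∫ ω', φ (U 0 ω') ∂P := by
    rw [← mul_assoc]
    congr 1
    rw [inv_mul_eq_div, div_eq_iff hr.ne', hrr]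
  rw [e]
  ring

lemma abs_QQ_le (P : Measure Ω) {U : ℤ → Ω → Fin d → ℝ} (hU : ∀ i ω j, U i ω j ∈ Icc (0 : ℝ) 1)
    {n : ℕ} (hn : 0 < n) {φ : (Fin d → ℝ) → ℝ} (hφ : ∀ x, |φ x| ≤ 1) (k : Fin d) {s x h : ℝ}
    (hs : s ∈ Icc (0 : ℝ) 1) (hx : 0 ≤ x) (hh : 0 < h)
    (hxh : h / 2 ≤ Real.sqrt n * x - (Real.sqrt n)⁻¹)
    {σ : ℕ → ℝ} (hσ : Monotone σ) {N : ℕ} (hN : 0 < N) (hσ0 : σ 0 = s - x) (hσN : σ N = s + x)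
    {η : ℝ} (hη : 0 ≤ η)
    (hση : ∀ m < N, Real.sqrt n * ∫ ω, lt01 (U 0 ω k) (σ (m + 1)) - lt01 (U 0 ω k) (σ m) ∂P ≤ η)
    (ω : Ω) : |QQ U n φ k s ω| ≤
      ∑ m ∈ Finset.range N, (|smn U n (fun y => φ y * (lt01 (y k) (σ m) - lt01 (y k) s)) ω| +
        |emp P U n (fun y => lt01 (y k) (σ (m + 1)) - lt01 (y k) (σ m)) ω|) + η +
      2 / h * (TT U n k s ω * (|al U n k (s + x) ω| + |al U n k (s - x) ω|)) := by
  have hr : 0 ≤ (Real.sqrt n)⁻¹ := inv_nonneg.2 (Real.sqrt_nonneg _)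
  set a := |al U n k (s + x) ω| with ha
  set b := |al U n k (s - x) ω| with hb
  have ha0 : 0 ≤ a := abs_nonneg _
  have hb0 : 0 ≤ b := abs_nonneg _
  have hT0 := TT_nonneg U n k s ω
  set F : ℕ → ℝ := fun m =>
    |smn U n (fun y => φ y * (lt01 (y k) (σ m) - lt01 (y k) s)) ω| +
        |emp P U n (fun y => lt01 (y k) (σ (m + 1)) - lt01 (y k) (σ m)) ω| with hF
  have hF0 : ∀ m, 0 ≤ F m := fun m => add_nonneg (abs_nonneg _) (abs_nonneg _)
  have hsum0 : 0 ≤ ∑ m ∈ Finset.range N, F m := Finset.sum_nonneg fun m _ => hF0 m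
  by_cases hrare : h / 2 ≤ a ∨ h / 2 ≤ b
  · have h1 : 1 ≤ 2 / h * (a + b) := by
      rw [div_mul_eq_mul_div, le_div_iff₀ hh]
      rcases hrare with h1 | h1 <;> linarith
    have h2 : TT U n k s ω ≤ 2 / h * (TT U n k s ω * (a + b)) := by
      calc TT U n k s ω ≤ TT U n k s ω * (2 / h * (a + b)) := le_mul_of_one_le_right hT0 h1
        _ = _ := by ring
    linarith [abs_QQ_le_TT hφ k s ω (U := U) (n := n)]
  · push Not at hrare
    have hclose : ∀ i, lt01 (pseudoObs U n i ω k) s - lt01 (U i ω k) s ≠ 0 →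
        s - x ≤ U i ω k ∧ U i ω k < s + x := by
      intro i hne
      by_contra hfar
      rcases large_al_of_far hn hU hs hne hfar hx with h1 | h1
      · linarith [hrare.1]
      · linarith [hrare.2]
    obtain ⟨m, hm, hstep⟩ := exists_grid_step n (fun i => U i ω k) (s := s) hσ hN
      (fun i _ hlt => by
        by_contra hc
        simp only [hσ0] at hlt
        have := (hclose i (by
          rw [pseudoObs_eq_rk, lt01, lt01, if_neg hc, if_pos (by linarith)]; norm_num)).1
        linarith)
      (fun i _ hlt => by
        by_contra hc
        simp only [hσN, not_lt] at hc
        have := (hclose i (by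
          rw [pseudoObs_eq_rk, lt01, lt01, if_pos hlt, if_neg (by linarith)]; norm_num)).2
        linarith)
    have h1 : |QQ U n φ k s ω - smn U n (fun y => φ y * (lt01 (y k) (σ m) - lt01 (y k) s)) ω| ≤
        smn U n (fun y => lt01 (y k) (σ (m + 1)) - lt01 (y k) (σ m)) ω := by
      unfold QQ smn
      rw [← mul_sub, ← Finset.sum_sub_distrib, abs_mul, abs_of_nonneg hr]
      refine mul_le_mul_of_nonneg_left ((Finset.abs_sum_le_sum_abs _ _).trans
        (Finset.sum_le_sum fun i hi => ?_)) hr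
      have e : φ (U i ω) * (lt01 (pseudoObs U n i ω k) s - lt01 (U i ω k) s) -
          φ (U i ω) * (lt01 (U i ω k) (σ m) - lt01 (U i ω k) s) =
          φ (U i ω) * (lt01 (pseudoObs U n i ω k) s - lt01 (U i ω k) (σ m)) := by ring
      have h2 := hstep i hi
      rw [← pseudoObs_eq_rk] at h2
      rw [e, abs_mul, abs_of_nonneg (sub_nonneg.2 h2.1)]
      calc |φ (U i ω)| * (lt01 (pseudoObs U n i ω k) s - lt01 (U i ω k) (σ m)) ≤
          1 * (lt01 (pseudoObs U n i ω k) s - lt01 (U i ω k) (σ m)) :=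
            mul_le_mul_of_nonneg_right (hφ _) (sub_nonneg.2 h2.1)
        _ ≤ _ := by linarith [h2.2]
    rw [smn_eq P U hn (fun y => lt01 (y k) (σ (m + 1)) - lt01 (y k) (σ m))] at h1
    have h2 : |QQ U n φ k s ω| ≤ F m + η := by
      have h3 := abs_sub_abs_le_abs_sub (QQ U n φ k s ω)
        (smn U n (fun y => φ y * (lt01 (y k) (σ m) - lt01 (y k) s)) ω)
      have h4 := le_abs_self (emp P U n (fun y => lt01 (y k) (σ (m + 1)) - lt01 (y k) (σ m)) ω)
      have h5 := hση m hm
      simp only [hF]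
      linarith
    have h3 : F m ≤ ∑ m ∈ Finset.range N, F m :=
      Finset.single_le_sum (fun m _ => hF0 m) (Finset.mem_range.2 hm)
    have : 0 ≤ 2 / h * (TT U n k s ω * (a + b)) := by positivity
    linarith

variable {P : Measure Ω} [IsProbabilityMeasure P]

lemma EmpBound.integral_abs_le {U : ℤ → Ω → E} (hm : ∀ i, Measurable (U i)) {κ C : ℝ}
    (hB : EmpBound P U κ C) (hκ0 : 0 < κ) {n : ℕ} (hn : 0 < n) {φ : E → ℝ} (hφ : Measurable φ)
    (hφ1 : ∀ x, |φ x| ≤ 1) {q : ℝ} (hq : ∫ ω, |φ (U 0 ω)| ∂P ≤ q) :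
    ∫ ω, |emp P U n φ ω| ∂P ≤ √C * q ^ κ := by
  have h0 : 0 ≤ ∫ ω, |φ (U 0 ω)| ∂P := integral_nonneg fun _ => abs_nonneg _
  rw [← sqrt_mul_rpow_le hB.1 (h0.trans hq)]
  refine (integral_abs_le_sqrt (integrable_emp hm n hφ hφ1) (integrable_emp_sq hm n hφ hφ1)).trans
    (Real.sqrt_le_sqrt ((hB.2 φ hφ hφ1 n hn).trans ?_))
  exact mul_le_mul_of_nonneg_left (Real.rpow_le_rpow h0 hq (by linarith)) hB.1.le

lemma UnifSeq.integral_abs_lt01_sub {U : ℤ → Ω → Fin d → ℝ} (h : UnifSeq P U) (k : Fin d) {s t : ℝ}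
    (hs : s ∈ Icc (0 : ℝ) 1) (ht : t ∈ Icc (0 : ℝ) 1) :
    ∫ ω, |lt01 (U 0 ω k) t - lt01 (U 0 ω k) s| ∂P = |t - s| := by
  wlog hst : s ≤ t generalizing s t
  · rw [abs_sub_comm, ← this ht hs (le_of_not_ge hst)]
    simp only [abs_sub_comm]
  have e : ∀ ω, |lt01 (U 0 ω k) t - lt01 (U 0 ω k) s| = lt01 (U 0 ω k) t - lt01 (U 0 ω k) s := by
    intro ω
    rw [abs_of_nonneg]
    unfold lt01
    split_ifs <;> norm_num
    linarith
  simp only [e]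
  rw [integral_sub (integrable_lt01 h k t) (integrable_lt01 h k s), h.integral_lt01 k hs,
    h.integral_lt01 k ht, abs_of_nonneg (by linarith)]

/-- A square-integrable bound for products of marginal empirical processes. -/
def sqs (U : ℤ → Ω → Fin d → ℝ) (n : ℕ) (k : Fin d) (s t r : ℝ) (ω : Ω) : ℝ :=
  al U n k s ω ^ 2 + al U n k t ω ^ 2 + al U n k r ω ^ 2 + 1

lemma sqs_nonneg (U : ℤ → Ω → Fin d → ℝ) (n : ℕ) (k : Fin d) (s t r : ℝ) (ω : Ω) :
    0 ≤ sqs U n k s t r ω := by unfold sqs; positivity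

lemma TT_mul_le_sqs {U : ℤ → Ω → Fin d → ℝ} {κ : ℝ} (hκ0 : 0 < κ) (hκ : κ < 1 / 2) {n : ℕ}
    (hn : 0 < n) (k : Fin d) {s : ℝ} (hs : s ∈ Icc (0 : ℝ) 1) (t r : ℝ) {ω : Ω}
    (hω : ω ∈ Good U n (tieLen κ n)) :
    TT U n k s ω * (|al U n k t ω| + |al U n k r ω|) ≤ sqs U n k s t r ω := by
  have h1 := UnifSeq.TT_le_of_good hκ hn hω k hs
  have h2 : (n : ℝ) ^ (-κ) ≤ 1 := Real.rpow_le_one_of_one_le_of_nonpos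
    (by exact_mod_cast hn) (by linarith)
  unfold sqs
  rw [← sq_abs (al U n k s ω), ← sq_abs (al U n k t ω), ← sq_abs (al U n k r ω)]
  set A := |al U n k s ω|
  set a := |al U n k t ω|
  set b := |al U n k r ω|
  have ha0 : 0 ≤ a := abs_nonneg _
  have hb0 : 0 ≤ b := abs_nonneg _
  calc TT U n k s ω * (a + b) ≤ (A + 1) * (a + b) :=
        mul_le_mul_of_nonneg_right (by linarith) (by linarith)
    _ ≤ _ := by nlinarith [sq_nonneg (A - a), sq_nonneg (A - b), sq_nonneg (a - 1),
        sq_nonneg (b - 1)]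

lemma UnifSeq.integrable_sqs {U : ℤ → Ω → Fin d → ℝ} (h : UnifSeq P U) (n : ℕ) (k : Fin d)
    {s t r : ℝ} (hs : s ∈ Icc (0 : ℝ) 1) (ht : t ∈ Icc (0 : ℝ) 1) (hr : r ∈ Icc (0 : ℝ) 1) :
    Integrable (sqs U n k s t r) P :=
  (((integrable_al_sq h n k hs).add (integrable_al_sq h n k ht)).add
    (integrable_al_sq h n k hr)).add (integrable_const 1)

lemma UnifSeq.integral_sqs_le {U : ℤ → Ω → Fin d → ℝ} (h : UnifSeq P U) {κ C : ℝ}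
    (hB : EmpBound P U κ C) (hκ0 : 0 < κ) {n : ℕ} (hn : 0 < n) (k : Fin d)
    {s t r : ℝ} (hs : s ∈ Icc (0 : ℝ) 1) (ht : t ∈ Icc (0 : ℝ) 1) (hr : r ∈ Icc (0 : ℝ) 1) :
    ∫ ω, sqs U n k s t r ω ∂P ≤ 3 * C + 1 := by
  have hal : ∀ t ∈ Icc (0 : ℝ) 1, ∫ ω, al U n k t ω ^ 2 ∂P ≤ C := fun t ht => by
    refine (h.integral_al_sq_le hB hn k ht).trans (mul_le_of_le_one_right hB.1.le ?_)
    refine Real.rpow_le_one (le_min ht.1 (by linarith [ht.2])) ?_ (by linarith)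
    exact (min_le_left _ _).trans ht.2
  have i1 := integrable_al_sq h n k hs
  have i2 := integrable_al_sq h n k ht
  have i3 := integrable_al_sq h n k hr
  have i12 : Integrable (fun ω => al U n k s ω ^ 2 + al U n k t ω ^ 2) P := i1.add i2
  have i123 : Integrable (fun ω => al U n k s ω ^ 2 + al U n k t ω ^ 2 + al U n k r ω ^ 2) P :=
    i12.add i3
  unfold sqs
  rw [integral_add i123 (integrable_const 1), integral_add i12 i3, integral_add i1 i2]
  have := hal s hs
  have := hal t ht
  have := hal r hr
  simp
  linarith

end

/-! ### Pointwise convergence of the linearization error -/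

section

variable {P : Measure Ω} [IsProbabilityMeasure P] {U : ℤ → Ω → Fin 2 → ℝ}

lemma tendsto_sqrt_mul_slope {f : ℝ → ℝ} {D s : ℝ} (hf : HasDerivAt f D s) (c : ℝ) :
    Tendsto (fun n : ℕ => Real.sqrt n *
      (f (s + c * (Real.sqrt n)⁻¹) - f s - D * (c * (Real.sqrt n)⁻¹))) atTop (nhds 0) := by
  have h0 : Tendsto (fun n : ℕ => (Real.sqrt n)⁻¹) atTop (nhds 0) :=
    tendsto_inv_atTop_zero.comp (Real.tendsto_sqrt_atTop.comp tendsto_natCast_atTop_atTop)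
  have h1 : Tendsto (fun n : ℕ => s + c * (Real.sqrt n)⁻¹) atTop (nhds s) := by
    simpa using (h0.const_mul c).const_add s
  have h2 := (hasDerivAt_iff_isLittleO.1 hf).comp_tendsto h1
  have h3 : (fun n : ℕ => s + c * (Real.sqrt n)⁻¹ - s) =O[atTop] fun n : ℕ => (Real.sqrt n)⁻¹ := by
    simp only [add_sub_cancel_left]
    exact (Asymptotics.isBigO_refl _ _).const_mul_left c
  have h4 := (h2.trans_isBigO h3).tendsto_div_nhds_zero
  refine h4.congr fun n => ?_
  simp only [Function.comp, smul_eq_mul]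
  rw [div_inv_eq_mul, mul_comm]
  congr 1
  ring

lemma UnifSeq.integral_mul_lt01_sub (h : UnifSeq P U) {j k : Fin 2} (hjk : j ≠ k) {u : Fin 2 → ℝ}
    (hu : ∀ i, u i ∈ Icc (0 : ℝ) 1) {t : ℝ} (ht : t ∈ Icc (0 : ℝ) 1) (D : ℝ) :
    ∫ ω, (lt01 (U 0 ω j) (u j) - D) * (lt01 (U 0 ω k) t - lt01 (U 0 ω k) (u k)) ∂P =
      cop P U (Function.update u k t) - cop P U u - D * (t - u k) := by
  have hp : ∀ v : Fin 2 → ℝ, Integrable (fun ω => ∏ i, lt01 (U 0 ω i) (v i)) P := fun v =>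
    integrable_of_abs_le ((measurable_prod_lt01 v).comp (h.meas 0)) fun ω => by
      have := prod_lt01_mem (U 0 ω) v
      rw [abs_of_nonneg this.1]; exact this.2
  have e : ∀ ω, (lt01 (U 0 ω j) (u j) - D) * (lt01 (U 0 ω k) t - lt01 (U 0 ω k) (u k)) =
      ((∏ i, lt01 (U 0 ω i) (Function.update u k t i)) - ∏ i, lt01 (U 0 ω i) (u i)) -
        D * (lt01 (U 0 ω k) t - lt01 (U 0 ω k) (u k)) := by
    intro ω
    rw [prod_pair hjk, prod_pair hjk, Function.update_self, Function.update_of_ne hjk]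
    ring
  simp only [e]
  have i1 : Integrable (fun ω => (∏ i, lt01 (U 0 ω i) (Function.update u k t i)) -
      ∏ i, lt01 (U 0 ω i) (u i)) P := (hp _).sub (hp _)
  have i2 : Integrable (fun ω => lt01 (U 0 ω k) t - lt01 (U 0 ω k) (u k)) P :=
    (integrable_lt01 h k t).sub (integrable_lt01 h k (u k))
  rw [integral_sub i1 (i2.const_mul D), integral_sub (hp _) (hp _), integral_const_mul,
    integral_sub (integrable_lt01 h k t) (integrable_lt01 h k (u k)), h.integral_prod_lt01,
    h.integral_prod_lt01, h.integral_lt01 k ht, h.integral_lt01 k (hu k)]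


/-- The weight of the changes of side of the `k`-th coordinates in the remainder. -/
def wt (P : Measure Ω) (U : ℤ → Ω → Fin 2 → ℝ) (j k : Fin 2) (u x : Fin 2 → ℝ) : ℝ :=
  lt01 (x j) (u j) - Cdot (cop P U) k u

lemma abs_wt_le {K : ℝ} (hR : UnifSeq.CopReg P U K) (j k : Fin 2) {u : Fin 2 → ℝ} (hu : u ∈ cube)
    (x : Fin 2 → ℝ) : |wt P U j k u x| ≤ 1 := by
  have h1 := hR.mem k u (mem_VV_of_cube hu k)
  have h2 := lt01_nonneg (x j) (u j)
  have h3 := lt01_le_one (x j) (u j)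
  unfold wt
  rw [abs_le]; constructor <;> linarith [h1.1, h1.2]

lemma measurable_wt (j k : Fin 2) (u : Fin 2 → ℝ) : Measurable (wt P U j k u) :=
  (measurable_lt01_coord j _).sub_const _

lemma tendsto_inv_sqrt : Tendsto (fun n : ℕ => (Real.sqrt n)⁻¹) atTop (nhds 0) :=
  tendsto_inv_atTop_zero.comp (Real.tendsto_sqrt_atTop.comp tendsto_natCast_atTop_atTop)

lemma eventually_add_mem {s : ℝ} (hs : 0 < s ∧ s < 1) (c : ℝ) :
    ∀ᶠ n : ℕ in atTop, s + c * (Real.sqrt n)⁻¹ ∈ Icc (0 : ℝ) 1 := by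
  have h1 : Tendsto (fun n : ℕ => s + c * (Real.sqrt n)⁻¹) atTop (nhds s) := by
    simpa using (tendsto_inv_sqrt.const_mul c).const_add s
  exact h1.eventually (Icc_mem_nhds hs.1 hs.2)

lemma UnifSeq.tendsto_integral_abs_smn (h : UnifSeq P U) {κ C K : ℝ} (hB : EmpBound P U κ C)
    (hκ0 : 0 < κ) (hR : UnifSeq.CopReg P U K) {j k : Fin 2} (hjk : j ≠ k) {u : Fin 2 → ℝ}
    (hu : u ∈ cube) (c : ℝ) :
    Tendsto (fun n : ℕ => ∫ ω, |smn U n (fun y => wt P U j k u y *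
      (lt01 (y k) (u k + c * (Real.sqrt n)⁻¹) - lt01 (y k) (u k))) ω| ∂P) atTop (nhds 0) := by
  have huI := fun i => mem_Icc_of_cube hu i
  have h1 : Tendsto (fun n : ℕ => √C * (|c| * (Real.sqrt n)⁻¹) ^ κ +
      |Real.sqrt n * (cop P U (Function.update u k (u k + c * (Real.sqrt n)⁻¹)) - cop P U u -
        Cdot (cop P U) k u * (c * (Real.sqrt n)⁻¹))|) atTop (nhds 0) := by
    have h2 : Tendsto (fun n : ℕ => √C * (|c| * (Real.sqrt n)⁻¹) ^ κ) atTop (nhds 0) := by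
      have := ((tendsto_inv_sqrt.const_mul |c|).rpow_const (p := κ) (Or.inr hκ0.le)).const_mul √C
      simpa [Real.zero_rpow hκ0.ne'] using this
    have h3 := tendsto_sqrt_mul_slope (hR.deriv k u (mem_VV_of_cube hu k)) c
    simp only [Function.update_eq_self] at h3
    simpa using h2.add h3.abs
  refine tendsto_of_tendsto_of_tendsto_of_le_of_le' tendsto_const_nhds h1
    (Eventually.of_forall fun n => integral_nonneg fun _ => abs_nonneg _) ?_
  filter_upwards [eventually_add_mem (hu k) c, eventually_gt_atTop 0] with n hn hn0
  set t := u k + c * (Real.sqrt n)⁻¹ with ht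
  set ψ : (Fin 2 → ℝ) → ℝ := fun y => wt P U j k u y * (lt01 (y k) t - lt01 (y k) (u k)) with hψ
  have hψm : Measurable ψ := (measurable_wt j k u).mul
    ((measurable_lt01_coord k t).sub (measurable_lt01_coord k (u k)))
  have hψ1 : ∀ y, |ψ y| ≤ |lt01 (y k) t - lt01 (y k) (u k)| := fun y => by
    simp only [hψ]
    rw [abs_mul]
    exact mul_le_of_le_one_left (abs_nonneg _) (abs_wt_le hR j k hu y)
  have hψ2 : ∀ y, |ψ y| ≤ 1 := fun y => (hψ1 y).trans (abs_lt01_sub_le _ _ _ _)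
  have hi : Integrable (fun ω => |lt01 (U 0 ω k) t - lt01 (U 0 ω k) (u k)|) P :=
    ((integrable_lt01 h k t).sub (integrable_lt01 h k (u k))).abs
  have h4 : ∫ ω, |ψ (U 0 ω)| ∂P ≤ |c| * (Real.sqrt n)⁻¹ := by
    refine (integral_mono_of_nonneg (ae_of_all _ fun _ => abs_nonneg _) hi
      (ae_of_all _ fun ω => hψ1 _)).trans_eq ?_
    rw [h.integral_abs_lt01_sub k (huI k) hn, ht, add_sub_cancel_left, abs_mul,
      abs_of_nonneg (inv_nonneg.2 (Real.sqrt_nonneg n))]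
  have h5 := hB.integral_abs_le h.meas hκ0 hn0 hψm hψ2 h4
  have h6 : ∫ ω, ψ (U 0 ω) ∂P = cop P U (Function.update u k t) - cop P U u -
      Cdot (cop P U) k u * (c * (Real.sqrt n)⁻¹) := by
    have := h.integral_mul_lt01_sub hjk huI hn (Cdot (cop P U) k u)
    rw [show t - u k = c * (Real.sqrt n)⁻¹ by rw [ht]; ring] at this
    exact this
  have hie := (integrable_emp (P := P) h.meas n hψm hψ2).abs
  calc ∫ ω, |smn U n ψ ω| ∂P ≤ ∫ ω, (|emp P U n ψ ω| + |Real.sqrt n * ∫ ω', ψ (U 0 ω') ∂P|) ∂P := by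
        refine integral_mono_of_nonneg (ae_of_all _ fun _ => abs_nonneg _)
          (hie.add (integrable_const _)) (ae_of_all _ fun ω => ?_)
        simp only
        rw [smn_eq P U hn0]
        exact abs_add_le _ _
    _ = ∫ ω, |emp P U n ψ ω| ∂P + |Real.sqrt n * ∫ ω', ψ (U 0 ω') ∂P| := by
        rw [integral_add hie (integrable_const _)]; simp
    _ ≤ _ := by rw [h6]; linarith

lemma UnifSeq.tendsto_integral_abs_emp (h : UnifSeq P U) {κ C : ℝ} (hB : EmpBound P U κ C)
    (hκ0 : 0 < κ) (k : Fin 2) {s : ℝ} (hs : 0 < s ∧ s < 1) (c c' : ℝ) :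
    Tendsto (fun n : ℕ => ∫ ω, |emp P U n (fun y =>
      lt01 (y k) (s + c' * (Real.sqrt n)⁻¹) - lt01 (y k) (s + c * (Real.sqrt n)⁻¹)) ω| ∂P)
      atTop (nhds 0) := by
  have h2 : Tendsto (fun n : ℕ => √C * (|c' - c| * (Real.sqrt n)⁻¹) ^ κ) atTop (nhds 0) := by
    have := ((tendsto_inv_sqrt.const_mul |c' - c|).rpow_const (p := κ)
      (Or.inr hκ0.le)).const_mul √C
    simpa [Real.zero_rpow hκ0.ne'] using this
  refine tendsto_of_tendsto_of_tendsto_of_le_of_le' tendsto_const_nhds h2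
    (Eventually.of_forall fun n => integral_nonneg fun _ => abs_nonneg _) ?_
  filter_upwards [eventually_add_mem hs c, eventually_add_mem hs c', eventually_gt_atTop 0]
    with n hn hn' hn0
  refine hB.integral_abs_le h.meas hκ0 hn0 (φ := fun y => lt01 (y k) (s + c' * (Real.sqrt n)⁻¹) -
      lt01 (y k) (s + c * (Real.sqrt n)⁻¹))
    ((measurable_lt01_coord k _).sub (measurable_lt01_coord k _))
    (fun y => abs_lt01_sub_le _ _ _ _) ?_
  rw [h.integral_abs_lt01_sub k hn hn', add_sub_add_left_eq_sub, ← sub_mul, abs_mul,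
      abs_of_nonneg (inv_nonneg.2 (Real.sqrt_nonneg n))]


lemma eventually_half_le {h : ℝ} (hh : 0 < h) :
    ∀ᶠ n : ℕ in atTop, h / 2 ≤ Real.sqrt n * (h * (Real.sqrt n)⁻¹) - (Real.sqrt n)⁻¹ := by
  filter_upwards [tendsto_inv_sqrt.eventually (gt_mem_nhds (half_pos hh)), eventually_gt_atTop 0]
    with n hn hn0
  have hr : Real.sqrt n ≠ 0 := (Real.sqrt_pos.2 (by exact_mod_cast hn0)).ne'
  rw [mul_left_comm, mul_inv_cancel₀ hr]
  linarith

lemma UnifSeq.tendsto_integral_abs_QQ (h : UnifSeq P U) {κ C K : ℝ} (hB : EmpBound P U κ C)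
    (hκ0 : 0 < κ) (hκ : κ < 1 / 2) (hR : UnifSeq.CopReg P U K) {j k : Fin 2} (hjk : j ≠ k)
    {u : Fin 2 → ℝ} (hu : u ∈ cube) :
    Tendsto (fun n : ℕ => ∫ ω in Good U n (tieLen κ n), |QQ U n (wt P U j k u) k (u k) ω| ∂P)
      atTop (nhds 0) := by
  have hC := hB.1
  have huI := fun i => mem_Icc_of_cube hu i
  rw [Metric.tendsto_nhds]
  intro ε hε
  obtain ⟨a, ha, haC⟩ : ∃ a : ℝ, 0 < a ∧ 2 / a * (3 * C + 1) ≤ ε / 4 := by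
    refine ⟨8 * (3 * C + 1) / ε, by positivity, le_of_eq ?_⟩
    field_simp
    norm_num
  obtain ⟨N, hN⟩ := exists_nat_gt (8 * a / ε)
  have hN0 : (0 : ℝ) < N := lt_of_le_of_lt (by positivity) hN
  have hNη : 2 * a / N ≤ ε / 4 := by
    rw [div_lt_iff₀ hε] at hN
    rw [div_le_iff₀ hN0]; linarith
  set c : ℕ → ℝ := fun m => -a + m * (2 * a / N) with hc
  have hlim : Tendsto (fun n : ℕ => ∑ m ∈ Finset.range N,
      (∫ ω, |smn U n (fun y => wt P U j k u y *
        (lt01 (y k) (u k + c m * (Real.sqrt n)⁻¹) - lt01 (y k) (u k))) ω| ∂P +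
      ∫ ω, |emp P U n (fun y => lt01 (y k) (u k + c (m + 1) * (Real.sqrt n)⁻¹) -
        lt01 (y k) (u k + c m * (Real.sqrt n)⁻¹)) ω| ∂P)) atTop (nhds 0) := by
    have := tendsto_finsetSum (Finset.range N) fun m _ =>
      (h.tendsto_integral_abs_smn hB hκ0 hR hjk hu (c m)).add
        (h.tendsto_integral_abs_emp hB hκ0 k (hu k) (c m) (c (m + 1)))
    simpa using this
  have hmem : ∀ᶠ n : ℕ in atTop, ∀ m ∈ Finset.range (N + 1),
      u k + c m * (Real.sqrt n)⁻¹ ∈ Icc (0 : ℝ) 1 :=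
    (Finset.eventually_all _).2 fun m _ => eventually_add_mem (hu k) (c m)
  filter_upwards [hlim.eventually (gt_mem_nhds (show (0 : ℝ) < ε / 4 by linarith)), hmem,
    eventually_half_le ha, eventually_gt_atTop 0, eventually_add_mem (hu k) a,
    eventually_add_mem (hu k) (-a)] with n h1 h2 h3 hn0 h4 h5
  have hr0 : 0 ≤ (Real.sqrt n)⁻¹ := inv_nonneg.2 (Real.sqrt_nonneg _)
  have hr : Real.sqrt n ≠ 0 := (Real.sqrt_pos.2 (by exact_mod_cast hn0)).ne'
  rw [Real.dist_eq, sub_zero, abs_of_nonneg (integral_nonneg fun _ => abs_nonneg _)]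
  rw [neg_mul, ← sub_eq_add_neg] at h5
  set G := Good U n (tieLen κ n) with hG
  have hσ : Monotone fun m : ℕ => u k + c m * (Real.sqrt n)⁻¹ := by
    intro m m' hm
    have : c m ≤ c m' := by
      simp only [hc]
      have : (m : ℝ) ≤ m' := by exact_mod_cast hm
      gcongr
    simp only
    gcongr
  have hpt := fun ω => abs_QQ_le P h.mem hn0 (abs_wt_le hR j k hu) k (huI k)
    (mul_nonneg ha.le hr0) ha h3 hσ (by exact_mod_cast hN0) (by simp [hc]; ring)
    (by simp only [hc]; field_simp; ring) (η := 2 * a / N) (by positivity) (fun m hm => by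
      rw [integral_sub (integrable_lt01 h k _) (integrable_lt01 h k _), h.integral_lt01 k
        (h2 _ (Finset.mem_range.2 (by omega))), h.integral_lt01 k
        (h2 _ (Finset.mem_range.2 (by omega)))]
      refine le_of_eq ?_
      simp only [hc]; push_cast; field_simp; ring) ω
  have hi1 : ∀ m, Integrable (fun ω => |smn U n (fun y => wt P U j k u y *
        (lt01 (y k) (u k + c m * (Real.sqrt n)⁻¹) - lt01 (y k) (u k))) ω|) P := by
    intro m
    have hi := integrable_emp (P := P) h.meas n (φ := fun y => wt P U j k u y *
        (lt01 (y k) (u k + c m * (Real.sqrt n)⁻¹) - lt01 (y k) (u k))) (M := 1)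
      ((measurable_wt j k u).mul
        ((measurable_lt01_coord k _).sub (measurable_lt01_coord k (u k)))) fun y => by
        rw [abs_mul]
        exact mul_le_one₀ (abs_wt_le hR j k hu y) (abs_nonneg _) (abs_lt01_sub_le _ _ _ _)
    have e := funext fun ω => smn_eq P U hn0 (fun y => wt P U j k u y *
        (lt01 (y k) (u k + c m * (Real.sqrt n)⁻¹) - lt01 (y k) (u k))) ω
    have := (hi.add (integrable_const (Real.sqrt n * ∫ ω', (wt P U j k u (U 0 ω') *
        (lt01 (U 0 ω' k) (u k + c m * (Real.sqrt n)⁻¹) - lt01 (U 0 ω' k) (u k))) ∂P))).abs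
    exact this.congr (ae_of_all _ fun ω => by simp only [Pi.add_apply, smn_eq P U hn0])
  have hi2 : ∀ m, Integrable (fun ω => |emp P U n (fun y =>
      lt01 (y k) (u k + c (m + 1) * (Real.sqrt n)⁻¹) -
        lt01 (y k) (u k + c m * (Real.sqrt n)⁻¹)) ω|) P := fun m =>
    (integrable_emp h.meas n (M := 1) ((measurable_lt01_coord k _).sub (measurable_lt01_coord k _))
      fun y => abs_lt01_sub_le _ _ _ _).abs
  have hi3 := h.integrable_sqs n k (huI k) h4 h5
  have hi12 : ∀ m, Integrable (fun ω => |smn U n (fun y => wt P U j k u y *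
        (lt01 (y k) (u k + c m * (Real.sqrt n)⁻¹) - lt01 (y k) (u k))) ω| +
      |emp P U n (fun y => lt01 (y k) (u k + c (m + 1) * (Real.sqrt n)⁻¹) -
        lt01 (y k) (u k + c m * (Real.sqrt n)⁻¹)) ω|) P := fun m => (hi1 m).add (hi2 m)
  have hiS : Integrable (fun ω => ∑ m ∈ Finset.range N, (|smn U n (fun y => wt P U j k u y *
        (lt01 (y k) (u k + c m * (Real.sqrt n)⁻¹) - lt01 (y k) (u k))) ω| +
      |emp P U n (fun y => lt01 (y k) (u k + c (m + 1) * (Real.sqrt n)⁻¹) -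
        lt01 (y k) (u k + c m * (Real.sqrt n)⁻¹)) ω|)) P :=
    integrable_finsetSum _ fun m _ => hi12 m
  have hiS2 : Integrable (fun ω => ∑ m ∈ Finset.range N, (|smn U n (fun y => wt P U j k u y *
        (lt01 (y k) (u k + c m * (Real.sqrt n)⁻¹) - lt01 (y k) (u k))) ω| +
      |emp P U n (fun y => lt01 (y k) (u k + c (m + 1) * (Real.sqrt n)⁻¹) -
        lt01 (y k) (u k + c m * (Real.sqrt n)⁻¹)) ω|) + 2 * a / N) P :=
    hiS.add (integrable_const _)
  have hi3' : Integrable (fun ω => 2 / a * sqs U n k (u k) (u k + a * (Real.sqrt n)⁻¹)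
      (u k - a * (Real.sqrt n)⁻¹) ω) P := hi3.const_mul _
  have h7 := setIntegral_le_integral_of_le (measurableSet_Good h.meas n _) (hiS2.add hi3')
    (G := G) (f := fun ω => |QQ U n (wt P U j k u) k (u k) ω|)
    (fun ω => add_nonneg (add_nonneg (Finset.sum_nonneg fun m _ =>
      add_nonneg (abs_nonneg _) (abs_nonneg _)) (by positivity))
      (mul_nonneg (by positivity) (sqs_nonneg _ _ _ _ _ _ _))) (fun ω => abs_nonneg _)
    (fun ω hω => (hpt ω).trans (add_le_add le_rfl (mul_le_mul_of_nonneg_left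
      (TT_mul_le_sqs hκ0 hκ hn0 k (huI k) _ _ hω) (by positivity))))
  refine h7.trans_lt (lt_of_eq_of_lt (integral_add hiS2 hi3') ?_)
  rw [integral_add hiS (integrable_const _),
    integral_finsetSum _ fun m _ => hi12 m, integral_const_mul]
  have e2 := fun m => integral_add (hi1 m) (hi2 m)
  simp only [e2]
  have h8 := h.integral_sqs_le hB hκ0 hn0 k (huI k) h4 h5
  have h9 : 2 / a * ∫ ω, sqs U n k (u k) (u k + a * (Real.sqrt n)⁻¹)
      (u k - a * (Real.sqrt n)⁻¹) ω ∂P ≤ ε / 4 :=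
    (mul_le_mul_of_nonneg_left h8 (by positivity)).trans haC
  simp only [integral_const, probReal_univ, one_smul]
  linarith


/-- Normalized number of indices for which both coordinates change side under ranking. -/
def BB (U : ℤ → Ω → Fin 2 → ℝ) (n : ℕ) (j k : Fin 2) (u : Fin 2 → ℝ) (ω : Ω) : ℝ :=
  (Real.sqrt n)⁻¹ * ∑ i ∈ Finset.Icc (1 : ℤ) n,
    |(lt01 (pseudoObs U n i ω j) (u j) - lt01 (U i ω j) (u j)) *
          (lt01 (pseudoObs U n i ω k) (u k) - lt01 (U i ω k) (u k))|

lemma BB_nonneg (U : ℤ → Ω → Fin 2 → ℝ) (n : ℕ) (j k : Fin 2) (u : Fin 2 → ℝ) (ω : Ω) :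
    0 ≤ BB U n j k u ω :=
  mul_nonneg (inv_nonneg.2 (Real.sqrt_nonneg _)) (Finset.sum_nonneg fun _ _ => abs_nonneg _)

lemma BB_le (hU : ∀ i ω j, U i ω j ∈ Icc (0 : ℝ) 1) {n : ℕ}
    (hn : 0 < n) (j k : Fin 2) {u : Fin 2 → ℝ} {x h : ℝ} (hu : ∀ i, u i ∈ Icc (0 : ℝ) 1)
    (hx : 0 ≤ x) (hh : 0 < h) (hxh : h / 2 ≤ Real.sqrt n * x - (Real.sqrt n)⁻¹) (ω : Ω) :
    BB U n j k u ω ≤ cnt U n {y | (u j - x ≤ y j ∧ y j < u j + x) ∧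
        u k - x ≤ y k ∧ y k < u k + x} ω +
      2 / h * (TT U n j (u j) ω * (|al U n j (u j + x) ω| + |al U n j (u j - x) ω|)) +
      2 / h * (TT U n k (u k) ω * (|al U n k (u k + x) ω| + |al U n k (u k - x) ω|)) := by
  set B : Set (Fin 2 → ℝ) := {y | (u j - x ≤ y j ∧ y j < u j + x) ∧
        u k - x ≤ y k ∧ y k < u k + x} with hB
  set a : Fin 2 → ℝ := fun l => |al U n l (u l + x) ω| + |al U n l (u l - x) ω| with ha
  set δ : ℤ → Fin 2 → ℝ := fun i l => lt01 (pseudoObs U n i ω l) (u l) - lt01 (U i ω l) (u l) with hδ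
  have ha0 : ∀ l, 0 ≤ a l := fun l => by positivity
  have hδ1 : ∀ i l, |δ i l| ≤ 1 := fun i l => abs_lt01_sub_le _ _ _ _
  have hfar : ∀ i l, ¬ (u l - x ≤ U i ω l ∧ U i ω l < u l + x) →
      |δ i l| ≤ 2 / h * a l * |δ i l| := by
    intro i l hf
    by_cases hne : δ i l = 0
    · simp [hne]
    · refine le_mul_of_one_le_left (abs_nonneg _) ?_
      rw [div_mul_eq_mul_div, le_div_iff₀ hh]
      have h1 := abs_nonneg (al U n l (u l + x) ω)
      have h2 := abs_nonneg (al U n l (u l - x) ω)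
      simp only [ha]
      rcases large_al_of_far hn hU (hu l) hne hf hx with h3 | h3 <;> linarith
  have hpt : ∀ i, |δ i j * δ i k| ≤ indic B (U i ω) + 2 / h * a j * |δ i j| +
      2 / h * a k * |δ i k| := by
    intro i
    have p1 : 0 ≤ 2 / h * a j * |δ i j| := mul_nonneg (mul_nonneg (by positivity) (ha0 j)) (abs_nonneg _)
    have p2 : 0 ≤ 2 / h * a k * |δ i k| := mul_nonneg (mul_nonneg (by positivity) (ha0 k)) (abs_nonneg _)
    have p3 := indic_nonneg B (U i ω)
    have l1 : |δ i j * δ i k| ≤ |δ i j| := by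
      rw [abs_mul]; exact mul_le_of_le_one_right (abs_nonneg _) (hδ1 i k)
    have l2 : |δ i j * δ i k| ≤ |δ i k| := by
      rw [abs_mul]; exact mul_le_of_le_one_left (abs_nonneg _) (hδ1 i j)
    by_cases hj : u j - x ≤ U i ω j ∧ U i ω j < u j + x
    · by_cases hk : u k - x ≤ U i ω k ∧ U i ω k < u k + x
      · have : indic B (U i ω) = 1 := by
          have hm : U i ω ∈ B := ⟨hj, hk⟩
          simp [indic, hm]
        linarith [hδ1 i j]
      · linarith [hfar i k hk]
    · linarith [hfar i j hj]
  have e : cnt U n B ω + 2 / h * (TT U n j (u j) ω * a j) + 2 / h * (TT U n k (u k) ω * a k) =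
      (Real.sqrt n)⁻¹ * ∑ i ∈ Finset.Icc (1 : ℤ) n,
        (indic B (U i ω) + 2 / h * a j * |δ i j| + 2 / h * a k * |δ i k|) := by
    unfold cnt TT
    rw [Finset.sum_add_distrib, Finset.sum_add_distrib, ← Finset.mul_sum, ← Finset.mul_sum]
    ring
  rw [e]
  exact mul_le_mul_of_nonneg_left (Finset.sum_le_sum fun i _ => hpt i)
    (inv_nonneg.2 (Real.sqrt_nonneg _))

lemma UnifSeq.tendsto_integral_BB (h : UnifSeq P U) {κ C K : ℝ} (hB : EmpBound P U κ C)
    (hκ0 : 0 < κ) (hκ : κ < 1 / 2) (hR : UnifSeq.CopReg P U K) {j k : Fin 2} (hjk : j ≠ k)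
    {u : Fin 2 → ℝ} (hu : u ∈ cube) :
    Tendsto (fun n : ℕ => ∫ ω in Good U n (tieLen κ n), BB U n j k u ω ∂P) atTop (nhds 0) := by
  have hC := hB.1
  have hK := hR.pos
  have huI := fun i => mem_Icc_of_cube hu i
  rw [Metric.tendsto_nhds]
  intro ε hε
  obtain ⟨a, ha, haC⟩ : ∃ a : ℝ, 0 < a ∧ 2 / a * (3 * C + 1) ≤ ε / 4 := by
    refine ⟨8 * (3 * C + 1) / ε, by positivity, le_of_eq ?_⟩
    field_simp
    norm_num
  set q := min (u k) (1 - u k) with hq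
  have hq0 : 0 < q := lt_min (hu k).1 (by linarith [(hu k).2])
  have hlim : Tendsto (fun n : ℕ => 16 * K * a ^ 2 / q * (Real.sqrt n)⁻¹) atTop (nhds 0) := by
    simpa using tendsto_inv_sqrt.const_mul (16 * K * a ^ 2 / q)
  have hsmall : ∀ᶠ n : ℕ in atTop, a * (Real.sqrt n)⁻¹ < q / 2 := by
    have : Tendsto (fun n : ℕ => a * (Real.sqrt n)⁻¹) atTop (nhds 0) := by
      simpa using tendsto_inv_sqrt.const_mul a
    exact this.eventually (gt_mem_nhds (half_pos hq0))
  have hmem : ∀ l, ∀ᶠ n : ℕ in atTop, u l + a * (Real.sqrt n)⁻¹ ∈ Icc (0 : ℝ) 1 ∧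
      u l - a * (Real.sqrt n)⁻¹ ∈ Icc (0 : ℝ) 1 := fun l => by
    filter_upwards [eventually_add_mem (hu l) a, eventually_add_mem (hu l) (-a)] with n h1 h2
    rw [neg_mul, ← sub_eq_add_neg] at h2
    exact ⟨h1, h2⟩
  filter_upwards [hlim.eventually (gt_mem_nhds (show (0 : ℝ) < ε / 4 by linarith)), hmem j, hmem k,
    eventually_half_le ha, eventually_gt_atTop 0, hsmall] with n h1 h2 h2' h3 hn0 h4
  have hrp : 0 < Real.sqrt n := Real.sqrt_pos.2 (by exact_mod_cast hn0)
  have hr0 : 0 < (Real.sqrt n)⁻¹ := inv_pos.2 hrp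
  rw [Real.dist_eq, sub_zero, abs_of_nonneg (integral_nonneg fun _ => BB_nonneg _ _ _ _ _ _)]
  set x := a * (Real.sqrt n)⁻¹ with hx
  have hx0 : 0 < x := mul_pos ha hr0
  set A : Set (Fin 2 → ℝ) := {y | (u j - x ≤ y j ∧ y j < u j + x) ∧
        u k - x ≤ y k ∧ y k < u k + x} with hA
  have hAm : MeasurableSet A := by
    have hs : ∀ l : Fin 2, MeasurableSet {y : Fin 2 → ℝ | u l - x ≤ y l ∧ y l < u l + x} := fun l =>
      (measurableSet_le measurable_const (measurable_pi_apply l)).inter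
        (measurableSet_lt (measurable_pi_apply l) measurable_const)
    exact (hs j).inter (hs k)
  have hpt := fun ω => BB_le (U := U) h.mem hn0 j k huI hx0.le ha h3 ω
  have hi0 := integrable_cnt (P := P) h.meas n hAm
  have hij : Integrable (fun ω => 2 / a * sqs U n j (u j) (u j + x) (u j - x) ω) P :=
    (h.integrable_sqs n j (huI j) h2.1 h2.2).const_mul _
  have hik : Integrable (fun ω => 2 / a * sqs U n k (u k) (u k + x) (u k - x) ω) P :=
    (h.integrable_sqs n k (huI k) h2'.1 h2'.2).const_mul _
  have hi01 : Integrable (fun ω => cnt U n A ω + 2 / a * sqs U n j (u j) (u j + x) (u j - x) ω) P :=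
    hi0.add hij
  have h7 := setIntegral_le_integral_of_le (measurableSet_Good h.meas n (tieLen κ n))
    (hi01.add hik) (f := BB U n j k u)
    (fun ω => add_nonneg (add_nonneg (cnt_nonneg _ _ _ _)
      (mul_nonneg (by positivity) (sqs_nonneg _ _ _ _ _ _ _)))
      (mul_nonneg (by positivity) (sqs_nonneg _ _ _ _ _ _ _))) (fun ω => BB_nonneg _ _ _ _ _ _)
    (fun ω hω => (hpt ω).trans (add_le_add (add_le_add le_rfl (mul_le_mul_of_nonneg_left
      (TT_mul_le_sqs hκ0 hκ hn0 j (huI j) _ _ hω) (by positivity))) (mul_le_mul_of_nonneg_left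
      (TT_mul_le_sqs hκ0 hκ hn0 k (huI k) _ _ hω) (by positivity))))
  refine h7.trans_lt (lt_of_eq_of_lt (integral_add hi01 hik) ?_)
  rw [integral_add hi0 hij, integral_const_mul, integral_const_mul, h.integral_cnt n hAm]
  have h8 := (mul_le_mul_of_nonneg_left (h.integral_sqs_le hB hκ0 hn0 k (huI k) h2'.1 h2'.2)
    (show 0 ≤ 2 / a by positivity)).trans haC
  have h9 := (mul_le_mul_of_nonneg_left (h.integral_sqs_le hB hκ0 hn0 j (huI j) h2.1 h2.2)
    (show 0 ≤ 2 / a by positivity)).trans haC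
  have h10 := h.prob_box_le hR hjk huI hq0 (s := u k - x) (t := u k + x) (s' := u j - x)
    (t' := u j + x) (by linarith [min_le_left (u k) (1 - u k)]) (by linarith)
    (by linarith [min_le_right (u k) (1 - u k)]) h2.2.1 (by linarith) h2.1.2
  have h11 : Real.sqrt n * P.real {ω | U 0 ω ∈ A} ≤ 16 * K * a ^ 2 / q * (Real.sqrt n)⁻¹ := by
    refine (mul_le_mul_of_nonneg_left h10 hrp.le).trans_eq ?_
    rw [hx]
    field_simp
    ring
  linarith


lemma abs_normalized_sum_le (n : ℕ) {f : ℤ → ℝ} (hf : ∀ i, |f i| ≤ 1) :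
    |(Real.sqrt n)⁻¹ * ∑ i ∈ Finset.Icc (1 : ℤ) n, f i| ≤ (Real.sqrt n)⁻¹ * n := by
  rw [abs_mul, abs_of_nonneg (inv_nonneg.2 (Real.sqrt_nonneg _))]
  refine mul_le_mul_of_nonneg_left ((Finset.abs_sum_le_sum_abs _ _).trans
    ((Finset.sum_le_sum fun i _ => hf i).trans_eq ?_)) (inv_nonneg.2 (Real.sqrt_nonneg _))
  simp

lemma measurable_side (hm : ∀ i, Measurable (U i)) (n : ℕ) (k : Fin 2) (s : ℝ) (i : ℤ) :
    Measurable fun ω => lt01 (pseudoObs U n i ω k) s - lt01 (U i ω k) s :=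
  (Measurable.lt01_const (measurable_pseudoObs hm n i k) s).sub
      (Measurable.lt01_const ((measurable_pi_apply k).comp (hm i)) s)

lemma integrable_QQ (hm : ∀ i, Measurable (U i)) (n : ℕ) {φ : (Fin 2 → ℝ) → ℝ}
    (hφm : Measurable φ) (hφ : ∀ x, |φ x| ≤ 1) (k : Fin 2) (s : ℝ) :
    Integrable (QQ U n φ k s) P :=
  integrable_of_abs_le (Measurable.const_mul (Finset.measurable_fun_sum _ fun i _ =>
    (hφm.comp (hm i)).mul (measurable_side hm n k s i)) _) fun ω =>
    abs_normalized_sum_le n fun i => by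
      rw [abs_mul]
      exact mul_le_one₀ (hφ _) (abs_nonneg _) (abs_lt01_sub_le _ _ _ _)

lemma integrable_BB (hm : ∀ i, Measurable (U i)) (n : ℕ) (j k : Fin 2) (u : Fin 2 → ℝ) :
    Integrable (BB U n j k u) P :=
  integrable_of_abs_le (Measurable.const_mul (Finset.measurable_fun_sum _ fun i _ =>
    ((measurable_side hm n j _ i).mul (measurable_side hm n k _ i)).abs) _) fun ω =>
    abs_normalized_sum_le n fun i => by
      rw [abs_abs, abs_mul]
      exact mul_le_one₀ (abs_lt01_sub_le _ _ _ _) (abs_nonneg _) (abs_lt01_sub_le _ _ _ _)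

lemma UnifSeq.tendsto_integral_abs_Rem (h : UnifSeq P U) (hC : Condition21 (cop P U)) {κ : ℝ}
    (hκ0 : 0 < κ) (hκ : κ < 1 / 2) {u : Fin 2 → ℝ} (hu : u ∈ cube) :
    Tendsto (fun n : ℕ => ∫ ω in Good U n (tieLen κ n), |Rem P U n u ω| ∂P) atTop (nhds 0) := by
  obtain ⟨C, hB⟩ := h.exists_empBound hκ0 hκ
  obtain ⟨K, hR⟩ := h.exists_copReg hC
  have huI := fun i => mem_Icc_of_cube hu i
  have h01 : (0 : Fin 2) ≠ 1 := by decide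
  have hpow : Tendsto (fun n : ℕ => 2 * (n : ℝ) ^ (-κ)) atTop (nhds 0) := by
    simpa using ((tendsto_rpow_neg_atTop hκ0).comp tendsto_natCast_atTop_atTop).const_mul 2
  have hlim := (((h.tendsto_integral_abs_QQ hB hκ0 hκ hR h01.symm hu).add
    (h.tendsto_integral_abs_QQ hB hκ0 hκ hR h01 hu)).add
    (h.tendsto_integral_BB hB hκ0 hκ hR h01 hu)).add hpow
  simp only [add_zero] at hlim
  refine tendsto_of_tendsto_of_tendsto_of_le_of_le' tendsto_const_nhds hlim
    (Eventually.of_forall fun n => integral_nonneg fun _ => abs_nonneg _) ?_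
  filter_upwards [eventually_gt_atTop 0] with n hn
  set G := Good U n (tieLen κ n) with hG
  have hGm : MeasurableSet G := measurableSet_Good h.meas n _
  have i1 := (integrable_QQ (P := P) h.meas n (measurable_wt (P := P) (U := U) 1 0 u)
    (abs_wt_le hR 1 0 hu) 0 (u 0)).abs.integrableOn (s := G)
  have i2 := (integrable_QQ (P := P) h.meas n (measurable_wt (P := P) (U := U) 0 1 u)
    (abs_wt_le hR 0 1 hu) 1 (u 1)).abs.integrableOn (s := G)
  have i3 := (integrable_BB (P := P) h.meas n 0 1 u).integrableOn (s := G)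
  have hr : 0 ≤ (Real.sqrt n)⁻¹ := inv_nonneg.2 (Real.sqrt_nonneg _)
  have hpt : ∀ ω ∈ G, |Rem P U n u ω| ≤ |QQ U n (wt P U 1 0 u) 0 (u 0) ω| +
      |QQ U n (wt P U 0 1 u) 1 (u 1) ω| + BB U n 0 1 u ω + 2 * (n : ℝ) ^ (-κ) := by
    intro ω hω
    have h4 := (abs_ta_le (one_le_tieLen hκ hn) hω 0 (huI 0)).trans (tieLen_le κ hn)
    have h5 := (abs_ta_le (one_le_tieLen hκ hn) hω 1 (huI 1)).trans (tieLen_le κ hn)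
    have hD0 := hR.mem 0 u (mem_VV_of_cube hu 0)
    have hD1 := hR.mem 1 u (mem_VV_of_cube hu 1)
    have e : Rem P U n u ω = QQ U n (wt P U 1 0 u) 0 (u 0) ω + QQ U n (wt P U 0 1 u) 1 (u 1) ω +
        (Real.sqrt n)⁻¹ * ∑ i ∈ Finset.Icc (1 : ℤ) n,
          ((lt01 (pseudoObs U n i ω 0) (u 0) - lt01 (U i ω 0) (u 0)) *
            (lt01 (pseudoObs U n i ω 1) (u 1) - lt01 (U i ω 1) (u 1))) +
        Cdot (cop P U) 0 u * ta U n 0 (u 0) ω + Cdot (cop P U) 1 u * ta U n 1 (u 1) ω := by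
      rw [h.Rem_eq h01 n hu]
      unfold QQ wt
      rw [← mul_add, ← mul_add, ← Finset.sum_add_distrib, ← Finset.sum_add_distrib]
    have hb : |(Real.sqrt n)⁻¹ * ∑ i ∈ Finset.Icc (1 : ℤ) n,
          ((lt01 (pseudoObs U n i ω 0) (u 0) - lt01 (U i ω 0) (u 0)) *
            (lt01 (pseudoObs U n i ω 1) (u 1) - lt01 (U i ω 1) (u 1)))| ≤ BB U n 0 1 u ω := by
      rw [abs_mul, abs_of_nonneg hr]
      exact mul_le_mul_of_nonneg_left (Finset.abs_sum_le_sum_abs _ _) hr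
    have ht0 : |Cdot (cop P U) 0 u * ta U n 0 (u 0) ω| ≤ (n : ℝ) ^ (-κ) := by
      rw [abs_mul, abs_of_nonneg hD0.1]
      exact (mul_le_of_le_one_left (abs_nonneg _) hD0.2).trans h4
    have ht1 : |Cdot (cop P U) 1 u * ta U n 1 (u 1) ω| ≤ (n : ℝ) ^ (-κ) := by
      rw [abs_mul, abs_of_nonneg hD1.1]
      exact (mul_le_of_le_one_left (abs_nonneg _) hD1.2).trans h5
    rw [e]
    refine (abs_add_le _ _).trans ((add_le_add ((abs_add_le _ _).trans (add_le_add
      ((abs_add_le _ _).trans (add_le_add (abs_add_le _ _) hb)) ht0)) ht1).trans_eq ?_)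
    ring
  have i12 : IntegrableOn (fun ω => |QQ U n (wt P U 1 0 u) 0 (u 0) ω| +
      |QQ U n (wt P U 0 1 u) 1 (u 1) ω|) G P := i1.add i2
  have i123 : IntegrableOn (fun ω => |QQ U n (wt P U 1 0 u) 0 (u 0) ω| +
      |QQ U n (wt P U 0 1 u) 1 (u 1) ω| + BB U n 0 1 u ω) G P := i12.add i3
  have ic : IntegrableOn (fun _ : Ω => 2 * (n : ℝ) ^ (-κ)) G P := (integrable_const _).integrableOn
  have hmono := integral_mono_of_nonneg (μ := P.restrict G) (f := fun ω => |Rem P U n u ω|)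
    (ae_of_all _ fun ω => abs_nonneg _) (i123.add ic)
    ((ae_restrict_iff' hGm).2 (ae_of_all _ fun ω hω => hpt ω hω))
  refine hmono.trans (le_of_eq_of_le (integral_add i123 ic) ?_)
  rw [integral_add i12 i3, integral_add i1 i2]
  refine add_le_add le_rfl ?_
  rw [setIntegral_const, smul_eq_mul]
  exact mul_le_of_le_one_left (by positivity) measureReal_le_one

end

/-! ### The linear part of the empirical copula process -/

section

variable {P : Measure Ω} [IsProbabilityMeasure P] {U : ℤ → Ω → Fin 2 → ℝ}

/-- The scalar bounds on the pieces of the linearization at `u`. -/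
lemma UnifSeq.integral_emp_hf_sq_le_aux (h : UnifSeq P U) {κ C K : ℝ}
    (hB : EmpBound P U κ C) (hκ0 : 0 < κ) (hκ : κ < 1 / 2) (hR : UnifSeq.CopReg P U K) {j k : Fin 2}
    {n : ℕ} (hn : 0 < n) {u : Fin 2 → ℝ} (hu : u ∈ cube) {p : ℝ}
    (hpj : min (u j) (1 - u j) = p) {b : (Fin 2 → ℝ) → ℝ} (hb : Measurable b) (hb1 : ∀ x, |b x| ≤ 1)
    (hbp : ∫ ω, |b (U 0 ω)| ∂P ≤ p) {c D : ℝ} (hD : |D| ≤ 1) (hc1 : |c| ≤ 1)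
    (hcp : |c| ≤ K * p / (u k * (1 - u k)))
    (hdec : ∀ ω, emp P U n (hf P U u) ω = emp P U n b ω + D * al U n j (u j) ω +
      c * al U n k (u k) ω) :
    ∫ ω, emp P U n (hf P U u) ω ^ 2 ∂P ≤ (3 * (C + C + C * (2 * K + 1) ^ 2)) * (p ^ κ) ^ 2 := by
  have hC := hB.1
  have hK := hR.pos
  have hj := hu j
  have hk := hu k
  have hp0 : 0 < p := by rw [← hpj]; exact lt_min hj.1 (by linarith)
  set q := min (u k) (1 - u k) with hq
  have hq0 : 0 < q := lt_min hk.1 (by linarith)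
  have hui := mem_Icc_of_cube hu
  have sq_rpow : ∀ x : ℝ, 0 ≤ x → x ^ (2 * κ) = (x ^ κ) ^ 2 := fun x hx => by
    rw [mul_comm, Real.rpow_mul hx]; norm_num
  have ib := integrable_emp_sq (P := P) h.meas n hb hb1
  have ij := integrable_al_sq h n j (hui j)
  have ik := integrable_al_sq h n k (hui k)
  have e1 : ∫ ω, emp P U n b ω ^ 2 ∂P ≤ C * (p ^ κ) ^ 2 := by
    refine (hB.2 b hb hb1 n hn).trans ?_
    rw [← sq_rpow p hp0.le]
    have : 0 ≤ ∫ ω, |b (U 0 ω)| ∂P := integral_nonneg fun _ => abs_nonneg _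
    gcongr
  have e2 := h.integral_al_sq_le hB hn j (hui j)
  rw [hpj, sq_rpow p hp0.le] at e2
  have e3 := h.integral_al_sq_le hB hn k (hui k)
  rw [← hq, sq_rpow q hq0.le] at e3
  have b3 : |c| * q ^ κ ≤ (2 * K + 1) * p ^ κ := by
    refine (mul_rpow_le_of_le_one (y := 2 * K * p) (abs_nonneg _) hc1 (by positivity) hq0 ?_ hκ0
      (by linarith)).trans (rpow_const_mul_le (by positivity) hp0.le hκ0 (by linarith))
    refine hcp.trans ?_
    have hqq : q / 2 ≤ u k * (1 - u k) := by
      rcases le_total (u k) (1 - u k) with hh | hh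
      · have : q = u k := min_eq_left hh
        nlinarith
      · have : q = 1 - u k := min_eq_right hh
        nlinarith
    rw [div_le_div_iff₀ (mul_pos hk.1 (by linarith)) hq0]
    have : 0 < K * p := by positivity
    nlinarith
  have hpt : ∀ ω, emp P U n (hf P U u) ω ^ 2 ≤
      3 * emp P U n b ω ^ 2 + 3 * al U n j (u j) ω ^ 2 + 3 * c ^ 2 * al U n k (u k) ω ^ 2 := fun ω => by
    rw [hdec]
    set x := emp P U n b ω
    set y := al U n j (u j) ω
    set z := al U n k (u k) ω
    have hD2 : D ^ 2 ≤ 1 := by rw [← sq_abs]; exact pow_le_one₀ (abs_nonneg _) hD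
    nlinarith [sq_nonneg (x - D * y), sq_nonneg (x - c * z), sq_nonneg (D * y - c * z),
      mul_le_mul_of_nonneg_right hD2 (sq_nonneg y)]
  have i1 : Integrable (fun ω => 3 * emp P U n b ω ^ 2) P := ib.const_mul 3
  have i2 : Integrable (fun ω => 3 * al U n j (u j) ω ^ 2) P := ij.const_mul 3
  have i3 : Integrable (fun ω => 3 * c ^ 2 * al U n k (u k) ω ^ 2) P := ik.const_mul _
  have i12 : Integrable (fun ω => 3 * emp P U n b ω ^ 2 + 3 * al U n j (u j) ω ^ 2) P := i1.add i2
  have i123 : Integrable (fun ω => 3 * emp P U n b ω ^ 2 + 3 * al U n j (u j) ω ^ 2 +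
    3 * c ^ 2 * al U n k (u k) ω ^ 2) P := i12.add i3
  refine (integral_mono (integrable_emp_sq (P := P) h.meas n (measurable_hf u)
    (hR.abs_hf_le hu)) i123 hpt).trans ?_
  rw [integral_add i12 i3, integral_add i1 i2, integral_const_mul, integral_const_mul,
    integral_const_mul]
  have e4 : c ^ 2 * ∫ ω, al U n k (u k) ω ^ 2 ∂P ≤ C * ((2 * K + 1) * p ^ κ) ^ 2 := by
    calc _ ≤ c ^ 2 * (C * (q ^ κ) ^ 2) := mul_le_mul_of_nonneg_left e3 (sq_nonneg _)
      _ = C * (|c| * q ^ κ) ^ 2 := by rw [mul_pow, sq_abs]; ring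
      _ ≤ _ := by gcongr
  nlinarith

lemma UnifSeq.exists_integral_emp_hf_sq_le (h : UnifSeq P U) (hC : Condition21 (cop P U)) {κ : ℝ}
    (hκ0 : 0 < κ) (hκ : κ < 1 / 2) : ∃ C, 0 < C ∧ ∀ n : ℕ, 0 < n → ∀ u ∈ cube,
      ∫ ω, emp P U n (hf P U u) ω ^ 2 ∂P ≤ C * (g1 u ^ κ) ^ 2 := by
  obtain ⟨C, hB⟩ := h.exists_empBound hκ0 hκ
  obtain ⟨K, hR⟩ := h.exists_copReg hC
  have hC := hB.1
  have hK := hR.pos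
  refine ⟨3 * (C + C + C * (2 * K + 1) ^ 2), by positivity, fun n hn u huc => ?_⟩
  have hui := mem_Icc_of_cube huc
  obtain ⟨j, k, hjk, hj⟩ : ∃ j k : Fin 2, j ≠ k ∧ min (u j) (1 - u j) = g1 u := by
    have e := g1_eq (j := 0) (k := 1) (by decide) u
    rcases min_choice (min (u 0) (1 - u 0)) (min (u 1) (1 - u 1)) with hh | hh
    · exact ⟨0, 1, by decide, by rw [e, hh]⟩
    · exact ⟨1, 0, by decide, by rw [e, hh]⟩
  have hVk := mem_VV_of_cube huc k
  have hDk := hR.mem k u hVk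
  have hDj := hR.mem j u (mem_VV_of_cube huc j)
  have mj := measurable_lt01_coord j (u j)
  have mk := measurable_lt01_coord k (u k)
  have hprod : ∫ ω, lt01 (U 0 ω j) (u j) * lt01 (U 0 ω k) (u k) ∂P = cop P U u := by
    rw [← h.integral_prod_lt01]; simp only [prod_pair hjk]
  have iprod : Integrable (fun ω => lt01 (U 0 ω j) (u j) * lt01 (U 0 ω k) (u k)) P :=
    integrable_of_abs_le (M := 1) ((mj.mul mk).comp (h.meas 0)) fun ω => by
      rw [abs_mul]; exact mul_le_one₀ (abs_lt01_le _ _) (abs_nonneg _) (abs_lt01_le _ _)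
  rcases min_choice (u j) (1 - u j) with hh | hh
  · refine h.integral_emp_hf_sq_le_aux hB hκ0 hκ hR (j := j) (k := k) hn huc hj
      (b := fun x => lt01 (x j) (u j) * lt01 (x k) (u k)) (mj.mul mk) (fun x => ?_) ?_
      (D := - Cdot (cop P U) j u) (c := - Cdot (cop P U) k u) ?_ ?_ ?_ fun ω => ?_
    · rw [abs_mul]; exact mul_le_one₀ (abs_lt01_le _ _) (abs_nonneg _) (abs_lt01_le _ _)
    · rw [← hj, hh]
      refine le_trans ?_ (h.integral_lt01 j (hui j)).le
      have iab : Integrable (fun ω => |lt01 (U 0 ω j) (u j) * lt01 (U 0 ω k) (u k)|) P := iprod.abs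
      refine integral_mono iab (integrable_lt01 h j _) fun ω => ?_
      simp only [abs_mul, abs_of_nonneg (lt01_nonneg _ _)]
      exact mul_le_of_le_one_right (lt01_nonneg _ _) (lt01_le_one _ _)
    · rw [abs_neg, abs_of_nonneg hDj.1]; exact hDj.2
    · rw [abs_neg, abs_of_nonneg hDk.1]; exact hDk.2
    · rw [abs_neg, abs_of_nonneg hDk.1, ← hj, hh]; exact hR.le hjk u hVk
    · unfold emp al
      rw [h.integral_hf huc, hprod]
      unfold hf
      simp only [prod_pair hjk, sum_pair hjk]
      rw [mul_left_comm _ (Real.sqrt n)⁻¹, mul_left_comm _ (Real.sqrt n)⁻¹, ← mul_add, ← mul_add]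
      congr 1
      rw [Finset.mul_sum, Finset.mul_sum, ← Finset.sum_add_distrib, ← Finset.sum_add_distrib]
      exact Finset.sum_congr rfl fun i _ => by ring
  · have hbb : ∀ x : Fin 2 → ℝ, |lt01 (x j) (u j) * lt01 (x k) (u k) - lt01 (x k) (u k)| ≤
        1 - lt01 (x j) (u j) := fun x => by
      have e : lt01 (x j) (u j) * lt01 (x k) (u k) - lt01 (x k) (u k) =
        - ((1 - lt01 (x j) (u j)) * lt01 (x k) (u k)) := by ring
      have h1 := lt01_le_one (x j) (u j)
      rw [e, abs_neg, abs_mul, abs_of_nonneg (sub_nonneg.2 h1), abs_of_nonneg (lt01_nonneg _ _)]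
      exact mul_le_of_le_one_right (sub_nonneg.2 h1) (lt01_le_one _ _)
    have mb : Measurable fun x : Fin 2 → ℝ =>
      lt01 (x j) (u j) * lt01 (x k) (u k) - lt01 (x k) (u k) := (mj.mul mk).sub mk
    have hb1 : ∀ x : Fin 2 → ℝ, |lt01 (x j) (u j) * lt01 (x k) (u k) - lt01 (x k) (u k)| ≤ 1 :=
      fun x => (hbb x).trans (by linarith [lt01_nonneg (x j) (u j)])
    refine h.integral_emp_hf_sq_le_aux hB hκ0 hκ hR (j := j) (k := k) hn huc hj
      (b := fun x => lt01 (x j) (u j) * lt01 (x k) (u k) - lt01 (x k) (u k)) mb hb1 ?_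
      (D := - Cdot (cop P U) j u) (c := 1 - Cdot (cop P U) k u) ?_ ?_ ?_ fun ω => ?_
    · have ib : Integrable (fun ω =>
          |lt01 (U 0 ω j) (u j) * lt01 (U 0 ω k) (u k) - lt01 (U 0 ω k) (u k)|) P :=
        (iprod.sub (integrable_lt01 h k _)).abs
      have i1 : Integrable (fun ω => 1 - lt01 (U 0 ω j) (u j)) P :=
        (integrable_const 1).sub (integrable_lt01 h j _)
      refine (integral_mono ib i1 fun ω => hbb (U 0 ω)).trans_eq ?_
      rw [integral_sub (integrable_const _) (integrable_lt01 h j (u j)), h.integral_lt01 j (hui j)]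
      simp [← hj, hh]
    · rw [abs_neg, abs_of_nonneg hDj.1]; exact hDj.2
    · rw [abs_of_nonneg (sub_nonneg.2 hDk.2)]; linarith [hDk.1]
    · rw [abs_of_nonneg (sub_nonneg.2 hDk.2), ← hj, hh]; exact hR.one_sub_le hjk u hVk
    · unfold emp al
      rw [h.integral_hf huc, integral_sub iprod (integrable_lt01 h k _), hprod,
        h.integral_lt01 k (hui k)]
      unfold hf
      simp only [prod_pair hjk, sum_pair hjk]
      rw [mul_left_comm _ (Real.sqrt n)⁻¹, mul_left_comm _ (Real.sqrt n)⁻¹, ← mul_add, ← mul_add]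
      congr 1
      rw [Finset.mul_sum, Finset.mul_sum, ← Finset.sum_add_distrib, ← Finset.sum_add_distrib]
      exact Finset.sum_congr rfl fun i _ => by ring

lemma emp_sum {U : ℤ → Ω → E} (hm : ∀ i, Measurable (U i)) (n : ℕ) {ι : Type*} (s : Finset ι)
    (c : ι → ℝ) {φ : ι → E → ℝ} {M : ℝ} (hφ : ∀ a, Measurable (φ a)) (hφ1 : ∀ a x, |φ a x| ≤ M)
    (ω : Ω) : emp P U n (fun x => ∑ a ∈ s, c a * φ a x) ω = ∑ a ∈ s, c a * emp P U n (φ a) ω := by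
  unfold emp
  have hi : ∀ a, Integrable (fun ω => c a * φ a (U 0 ω)) P := fun a =>
    (integrable_of_abs_le ((hφ a).comp (hm 0)) fun ω => hφ1 a (U 0 ω)).const_mul _
  rw [integral_finsetSum (f := fun a ω => c a * φ a (U 0 ω)) _ fun a _ => hi a]
  simp only [integral_const_mul, ← Finset.sum_sub_distrib, ← mul_sub]
  rw [Finset.sum_comm, Finset.mul_sum]
  refine Finset.sum_congr rfl fun a _ => ?_
  rw [← Finset.mul_sum]; ring

lemma emp_congr {U : ℤ → Ω → E} (n : ℕ) {φ ψ : E → ℝ}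
    (hφψ : ∀ i, ∀ᵐ ω ∂P, φ (U i ω) = ψ (U i ω)) : ∀ᵐ ω ∂P, emp P U n φ ω = emp P U n ψ ω := by
  filter_upwards [ae_all_iff.2 hφψ] with ω hω
  unfold emp
  rw [integral_congr_ae (hφψ 0)]
  simp only [hω]

lemma measurableSet_orthant (v : Fin d → ℝ) : MeasurableSet {x : Fin d → ℝ | ∀ j, x j ≤ v j} := by
  rw [ofPred_forall]
  exact MeasurableSet.iInter fun j => measurableSet_le (measurable_pi_apply j) measurable_const

lemma UnifSeq.tendsto_integral_emp_mul (h : UnifSeq P U) (u v : Fin 2 → ℝ) :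
    Tendsto (fun n : ℕ => ∫ ω, emp P U n (indic {x | ∀ j, x j ≤ u j}) ω *
      emp P U n (indic {x | ∀ j, x j ≤ v j}) ω ∂P) atTop (nhds (kcov P U u v)) := by
  have ht := tendsto_cov_partial_sums h.meas h.stat h.mix
    (measurable_indic (measurableSet_orthant u)) (measurable_indic (measurableSet_orthant v))
    (abs_indic_le _) (abs_indic_le _)
  have hc : ∀ u : Fin 2 → ℝ, ∫ ω, indic {x | ∀ j, x j ≤ u j} (U 0 ω) ∂P = cop P U u := fun u => by
    rw [h.integral_indic (measurableSet_orthant u) 0, h.cop_eq]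
    rfl
  have hk : kcov P U u v = ∑' k : ℤ, (∫ ω, indic {x | ∀ j, x j ≤ u j} (U 0 ω) *
      indic {x | ∀ j, x j ≤ v j} (U k ω) ∂P - (∫ ω, indic {x | ∀ j, x j ≤ u j} (U 0 ω) ∂P) *
        ∫ ω, indic {x | ∀ j, x j ≤ v j} (U 0 ω) ∂P) := by
    rw [hc, hc]
    unfold kcov
    rw [h.Uv_eq]
    rfl
  rw [hk]
  refine ht.congr fun n => ?_
  rw [← integral_const_mul]
  refine integral_congr_ae (ae_of_all _ fun ω => ?_)
  simp only [emp]
  have : ((n : ℝ))⁻¹ = (Real.sqrt n)⁻¹ * (Real.sqrt n)⁻¹ := by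
    rw [← mul_inv, Real.mul_self_sqrt (Nat.cast_nonneg n)]
  rw [this]; ring

/-- The orthant vertices used in the decomposition of `hf`. -/
def vtx (u : Fin 2 → ℝ) : Fin 3 → Fin 2 → ℝ := ![u, onePt 0 u, onePt 1 u]

/-- The coefficients used in the decomposition of `hf`. -/
def vcf (P : Measure Ω) (U : ℤ → Ω → Fin 2 → ℝ) (u : Fin 2 → ℝ) : Fin 3 → ℝ :=
  ![1, - Cdot (cop P U) 0 u, - Cdot (cop P U) 1 u]

lemma UnifSeq.ae_hf_eq (h : UnifSeq P U) (u : Fin 2 → ℝ) (i : ℤ) :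
    ∀ᵐ ω ∂P, hf P U u (U i ω) =
      ∑ a, vcf P U u a * indic {x | ∀ j, x j ≤ vtx u a j} (U i ω) := by
  filter_upwards [h.ae_ne i 0 (u 0), h.ae_ne i 1 (u 1)] with ω h0 h1
  have m0 := (h.mem i ω 0).2
  have m1 := (h.mem i ω 1).2
  have hl : ∀ x s : ℝ, x ≠ s → lt01 x s = if x ≤ s then 1 else 0 := fun x s hx => by
    unfold lt01
    have : x < s ↔ x ≤ s := ⟨le_of_lt, fun hh => lt_of_le_of_ne hh hx⟩
    simp [this]
  unfold hf
  simp only [Fin.prod_univ_two, Fin.sum_univ_two, Fin.sum_univ_three, vcf, vtx, onePt, indic,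
    indicator, mem_ofPred_eq, Fin.forall_fin_two, hl _ _ h0, hl _ _ h1]
  by_cases c0 : U i ω 0 ≤ u 0 <;> by_cases c1 : U i ω 1 ≤ u 1 <;> simp [c0, c1, m0, m1] <;> ring

lemma UnifSeq.tendsto_integral_emp_hf_mul (h : UnifSeq P U) (u v : Fin 2 → ℝ) :
    Tendsto (fun n : ℕ => ∫ ω, emp P U n (hf P U u) ω * emp P U n (hf P U v) ω ∂P) atTop
      (nhds (GammaCov P U u v)) := by
  have hG : GammaCov P U u v =
      ∑ a, ∑ b, vcf P U u a * vcf P U v b * kcov P U (vtx u a) (vtx v b) := by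
    simp only [GammaCov, Fin.sum_univ_three, Fin.sum_univ_two, vcf, vtx, Matrix.cons_val_zero,
      Matrix.cons_val_one, Matrix.cons_val_two, Matrix.head_cons, Matrix.tail_cons,
      Matrix.cons_val]
    ring
  rw [hG]
  refine Tendsto.congr (fun n => ?_) (tendsto_finsetSum _ fun a _ => tendsto_finsetSum _ fun b _ =>
    (h.tendsto_integral_emp_mul (vtx u a) (vtx v b)).const_mul (vcf P U u a * vcf P U v b))
  have mi := fun w : Fin 2 → ℝ => measurable_indic (measurableSet_orthant w)
  have key : ∀ w, ∀ᵐ ω ∂P, emp P U n (hf P U w) ω =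
      ∑ a, vcf P U w a * emp P U n (indic {x | ∀ j, x j ≤ vtx w a j}) ω := fun w => by
    filter_upwards [emp_congr (φ := hf P U w)
      (ψ := fun x => ∑ a, vcf P U w a * indic {x | ∀ j, x j ≤ vtx w a j} x) n (h.ae_hf_eq w)]
      with ω hω
    rw [hω, emp_sum h.meas n _ _ (fun a => mi (vtx w a)) (fun a => abs_indic_le _)]
  have hint : ∀ a b, Integrable (fun ω => vcf P U u a * vcf P U v b *
      (emp P U n (indic {x | ∀ j, x j ≤ vtx u a j}) ω *
        emp P U n (indic {x | ∀ j, x j ≤ vtx v b j}) ω)) P := fun a b => by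
    refine Integrable.const_mul (integrable_of_abs_le
      ((measurable_emp h.meas n (mi _)).mul (measurable_emp h.meas n (mi _)))
      (M := ((Real.sqrt n)⁻¹ * (n * (2 * 1))) * ((Real.sqrt n)⁻¹ * (n * (2 * 1)))) fun ω => ?_) _
    simp only [Pi.mul_apply]
    rw [abs_mul]
    exact mul_le_mul (abs_emp_le U n (abs_indic_le _) ω) (abs_emp_le U n (abs_indic_le _) ω)
      (abs_nonneg _) (by positivity)
  rw [integral_congr_ae (g := fun ω => ∑ a, ∑ b, vcf P U u a * vcf P U v b *
      (emp P U n (indic {x | ∀ j, x j ≤ vtx u a j}) ω *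
        emp P U n (indic {x | ∀ j, x j ≤ vtx v b j}) ω))]
  · rw [integral_finsetSum (f := fun a ω => ∑ b, vcf P U u a * vcf P U v b *
      (emp P U n (indic {x | ∀ j, x j ≤ vtx u a j}) ω *
        emp P U n (indic {x | ∀ j, x j ≤ vtx v b j}) ω)) _
      fun a _ => integrable_finsetSum _ fun b _ => hint a b]
    refine Finset.sum_congr rfl fun a _ => ?_
    rw [integral_finsetSum (f := fun b ω => vcf P U u a * vcf P U v b *
      (emp P U n (indic {x | ∀ j, x j ≤ vtx u a j}) ω *
        emp P U n (indic {x | ∀ j, x j ≤ vtx v b j}) ω)) _ fun b _ => hint a b]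
    exact Finset.sum_congr rfl fun b _ => (integral_const_mul _ _).symm
  · filter_upwards [key u, key v] with ω h1 h2
    rw [h1, h2, Finset.sum_mul_sum]
    exact Finset.sum_congr rfl fun a _ => Finset.sum_congr rfl fun b _ => by ring

end

/-! ### Measurability in the parameter -/

section

variable {P : Measure Ω} [IsProbabilityMeasure P] {U : ℤ → Ω → Fin 2 → ℝ}

lemma measurableSet_cube : MeasurableSet cube := by
  unfold cube
  rw [ofPred_forall]
  exact MeasurableSet.iInter fun j => (measurableSet_lt measurable_const (measurable_pi_apply j)).inter
    (measurableSet_lt (measurable_pi_apply j) measurable_const)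

lemma measurable_g1 : Measurable (g1 : (Fin 2 → ℝ) → ℝ) := by
  have : (g1 : (Fin 2 → ℝ) → ℝ) = fun u => min (min (u 0) (1 - u 0)) (min (u 1) (1 - u 1)) := by
    ext u; exact g1_eq (by decide) u
  rw [this]
  fun_prop

lemma g1_le_half (u : Fin 2 → ℝ) : g1 u ≤ 1 / 2 := by
  have h0 := (g1_le u 0).trans (min_le_left _ _)
  have h1 := (g1_le u 0).trans (min_le_right _ _)
  linarith

/-- `hf` cut off outside the open unit square. -/
def hfc (P : Measure Ω) (U : ℤ → Ω → Fin 2 → ℝ) (u x : Fin 2 → ℝ) : ℝ :=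
  cube.indicator (fun u => hf P U u x) u

lemma hfc_of_mem {u : Fin 2 → ℝ} (hu : u ∈ cube) : hfc P U u = hf P U u := by
  ext x; simp [hfc, hu]

lemma hfc_of_notMem {u : Fin 2 → ℝ} (hu : u ∉ cube) : hfc P U u = fun _ => 0 := by
  ext x; simp [hfc, hu]

lemma UnifSeq.CopReg.abs_hfc_le {K : ℝ} (hR : UnifSeq.CopReg P U K) (u x : Fin 2 → ℝ) :
    |hfc P U u x| ≤ 2 := by
  by_cases hu : u ∈ cube
  · rw [hfc_of_mem hu]; exact hR.abs_hf_le hu x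
  · rw [hfc_of_notMem hu]; simp

lemma UnifSeq.CopReg.measurable_hfc {K : ℝ} (hR : UnifSeq.CopReg P U K) :
    Measurable fun q : (Fin 2 → ℝ) × (Fin 2 → ℝ) => hfc P U q.1 q.2 := by
  have hD : ∀ j, Measurable (cube.indicator (Cdot (cop P U) j)) := fun j => by
    classical
    rw [← piecewise_eq_indicator]
    exact ContinuousOn.measurable_piecewise
      ((hR.cont j).mono fun u hu => mem_VV_of_cube hu j) continuousOn_const measurableSet_cube
  have hl : ∀ j, Measurable fun q : (Fin 2 → ℝ) × (Fin 2 → ℝ) => lt01 (q.2 j) (q.1 j) := fun j => by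
    exact Measurable.ite (measurableSet_lt ((measurable_pi_apply j).comp measurable_snd)
      ((measurable_pi_apply j).comp measurable_fst)) measurable_const measurable_const
  have e : (fun q : (Fin 2 → ℝ) × (Fin 2 → ℝ) => hfc P U q.1 q.2) = fun q =>
      cube.indicator 1 q.1 * (lt01 (q.2 0) (q.1 0) * lt01 (q.2 1) (q.1 1)) -
      (cube.indicator (Cdot (cop P U) 0) q.1 * lt01 (q.2 0) (q.1 0) +
        cube.indicator (Cdot (cop P U) 1) q.1 * lt01 (q.2 1) (q.1 1)) := by
    ext q
    by_cases hq : q.1 ∈ cube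
    · simp [hfc, hf, hq, Fin.prod_univ_two]
    · simp [hfc, hq]
  rw [e]
  have h1 : Measurable (cube.indicator (1 : (Fin 2 → ℝ) → ℝ)) :=
    measurable_one.indicator measurableSet_cube
  exact ((h1.comp measurable_fst).mul ((hl 0).mul (hl 1))).sub
    ((((hD 0).comp measurable_fst).mul (hl 0)).add (((hD 1).comp measurable_fst).mul (hl 1)))

lemma UnifSeq.CopReg.measurable_hfc_right {K : ℝ} (hR : UnifSeq.CopReg P U K) (u : Fin 2 → ℝ) :
    Measurable (hfc P U u) :=
  hR.measurable_hfc.comp (measurable_const.prodMk measurable_id)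

lemma measurable_emp_hfc {K : ℝ} (hR : UnifSeq.CopReg P U K) (hm : ∀ i, Measurable (U i)) (n : ℕ) :
    Measurable fun q : (Fin 2 → ℝ) × Ω => emp P U n (hfc P U q.1) q.2 := by
  unfold emp
  have h0 : ∀ i, Measurable fun q : (Fin 2 → ℝ) × Ω => hfc P U q.1 (U i q.2) := fun i =>
    hR.measurable_hfc.comp (measurable_fst.prodMk ((hm i).comp measurable_snd))
  have h1 : Measurable fun u : Fin 2 → ℝ => ∫ ω, hfc P U u (U 0 ω) ∂P :=
    ((h0 0).stronglyMeasurable.integral_prod_right (ν := P)).measurable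
  exact (Finset.measurable_fun_sum _ fun i _ => (h0 i).sub (h1.comp measurable_fst)).const_mul _

lemma emp_zero {U : ℤ → Ω → E} (n : ℕ) (ω : Ω) : emp P U n (fun _ => 0) ω = 0 := by
  simp [emp]

lemma UnifSeq.exists_integral_emp_hfc_sq_le (h : UnifSeq P U) (hC : Condition21 (cop P U)) {κ : ℝ}
    (hκ0 : 0 < κ) (hκ : κ < 1 / 2) : ∃ C, 0 < C ∧ ∀ n : ℕ, 0 < n → ∀ u,
      ∫ ω, emp P U n (hfc P U u) ω ^ 2 ∂P ≤ C * (g1 u ^ κ) ^ 2 := by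
  obtain ⟨C, hC0, hb⟩ := h.exists_integral_emp_hf_sq_le hC hκ0 hκ
  refine ⟨C, hC0, fun n hn u => ?_⟩
  by_cases hu : u ∈ cube
  · rw [hfc_of_mem hu]; exact hb n hn u hu
  · simp only [hfc_of_notMem hu, emp_zero]
    simp only [ne_eq, OfNat.ofNat_ne_zero, not_false_eq_true, zero_pow, integral_zero]
    positivity

/-- The limiting covariance kernel cut off outside the open unit square. -/
def Gamc (P : Measure Ω) (U : ℤ → Ω → Fin 2 → ℝ) (u v : Fin 2 → ℝ) : ℝ :=
  (cube ×ˢ cube).indicator (fun q => GammaCov P U q.1 q.2) (u, v)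

lemma Gamc_of_mem {u v : Fin 2 → ℝ} (hu : u ∈ cube) (hv : v ∈ cube) :
    Gamc P U u v = GammaCov P U u v := by simp [Gamc, hu, hv]

lemma UnifSeq.tendsto_integral_emp_hfc_mul (h : UnifSeq P U) (u v : Fin 2 → ℝ) :
    Tendsto (fun n : ℕ => ∫ ω, emp P U n (hfc P U u) ω * emp P U n (hfc P U v) ω ∂P) atTop
      (nhds (Gamc P U u v)) := by
  by_cases hu : u ∈ cube
  · by_cases hv : v ∈ cube
    · rw [hfc_of_mem hu, hfc_of_mem hv, Gamc_of_mem hu hv]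
      exact h.tendsto_integral_emp_hf_mul u v
    · simp [hfc_of_notMem hv, emp_zero, Gamc, hv]
  · simp [hfc_of_notMem hu, emp_zero, Gamc, hu]

lemma UnifSeq.CopReg.abs_integral_emp_hfc_mul_le {K : ℝ} (hR : UnifSeq.CopReg P U K)
    (hm : ∀ i, Measurable (U i)) {C κ : ℝ} {n : ℕ}
    (hC : 0 < C) (hb : ∀ u, ∫ ω, emp P U n (hfc P U u) ω ^ 2 ∂P ≤ C * (g1 u ^ κ) ^ 2)
    (u v : Fin 2 → ℝ) : |∫ ω, emp P U n (hfc P U u) ω * emp P U n (hfc P U v) ω ∂P| ≤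
      C * (cube.indicator (fun u => g1 u ^ κ) u * cube.indicator (fun u => g1 u ^ κ) v) := by
  by_cases hu : u ∈ cube
  swap
  · simp [hfc_of_notMem hu, emp_zero, hu]
  by_cases hv : v ∈ cube
  swap
  · simp [hfc_of_notMem hv, emp_zero, hv]
  simp only [hu, hv, indicator_of_mem]
  set a := g1 u ^ κ with ha
  set b := g1 v ^ κ with hb'
  have ha0 : 0 < a := Real.rpow_pos_of_pos (g1_pos hu) _
  have hb0 : 0 < b := Real.rpow_pos_of_pos (g1_pos hv) _
  have iu := integrable_emp_sq (P := P) hm n (hR.measurable_hfc_right u) (hR.abs_hfc_le u)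
  have iv := integrable_emp_sq (P := P) hm n (hR.measurable_hfc_right v) (hR.abs_hfc_le v)
  have i1 : Integrable (fun ω => (b / (2 * a)) * emp P U n (hfc P U u) ω ^ 2) P := iu.const_mul _
  have i2 : Integrable (fun ω => (a / (2 * b)) * emp P U n (hfc P U v) ω ^ 2) P := iv.const_mul _
  have hpt : ∀ ω, |emp P U n (hfc P U u) ω * emp P U n (hfc P U v) ω| ≤
      (b / (2 * a)) * emp P U n (hfc P U u) ω ^ 2 + (a / (2 * b)) * emp P U n (hfc P U v) ω ^ 2 := by
    intro ω
    set x := emp P U n (hfc P U u) ω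
    set y := emp P U n (hfc P U v) ω
    rw [abs_mul, ← sq_abs x, ← sq_abs y]
    have e : (b / (2 * a)) * |x| ^ 2 + (a / (2 * b)) * |y| ^ 2 - |x| * |y| =
        (b * |x| - a * |y|) ^ 2 / (2 * a * b) := by field_simp; ring
    have : 0 ≤ (b * |x| - a * |y|) ^ 2 / (2 * a * b) := by positivity
    linarith
  refine (abs_integral_le_integral_abs).trans ((integral_mono_of_nonneg
    (ae_of_all _ fun ω => abs_nonneg _) (i1.add i2) (ae_of_all _ hpt)).trans ?_)
  refine (integral_add i1 i2).le.trans ?_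
  rw [integral_const_mul, integral_const_mul]
  calc _ ≤ b / (2 * a) * (C * a ^ 2) + a / (2 * b) * (C * b ^ 2) := by
        have := hb u
        have := hb v
        gcongr
    _ = C * (a * b) := by field_simp; ring

lemma UnifSeq.abs_Gamc_le (h : UnifSeq P U) {K : ℝ} (hR : UnifSeq.CopReg P U K) {C κ : ℝ}
    (hC : 0 < C) (hb : ∀ n : ℕ, 0 < n → ∀ u,
      ∫ ω, emp P U n (hfc P U u) ω ^ 2 ∂P ≤ C * (g1 u ^ κ) ^ 2)
    (u v : Fin 2 → ℝ) : |Gamc P U u v| ≤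
      C * (cube.indicator (fun u => g1 u ^ κ) u * cube.indicator (fun u => g1 u ^ κ) v) :=
  le_of_tendsto (h.tendsto_integral_emp_hfc_mul u v).abs <| by
    filter_upwards [eventually_gt_atTop 0] with n hn
    exact hR.abs_integral_emp_hfc_mul_le h.meas hC (hb n hn) u v

lemma measurable_integral_mul {F : E × Ω → ℝ} (hF : Measurable F) :
    Measurable fun q : E × E => ∫ ω, F (q.1, ω) * F (q.2, ω) ∂P := by
  have ha : Measurable fun q : (E × E) × Ω => F (q.1.1, q.2) :=
    hF.comp ((measurable_fst.comp measurable_fst).prodMk measurable_snd)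
  have hb : Measurable fun q : (E × E) × Ω => F (q.1.2, q.2) :=
    hF.comp ((measurable_snd.comp measurable_fst).prodMk measurable_snd)
  exact ((ha.mul hb).stronglyMeasurable.integral_prod_right (ν := P)).measurable

lemma UnifSeq.CopReg.measurable_integral_emp_hfc_mul {K : ℝ} (hR : UnifSeq.CopReg P U K)
    (hm : ∀ i, Measurable (U i)) (n : ℕ) : Measurable fun q : (Fin 2 → ℝ) × (Fin 2 → ℝ) =>
      ∫ ω, emp P U n (hfc P U q.1) ω * emp P U n (hfc P U q.2) ω ∂P :=
  measurable_integral_mul (F := fun q : (Fin 2 → ℝ) × Ω => emp P U n (hfc P U q.1) q.2)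
    (measurable_emp_hfc hR hm n)

lemma UnifSeq.measurable_Gamc (h : UnifSeq P U) {K : ℝ} (hR : UnifSeq.CopReg P U K) :
    Measurable fun q : (Fin 2 → ℝ) × (Fin 2 → ℝ) => Gamc P U q.1 q.2 :=
  measurable_of_tendsto_metrizable (hR.measurable_integral_emp_hfc_mul h.meas)
    (tendsto_pi_nhds.2 fun q => h.tendsto_integral_emp_hfc_mul q.1 q.2)

end

/-! ### Central limit theorem for integrals of empirical processes -/

section

variable {T : Type*} [MeasurableSpace T]
variable {P : Measure Ω} [IsProbabilityMeasure P] {X : ℤ → Ω → E}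

lemma emp_integral (hm : ∀ i, Measurable (X i)) (n : ℕ) {ν : Measure T} [IsFiniteMeasure ν]
    {H : T → E → ℝ} (hH : Measurable fun q : T × E => H q.1 q.2) {M : ℝ} (hM : ∀ u x, |H u x| ≤ M)
    (ω : Ω) : emp P X n (fun x => ∫ u, H u x ∂ν) ω = ∫ u, emp P X n (H u) ω ∂ν := by
  have hx : ∀ x, Measurable fun u => H u x := fun x => hH.comp (measurable_id.prodMk measurable_const)
  have hi : ∀ x, Integrable (fun u => H u x) ν := fun x =>
    integrable_of_abs_le (hx x) fun u => hM u x
  have hj : Measurable fun q : T × Ω => H q.1 (X 0 q.2) :=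
    hH.comp (measurable_fst.prodMk ((hm 0).comp measurable_snd))
  have hk : Measurable fun u => ∫ ω, H u (X 0 ω) ∂P :=
    (hj.stronglyMeasurable.integral_prod_right (ν := P)).measurable
  have hki : Integrable (fun u => ∫ ω, H u (X 0 ω) ∂P) ν :=
    integrable_of_abs_le hk fun u => abs_integral_le_one fun ω => hM u (X 0 ω)
  have hsw : ∫ ω, ∫ u, H u (X 0 ω) ∂ν ∂P = ∫ u, ∫ ω, H u (X 0 ω) ∂P ∂ν :=
    (integral_integral_swap (f := fun u ω => H u (X 0 ω))
      (integrable_of_abs_le hj fun q => hM _ _)).symm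
  unfold emp
  rw [hsw, integral_const_mul]
  congr 1
  have hs : ∀ i : ℤ, Integrable (fun u => H u (X i ω) - ∫ ω', H u (X 0 ω') ∂P) ν := fun i =>
    (hi (X i ω)).sub hki
  rw [integral_finsetSum (f := fun i u => H u (X i ω) - ∫ ω', H u (X 0 ω') ∂P) _ fun i _ => hs i]
  exact Finset.sum_congr rfl fun i _ => (integral_sub (hi (X i ω)) hki).symm

lemma measurable_emp_param (hm : ∀ i, Measurable (X i)) (n : ℕ)
    {H : T → E → ℝ} (hH : Measurable fun q : T × E => H q.1 q.2) :
    Measurable fun q : T × Ω => emp P X n (H q.1) q.2 := by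
  unfold emp
  have h0 : ∀ i, Measurable fun q : T × Ω => H q.1 (X i q.2) := fun i =>
    hH.comp (measurable_fst.prodMk ((hm i).comp measurable_snd))
  have h1 : Measurable fun u : T => ∫ ω, H u (X 0 ω) ∂P :=
    ((h0 0).stronglyMeasurable.integral_prod_right (ν := P)).measurable
  exact (Finset.measurable_fun_sum _ fun i _ => (h0 i).sub (h1.comp measurable_fst)).const_mul _

lemma integral_emp_integral_sq (hm : ∀ i, Measurable (X i)) (n : ℕ) {ν : Measure T}
    [IsFiniteMeasure ν] {H : T → E → ℝ} (hH : Measurable fun q : T × E => H q.1 q.2) {M : ℝ}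
    (hM : ∀ u x, |H u x| ≤ M) :
    ∫ ω, emp P X n (fun x => ∫ u, H u x ∂ν) ω ^ 2 ∂P =
      ∫ q, ∫ ω, emp P X n (H q.1) ω * emp P X n (H q.2) ω ∂P ∂(ν.prod ν) := by
  have hF := measurable_emp_param (P := P) hm n hH
  set F : T × Ω → ℝ := fun q => emp P X n (H q.1) q.2 with hFd
  have hFb : ∀ q, |F q| ≤ (Real.sqrt n)⁻¹ * (n * (2 * M)) := fun q => abs_emp_le X n (hM q.1) q.2
  have ha : Measurable fun q : (T × T) × Ω => F (q.1.1, q.2) :=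
    hF.comp ((measurable_fst.comp measurable_fst).prodMk measurable_snd)
  have hb : Measurable fun q : (T × T) × Ω => F (q.1.2, q.2) :=
    hF.comp ((measurable_snd.comp measurable_fst).prodMk measurable_snd)
  have hi : Integrable (fun q : (T × T) × Ω => F (q.1.1, q.2) * F (q.1.2, q.2))
      ((ν.prod ν).prod P) := integrable_of_abs_le (ha.mul hb)
        (M := ((Real.sqrt n)⁻¹ * (n * (2 * M))) * ((Real.sqrt n)⁻¹ * (n * (2 * M)))) fun q => by
    rw [abs_mul]
    exact mul_le_mul (hFb _) (hFb _) (abs_nonneg _) ((abs_nonneg _).trans (hFb (q.1.1, q.2)))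
  have hsw := integral_integral_swap (f := fun (q : T × T) ω => F (q.1, ω) * F (q.2, ω)) hi
  refine Eq.trans ?_ hsw.symm
  refine integral_congr_ae (ae_of_all _ fun ω => ?_)
  simp only
  rw [emp_integral hm n hH hM, sq]
  exact (integral_prod_mul (fun u => F (u, ω)) (fun u => F (u, ω))).symm

/-- Data for the central limit theorem of an integrated empirical process. -/
structure IntEmp (P : Measure Ω) (X : ℤ → Ω → E) (ν : Measure T) (H : T → E → ℝ)
    (Gam : T × T → ℝ) (B : T → ℝ) (M : ℝ) : Prop where
  meas : Measurable fun q : T × E => H q.1 q.2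
  bdd : ∀ u x, |H u x| ≤ M
  measGam : Measurable Gam
  lim : ∀ u v, Tendsto (fun n : ℕ => ∫ ω, emp P X n (H u) ω * emp P X n (H v) ω ∂P) atTop
    (nhds (Gam (u, v)))
  le : ∀ n : ℕ, 0 < n → ∀ u v, |∫ ω, emp P X n (H u) ω * emp P X n (H v) ω ∂P| ≤ B u * B v
  abs_le : ∀ n : ℕ, 0 < n → ∀ u, ∫ ω, |emp P X n (H u) ω| ∂P ≤ B u
  int : Integrable B ν

section intemp
variable {ν : Measure T} [SFinite ν] {H : T → E → ℝ} {Gam : T × T → ℝ} {B : T → ℝ} {M : ℝ}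

lemma IntEmp.integrable_Gam (h : IntEmp P X ν H Gam B M) : Integrable Gam (ν.prod ν) := by
  refine (h.int.mul_prod h.int).mono' h.measGam.aestronglyMeasurable (ae_of_all _ fun q => ?_)
  refine le_of_tendsto (h.lim q.1 q.2).abs ?_
  filter_upwards [eventually_gt_atTop 0] with n hn using h.le n hn q.1 q.2

lemma IntEmp.tendsto_charFun_restrict (h : IntEmp P X ν H Gam B M) (hm : ∀ i, Measurable (X i))
    (hstat : StrictlyStationary P X) (hmix : ExpAlphaMixing P X) {K : Set T} (hK : ν K ≠ ⊤) (t : ℝ) :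
    Tendsto (fun n : ℕ => ∫ ω, Complex.exp (Complex.I *
      ((t * emp P X n (fun x => ∫ u in K, H u x ∂ν) ω : ℝ) : ℂ)) ∂P) atTop
      (nhds ((Real.exp (-(t ^ 2 * (∫ q in K ×ˢ K, Gam q ∂(ν.prod ν)) / 2)) : ℝ) : ℂ)) := by
  have : IsFiniteMeasure (ν.restrict K) := ⟨by simpa using hK.lt_top⟩
  set Φ : E → ℝ := fun x => ∫ u in K, H u x ∂ν with hΦ
  have hΦm : Measurable Φ :=
    (h.meas.stronglyMeasurable.integral_prod_left (μ := ν.restrict K)).measurable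
  have hΦb : ∀ x, |Φ x| ≤ M * (ν.restrict K).real univ := fun x => by
    have := norm_integral_le_of_norm_le_const (μ := ν.restrict K) (f := fun u => H u x)
      (ae_of_all _ fun u => h.bdd u x)
    simpa using this
  set m := ∫ ω, Φ (X 0 ω) ∂P with hmdef
  have hΦi : Integrable (fun ω => Φ (X 0 ω)) P :=
    integrable_of_abs_le (hΦm.comp (hm 0)) fun ω => hΦb _
  have hb' : ∀ x, |Φ x - m| ≤ 2 * (|M| * (ν.restrict K).real univ) + 1 := fun x => by
    have h1 := hΦb x
    have h2 : |m| ≤ M * (ν.restrict K).real univ := abs_integral_le_one fun ω => hΦb _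
    have h3 := mul_le_mul_of_nonneg_right (le_abs_self M)
      (measureReal_nonneg (μ := ν.restrict K) (s := univ))
    have h4 := abs_sub (Φ x) m
    linarith
  have hcl := tendsto_charFun_of_bounded hm hstat hmix (φ := fun x => Φ x - m)
    (hΦm.sub_const _) (M := 2 * (|M| * (ν.restrict K).real univ) + 1) (by positivity) hb'
    (by rw [integral_sub hΦi (integrable_const _)]; simp [hmdef])
    (σ2 := ∫ q in K ×ˢ K, Gam q ∂(ν.prod ν)) ?_ t
  · refine hcl.congr fun n => integral_congr_ae (ae_of_all _ fun ω => ?_)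
    simp only [emp]
    rw [← hmdef, div_eq_mul_inv, mul_assoc]
  · have hdc : Tendsto (fun n : ℕ => ∫ q, ∫ ω, emp P X n (H q.1) ω * emp P X n (H q.2) ω ∂P
        ∂((ν.restrict K).prod (ν.restrict K))) atTop
        (nhds (∫ q, Gam q ∂((ν.restrict K).prod (ν.restrict K)))) := by
      refine tendsto_integral_filter_of_dominated_convergence (fun q => B q.1 * B q.2)
        (Eventually.of_forall fun n => ?_) ?_ (h.int.restrict.mul_prod h.int.restrict)
        (ae_of_all _ fun q => h.lim q.1 q.2)
      · exact (measurable_integral_mul (F := fun q : T × Ω => emp P X n (H q.1) q.2)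
          (measurable_emp_param hm n h.meas)).aestronglyMeasurable
      · filter_upwards [eventually_gt_atTop 0] with n hn
        exact ae_of_all _ fun q => h.le n hn q.1 q.2
    rw [Measure.prod_restrict] at hdc
    refine hdc.congr fun n => ?_
    rw [← Measure.prod_restrict, ← integral_emp_integral_sq hm n h.meas h.bdd, ← integral_const_mul]
    refine integral_congr_ae (ae_of_all _ fun ω => ?_)
    simp only [emp]
    rw [mul_pow, inv_pow, Real.sq_sqrt (Nat.cast_nonneg n)]

lemma IntEmp.integrable_prod (h : IntEmp P X ν H Gam B M) (hm : ∀ i, Measurable (X i)) {n : ℕ}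
    (hn : 0 < n) : Integrable (fun q : T × Ω => emp P X n (H q.1) q.2) (ν.prod P) := by
  have hF := measurable_emp_param (P := P) hm n h.meas
  have hu : ∀ u, Measurable (H u) := fun u => h.meas.comp (measurable_const.prodMk measurable_id)
  refine (integrable_prod_iff hF.aestronglyMeasurable).2
    ⟨ae_of_all _ fun u => integrable_emp hm n (hu u) (h.bdd u), h.int.mono'
      (hF.norm.stronglyMeasurable.integral_prod_right (ν := P)).aestronglyMeasurable
      (ae_of_all _ fun u => ?_)⟩
  rw [Real.norm_of_nonneg (integral_nonneg fun _ => norm_nonneg _)]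
  exact h.abs_le n hn u

lemma IntEmp.integral_abs_sub_le (h : IntEmp P X ν H Gam B M) (hm : ∀ i, Measurable (X i)) {n : ℕ}
    (hn : 0 < n) {K : Set T} (hKm : MeasurableSet K) (hK : ν K ≠ ⊤) :
    ∫ ω, |(∫ u, emp P X n (H u) ω ∂ν) - emp P X n (fun x => ∫ u in K, H u x ∂ν) ω| ∂P ≤
      ∫ u in Kᶜ, B u ∂ν := by
  have : IsFiniteMeasure (ν.restrict K) := ⟨by simpa using hK.lt_top⟩
  have hi := h.integrable_prod hm hn
  have hic : Integrable (fun q : T × Ω => emp P X n (H q.1) q.2) ((ν.restrict Kᶜ).prod P) := by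
    have := hi.integrableOn (s := Kᶜ ×ˢ univ)
    rwa [IntegrableOn, ← Measure.prod_restrict, Measure.restrict_univ] at this
  have e1 : ∀ᵐ ω ∂P, |(∫ u, emp P X n (H u) ω ∂ν) - emp P X n (fun x => ∫ u in K, H u x ∂ν) ω| ≤
      ∫ u in Kᶜ, |emp P X n (H u) ω| ∂ν := by
    filter_upwards [hi.prod_left_ae] with ω hω
    rw [emp_integral hm n h.meas h.bdd, ← integral_add_compl hKm hω, add_sub_cancel_left]
    exact abs_integral_le_integral_abs
  have hin : Integrable (fun ω => ∫ u in Kᶜ, |emp P X n (H u) ω| ∂ν) P :=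
    hic.abs.integral_prod_right
  refine (integral_mono_of_nonneg (ae_of_all _ fun ω => abs_nonneg _) hin e1).trans ?_
  have hsw := integral_integral_swap (f := fun u ω => |emp P X n (H u) ω|) hic.abs
  rw [← hsw]
  exact integral_mono_of_nonneg (ae_of_all _ fun u => integral_nonneg fun _ => abs_nonneg _)
    h.int.restrict (ae_of_all _ fun u => h.abs_le n hn u)

lemma norm_exp_I_sub_le (x y : ℝ) : ‖Complex.exp (Complex.I * (x : ℂ)) -
    Complex.exp (Complex.I * (y : ℂ))‖ ≤ |x - y| := by
  have e : Complex.exp (Complex.I * (x : ℂ)) - Complex.exp (Complex.I * (y : ℂ)) =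
      Complex.exp (Complex.I * (y : ℂ)) * (Complex.exp (Complex.I * ((x - y : ℝ) : ℂ)) - 1) := by
    rw [mul_sub, ← Complex.exp_add]; push_cast; ring_nf
  rw [e, norm_mul, mul_comm Complex.I (y : ℂ), Complex.norm_exp_ofReal_mul_I, one_mul]
  exact Real.norm_exp_I_mul_ofReal_sub_one_le

lemma norm_integral_exp_mul_sub_le {Y Z : Ω → ℝ} (hY : AEMeasurable Y P) (hZ : AEMeasurable Z P)
    (hd : Integrable (fun ω => Y ω - Z ω) P) (t : ℝ) :
    ‖(∫ ω, Complex.exp (Complex.I * ((t * Y ω : ℝ) : ℂ)) ∂P) -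
      ∫ ω, Complex.exp (Complex.I * ((t * Z ω : ℝ) : ℂ)) ∂P‖ ≤ |t| * ∫ ω, |Y ω - Z ω| ∂P := by
  have hint : ∀ {W : Ω → ℝ}, AEMeasurable W P →
      Integrable (fun ω => Complex.exp (Complex.I * ((t * W ω : ℝ) : ℂ))) P := fun {W} hW => by
    refine Integrable.of_bound (C := 1) ?_ (ae_of_all _ fun ω => ?_)
    · exact (Complex.measurable_exp.comp_aemeasurable ((Complex.measurable_ofReal.comp_aemeasurable
        (hW.const_mul t)).const_mul Complex.I)).aestronglyMeasurable
    · rw [mul_comm, Complex.norm_exp_ofReal_mul_I]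
  rw [← integral_sub (hint hY) (hint hZ), ← integral_const_mul]
  refine (norm_integral_le_integral_norm _).trans (integral_mono_of_nonneg
    (ae_of_all _ fun _ => norm_nonneg _) (hd.abs.const_mul _) (ae_of_all _ fun ω => ?_))
  refine (norm_exp_I_sub_le _ _).trans_eq ?_
  rw [← mul_sub, abs_mul]

/-- Central limit theorem, in terms of characteristic functions, for an integrated
empirical process. -/
lemma IntEmp.tendsto_charFun (h : IntEmp P X ν H Gam B M) (hm : ∀ i, Measurable (X i))
    (hstat : StrictlyStationary P X) (hmix : ExpAlphaMixing P X) {K : ℕ → Set T}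
    (hKm : ∀ m, MeasurableSet (K m)) (hK : ∀ m, ν (K m) ≠ ⊤) (hmono : Monotone K)
    (hun : ⋃ m, K m = univ) (t : ℝ) :
    Tendsto (fun n : ℕ => ∫ ω, Complex.exp (Complex.I *
      ((t * ∫ u, emp P X n (H u) ω ∂ν : ℝ) : ℂ)) ∂P) atTop
      (nhds ((Real.exp (-(t ^ 2 * (∫ q, Gam q ∂(ν.prod ν)) / 2)) : ℝ) : ℂ)) := by
  have hσ : Tendsto (fun m => ∫ q in K m ×ˢ K m, Gam q ∂(ν.prod ν)) atTop
      (nhds (∫ q, Gam q ∂(ν.prod ν))) := by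
    have hun2 : ⋃ m, K m ×ˢ K m = univ := by
      refine eq_univ_of_forall fun q => ?_
      obtain ⟨a, ha⟩ := mem_iUnion.1 (hun ▸ mem_univ q.1)
      obtain ⟨b, hb⟩ := mem_iUnion.1 (hun ▸ mem_univ q.2)
      exact mem_iUnion.2 ⟨max a b, hmono (le_max_left a b) ha, hmono (le_max_right a b) hb⟩
    have := tendsto_setIntegral_of_monotone (μ := ν.prod ν) (f := Gam)
      (fun m => (hKm m).prod (hKm m)) (fun a b hab => prod_mono (hmono hab) (hmono hab))
      h.integrable_Gam.integrableOn
    rwa [hun2, setIntegral_univ] at this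
  have hε : Tendsto (fun m => ∫ u in (K m)ᶜ, B u ∂ν) atTop (nhds 0) := by
    have := tendsto_setIntegral_of_monotone (μ := ν) (f := B) hKm hmono h.int.integrableOn
    rw [hun, setIntegral_univ] at this
    have h2 := this.const_sub (∫ u, B u ∂ν)
    rw [sub_self] at h2
    refine h2.congr fun m => ?_
    rw [← integral_add_compl (hKm m) h.int]; ring
  have hg : Tendsto (fun m => ((Real.exp (-(t ^ 2 * (∫ q in K m ×ˢ K m, Gam q ∂(ν.prod ν)) / 2)) : ℝ)
      : ℂ)) atTop (nhds ((Real.exp (-(t ^ 2 * (∫ q, Gam q ∂(ν.prod ν)) / 2)) : ℝ) : ℂ)) := by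
    refine (Complex.continuous_ofReal.tendsto _).comp ((Real.continuous_exp.tendsto _).comp ?_)
    exact ((hσ.const_mul _).div_const 2).neg
  rw [Metric.tendsto_atTop]
  intro ε hε0
  have ev1 := (Metric.tendsto_atTop.1 hg) (ε / 3) (by positivity)
  have ev2 := (Metric.tendsto_atTop.1 hε) (ε / 3 / (|t| + 1)) (by positivity)
  obtain ⟨m1, hm1⟩ := ev1
  obtain ⟨m2, hm2⟩ := ev2
  set m := max m1 m2
  have a1 := hm1 m (le_max_left _ _)
  have a2 := hm2 m (le_max_right _ _)
  rw [Real.dist_0_eq_abs] at a2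
  have a2' : |t| * ∫ u in (K m)ᶜ, B u ∂ν ≤ ε / 3 := by
    have h1 := (le_abs_self _).trans a2.le
    calc _ ≤ |t| * (ε / 3 / (|t| + 1)) := mul_le_mul_of_nonneg_left h1 (abs_nonneg _)
      _ ≤ (|t| + 1) * (ε / 3 / (|t| + 1)) := by gcongr; linarith
      _ = ε / 3 := by field_simp
  obtain ⟨N, hN⟩ := (Metric.tendsto_atTop.1
    (h.tendsto_charFun_restrict hm hstat hmix (hK m) t)) (ε / 3) (by positivity)
  refine ⟨max N 1, fun n hn => ?_⟩
  have a3 := hN n ((le_max_left _ _).trans hn)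
  have hn0 : 0 < n := (le_max_right N 1).trans hn
  have : IsFiniteMeasure (ν.restrict (K m)) := ⟨by simpa using (hK m).lt_top⟩
  have iZ : Integrable (fun ω => ∫ u, emp P X n (H u) ω ∂ν) P :=
    (h.integrable_prod hm hn0).integral_prod_right
  have hΦm : Measurable (fun x => ∫ u in K m, H u x ∂ν) :=
    (h.meas.stronglyMeasurable.integral_prod_left (μ := ν.restrict (K m))).measurable
  have iY : Integrable (emp P X n (fun x => ∫ u in K m, H u x ∂ν)) P := by
    refine integrable_emp (M := M * (ν.restrict (K m)).real univ) hm n hΦm fun x => ?_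
    have := norm_integral_le_of_norm_le_const (μ := ν.restrict (K m)) (f := fun u => H u x)
      (ae_of_all _ fun u => h.bdd u x)
    simpa using this
  have a4 := (norm_integral_exp_mul_sub_le (P := P) iZ.aemeasurable iY.aemeasurable (iZ.sub iY) t).trans
    (mul_le_mul_of_nonneg_left (h.integral_abs_sub_le hm hn0 (hKm m) (hK m)) (abs_nonneg t))
  rw [dist_eq_norm] at a1 a3 ⊢
  have := norm_add₃_le (a := (∫ ω, Complex.exp (Complex.I *
      ((t * ∫ u, emp P X n (H u) ω ∂ν : ℝ) : ℂ)) ∂P) - ∫ ω, Complex.exp (Complex.I *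
      ((t * emp P X n (fun x => ∫ u in K m, H u x ∂ν) ω : ℝ) : ℂ)) ∂P)
    (b := (∫ ω, Complex.exp (Complex.I *
      ((t * emp P X n (fun x => ∫ u in K m, H u x ∂ν) ω : ℝ) : ℂ)) ∂P) -
      ((Real.exp (-(t ^ 2 * (∫ q in K m ×ˢ K m, Gam q ∂(ν.prod ν)) / 2)) : ℝ) : ℂ))
    (c := ((Real.exp (-(t ^ 2 * (∫ q in K m ×ˢ K m, Gam q ∂(ν.prod ν)) / 2)) : ℝ) : ℂ) -
      ((Real.exp (-(t ^ 2 * (∫ q, Gam q ∂(ν.prod ν)) / 2)) : ℝ) : ℂ))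
  rw [sub_add_sub_cancel, sub_add_sub_cancel] at this
  linarith

end intemp

end

/-! ### Score measures and the linear part -/

section

variable {P : Measure Ω} [IsProbabilityMeasure P] {U : ℤ → Ω → Fin 2 → ℝ}
variable {νp νm : Measure (Fin 2 → ℝ)} {w : ℝ}

/-- The Jordan pair of the signed measure attached to a score function. -/
structure ScoreMeas (νp νm : Measure (Fin 2 → ℝ)) (w : ℝ) : Prop where
  fin : ∀ x y : Fin 2 → ℝ, (∀ j, 0 < x j) → (∀ j, y j < 1) →
      νp {w | ∀ j, x j ≤ w j ∧ w j ≤ y j} < ⊤ ∧ νm {w | ∀ j, x j ≤ w j ∧ w j ≤ y j} < ⊤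
  supp : νp {u | ¬ ∀ j, 0 < u j ∧ u j < 1} = 0 ∧ νm {u | ¬ ∀ j, 0 < u j ∧ u j < 1} = 0
  sing : νp ⟂ₘ νm
  int : ∫⁻ u, ENNReal.ofReal (gW w u) ∂(νp + νm) < ⊤

/-- Exhaustion of the plane by sets of finite score measure. -/
def exhaust (m : ℕ) : Set (Fin 2 → ℝ) :=
  {u | ∀ j, 1 / ((m : ℝ) + 2) ≤ u j ∧ u j ≤ 1 - 1 / ((m : ℝ) + 2)} ∪ cubeᶜ

lemma measurableSet_exhaust (m : ℕ) : MeasurableSet (exhaust m) := by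
  refine MeasurableSet.union ?_ measurableSet_cube.compl
  rw [ofPred_forall]
  exact MeasurableSet.iInter fun j => (measurableSet_le measurable_const (measurable_pi_apply j)).inter
    (measurableSet_le (measurable_pi_apply j) measurable_const)

lemma monotone_exhaust : Monotone exhaust := by
  intro m n hmn u hu
  have : 1 / ((n : ℝ) + 2) ≤ 1 / ((m : ℝ) + 2) := by gcongr
  rcases hu with hu | hu
  · exact Or.inl fun j => ⟨this.trans (hu j).1, (hu j).2.trans (by linarith)⟩
  · exact Or.inr hu

lemma iUnion_exhaust : ⋃ m, exhaust m = univ := by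
  refine eq_univ_of_forall fun u => ?_
  by_cases hu : u ∈ cube
  · have hg := g1_pos hu
    obtain ⟨m, hm⟩ := exists_nat_one_div_lt hg
    have h2 : 1 / ((m : ℝ) + 2) ≤ 1 / ((m : ℝ) + 1) := by gcongr; norm_num
    refine mem_iUnion.2 ⟨m, Or.inl fun j => ?_⟩
    have h3 := (g1_le u j).trans (min_le_left _ _)
    have h4 := (g1_le u j).trans (min_le_right _ _)
    constructor <;> linarith
  · exact mem_iUnion.2 ⟨0, Or.inr hu⟩

lemma cube_compl_eq : cubeᶜ = {u : Fin 2 → ℝ | ¬ ∀ j, 0 < u j ∧ u j < 1} := rfl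

namespace ScoreMeas
variable (hν : ScoreMeas νp νm w)
include hν

lemma compl_cube : (νp + νm) cubeᶜ = 0 := by
  rw [cube_compl_eq, Measure.add_apply, hν.supp.1, hν.supp.2, add_zero]

lemma ae_cube : ∀ᵐ u ∂(νp + νm), u ∈ cube := by
  rw [ae_iff]; exact hν.compl_cube

lemma exhaust_ne_top (m : ℕ) : (νp + νm) (exhaust m) ≠ ⊤ := by
  refine ne_top_of_le_ne_top ?_ (measure_union_le _ _)
  rw [hν.compl_cube, add_zero, Measure.add_apply]
  have h0 : (0 : ℝ) < 1 / ((m : ℝ) + 2) := by positivity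
  have := hν.fin (fun _ => 1 / ((m : ℝ) + 2)) (fun _ => 1 - 1 / ((m : ℝ) + 2)) (fun _ => h0)
    (fun _ => by linarith)
  exact (ENNReal.add_lt_top.2 this).ne

lemma sigmaFinite : SigmaFinite (νp + νm) :=
  ⟨⟨{ set := exhaust
      set_mem := fun _ => trivial
      finite := fun m => (hν.exhaust_ne_top m).lt_top
      spanning := iUnion_exhaust }⟩⟩

lemma integrable_pow {κ : ℝ} (hκ : w ≤ κ) :
    Integrable (cube.indicator fun u => g1 u ^ κ) (νp + νm) := by
  have hgm : Measurable fun u : Fin 2 → ℝ => gW w u := measurable_g1.pow_const w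
  have hI : Integrable (cube.indicator (gW w)) (νp + νm) := by
    rw [integrable_indicator_iff measurableSet_cube, IntegrableOn]
    refine ⟨hgm.aestronglyMeasurable, ?_⟩
    rw [hasFiniteIntegral_iff_ofReal]
    · exact (setLIntegral_le_lintegral _ _).trans_lt hν.int
    · refine (ae_restrict_iff' measurableSet_cube).2 (ae_of_all _ fun u hu => ?_)
      exact Real.rpow_nonneg (g1_pos hu).le _
  refine hI.mono' ((measurable_g1.pow_const κ).indicator measurableSet_cube).aestronglyMeasurable
    (ae_of_all _ fun u => ?_)
  by_cases hu : u ∈ cube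
  · simp only [indicator_of_mem hu, gW]
    rw [Real.norm_of_nonneg (Real.rpow_nonneg (g1_pos hu).le _)]
    exact Real.rpow_le_rpow_of_exponent_ge (g1_pos hu) ((g1_le_half u).trans (by norm_num)) hκ
  · simp [hu]

lemma exists_sign : ∃ s : (Fin 2 → ℝ) → ℝ, Measurable s ∧ (∀ u, |s u| = 1) ∧
    ∀ f : (Fin 2 → ℝ) → ℝ, Integrable f (νp + νm) → ∫ u, f u * s u ∂(νp + νm) = sJint νp νm f := by
  classical
  obtain ⟨A, hA, h1, h2⟩ := hν.sing
  refine ⟨A.piecewise (fun _ => -1) fun _ => 1,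
    Measurable.piecewise hA measurable_const measurable_const, fun u => ?_, fun f hf => ?_⟩
  · by_cases hu : u ∈ A <;> simp [hu]
  · have hsm : Measurable (A.piecewise (fun _ => (-1 : ℝ)) fun _ => 1) :=
      Measurable.piecewise hA measurable_const measurable_const
    have hi : Integrable (fun u => f u * A.piecewise (fun _ => (-1 : ℝ)) (fun _ => 1) u)
        (νp + νm) := hf.mul_bdd (c := 1) hsm.aestronglyMeasurable (ae_of_all _ fun u => by
          by_cases hu : u ∈ A <;> simp [hu])
    rw [integral_add_measure hi.left_of_add_measure hi.right_of_add_measure, sJint, sub_eq_add_neg,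
      ← integral_neg]
    congr 1
    · refine integral_congr_ae ?_
      filter_upwards [measure_eq_zero_iff_ae_notMem.1 h1] with u hu
      simp [hu]
    · refine integral_congr_ae ?_
      filter_upwards [measure_eq_zero_iff_ae_notMem.1 h2] with u hu
      have : u ∈ A := not_not.1 hu
      simp [this]

end ScoreMeas

lemma emp_mul_const {X : ℤ → Ω → E} (n : ℕ) (φ : E → ℝ) (c : ℝ) (ω : Ω) :
    emp P X n (fun x => φ x * c) ω = emp P X n φ ω * c := by
  unfold emp
  rw [integral_mul_const, mul_assoc, Finset.sum_mul]
  simp only [sub_mul]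

/-- The integral of the empirical process `emp (hfc u)` with respect to the score measure. -/
lemma UnifSeq.intEmp (h : UnifSeq P U) (hν : ScoreMeas νp νm w) {s : (Fin 2 → ℝ) → ℝ}
    (hsm : Measurable s) (hs : ∀ u, |s u| = 1) {K C κ : ℝ} (hR : UnifSeq.CopReg P U K)
    (hC0 : 0 < C) (hκ : w ≤ κ) (hb : ∀ n : ℕ, 0 < n → ∀ u,
      ∫ ω, emp P U n (hfc P U u) ω ^ 2 ∂P ≤ C * (g1 u ^ κ) ^ 2) :
    IntEmp P U (νp + νm) (fun u x => hfc P U u x * s u)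
      (fun q => Gamc P U q.1 q.2 * (s q.1 * s q.2))
      (fun u => Real.sqrt C * cube.indicator (fun u => g1 u ^ κ) u) 2 where
  meas := hR.measurable_hfc.mul (hsm.comp measurable_fst)
  bdd u x := by rw [abs_mul, hs, mul_one]; exact hR.abs_hfc_le u x
  measGam := (h.measurable_Gamc hR).mul ((hsm.comp measurable_fst).mul (hsm.comp measurable_snd))
  lim u v := by
    simp only [emp_mul_const, mul_mul_mul_comm _ (s u) _ (s v), integral_mul_const]
    exact (h.tendsto_integral_emp_hfc_mul u v).mul_const _
  le n hn u v := by
    simp only [emp_mul_const, mul_mul_mul_comm _ (s u) _ (s v), integral_mul_const]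
    rw [abs_mul, abs_mul, hs, hs, mul_one, mul_one]
    refine (hR.abs_integral_emp_hfc_mul_le h.meas hC0 (hb n hn) u v).trans_eq ?_
    rw [mul_mul_mul_comm, Real.mul_self_sqrt hC0.le]
  abs_le n hn u := by
    simp only [emp_mul_const, abs_mul, hs, mul_one]
    by_cases hu : u ∈ cube
    · rw [indicator_of_mem hu]
      refine (integral_abs_le_sqrt (integrable_emp h.meas n (hR.measurable_hfc_right u)
        (hR.abs_hfc_le u)) (integrable_emp_sq h.meas n (hR.measurable_hfc_right u)
        (hR.abs_hfc_le u))).trans ((Real.sqrt_le_sqrt (hb n hn u)).trans_eq ?_)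
      rw [Real.sqrt_mul hC0.le, Real.sqrt_sq (Real.rpow_nonneg (g1_pos hu).le _)]
    · simp [hfc_of_notMem hu, emp_zero, hu]
  int := (hν.integrable_pow hκ).const_mul _

lemma UnifSeq.integral_Gamc (h : UnifSeq P U) (hν : ScoreMeas νp νm w) {s : (Fin 2 → ℝ) → ℝ}
    (hsm : Measurable s) (hs : ∀ u, |s u| = 1)
    (hsJ : ∀ f : (Fin 2 → ℝ) → ℝ, Integrable f (νp + νm) →
      ∫ u, f u * s u ∂(νp + νm) = sJint νp νm f)
    {K C κ : ℝ} (hR : UnifSeq.CopReg P U K)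
    (hC0 : 0 < C) (hκ : w ≤ κ) (hb : ∀ n : ℕ, 0 < n → ∀ u,
      ∫ ω, emp P U n (hfc P U u) ω ^ 2 ∂P ≤ C * (g1 u ^ κ) ^ 2) :
    ∫ q, Gamc P U q.1 q.2 * (s q.1 * s q.2) ∂((νp + νm).prod (νp + νm)) = sigmaSq P U νp νm := by
  have := hν.sigmaFinite
  have hG := hν.integrable_pow hκ
  have hGi := (h.intEmp hν hsm hs hR hC0 hκ hb).integrable_Gam
  have hΓ := h.measurable_Gamc hR
  have hin : ∀ v, Integrable (fun u => Gamc P U u v) (νp + νm) := fun v => by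
    refine ((hG.mul_const (cube.indicator (fun u => g1 u ^ κ) v)).const_mul C).mono'
      (hΓ.comp (measurable_id.prodMk measurable_const)).aestronglyMeasurable
      (ae_of_all _ fun u => ?_)
    exact h.abs_Gamc_le hR hC0 hb u v
  have hout : Integrable (fun v => sJint νp νm fun u => Gamc P U u v) (νp + νm) := by
    have e : (fun v => sJint νp νm fun u => Gamc P U u v) =
        fun v => (∫ u, Gamc P U u v * (s u * s v) ∂(νp + νm)) * s v := by
      ext v
      have hs2 : s v * s v = 1 := by rw [← abs_mul_abs_self, hs, mul_one]
      simp only [← mul_assoc]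
      rw [integral_mul_const, mul_assoc, hs2, mul_one, hsJ _ (hin v)]
    rw [e]
    exact hGi.integral_prod_right.mul_bdd (c := 1) hsm.aestronglyMeasurable
      (ae_of_all _ fun u => (hs u).le)
  rw [integral_prod_symm _ hGi, sigmaSq]
  have e2 : ∀ v, ∫ u, Gamc P U u v * (s u * s v) ∂(νp + νm) =
      (sJint νp νm fun u => Gamc P U u v) * s v := fun v => by
    simp only [← mul_assoc]
    rw [integral_mul_const, hsJ _ (hin v)]
  simp only [e2]
  rw [hsJ _ hout]
  have hae := ae_add_measure_iff.1 hν.ae_cube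
  have e3 : ∀ v ∈ cube, (sJint νp νm fun u => Gamc P U u v) =
      sJint νp νm fun u => GammaCov P U u v := fun v hv => by
    unfold sJint
    congr 1
    · refine integral_congr_ae ?_
      filter_upwards [hae.1] with u hu using Gamc_of_mem hu hv
    · refine integral_congr_ae ?_
      filter_upwards [hae.2] with u hu using Gamc_of_mem hu hv
  refine congrArg₂ (· - ·) ?_ ?_
  · refine integral_congr_ae ?_
    filter_upwards [hae.1] with u hu using e3 u hu
  · refine integral_congr_ae ?_
    filter_upwards [hae.2] with u hu using e3 u hu

/-- Central limit theorem for the linear part of the rank statistic. -/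
lemma UnifSeq.tendsto_charFun_linear (h : UnifSeq P U) (hν : ScoreMeas νp νm w)
    {s : (Fin 2 → ℝ) → ℝ} (hsm : Measurable s) (hs : ∀ u, |s u| = 1)
    (hsJ : ∀ f : (Fin 2 → ℝ) → ℝ, Integrable f (νp + νm) →
      ∫ u, f u * s u ∂(νp + νm) = sJint νp νm f)
    {K C κ : ℝ} (hR : UnifSeq.CopReg P U K)
    (hC0 : 0 < C) (hκ : w ≤ κ) (hb : ∀ n : ℕ, 0 < n → ∀ u,
      ∫ ω, emp P U n (hfc P U u) ω ^ 2 ∂P ≤ C * (g1 u ^ κ) ^ 2) (t : ℝ) :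
    Tendsto (fun n : ℕ => ∫ ω, Complex.exp (Complex.I *
      ((t * ∫ u, emp P U n (hfc P U u) ω * s u ∂(νp + νm) : ℝ) : ℂ)) ∂P) atTop
      (nhds ((Real.exp (-(t ^ 2 * sigmaSq P U νp νm / 2)) : ℝ) : ℂ)) := by
  have := hν.sigmaFinite
  have := (h.intEmp hν hsm hs hR hC0 hκ hb).tendsto_charFun h.meas h.stat h.mix
    measurableSet_exhaust hν.exhaust_ne_top monotone_exhaust iUnion_exhaust t
  rw [h.integral_Gamc hν hsm hs hsJ hR hC0 hκ hb] at this
  simpa only [emp_mul_const] using this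

end

/-! ### Replacing the empirical copula process by its linear part -/

section

variable {P : Measure Ω} [IsProbabilityMeasure P] {U : ℤ → Ω → Fin 2 → ℝ}
variable {νp νm : Measure (Fin 2 → ℝ)} {w : ℝ}

/-- The box spanned by the possible values of the pseudo-observations. -/
def rankBox (n : ℕ) : Set (Fin 2 → ℝ) :=
  {x | ∀ j, 1 / ((n : ℝ) + 1) < x j ∧ x j ≤ ((n : ℝ) + 1) / (n + 2)}

lemma measurableSet_rankBox (n : ℕ) : MeasurableSet (rankBox n) := by
  unfold rankBox
  rw [ofPred_forall]
  exact MeasurableSet.iInter fun j => (measurableSet_lt measurable_const (measurable_pi_apply j)).inter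
    (measurableSet_le (measurable_pi_apply j) measurable_const)

lemma rankBox_upper (n : ℕ) : ((n : ℝ) + 1) / (n + 2) = 1 - 1 / ((n : ℝ) + 2) := by
  field_simp; ring

lemma le_g1_of_rankBox {n : ℕ} {u : Fin 2 → ℝ} (hu : u ∈ rankBox n) : 1 / ((n : ℝ) + 2) ≤ g1 u := by
  have h1 : 1 / ((n : ℝ) + 2) ≤ 1 / ((n : ℝ) + 1) := by gcongr; norm_num
  have h2 := rankBox_upper n
  rw [g1_eq (by decide : (0 : Fin 2) ≠ 1)]
  refine le_min (le_min ?_ ?_) (le_min ?_ ?_)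
  · linarith [(hu 0).1]
  · linarith [(hu 0).2]
  · linarith [(hu 1).1]
  · linarith [(hu 1).2]

lemma rankBox_subset_cube (n : ℕ) : rankBox n ⊆ cube := fun _ hu =>
  mem_cube_of_g1_pos ((by positivity : (0 : ℝ) < 1 / ((n : ℝ) + 2)).trans_le (le_g1_of_rankBox hu))

lemma eventually_mem_rankBox {u : Fin 2 → ℝ} (hu : u ∈ cube) : ∀ᶠ n : ℕ in atTop, u ∈ rankBox n := by
  have h1 : Tendsto (fun n : ℕ => 1 / ((n : ℝ) + 1)) atTop (nhds 0) :=
    tendsto_one_div_add_atTop_nhds_zero_nat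
  have h2 := h1.eventually_lt_const (g1_pos hu)
  filter_upwards [h2] with n hn j
  have h3 := (g1_le u j).trans (min_le_left _ _)
  have h4 := (g1_le u j).trans (min_le_right _ _)
  have h5 : 1 / ((n : ℝ) + 2) ≤ 1 / ((n : ℝ) + 1) := by gcongr; norm_num
  have h6 := rankBox_upper n
  constructor <;> linarith

lemma ScoreMeas.rankBox_ne_top (hν : ScoreMeas νp νm w) (n : ℕ) : (νp + νm) (rankBox n) ≠ ⊤ := by
  have h1 : rankBox n ⊆ {u : Fin 2 → ℝ | ∀ j, 1 / ((n : ℝ) + 1) ≤ u j ∧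
      u j ≤ ((n : ℝ) + 1) / (n + 2)} := fun u hu j => ⟨(hu j).1.le, (hu j).2⟩
  refine ne_top_of_le_ne_top ?_ (measure_mono h1)
  rw [Measure.add_apply]
  have := hν.fin (fun _ => 1 / ((n : ℝ) + 1)) (fun _ => ((n : ℝ) + 1) / (n + 2))
    (fun _ => by positivity) (fun _ => by rw [div_lt_one (by positivity)]; linarith)
  exact (ENNReal.add_lt_top.2 this).ne

/-- The empirical copula process of the pseudo-observations, with strict inequalities. -/
def ecp (P : Measure Ω) (U : ℤ → Ω → Fin 2 → ℝ) (n : ℕ) (u : Fin 2 → ℝ) (ω : Ω) : ℝ :=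
  (Real.sqrt n)⁻¹ * ∑ i ∈ Finset.Icc (1 : ℤ) n,
    ((∏ j, lt01 (pseudoObs U n i ω j) (u j)) - cop P U u)

lemma measurable_prod_lt01_joint {F : Ω → Fin 2 → ℝ} (hF : ∀ j, Measurable fun ω => F ω j) :
    Measurable fun q : (Fin 2 → ℝ) × Ω => ∏ j, lt01 (F q.2 j) (q.1 j) := by
  refine Finset.measurable_fun_prod _ fun j _ => ?_
  exact Measurable.ite (measurableSet_lt ((hF j).comp measurable_snd)
    ((measurable_pi_apply j).comp measurable_fst)) measurable_const measurable_const

lemma UnifSeq.measurable_cop (h : UnifSeq P U) : Measurable (cop P U) := by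
  have e : cop P U = fun u => ∫ ω, ∏ j, lt01 (U 0 ω j) (u j) ∂P := by
    ext u; exact (h.integral_prod_lt01 u).symm
  rw [e]
  exact ((measurable_prod_lt01_joint (h.meas_coord 0)).stronglyMeasurable.integral_prod_right
    (ν := P)).measurable

lemma UnifSeq.measurable_ecp (h : UnifSeq P U) (n : ℕ) :
    Measurable fun q : (Fin 2 → ℝ) × Ω => ecp P U n q.1 q.2 := by
  unfold ecp
  exact (Finset.measurable_fun_sum _ fun i _ => (measurable_prod_lt01_joint
    (fun j => measurable_pseudoObs h.meas n i j)).sub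
      (h.measurable_cop.comp measurable_fst)).const_mul _

lemma UnifSeq.abs_ecp_le (h : UnifSeq P U) (n : ℕ) (u : Fin 2 → ℝ) (ω : Ω) :
    |ecp P U n u ω| ≤ (Real.sqrt n)⁻¹ * n := by
  refine abs_normalized_sum_le n fun i => ?_
  have h1 := prod_lt01_mem (pseudoObs U n i ω) u
  have h2 : 0 ≤ cop P U u := ENNReal.toReal_nonneg
  have h3 : cop P U u ≤ 1 := by
    rw [← h.integral_prod_lt01 u]
    refine (le_abs_self _).trans (abs_integral_le_one fun ω => ?_)
    have := prod_lt01_mem (U 0 ω) u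
    rw [abs_of_nonneg this.1]; exact this.2
  rw [abs_le]; constructor <;> linarith [h1.1, h1.2]

section limit
variable {s : (Fin 2 → ℝ) → ℝ} {K C κ : ℝ}

lemma UnifSeq.tendsto_integral_rem (h : UnifSeq P U) (hC : Condition21 (cop P U))
    (hν : ScoreMeas νp νm w) (hsm : Measurable s) (hs : ∀ u, |s u| = 1)
    (hR : UnifSeq.CopReg P U K) (hκ0 : 0 < κ) (hκ : κ < 1 / 2) (hwκ : w ≤ κ) :
    Tendsto (fun n : ℕ => ∫ ω in Good U n (tieLen κ n),
      |∫ u in rankBox n, (ecp P U n u ω - emp P U n (hfc P U u) ω) * s u ∂(νp + νm)| ∂P)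
      atTop (nhds 0) := by
  have := hν.sigmaFinite
  obtain ⟨C, hC0, hb⟩ := h.exists_integral_abs_Rem_le hC hκ0 hκ
  set G := cube.indicator fun u : Fin 2 → ℝ => g1 u ^ κ with hG
  have hGi : Integrable G (νp + νm) := hν.integrable_pow hwκ
  set D : ℕ → (Fin 2 → ℝ) × Ω → ℝ := fun n q => ecp P U n q.1 q.2 - emp P U n (hfc P U q.1) q.2
    with hD
  have hDm : ∀ n, Measurable (D n) := fun n => (h.measurable_ecp n).sub
    (measurable_emp_hfc hR h.meas n)
  have hDb : ∀ n q, |D n q| ≤ (Real.sqrt n)⁻¹ * n + (Real.sqrt n)⁻¹ * (n * (2 * 2)) := fun n q =>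
    (abs_sub _ _).trans (add_le_add (h.abs_ecp_le n _ _) (abs_emp_le U n (hR.abs_hfc_le q.1) q.2))
  have hDR : ∀ n, ∀ u ∈ cube, ∀ ω, D n (u, ω) = Rem P U n u ω := fun n u hu ω => by
    simp only [hD, hfc_of_mem hu, ecp, Rem]
  have key : Tendsto (fun n : ℕ => ∫ u, (rankBox n).indicator
      (fun u => ∫ ω in Good U n (tieLen κ n), |D n (u, ω)| ∂P) u ∂(νp + νm)) atTop (nhds 0) := by
    have : Tendsto (fun n : ℕ => ∫ u, (rankBox n).indicator
      (fun u => ∫ ω in Good U n (tieLen κ n), |D n (u, ω)| ∂P) u ∂(νp + νm)) atTop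
        (nhds (∫ _, (0 : ℝ) ∂(νp + νm))) := by
      refine tendsto_integral_filter_of_dominated_convergence (fun u => C * G u)
        (Eventually.of_forall fun n => ?_) ?_ (hGi.const_mul C) ?_
      · exact (((hDm n).abs.stronglyMeasurable.integral_prod_right
          (ν := P.restrict (Good U n (tieLen κ n)))).measurable.indicator
            (measurableSet_rankBox n)).aestronglyMeasurable
      · have hev : ∀ᶠ n : ℕ in atTop, 2 * (Real.sqrt n)⁻¹ ≤ ((n : ℝ) + 2) ^ (-κ) := by
          have h1 : Tendsto (fun n : ℕ => ((n : ℝ) + 2) ^ κ * (2 * (Real.sqrt n)⁻¹)) atTop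
              (nhds 0) := by
            have h2 : Tendsto (fun n : ℕ => 3 ^ κ * 2 * (n : ℝ) ^ (-(1 / 2 - κ))) atTop
                (nhds 0) := by
              simpa using ((tendsto_rpow_neg_atTop (by linarith : 0 < 1 / 2 - κ)).comp
                tendsto_natCast_atTop_atTop).const_mul (3 ^ κ * 2)
            refine squeeze_zero' (Eventually.of_forall fun n => by positivity) ?_ h2
            filter_upwards [eventually_gt_atTop 0] with n hn
            have hn1 : (1 : ℝ) ≤ n := by exact_mod_cast hn
            have e1 : ((n : ℝ) + 2) ^ κ ≤ 3 ^ κ * (n : ℝ) ^ κ := by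
              rw [← Real.mul_rpow (by norm_num) (by positivity)]
              exact Real.rpow_le_rpow (by positivity) (by linarith) hκ0.le
            have e2 : (Real.sqrt n)⁻¹ = (n : ℝ) ^ (-(1 / 2) : ℝ) := by
              rw [Real.sqrt_eq_rpow, Real.rpow_neg (by positivity)]
            calc _ ≤ 3 ^ κ * (n : ℝ) ^ κ * (2 * (Real.sqrt n)⁻¹) := by gcongr
              _ = 3 ^ κ * 2 * ((n : ℝ) ^ κ * (n : ℝ) ^ (-(1 / 2) : ℝ)) := by rw [e2]; ring
              _ = _ := by rw [← Real.rpow_add (by linarith)]; ring_nf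
          filter_upwards [h1.eventually_le_const (zero_lt_one)] with n hn
          rw [Real.rpow_neg (by positivity), ← one_div (((n : ℝ) + 2) ^ κ),
            le_div_iff₀ (by positivity)]
          linarith
        filter_upwards [hev, eventually_gt_atTop 0] with n hn hn0
        refine ae_of_all _ fun u => ?_
        by_cases hu : u ∈ rankBox n
        · have huc := rankBox_subset_cube n hu
          rw [indicator_of_mem hu, hG, indicator_of_mem huc,
            Real.norm_of_nonneg (integral_nonneg fun _ => abs_nonneg _)]
          simp only [hDR n u huc]
          exact hb n hn0 hn u (le_g1_of_rankBox hu)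
        · rw [indicator_of_notMem hu, norm_zero]
          refine mul_nonneg hC0.le (indicator_nonneg (fun u hu => ?_) _)
          exact Real.rpow_nonneg (g1_pos hu).le _
      · filter_upwards [hν.ae_cube] with u hu
        refine squeeze_zero (fun n => indicator_nonneg (fun _ _ =>
          integral_nonneg fun _ => abs_nonneg _) _) (fun n => indicator_le_self' (fun _ _ =>
          integral_nonneg fun _ => abs_nonneg _) _) ?_
        simp only [hDR _ u hu]
        exact h.tendsto_integral_abs_Rem hC hκ0 hκ hu
    simpa using this
  refine squeeze_zero (fun n => integral_nonneg fun _ => abs_nonneg _) (fun n => ?_) key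
  have : IsFiniteMeasure ((νp + νm).restrict (rankBox n)) :=
    ⟨by simpa using (hν.rankBox_ne_top n).lt_top⟩
  have hi : Integrable (fun q : (Fin 2 → ℝ) × Ω => |D n q|)
      (((νp + νm).restrict (rankBox n)).prod (P.restrict (Good U n (tieLen κ n)))) :=
    integrable_of_abs_le (hDm n).abs fun q => by rw [abs_abs]; exact hDb n q
  rw [integral_indicator (measurableSet_rankBox n)]
  have hsw := integral_integral_swap (f := fun u ω => |D n (u, ω)|) hi
  rw [hsw]
  refine integral_mono_of_nonneg (ae_of_all _ fun _ => abs_nonneg _) hi.integral_prod_right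
    (ae_of_all _ fun ω => ?_)
  refine abs_integral_le_integral_abs.trans_eq (integral_congr_ae (ae_of_all _ fun u => ?_))
  simp only [abs_mul, hs, mul_one, hD]

lemma UnifSeq.tendsto_integral_tail (h : UnifSeq P U)
    (hν : ScoreMeas νp νm w) (hsm : Measurable s) (hs : ∀ u, |s u| = 1)
    (hR : UnifSeq.CopReg P U K) (hC0 : 0 < C) (hκ : w ≤ κ) (hb : ∀ n : ℕ, 0 < n → ∀ u,
      ∫ ω, emp P U n (hfc P U u) ω ^ 2 ∂P ≤ C * (g1 u ^ κ) ^ 2) :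
    Tendsto (fun n : ℕ => ∫ ω, |(∫ u, emp P U n (hfc P U u) ω * s u ∂(νp + νm)) -
      ∫ u in rankBox n, emp P U n (hfc P U u) ω * s u ∂(νp + νm)| ∂P) atTop (nhds 0) := by
  have := hν.sigmaFinite
  have hI := h.intEmp hν hsm hs hR hC0 hκ hb
  set B := fun u => Real.sqrt C * cube.indicator (fun u : Fin 2 → ℝ => g1 u ^ κ) u with hB
  have key : Tendsto (fun n : ℕ => ∫ u, (rankBox n)ᶜ.indicator B u ∂(νp + νm)) atTop (nhds 0) := by
    have : Tendsto (fun n : ℕ => ∫ u, (rankBox n)ᶜ.indicator B u ∂(νp + νm)) atTop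
        (nhds (∫ _, (0 : ℝ) ∂(νp + νm))) := by
      refine tendsto_integral_filter_of_dominated_convergence (fun u => ‖B u‖)
        (Eventually.of_forall fun n =>
          hI.int.aestronglyMeasurable.indicator (measurableSet_rankBox n).compl)
        (Eventually.of_forall fun n => ae_of_all _ fun u => norm_indicator_le_norm_self _ _)
        hI.int.norm ?_
      filter_upwards [hν.ae_cube] with u hu
      refine tendsto_const_nhds.congr' ?_
      filter_upwards [eventually_mem_rankBox hu] with n hn
      simp [hn]
    simpa using this
  refine squeeze_zero' (Eventually.of_forall fun n => integral_nonneg fun _ => abs_nonneg _)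
    ?_ key
  filter_upwards [eventually_gt_atTop 0] with n hn
  have : IsFiniteMeasure ((νp + νm).restrict (rankBox n)) :=
    ⟨by simpa using (hν.rankBox_ne_top n).lt_top⟩
  have := hI.integral_abs_sub_le h.meas hn (measurableSet_rankBox n) (hν.rankBox_ne_top n)
  simp only [emp_integral h.meas n hI.meas hI.bdd] at this
  rw [integral_indicator (measurableSet_rankBox n).compl]
  simpa only [emp_mul_const] using this

/-- The integrated empirical copula process is asymptotically linear. -/
lemma UnifSeq.tendsto_integral_ecp_sub (h : UnifSeq P U) (hC : Condition21 (cop P U))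
    (hν : ScoreMeas νp νm w) (hsm : Measurable s) (hs : ∀ u, |s u| = 1)
    (hR : UnifSeq.CopReg P U K) (hC0 : 0 < C) (hκ0 : 0 < κ) (hκ : κ < 1 / 2) (hwκ : w ≤ κ)
    (hb : ∀ n : ℕ, 0 < n → ∀ u, ∫ ω, emp P U n (hfc P U u) ω ^ 2 ∂P ≤ C * (g1 u ^ κ) ^ 2) :
    Tendsto (fun n : ℕ => ∫ ω in Good U n (tieLen κ n),
      |(∫ u in rankBox n, ecp P U n u ω * s u ∂(νp + νm)) -
        ∫ u, emp P U n (hfc P U u) ω * s u ∂(νp + νm)| ∂P) atTop (nhds 0) := by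
  have := hν.sigmaFinite
  have hI := h.intEmp hν hsm hs hR hC0 hwκ hb
  have t1 := h.tendsto_integral_rem hC hν hsm hs hR hκ0 hκ hwκ
  have t2 := h.tendsto_integral_tail hν hsm hs hR hC0 hwκ hb
  have t3 := t1.add t2
  rw [add_zero] at t3
  refine squeeze_zero' (Eventually.of_forall fun n => integral_nonneg fun _ => abs_nonneg _)
    ?_ t3
  filter_upwards [eventually_gt_atTop 0] with n hn
  have : IsFiniteMeasure ((νp + νm).restrict (rankBox n)) :=
    ⟨by simpa using (hν.rankBox_ne_top n).lt_top⟩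
  have iE : Integrable (fun q : (Fin 2 → ℝ) × Ω => ecp P U n q.1 q.2 * s q.1)
      (((νp + νm).restrict (rankBox n)).prod P) :=
    integrable_of_abs_le ((h.measurable_ecp n).mul (hsm.comp measurable_fst))
      (M := (Real.sqrt n)⁻¹ * n) fun q => by
        rw [abs_mul, hs, mul_one]; exact h.abs_ecp_le n _ _
  have iH : Integrable (fun q : (Fin 2 → ℝ) × Ω => emp P U n (hfc P U q.1) q.2 * s q.1)
      (((νp + νm).restrict (rankBox n)).prod P) :=
    integrable_of_abs_le ((measurable_emp_hfc hR h.meas n).mul (hsm.comp measurable_fst))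
      (M := (Real.sqrt n)⁻¹ * (n * (2 * 2))) fun q => by
        rw [abs_mul, hs, mul_one]; exact abs_emp_le U n (hR.abs_hfc_le q.1) q.2
  have iZ : Integrable (fun ω => ∫ u, emp P U n (hfc P U u) ω * s u ∂(νp + νm)) P := by
    have := (hI.integrable_prod h.meas hn).integral_prod_right
    simpa only [emp_mul_const] using this
  have iA := iE.integral_prod_right
  have iB := iH.integral_prod_right
  have i1 : Integrable (fun ω => |∫ u in rankBox n, (ecp P U n u ω - emp P U n (hfc P U u) ω) * s u
      ∂(νp + νm)|) P := by
    have := (iE.sub iH).integral_prod_right.abs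
    simpa only [Pi.sub_apply, ← sub_mul] using this
  have i2 : Integrable (fun ω => |(∫ u, emp P U n (hfc P U u) ω * s u ∂(νp + νm)) -
      ∫ u in rankBox n, emp P U n (hfc P U u) ω * s u ∂(νp + νm)|) P := (iZ.sub iB).abs
  refine le_trans ?_ (add_le_add le_rfl (setIntegral_le_integral i2
    (s := Good U n (tieLen κ n)) (ae_of_all _ fun _ => abs_nonneg _)))
  rw [← integral_add i1.restrict i2.restrict]
  refine integral_mono_of_nonneg (ae_of_all _ fun _ => abs_nonneg _)
    (i1.restrict.add i2.restrict) ?_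
  filter_upwards [ae_restrict_of_ae iE.prod_left_ae, ae_restrict_of_ae iH.prod_left_ae]
    with ω h1 h2
  have e : ∫ u in rankBox n, (ecp P U n u ω - emp P U n (hfc P U u) ω) * s u ∂(νp + νm) =
      (∫ u in rankBox n, ecp P U n u ω * s u ∂(νp + νm)) -
        ∫ u in rankBox n, emp P U n (hfc P U u) ω * s u ∂(νp + νm) := by
    rw [← integral_sub h1 h2]
    simp only [sub_mul]
  change _ ≤ |_| + |_|
  rw [e, abs_sub_comm (∫ u, emp P U n (hfc P U u) ω * s u ∂(νp + νm))]
  refine le_trans (le_of_eq ?_) (abs_add_le _ _)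
  congr 1; ring

end limit

end

/-! ### Sections of bounded variation -/

section

variable {P : Measure Ω} [IsProbabilityMeasure P]

/-- Truncation to the interval `[a, b]`. -/
def clip (a b x : ℝ) : ℝ := max a (min x b)

lemma monotone_clip (a b : ℝ) : Monotone (clip a b) := fun _ _ h =>
  max_le_max le_rfl (min_le_min h le_rfl)

lemma clip_mem {a b : ℝ} (hab : a ≤ b) (x : ℝ) : clip a b x ∈ Icc a b :=
  ⟨le_max_left _ _, max_le hab (min_le_right _ _)⟩

lemma clip_of_mem {a b x : ℝ} (hx : x ∈ Icc a b) : clip a b x = x := by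
  rw [clip, min_eq_left hx.2, max_eq_right hx.1]

lemma clip_lt_iff {a b x s : ℝ} (ha : a < s) (hb : s ≤ b) : clip a b x < s ↔ x < s := by
  rw [clip, max_lt_iff, min_lt_iff]
  exact ⟨fun h => h.2.resolve_right (not_lt.2 hb), fun h => ⟨ha, Or.inl h⟩⟩

lemma exists_monotone_sub {φ : ℝ → ℝ} {a b V : ℝ} (hab : a ≤ b) (hV : 0 ≤ V)
    (h : eVariationOn φ (Icc a b) ≤ ENNReal.ofReal V) :
    ∃ (p q : ℝ → ℝ) (c : ℝ), Monotone p ∧ Monotone q ∧ (∀ x, p x ∈ Icc 0 V) ∧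
      (∀ x, q x ∈ Icc 0 (2 * V)) ∧ ∀ x ∈ Icc a b, φ x = p x - q x + c := by
  have hb : BoundedVariationOn φ (Icc a b) := ne_top_of_le_ne_top ENNReal.ofReal_ne_top h
  have hl := hb.locallyBoundedVariationOn
  have ha : a ∈ Icc a b := left_mem_Icc.2 hab
  have hp := variationOnFromTo.monotoneOn hl ha
  have hq := variationOnFromTo.sub_self_monotoneOn hl ha
  have hpb : ∀ x ∈ Icc a b, variationOnFromTo φ (Icc a b) a x ∈ Icc 0 V := fun x hx => by
    refine ⟨variationOnFromTo.nonneg_of_le φ _ hx.1, ?_⟩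
    rw [variationOnFromTo.eq_of_le φ _ hx.1]
    exact ENNReal.toReal_le_of_le_ofReal hV ((eVariationOn.mono φ inter_subset_left).trans h)
  have hφ : ∀ x ∈ Icc a b, |φ x - φ a| ≤ V := fun x hx => by
    rw [← Real.dist_eq]
    exact (hb.dist_le hx ha).trans (ENNReal.toReal_le_of_le_ofReal hV h)
  refine ⟨fun x => variationOnFromTo φ (Icc a b) a (clip a b x), fun x =>
    variationOnFromTo φ (Icc a b) a (clip a b x) - φ (clip a b x) + φ a, φ a,
    fun x y hxy => hp (clip_mem hab x) (clip_mem hab y) (monotone_clip a b hxy),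
    fun x y hxy => ?_, fun x => hpb _ (clip_mem hab x), fun x => ?_, fun x hx => ?_⟩
  · have := hq (clip_mem hab x) (clip_mem hab y) (monotone_clip a b hxy)
    simp only [Pi.sub_apply] at this
    simp only; linarith
  · have h1 := hpb _ (clip_mem hab x)
    have h2 := abs_le.1 (hφ _ (clip_mem hab x))
    have h3 := hq ha (clip_mem hab x) (clip_mem hab x).1
    simp only [Pi.sub_apply, variationOnFromTo.self] at h3
    constructor <;> linarith [h1.2]
  · simp only [clip_of_mem hx]; ring

/-- Two measures with the same mass whose distribution functions differ by at most `D`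
differ by at most `D` on all upper sets. -/
lemma abs_measureReal_upperSet_sub_le {μ₁ μ₂ : Measure ℝ} [IsFiniteMeasure μ₁] [IsFiniteMeasure μ₂]
    (huniv : μ₁.real univ = μ₂.real univ) {D : ℝ} (hD : 0 ≤ D)
    (h : ∀ s, |μ₁.real (Iio s) - μ₂.real (Iio s)| ≤ D) {S : Set ℝ} (hS : IsUpperSet S) :
    |μ₁.real S - μ₂.real S| ≤ D := by
  have hIci : ∀ s, |μ₁.real (Ici s) - μ₂.real (Ici s)| ≤ D := fun s => by
    rw [← compl_Iio, measureReal_compl measurableSet_Iio, measureReal_compl measurableSet_Iio, huniv,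
      sub_sub_sub_cancel_left, abs_sub_comm]
    exact h s
  have hIoi : ∀ s, |μ₁.real (Ioi s) - μ₂.real (Ioi s)| ≤ D := fun s => by
    obtain ⟨u, hu1, hu2, hu3⟩ := exists_seq_strictAnti_tendsto s
    have hun : ⋃ k, Ici (u k) = Ioi s := by
      ext x
      simp only [mem_iUnion, mem_Ici, mem_Ioi]
      refine ⟨fun ⟨k, hk⟩ => (hu2 k).trans_le hk, fun hx => ?_⟩
      obtain ⟨k, hk⟩ := (hu3.eventually_lt_const hx).exists
      exact ⟨k, hk.le⟩
    have hlim : ∀ (μ : Measure ℝ) [IsFiniteMeasure μ], Tendsto (fun k => μ.real (Ici (u k))) atTop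
        (nhds (μ.real (Ioi s))) := fun μ _ => by
      rw [← hun]
      exact (ENNReal.tendsto_toReal (measure_ne_top _ _)).comp (tendsto_measure_iUnion_atTop
        fun k l hkl => Ici_subset_Ici.2 (hu1.antitone hkl))
    exact le_of_tendsto ((hlim μ₁).sub (hlim μ₂)).abs (Eventually.of_forall fun k => hIci _)
  rcases S.eq_empty_or_nonempty with rfl | hne
  · simpa using hD
  by_cases hbdd : BddBelow S
  · by_cases hm : sInf S ∈ S
    · have : S = Ici (sInf S) := by
        ext x
        exact ⟨fun hx => csInf_le hbdd hx, fun hx => hS hx hm⟩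
      rw [this]; exact hIci _
    · have : S = Ioi (sInf S) := by
        ext x
        refine ⟨fun hx => lt_of_le_of_ne (csInf_le hbdd hx) fun e => hm (e ▸ hx), fun hx => ?_⟩
        obtain ⟨y, hy, hyx⟩ := exists_lt_of_csInf_lt hne hx
        exact hS hyx.le hy
      rw [this]; exact hIoi _
  · have : S = univ := by
      refine eq_univ_of_forall fun x => ?_
      obtain ⟨y, hy, hyx⟩ := not_bddBelow_iff.1 hbdd x
      exact hS hyx.le hy
    rw [this, huniv]; simpa using hD

lemma abs_sum_sub_integral_le_of_monotone {n : ℕ} {y : ℤ → ℝ} {z : Ω → ℝ} (hz : Measurable z)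
    {D : ℝ} (h : ∀ s, |∑ i ∈ Finset.Icc (1 : ℤ) n, lt01 (y i) s - n * P.real {ω | z ω < s}| ≤ D)
    {p : ℝ → ℝ} (hp : Monotone p) {V : ℝ} (hV : 0 ≤ V) (hpV : ∀ x, p x ∈ Icc 0 V) :
    |∑ i ∈ Finset.Icc (1 : ℤ) n, p (y i) - n * ∫ ω, p (z ω) ∂P| ≤ V * D := by
  set μ₁ : Measure ℝ := ∑ i ∈ Finset.Icc (1 : ℤ) n, Measure.dirac (y i) with hμ₁
  set μ₂ : Measure ℝ := (n : ℝ≥0∞) • P.map z with hμ₂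
  have : IsProbabilityMeasure (P.map z) := Measure.isProbabilityMeasure_map hz.aemeasurable
  have : IsFiniteMeasure μ₂ := by
    rw [hμ₂]
    refine ⟨?_⟩
    rw [Measure.smul_apply, measure_univ, smul_eq_mul, mul_one]
    exact ENNReal.natCast_lt_top n
  have hreal1 : ∀ A : Set ℝ, MeasurableSet A →
      μ₁.real A = ∑ i ∈ Finset.Icc (1 : ℤ) n, A.indicator 1 (y i) := fun A hA => by
    rw [measureReal_def, hμ₁, Measure.finsetSum_apply, ENNReal.toReal_sum
      (fun i _ => measure_ne_top _ _)]
    refine Finset.sum_congr rfl fun i _ => ?_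
    rw [Measure.dirac_apply' _ hA]
    by_cases hi : y i ∈ A <;> simp [hi]
  have hreal2 : ∀ A : Set ℝ, MeasurableSet A → μ₂.real A = n * P.real (z ⁻¹' A) := fun A hA => by
    rw [hμ₂, measureReal_def, Measure.smul_apply, Measure.map_apply hz hA]; simp [measureReal_def]
  have hu : μ₁.real univ = μ₂.real univ := by
    rw [hreal1 _ MeasurableSet.univ, hreal2 _ MeasurableSet.univ]; simp
  have hIio : ∀ s, |μ₁.real (Iio s) - μ₂.real (Iio s)| ≤ D := fun s => by
    rw [hreal1 _ measurableSet_Iio, hreal2 _ measurableSet_Iio]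
    exact h s
  have hD0 : 0 ≤ D := (abs_nonneg _).trans (h 0)
  have := abs_integral_sub_integral_le_of_superlevel μ₁ μ₂ hp.measurable hV (ae_of_all _ hpV)
    (ae_of_all _ hpV) fun t _ => abs_measureReal_upperSet_sub_le hu hD0 hIio
      (S := {a | t ≤ p a}) fun x y hxy hx => le_trans hx (hp hxy)
  rwa [hμ₁, integral_finsetSum_measure fun i _ => integrable_dirac (by simp), hμ₂,
    integral_smul_measure, integral_map hz.aemeasurable hp.measurable.aestronglyMeasurable,
    Finset.sum_congr rfl fun i _ => integral_dirac _ _, ENNReal.toReal_natCast, smul_eq_mul] at this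

/-- Koksma-type inequality. -/
lemma abs_sum_sub_integral_le_of_eVariationOn {n : ℕ} {y : ℤ → ℝ} {z : Ω → ℝ} (hz : Measurable z)
    {D : ℝ} (h : ∀ s, |∑ i ∈ Finset.Icc (1 : ℤ) n, lt01 (y i) s - n * P.real {ω | z ω < s}| ≤ D)
    {φ : ℝ → ℝ} {a b V : ℝ} (hab : a ≤ b) (hV : 0 ≤ V)
    (hφ : eVariationOn φ (Icc a b) ≤ ENNReal.ofReal V)
    (hy : ∀ i ∈ Finset.Icc (1 : ℤ) n, y i ∈ Icc a b) (hzm : ∀ ω, z ω ∈ Icc a b) :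
    |∑ i ∈ Finset.Icc (1 : ℤ) n, φ (y i) - n * ∫ ω, φ (z ω) ∂P| ≤ 3 * V * D := by
  obtain ⟨p, q, c, hp, hq, hpV, hqV, e⟩ := exists_monotone_sub hab hV hφ
  have h1 := abs_sum_sub_integral_le_of_monotone hz h hp hV hpV
  have h2 := abs_sum_sub_integral_le_of_monotone hz h hq (by linarith) hqV
  have ip : Integrable (fun ω => p (z ω)) P :=
    integrable_of_abs_le (hp.measurable.comp hz) (M := V) fun ω => by
      rw [abs_of_nonneg (hpV _).1]; exact (hpV _).2
  have iq : Integrable (fun ω => q (z ω)) P :=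
    integrable_of_abs_le (hq.measurable.comp hz) (M := 2 * V) fun ω => by
      rw [abs_of_nonneg (hqV _).1]; exact (hqV _).2
  have e1 : ∑ i ∈ Finset.Icc (1 : ℤ) n, φ (y i) = ∑ i ∈ Finset.Icc (1 : ℤ) n, p (y i) -
      ∑ i ∈ Finset.Icc (1 : ℤ) n, q (y i) + n * c := by
    rw [Finset.sum_congr rfl fun i hi => e _ (hy i hi), Finset.sum_add_distrib,
      Finset.sum_sub_distrib]
    simp
  have e2 : ∫ ω, φ (z ω) ∂P = (∫ ω, p (z ω) ∂P) - (∫ ω, q (z ω) ∂P) + c := by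
    simp only [fun ω => e _ (hzm ω)]
    have ipq : Integrable (fun ω => p (z ω) - q (z ω)) P := ip.sub iq
    rw [integral_add ipq (integrable_const _), integral_sub ip iq]
    simp
  rw [e1, e2]
  calc _ = |(∑ i ∈ Finset.Icc (1 : ℤ) n, p (y i) - n * ∫ ω, p (z ω) ∂P) -
        (∑ i ∈ Finset.Icc (1 : ℤ) n, q (y i) - n * ∫ ω, q (z ω) ∂P)| := by congr 1; ring
    _ ≤ _ := (abs_sub _ _).trans (by linarith)

/-- On the good event the ranks are close to the truncated uniform law. -/
lemma UnifSeq.abs_sum_lt01_sub_clip_le {U : ℤ → Ω → Fin d → ℝ} (h : UnifSeq P U) {n L : ℕ}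
    (hL : 1 ≤ L) {ω : Ω} (hω : ω ∈ Good U n L) (j : Fin d) (s : ℝ) :
    |∑ i ∈ Finset.Icc (1 : ℤ) n, lt01 (pseudoObs U n i ω j) s - n * P.real {ω' |
      clip (1 / ((n : ℝ) + 1)) (((n : ℝ) + 1) / (n + 2)) (U 0 ω' j) < s}| ≤ L := by
  set a := 1 / ((n : ℝ) + 1)
  set b := ((n : ℝ) + 1) / (n + 2)
  have hL0 : (0 : ℝ) ≤ L := Nat.cast_nonneg L
  have ha : 0 < a := by positivity
  have hb : b < 1 := (div_lt_one (by positivity)).2 (by linarith)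
  have hnb : (n : ℝ) / ((n : ℝ) + 1) ≤ b := by
    rw [div_le_div_iff₀ (by positivity) (by positivity)]; nlinarith
  have hpo : ∀ i ∈ Finset.Icc (1 : ℤ) n, a ≤ pseudoObs U n i ω j ∧ pseudoObs U n i ω j ≤ b :=
    fun i hi => by
      rw [pseudoObs_eq_rk]
      exact ⟨(rk_mem n _ hi).1, (rk_mem n _ hi).2.trans hnb⟩
  rcases le_or_gt s a with hs | hs
  · have e1 : {ω' | clip a b (U 0 ω' j) < s} = ∅ :=
      eq_empty_of_forall_notMem fun ω' hω' => not_lt.2 (hs.trans (le_max_left _ _)) hω'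
    have e2 : ∀ i ∈ Finset.Icc (1 : ℤ) n, lt01 (pseudoObs U n i ω j) s = 0 := fun i hi =>
      if_neg (not_lt.2 (hs.trans (hpo i hi).1))
    rw [e1, Finset.sum_eq_zero e2]
    simpa using hL0
  rcases lt_or_ge b s with hs2 | hs2
  · have e1 : {ω' | clip a b (U 0 ω' j) < s} = univ :=
      eq_univ_of_forall fun ω' => max_lt hs ((min_le_right _ _).trans_lt hs2)
    have e2 : ∀ i ∈ Finset.Icc (1 : ℤ) n, lt01 (pseudoObs U n i ω j) s = 1 := fun i hi =>
      if_pos ((hpo i hi).2.trans_lt hs2)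
    rw [e1, Finset.sum_congr rfl e2]
    simpa using hL0
  · have hsI : s ∈ Icc (0 : ℝ) 1 := ⟨(ha.trans hs).le, hs2.trans hb.le⟩
    simp only [clip_lt_iff hs hs2, h.prob_lt j hsI]
    have := abs_sum_pseudoObs_le hL hω j hsI
    rwa [Finset.sum_sub_distrib, Finset.sum_const, Int.card_Icc, add_sub_cancel_right,
      Int.toNat_natCast, nsmul_eq_mul] at this

end

/-! ### Score functions -/

section

variable {P : Measure Ω} [IsProbabilityMeasure P] {U : ℤ → Ω → Fin 2 → ℝ}
variable {νp νm : Measure (Fin 2 → ℝ)} {w : ℝ}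

/-- A score function together with the Jordan pair of the attached signed measure. -/
structure ScoreFn (J : (Fin 2 → ℝ) → ℝ) (νp νm : Measure (Fin 2 → ℝ)) (w c₀ c₁ δ₀ : ℝ) : Prop
    extends ScoreMeas νp νm w where
  repr : ∀ x y : Fin 2 → ℝ, (∀ j, 0 < x j) → (∀ j, x j ≤ y j) → (∀ j, y j < 1) →
      (νp {w | ∀ j, x j < w j ∧ w j ≤ y j}).toReal - (νm {w | ∀ j, x j < w j ∧ w j ≤ y j}).toReal
        = J y - J (Function.update y 0 (x 0)) - J (Function.update y 1 (x 1)) + J x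
  bound : ∀ u : Fin 2 → ℝ, (∀ j, 0 < u j ∧ u j < 1) → |J u| ≤ c₀ * (gW w u)⁻¹
  pos : 0 < δ₀
  bdry : ∀ δ ∈ Set.Ioo (0 : ℝ) δ₀,
      eVariationOn (fun s => J ![s, 1 - δ]) (Set.Ioc δ (1 - δ)) ≤ ENNReal.ofReal (c₁ * δ ^ (-w)) ∧
      eVariationOn (fun s => J ![1 - δ, s]) (Set.Ioc δ (1 - δ)) ≤ ENNReal.ofReal (c₁ * δ ^ (-w))

/-- Lower end of the range of the ranks. -/
def lo (n : ℕ) : ℝ := 1 / ((n : ℝ) + 1)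

/-- Upper end of the range of the ranks. -/
def hi (n : ℕ) : ℝ := ((n : ℝ) + 1) / (n + 2)

lemma lo_pos (n : ℕ) : 0 < lo n := by unfold lo; positivity

lemma hi_eq (n : ℕ) : hi n = 1 - 1 / ((n : ℝ) + 2) := rankBox_upper n

lemma hi_lt_one (n : ℕ) : hi n < 1 := by
  rw [hi_eq]; linarith [(by positivity : (0 : ℝ) < 1 / ((n : ℝ) + 2))]

lemma half_le_hi (n : ℕ) : 1 / 2 ≤ hi n := by
  unfold hi; rw [div_le_div_iff₀ (by positivity) (by positivity)]; linarith [n.cast_nonneg (α := ℝ)]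

lemma lo_le_half {n : ℕ} (hn : 0 < n) : lo n ≤ 1 / 2 := by
  have : (1 : ℝ) ≤ n := by exact_mod_cast hn
  unfold lo; gcongr; linarith

lemma lo_le_hi {n : ℕ} (hn : 0 < n) : lo n ≤ hi n := (lo_le_half hn).trans (half_le_hi n)

/-- Coordinatewise truncation to the range of the ranks. -/
def clipV (n : ℕ) (x : Fin 2 → ℝ) : Fin 2 → ℝ := fun j => clip (lo n) (hi n) (x j)

lemma measurable_clipV (n : ℕ) : Measurable (clipV n) :=
  measurable_pi_lambda _ fun j => (monotone_clip _ _).measurable.comp (measurable_pi_apply j)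

lemma clipV_mem {n : ℕ} (hn : 0 < n) (x : Fin 2 → ℝ) (j : Fin 2) : clipV n x j ∈ Icc (lo n) (hi n) :=
  clip_mem (lo_le_hi hn) _

lemma clipV_mem_cube {n : ℕ} (hn : 0 < n) (x : Fin 2 → ℝ) : clipV n x ∈ cube := fun j =>
  ⟨(lo_pos n).trans_le (clipV_mem hn x j).1, (clipV_mem hn x j).2.trans_lt (hi_lt_one n)⟩

lemma clipV_of_mem {n : ℕ} {x : Fin 2 → ℝ} (hx : ∀ j, x j ∈ Icc (lo n) (hi n)) : clipV n x = x :=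
  funext fun j => clip_of_mem (hx j)

lemma pseudoObs_mem {n : ℕ} {i : ℤ} (hi' : i ∈ Finset.Icc (1 : ℤ) n) (ω : Ω) (j : Fin 2) :
    pseudoObs U n i ω j ∈ Icc (lo n) (hi n) := by
  rw [pseudoObs_eq_rk]
  refine ⟨(rk_mem n _ hi').1, (rk_mem n _ hi').2.trans ?_⟩
  unfold hi
  rw [div_le_div_iff₀ (by positivity) (by positivity)]; nlinarith

/-- The part of the score that is not determined by its boundary sections. -/
def core (νp νm : Measure (Fin 2 → ℝ)) (s : (Fin 2 → ℝ) → ℝ) (n : ℕ) (x : Fin 2 → ℝ) : ℝ :=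
  ∫ u in rankBox n, (∏ j, lt01 (x j) (u j)) * s u ∂(νp + νm)

lemma measurable_comp_clip {φ : ℝ → ℝ} {a b V : ℝ} (hab : a ≤ b) (hV : 0 ≤ V)
    (h : eVariationOn φ (Icc a b) ≤ ENNReal.ofReal V) :
    Measurable (fun x => φ (clip a b x)) ∧ ∃ M, ∀ x, |φ (clip a b x)| ≤ M := by
  obtain ⟨p, q, c, hp, hq, hpV, hqV, e⟩ := exists_monotone_sub hab hV h
  have e' : (fun x => φ (clip a b x)) = fun x => p (clip a b x) - q (clip a b x) + c :=
    funext fun x => e _ (clip_mem hab x)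
  refine ⟨?_, 3 * V + |c|, fun x => ?_⟩
  · rw [e']
    exact ((hp.measurable.comp (monotone_clip a b).measurable).sub
      (hq.measurable.comp (monotone_clip a b).measurable)).add_const c
  · rw [e _ (clip_mem hab x)]
    have h1 := hpV (clip a b x)
    have h2 := hqV (clip a b x)
    refine (abs_add_le _ _).trans (add_le_add_left ?_ _)
    rw [abs_le]; constructor <;> linarith [h1.1, h1.2, h2.1, h2.2]

section score
variable {J : (Fin 2 → ℝ) → ℝ} {c₀ c₁ δ₀ : ℝ} {s : (Fin 2 → ℝ) → ℝ}

lemma ScoreFn.eVariationOn_le (hJ : ScoreFn J νp νm w c₀ c₁ δ₀) {n : ℕ}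
    (hn : 1 / ((n : ℝ) + 2) < δ₀) :
    eVariationOn (fun x => J ![x, hi n]) (Icc (lo n) (hi n)) ≤
      ENNReal.ofReal (|c₁| * ((n : ℝ) + 2) ^ w) ∧
    eVariationOn (fun x => J ![hi n, x]) (Icc (lo n) (hi n)) ≤
      ENNReal.ofReal (|c₁| * ((n : ℝ) + 2) ^ w) := by
  have hpos : (0 : ℝ) < 1 / ((n : ℝ) + 2) := by positivity
  obtain ⟨h1, h2⟩ := hJ.bdry _ ⟨hpos, hn⟩
  rw [← hi_eq] at h1 h2
  have hsub : Icc (lo n) (hi n) ⊆ Ioc (1 / ((n : ℝ) + 2)) (hi n) := fun x hx =>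
    ⟨lt_of_lt_of_le (by unfold lo; gcongr; norm_num) hx.1, hx.2⟩
  have e : (1 / ((n : ℝ) + 2)) ^ (-w) = ((n : ℝ) + 2) ^ w := by
    rw [one_div, Real.inv_rpow (by positivity), Real.rpow_neg (by positivity), inv_inv]
  have hc : ENNReal.ofReal (c₁ * (1 / ((n : ℝ) + 2)) ^ (-w)) ≤
      ENNReal.ofReal (|c₁| * ((n : ℝ) + 2) ^ w) := by
    rw [e]
    exact ENNReal.ofReal_le_ofReal (mul_le_mul_of_nonneg_right (le_abs_self _) (by positivity))
  exact ⟨((eVariationOn.mono _ hsub).trans h1).trans hc,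
    ((eVariationOn.mono _ hsub).trans h2).trans hc⟩

lemma ScoreFn.eq_core (hJ : ScoreFn J νp νm w c₀ c₁ δ₀)
    (hsJ : ∀ f : (Fin 2 → ℝ) → ℝ, Integrable f (νp + νm) →
      ∫ u, f u * s u ∂(νp + νm) = sJint νp νm f) {n : ℕ} {x : Fin 2 → ℝ}
    (hx : ∀ j, x j ∈ Icc (lo n) (hi n)) :
    J x = J ![x 0, hi n] + J ![hi n, x 1] - J ![hi n, hi n] + core νp νm s n x := by
  set B := {v : Fin 2 → ℝ | ∀ j, x j < v j ∧ v j ≤ hi n} with hB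
  have hBm : MeasurableSet B := by
    rw [hB, ofPred_forall]
    exact MeasurableSet.iInter fun j => (measurableSet_lt measurable_const
      (measurable_pi_apply j)).inter (measurableSet_le (measurable_pi_apply j) measurable_const)
  have hBs : B ⊆ rankBox n := fun v hv j => ⟨(hx j).1.trans_lt (hv j).1, (hv j).2⟩
  have hr := hJ.repr x (fun _ => hi n) (fun j => (lo_pos n).trans_le (hx j).1)
    (fun j => (hx j).2) fun _ => hi_lt_one n
  have u0 : Function.update (fun _ : Fin 2 => hi n) 0 (x 0) = ![x 0, hi n] := by
    ext j; fin_cases j <;> simp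
  have u1 : Function.update (fun _ : Fin 2 => hi n) 1 (x 1) = ![hi n, x 1] := by
    ext j; fin_cases j <;> simp
  have u2 : (fun _ : Fin 2 => hi n) = ![hi n, hi n] := by
    ext j; fin_cases j <;> simp
  rw [u0, u1, u2] at hr
  have e : core νp νm s n x = ∫ u, B.indicator (fun _ => (1 : ℝ)) u * s u ∂(νp + νm) := by
    rw [core, ← integral_indicator (measurableSet_rankBox n)]
    refine integral_congr_ae (ae_of_all _ fun u => ?_)
    by_cases hu : u ∈ rankBox n
    · simp only [indicator_of_mem hu]
      congr 1
      by_cases huB : u ∈ B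
      · rw [indicator_of_mem huB]
        exact Finset.prod_eq_one fun j _ => if_pos (huB j).1
      · rw [indicator_of_notMem huB]
        have : ∃ j, ¬ x j < u j := by
          by_contra! hc
          exact huB fun j => ⟨hc j, (hu j).2⟩
        obtain ⟨j, hj⟩ := this
        exact Finset.prod_eq_zero (Finset.mem_univ j) (if_neg hj)
    · have huB : u ∉ B := fun h => hu (hBs h)
      simp [hu, huB]
  have hBfin : (νp + νm) B ≠ ⊤ := ne_top_of_le_ne_top (hJ.rankBox_ne_top n) (measure_mono hBs)
  rw [e, hsJ _ ((integrable_indicator_iff hBm).2 (integrableOn_const hBfin)), sJint,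
    integral_indicator_const _ hBm, integral_indicator_const _ hBm]
  simp only [smul_eq_mul, mul_one, Measure.real]
  rw [hB]
  linarith

lemma ScoreMeas.measurable_core (hν : ScoreMeas νp νm w) (hsm : Measurable s) (n : ℕ) :
    Measurable (core νp νm s n) := by
  have := hν.sigmaFinite
  have h1 : Measurable fun q : (Fin 2 → ℝ) × (Fin 2 → ℝ) => (∏ j, lt01 (q.1 j) (q.2 j)) * s q.2 :=
    ((measurable_prod_lt01_joint (F := fun x : Fin 2 → ℝ => x) fun j =>
      measurable_pi_apply j).comp measurable_swap).mul (hsm.comp measurable_snd)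
  exact (h1.stronglyMeasurable.integral_prod_right (ν := (νp + νm).restrict (rankBox n))).measurable

lemma ScoreFn.measurable_comp_clipV (hJ : ScoreFn J νp νm w c₀ c₁ δ₀) {n : ℕ} (hn0 : 0 < n)
    (hn : 1 / ((n : ℝ) + 2) < δ₀) : Measurable fun x => J (clipV n x) := by
  obtain ⟨s, hsm, -, hsJ⟩ := hJ.exists_sign
  obtain ⟨h1, h2⟩ := hJ.eVariationOn_le hn
  have hV : 0 ≤ |c₁| * ((n : ℝ) + 2) ^ w := by positivity
  simp only [fun x => hJ.eq_core hsJ (clipV_mem hn0 x)]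
  exact ((((measurable_comp_clip (lo_le_hi hn0) hV h1).1.comp (measurable_pi_apply 0)).add
    ((measurable_comp_clip (lo_le_hi hn0) hV h2).1.comp (measurable_pi_apply 1))).sub_const _).add
    ((hJ.measurable_core hsm n).comp (measurable_clipV n))

lemma ScoreFn.eventually_lt (hJ : ScoreFn J νp νm w c₀ c₁ δ₀) :
    ∀ᶠ n : ℕ in atTop, 1 / ((n : ℝ) + 2) < δ₀ := by
  filter_upwards [(tendsto_one_div_add_atTop_nhds_zero_nat (𝕜 := ℝ)).eventually_lt_const hJ.pos]
    with n hn
  refine lt_of_le_of_lt ?_ hn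
  gcongr; norm_num

lemma ScoreFn.measurable_indicator (hJ : ScoreFn J νp νm w c₀ c₁ δ₀) :
    Measurable (cube.indicator J) := by
  obtain ⟨N, hN⟩ := eventually_atTop.1 (hJ.eventually_lt.and (eventually_gt_atTop 0))
  refine measurable_of_tendsto_metrizable (f := fun m : ℕ => cube.indicator fun x =>
    J (clipV (m + N) x)) (fun m => ?_) (tendsto_pi_nhds.2 fun x => ?_)
  · obtain ⟨h1, h2⟩ := hN (m + N) (by omega)
    exact (hJ.measurable_comp_clipV h2 h1).indicator measurableSet_cube
  · by_cases hx : x ∈ cube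
    · simp only [indicator_of_mem hx]
      refine tendsto_const_nhds.congr' ?_
      filter_upwards [(tendsto_add_atTop_nat N).eventually (eventually_mem_rankBox hx)] with m hm
      rw [clipV_of_mem fun j => ⟨(hm j).1.le, (hm j).2⟩]
    · simp [hx]

end score

end

/-! ### Representation of the rank statistic -/

section

variable {P : Measure Ω} [IsProbabilityMeasure P] {U : ℤ → Ω → Fin 2 → ℝ}
variable {νp νm : Measure (Fin 2 → ℝ)} {w : ℝ}
variable {J : (Fin 2 → ℝ) → ℝ} {c₀ c₁ δ₀ : ℝ} {s : (Fin 2 → ℝ) → ℝ}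

lemma ScoreMeas.abs_core_le (hν : ScoreMeas νp νm w) (hs : ∀ u, |s u| = 1) (n : ℕ)
    (x : Fin 2 → ℝ) : |core νp νm s n x| ≤ (νp + νm).real (rankBox n) := by
  have := norm_setIntegral_le_of_norm_le_const (μ := νp + νm) (s := rankBox n) (C := 1)
    (f := fun u => (∏ j, lt01 (x j) (u j)) * s u) (hν.rankBox_ne_top n).lt_top fun u _ => by
      rw [norm_mul, Real.norm_eq_abs, Real.norm_eq_abs, hs, mul_one,
        abs_of_nonneg (prod_lt01_mem x u).1]
      exact (prod_lt01_mem x u).2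
  simpa [core] using this

lemma UnifSeq.integral_core_clipV (h : UnifSeq P U) (hν : ScoreMeas νp νm w) (hsm : Measurable s)
    (hs : ∀ u, |s u| = 1) (n : ℕ) :
    ∫ ω, core νp νm s n (clipV n (U 0 ω)) ∂P = ∫ u in rankBox n, cop P U u * s u ∂(νp + νm) := by
  have := hν.sigmaFinite
  have : IsFiniteMeasure ((νp + νm).restrict (rankBox n)) :=
    ⟨by simpa using (hν.rankBox_ne_top n).lt_top⟩
  have hm : Measurable fun q : Ω × (Fin 2 → ℝ) =>
      (∏ j, lt01 (clipV n (U 0 q.1) j) (q.2 j)) * s q.2 :=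
    ((measurable_prod_lt01_joint (F := fun ω => clipV n (U 0 ω)) fun j =>
      (measurable_pi_apply j).comp ((measurable_clipV n).comp (h.meas 0))).comp
        measurable_swap).mul (hsm.comp measurable_snd)
  have hi : Integrable (fun q : Ω × (Fin 2 → ℝ) =>
      (∏ j, lt01 (clipV n (U 0 q.1) j) (q.2 j)) * s q.2) (P.prod ((νp + νm).restrict (rankBox n))) :=
    integrable_of_abs_le (M := 1) hm fun q => by
      have := prod_lt01_mem (clipV n (U 0 q.1)) q.2
      rw [abs_mul, hs, mul_one, abs_of_nonneg this.1]; exact this.2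
  have hsw := integral_integral_swap (f := fun ω u => (∏ j, lt01 (clipV n (U 0 ω) j) (u j)) * s u) hi
  unfold core
  rw [hsw]
  refine setIntegral_congr_fun (measurableSet_rankBox n) fun u hu => ?_
  simp only [integral_mul_const]
  rw [← h.integral_prod_lt01 u]
  congr 2 with ω
  refine Finset.prod_congr rfl fun j _ => ?_
  exact if_congr (clip_lt_iff (hu j).1 (hu j).2) rfl rfl

lemma measurable_prod_lt01_right (x : Fin 2 → ℝ) :
    Measurable fun u : Fin 2 → ℝ => ∏ j, lt01 (x j) (u j) :=
  Finset.measurable_fun_prod _ fun j _ => Measurable.ite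
    (measurableSet_lt measurable_const (measurable_pi_apply j)) measurable_const measurable_const

/-- The rank statistic is a linear functional of the empirical copula process up to
boundary terms. -/
lemma UnifSeq.abs_sum_score_sub_le (h : UnifSeq P U) (hJ : ScoreFn J νp νm w c₀ c₁ δ₀)
    (hsm : Measurable s) (hs : ∀ u, |s u| = 1)
    (hsJ : ∀ f : (Fin 2 → ℝ) → ℝ, Integrable f (νp + νm) →
      ∫ u, f u * s u ∂(νp + νm) = sJint νp νm f) {n L : ℕ} (hn0 : 0 < n)
    (hn : 1 / ((n : ℝ) + 2) < δ₀) (hL : 1 ≤ L) {ω : Ω} (hω : ω ∈ Good U n L) :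
    |(Real.sqrt n)⁻¹ * (∑ i ∈ Finset.Icc (1 : ℤ) n, J (pseudoObs U n i ω) -
        n * ∫ ω', J (clipV n (U 0 ω')) ∂P) - ∫ u in rankBox n, ecp P U n u ω * s u ∂(νp + νm)| ≤
      6 * |c₁| * ((n : ℝ) + 2) ^ w * ((Real.sqrt n)⁻¹ * L) := by
  have : IsFiniteMeasure ((νp + νm).restrict (rankBox n)) :=
    ⟨by simpa using (hJ.rankBox_ne_top n).lt_top⟩
  obtain ⟨h1, h2⟩ := hJ.eVariationOn_le hn
  set V := |c₁| * ((n : ℝ) + 2) ^ w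
  have hV : 0 ≤ V := by positivity
  have hab := lo_le_hi hn0
  obtain ⟨m1, M1, b1⟩ := measurable_comp_clip hab hV h1
  obtain ⟨m2, M2, b2⟩ := measurable_comp_clip hab hV h2
  have hz : ∀ j, Measurable fun ω => clip (lo n) (hi n) (U 0 ω j) := fun j =>
    (monotone_clip _ _).measurable.comp (h.meas_coord 0 j)
  have i1 : Integrable (fun ω => J ![clipV n (U 0 ω) 0, hi n]) P :=
    integrable_of_abs_le (m1.comp (h.meas_coord 0 0)) fun ω => b1 _
  have i2 : Integrable (fun ω => J ![hi n, clipV n (U 0 ω) 1]) P :=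
    integrable_of_abs_le (m2.comp (h.meas_coord 0 1)) fun ω => b2 _
  have i3 : Integrable (fun ω => core νp νm s n (clipV n (U 0 ω))) P :=
    integrable_of_abs_le (((hJ.measurable_core hsm n).comp (measurable_clipV n)).comp (h.meas 0))
      fun ω => hJ.abs_core_le hs n _
  have eE : ∫ ω', J (clipV n (U 0 ω')) ∂P = (∫ ω', J ![clipV n (U 0 ω') 0, hi n] ∂P) +
      (∫ ω', J ![hi n, clipV n (U 0 ω') 1] ∂P) - J ![hi n, hi n] +
      ∫ u in rankBox n, cop P U u * s u ∂(νp + νm) := by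
    simp only [fun ω => hJ.eq_core hsJ (clipV_mem hn0 (U 0 ω))]
    have i12 : Integrable (fun ω => J ![clipV n (U 0 ω) 0, hi n] + J ![hi n, clipV n (U 0 ω) 1]) P :=
      i1.add i2
    have i4 : Integrable (fun ω => J ![clipV n (U 0 ω) 0, hi n] + J ![hi n, clipV n (U 0 ω) 1] -
      J ![hi n, hi n]) P := i12.sub (integrable_const _)
    rw [integral_add i4 i3, integral_sub i12 (integrable_const _), integral_add i1 i2,
      h.integral_core_clipV hJ.toScoreMeas hsm hs]
    simp
  have eS : ∑ i ∈ Finset.Icc (1 : ℤ) n, J (pseudoObs U n i ω) =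
      (∑ i ∈ Finset.Icc (1 : ℤ) n, J ![pseudoObs U n i ω 0, hi n]) +
      (∑ i ∈ Finset.Icc (1 : ℤ) n, J ![hi n, pseudoObs U n i ω 1]) - n * J ![hi n, hi n] +
      ∑ i ∈ Finset.Icc (1 : ℤ) n, core νp νm s n (pseudoObs U n i ω) := by
    rw [Finset.sum_congr rfl fun i hi' => hJ.eq_core hsJ (pseudoObs_mem hi' ω),
      Finset.sum_add_distrib, Finset.sum_sub_distrib, Finset.sum_add_distrib]
    simp
  have ic : ∀ i, Integrable (fun u => (∏ j, lt01 (pseudoObs U n i ω j) (u j)) * s u)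
      ((νp + νm).restrict (rankBox n)) := fun i => by
    refine integrable_of_abs_le (M := 1) ((measurable_prod_lt01_right _).mul hsm) fun u => ?_
    have := prod_lt01_mem (pseudoObs U n i ω) u
    rw [abs_mul, hs, mul_one, abs_of_nonneg this.1]; exact this.2
  have icop : Integrable (fun u => cop P U u * s u) ((νp + νm).restrict (rankBox n)) := by
    refine integrable_of_abs_le (M := 1) (h.measurable_cop.mul hsm) fun u => ?_
    rw [abs_mul, hs, mul_one, abs_of_nonneg (show 0 ≤ cop P U u from ENNReal.toReal_nonneg)]
    exact measureReal_le_one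
  have eC : ∫ u in rankBox n, ecp P U n u ω * s u ∂(νp + νm) = (Real.sqrt n)⁻¹ *
      (∑ i ∈ Finset.Icc (1 : ℤ) n, core νp νm s n (pseudoObs U n i ω) -
        n * ∫ u in rankBox n, cop P U u * s u ∂(νp + νm)) := by
    have isum : Integrable (fun u => ∑ i ∈ Finset.Icc (1 : ℤ) n,
        (∏ j, lt01 (pseudoObs U n i ω j) (u j)) * s u) ((νp + νm).restrict (rankBox n)) :=
      integrable_finsetSum _ fun i _ => ic i
    have e1 : ∀ u, ecp P U n u ω * s u = (Real.sqrt n)⁻¹ * ((∑ i ∈ Finset.Icc (1 : ℤ) n,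
        (∏ j, lt01 (pseudoObs U n i ω j) (u j)) * s u) - n * (cop P U u * s u)) := fun u => by
      rw [ecp, Finset.sum_sub_distrib, ← Finset.sum_mul]
      simp
      ring
    simp only [e1]
    rw [integral_const_mul, integral_sub isum (icop.const_mul _), integral_const_mul,
      integral_finsetSum (f := fun i u => (∏ j, lt01 (pseudoObs U n i ω j) (u j)) * s u) _
        fun i _ => ic i]
    rfl
  have k1 := abs_sum_sub_integral_le_of_eVariationOn (hz 0) (h.abs_sum_lt01_sub_clip_le hL hω 0)
    hab hV h1 (fun i hi' => pseudoObs_mem hi' ω 0) fun ω' => clip_mem hab _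
  have k2 := abs_sum_sub_integral_le_of_eVariationOn (hz 1) (h.abs_sum_lt01_sub_clip_le hL hω 1)
    hab hV h2 (fun i hi' => pseudoObs_mem hi' ω 1) fun ω' => clip_mem hab _
  rw [eS, eE, eC, ← mul_sub, abs_mul, abs_of_nonneg (by positivity)]
  have : 6 * |c₁| * ((n : ℝ) + 2) ^ w * ((Real.sqrt n)⁻¹ * L) =
    (Real.sqrt n)⁻¹ * (3 * V * L + 3 * V * L) := by ring
  rw [this]
  refine mul_le_mul_of_nonneg_left ?_ (by positivity)
  refine le_trans (le_of_eq ?_) ((abs_add_le _ _).trans (add_le_add k1 k2))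
  congr 1
  simp only [clipV]
  ring

end

/-! ### Bias of the truncation -/

section

variable {P : Measure Ω} [IsProbabilityMeasure P] {U : ℤ → Ω → Fin 2 → ℝ}
variable {νp νm : Measure (Fin 2 → ℝ)} {w : ℝ}
variable {J : (Fin 2 → ℝ) → ℝ} {c₀ c₁ δ₀ : ℝ}

lemma UnifSeq.map_coord (h : UnifSeq P U) (j : Fin 2) :
    P.map (fun ω => U 0 ω j) = volume.restrict (Ioc (0 : ℝ) 1) := by
  have : IsProbabilityMeasure (P.map fun ω => U 0 ω j) :=
    Measure.isProbabilityMeasure_map (h.meas_coord 0 j).aemeasurable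
  refine Measure.ext_of_Iic _ _ fun a => ?_
  rw [Measure.map_apply (h.meas_coord 0 j) measurableSet_Iic,
    Measure.restrict_apply measurableSet_Iic]
  have e : Iic a ∩ Ioc (0 : ℝ) 1 = Ioc 0 (min a 1) := by
    ext x; simp only [mem_inter_iff, mem_Iic, mem_Ioc, le_min_iff]; tauto
  rw [e, Real.volume_Ioc, sub_zero]
  change P {ω | U 0 ω j ≤ a} = _
  rcases lt_or_ge a 0 with ha | ha
  · rw [ENNReal.ofReal_of_nonpos ((min_le_left _ _).trans ha.le)]
    convert measure_empty (μ := P)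
    exact eq_empty_of_forall_notMem fun ω hω => not_le.2 (ha.trans_le (h.mem 0 ω j).1) hω
  rcases le_total a 1 with h1 | h1
  · rw [min_eq_left h1, ← ofReal_measureReal, h.unif j a ⟨ha, h1⟩]
  · rw [min_eq_right h1, ENNReal.ofReal_one]
    convert measure_univ (μ := P)
    exact eq_univ_of_forall fun ω => (h.mem 0 ω j).2.trans h1

lemma UnifSeq.integrable_rpow (h : UnifSeq P U) (j : Fin 2) {v : ℝ} (hv : v < 1) :
    Integrable (fun ω => (U 0 ω j) ^ (-v)) P ∧ Integrable (fun ω => (1 - U 0 ω j) ^ (-v)) P := by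
  have i1 : IntervalIntegrable (fun x : ℝ => x ^ (-v)) volume 0 1 :=
    intervalIntegral.intervalIntegrable_rpow' (by linarith)
  have i2 : IntervalIntegrable (fun x : ℝ => (1 - x) ^ (-v)) volume 0 1 := by
    simpa using (i1.comp_sub_left 1).symm
  rw [intervalIntegrable_iff_integrableOn_Ioc_of_le zero_le_one, IntegrableOn,
    ← h.map_coord j] at i1 i2
  exact ⟨i1.comp_measurable (h.meas_coord 0 j), i2.comp_measurable (h.meas_coord 0 j)⟩

lemma UnifSeq.ae_cube (h : UnifSeq P U) (i : ℤ) : ∀ᵐ ω ∂P, U i ω ∈ cube := by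
  filter_upwards [ae_all_iff.2 fun j => h.ae_ne i j 0, ae_all_iff.2 fun j => h.ae_ne i j 1]
    with ω h0 h1 j
  have := h.mem i ω j
  exact ⟨this.1.lt_of_ne (h0 j).symm, this.2.lt_of_ne (h1 j)⟩

lemma UnifSeq.integrable_g1_rpow (h : UnifSeq P U) {v : ℝ} (hv : v < 1) :
    Integrable (fun ω => g1 (U 0 ω) ^ (-v)) P := by
  have i0 := h.integrable_rpow 0 hv
  have i1 := h.integrable_rpow 1 hv
  have hs : Integrable (fun ω => (U 0 ω 0) ^ (-v) + (1 - U 0 ω 0) ^ (-v) +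
      ((U 0 ω 1) ^ (-v) + (1 - U 0 ω 1) ^ (-v))) P := (i0.1.add i0.2).add (i1.1.add i1.2)
  refine hs.mono'
    ((measurable_g1.comp (h.meas 0)).pow_const _).aestronglyMeasurable ?_
  filter_upwards [h.ae_cube 0] with ω hω
  have k0 := hω 0
  have k1 := hω 1
  have p1 : 0 ≤ (U 0 ω 0) ^ (-v) := Real.rpow_nonneg k0.1.le _
  have p2 : 0 ≤ (1 - U 0 ω 0) ^ (-v) := Real.rpow_nonneg (by linarith) _
  have p3 : 0 ≤ (U 0 ω 1) ^ (-v) := Real.rpow_nonneg k1.1.le _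
  have p4 : 0 ≤ (1 - U 0 ω 1) ^ (-v) := Real.rpow_nonneg (by linarith) _
  rw [Real.norm_of_nonneg (Real.rpow_nonneg (g1_pos hω).le _)]
  rw [g1_eq (j := 0) (k := 1) (by decide)]
  rcases min_choice (min (U 0 ω 0) (1 - U 0 ω 0)) (min (U 0 ω 1) (1 - U 0 ω 1)) with e | e <;>
    rw [e]
  · rcases min_choice (U 0 ω 0) (1 - U 0 ω 0) with e | e <;> rw [e] <;> linarith
  · rcases min_choice (U 0 ω 1) (1 - U 0 ω 1) with e | e <;> rw [e] <;> linarith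

lemma ScoreFn.integrable_comp (hJ : ScoreFn J νp νm w c₀ c₁ δ₀) (h : UnifSeq P U) (hw : w < 1) :
    Integrable (fun ω => J (U 0 ω)) P := by
  have hm : AEStronglyMeasurable (fun ω => J (U 0 ω)) P := by
    refine ⟨_, (hJ.measurable_indicator.comp (h.meas 0)).stronglyMeasurable, ?_⟩
    filter_upwards [h.ae_cube 0] with ω hω
    simp [hω]
  refine ((h.integrable_g1_rpow hw).const_mul c₀).mono' hm ?_
  filter_upwards [h.ae_cube 0] with ω hω
  rw [Real.rpow_neg (g1_pos hω).le]
  exact hJ.bound _ hω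

lemma g1_le_g1_clipV {n : ℕ} (hn : 0 < n) {x : Fin 2 → ℝ} : g1 x ≤ g1 (clipV n x) := by
  have h1 := lo_le_half hn
  have h2 := half_le_hi n
  have h3 := g1_le_half x
  have key : ∀ j, g1 x ≤ min (clipV n x j) (1 - clipV n x j) := fun j => by
    have h4 := le_min_iff.1 (g1_le x j)
    have a1 : min (x j) (hi n) ≤ clipV n x j := le_max_right _ _
    have a2 : clipV n x j ≤ max (lo n) (x j) := max_le_max le_rfl (min_le_left _ _)
    have a3 : g1 x ≤ min (x j) (hi n) := le_min h4.1 (by linarith)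
    have a4 : max (lo n) (x j) ≤ 1 - g1 x := max_le (by linarith) (by linarith)
    exact le_min (by linarith) (by linarith)
  rw [g1_eq (u := clipV n x) (j := 0) (k := 1) (by decide)]
  exact le_min (key 0) (key 1)

lemma clipV_eq_of_le_g1 {n : ℕ} {x : Fin 2 → ℝ} (hx : lo n ≤ g1 x) : clipV n x = x := by
  refine clipV_of_mem fun j => ?_
  have h4 := le_min_iff.1 (g1_le x j)
  have h5 : 1 / ((n : ℝ) + 2) ≤ lo n := by unfold lo; gcongr; norm_num
  have h6 := hi_eq n
  constructor <;> linarith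

lemma ScoreFn.abs_comp_clipV_sub_le (hJ : ScoreFn J νp νm w c₀ c₁ δ₀) (hw : 0 ≤ w) {v : ℝ}
    (hv : w ≤ v) {n : ℕ} (hn : 0 < n) {x : Fin 2 → ℝ} (hx : x ∈ cube) :
    |J (clipV n x) - J x| ≤ 2 * |c₀| * lo n ^ (v - w) * g1 x ^ (-v) := by
  have hg := g1_pos hx
  rcases le_or_gt (lo n) (g1 x) with hl | hl
  · rw [clipV_eq_of_le_g1 hl, sub_self, abs_zero]
    have := lo_pos n
    positivity
  · have hb : ∀ y ∈ cube, g1 x ≤ g1 y → |J y| ≤ |c₀| * g1 x ^ (-w) := fun y hy hxy => by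
      refine (hJ.bound y hy).trans ?_
      rw [gW, ← Real.rpow_neg (g1_pos hy).le]
      refine mul_le_mul (le_abs_self _) (Real.rpow_le_rpow_of_nonpos hg hxy (by linarith))
        (Real.rpow_nonneg (g1_pos hy).le _) (abs_nonneg _)
    have h1 := hb _ (clipV_mem_cube hn x) (g1_le_g1_clipV hn)
    have h2 := hb x hx le_rfl
    have h3 : g1 x ^ (-w) ≤ lo n ^ (v - w) * g1 x ^ (-v) := by
      have e : g1 x ^ (-w) = g1 x ^ (v - w) * g1 x ^ (-v) := by
        rw [← Real.rpow_add hg]; ring_nf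
      rw [e]
      exact mul_le_mul_of_nonneg_right (Real.rpow_le_rpow hg.le hl.le (by linarith))
        (Real.rpow_nonneg hg.le _)
    have h4 := mul_le_mul_of_nonneg_left h3 (abs_nonneg c₀)
    refine (abs_sub _ _).trans ?_
    linarith

lemma ScoreFn.tendsto_bias (hJ : ScoreFn J νp νm w c₀ c₁ δ₀) (h : UnifSeq P U) (hw0 : 0 ≤ w)
    (hw : w < 1 / 2) :
    Tendsto (fun n : ℕ => Real.sqrt n * ((∫ ω, J (clipV n (U 0 ω)) ∂P) - ∫ ω, J (U 0 ω) ∂P)) atTop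
      (nhds 0) := by
  obtain ⟨v, hv1, hv2⟩ := exists_between (by linarith : w + 1 / 2 < 1)
  set I := ∫ ω, g1 (U 0 ω) ^ (-v) ∂P
  have hlim : Tendsto (fun n : ℕ => 2 * |c₀| * I * (n : ℝ) ^ (-(v - w - 1 / 2))) atTop (nhds 0) := by
    simpa using ((tendsto_rpow_neg_atTop (by linarith : 0 < v - w - 1 / 2)).comp
      tendsto_natCast_atTop_atTop).const_mul (2 * |c₀| * I)
  refine squeeze_zero_norm' ?_ hlim
  filter_upwards [eventually_gt_atTop 0, hJ.eventually_lt] with n hn hnδ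
  have hn' : (0 : ℝ) < n := by exact_mod_cast hn
  have iU := hJ.integrable_comp h (by linarith)
  have hae : ∀ᵐ ω ∂P, ‖J (clipV n (U 0 ω)) - J (U 0 ω)‖ ≤
      2 * |c₀| * lo n ^ (v - w) * g1 (U 0 ω) ^ (-v) := by
    filter_upwards [h.ae_cube 0] with ω hω
    exact hJ.abs_comp_clipV_sub_le hw0 (by linarith) hn hω
  have ig := (h.integrable_g1_rpow hv2).const_mul (2 * |c₀| * lo n ^ (v - w))
  have iD : Integrable (fun ω => J (clipV n (U 0 ω)) - J (U 0 ω)) P :=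
    ig.mono' (((hJ.measurable_comp_clipV hn hnδ).comp (h.meas 0)).aestronglyMeasurable.sub
      iU.aestronglyMeasurable) hae
  have iV : Integrable (fun ω => J (clipV n (U 0 ω))) P :=
    (iD.add iU).congr (ae_of_all _ fun ω => by simp)
  have hI0 : 0 ≤ I := integral_nonneg_of_ae (by
    filter_upwards [h.ae_cube 0] with ω hω using Real.rpow_nonneg (g1_pos hω).le _)
  have h1 := norm_integral_le_of_norm_le ig hae
  rw [integral_const_mul] at h1
  rw [← integral_sub iV iU, norm_mul, Real.norm_of_nonneg (Real.sqrt_nonneg _)]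
  have h2 : lo n ^ (v - w) ≤ (n : ℝ) ^ (-(v - w)) := by
    rw [Real.rpow_neg hn'.le, ← Real.inv_rpow hn'.le, ← one_div]
    refine Real.rpow_le_rpow (lo_pos n).le ?_ (by linarith)
    unfold lo; gcongr; linarith
  calc _ ≤ Real.sqrt n * (2 * |c₀| * (n : ℝ) ^ (-(v - w)) * I) := by
        refine mul_le_mul_of_nonneg_left (h1.trans ?_) (Real.sqrt_nonneg _)
        gcongr
    _ = 2 * |c₀| * I * ((n : ℝ) ^ (1 / 2 : ℝ) * (n : ℝ) ^ (-(v - w))) := by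
        rw [Real.sqrt_eq_rpow]; ring
    _ = _ := by rw [← Real.rpow_add hn']; ring_nf

end

/-! ### Convergence in distribution -/

section

variable {P : Measure Ω} [IsProbabilityMeasure P] {U : ℤ → Ω → Fin 2 → ℝ}
variable {νp νm : Measure (Fin 2 → ℝ)} {w : ℝ}
variable {J : (Fin 2 → ℝ) → ℝ} {c₀ c₁ δ₀ : ℝ}

lemma integrable_cexp_I {Y : Ω → ℝ} (hY : AEMeasurable Y P) (t : ℝ) :
    Integrable (fun ω => Complex.exp (Complex.I * ((t * Y ω : ℝ) : ℂ))) P :=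
  Integrable.of_bound (C := 1) (by fun_prop) (ae_of_all _ fun ω => by
    rw [Complex.norm_exp_I_mul_ofReal])

/-- Characteristic functions of variables that are close in mean on a large event. -/
lemma norm_integral_cexp_sub_le {Y Z D : Ω → ℝ} (hY : AEMeasurable Y P) (hZ : AEMeasurable Z P)
    (hD : Integrable D P) {A : Set Ω} (hA : MeasurableSet A) {ε : ℝ} (hε : 0 ≤ ε)
    (hD0 : ∀ ω, 0 ≤ D ω) (hb : ∀ ω ∈ A, |Y ω - Z ω| ≤ ε + D ω) (t : ℝ) :
    ‖(∫ ω, Complex.exp (Complex.I * ((t * Y ω : ℝ) : ℂ)) ∂P) -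
      ∫ ω, Complex.exp (Complex.I * ((t * Z ω : ℝ) : ℂ)) ∂P‖ ≤
      2 * P.real Aᶜ + |t| * (ε + ∫ ω in A, D ω ∂P) := by
  have i1 : Integrable (Aᶜ.indicator fun _ => (2 : ℝ)) P :=
    (integrable_const _).indicator hA.compl
  have i2 : Integrable (A.indicator D) P := hD.indicator hA
  have i3 : Integrable (fun ω => ε + A.indicator D ω) P := (integrable_const _).add i2
  rw [← integral_sub (integrable_cexp_I hY t) (integrable_cexp_I hZ t)]
  refine (norm_integral_le_of_norm_le (i1.add (i3.const_mul |t|)) (ae_of_all _ fun ω => ?_)).trans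
    (le_of_eq ?_)
  · simp only [Pi.add_apply]
    by_cases hω : ω ∈ A
    · rw [indicator_of_notMem (by simpa using hω), indicator_of_mem hω, zero_add]
      refine (norm_exp_I_sub_le _ _).trans ?_
      rw [← mul_sub, abs_mul]
      exact mul_le_mul_of_nonneg_left (hb ω hω) (abs_nonneg _)
    · rw [indicator_of_mem (by simpa using hω), indicator_of_notMem hω, add_zero]
      refine (norm_sub_le _ _).trans ?_
      rw [Complex.norm_exp_I_mul_ofReal, Complex.norm_exp_I_mul_ofReal]
      nlinarith [abs_nonneg t]
  · simp only [Pi.add_apply]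
    rw [integral_add i1 (i3.const_mul _), integral_const_mul, integral_add (integrable_const _) i2,
      integral_indicator hA, integral_indicator hA.compl]
    simp [mul_comm]

/-- The centred and normalized rank statistic of a uniform sequence. -/
def rankDev (P : Measure Ω) (U : ℤ → Ω → Fin 2 → ℝ) (J : (Fin 2 → ℝ) → ℝ) (n : ℕ) (ω : Ω) : ℝ :=
  Real.sqrt n * (((n : ℝ)⁻¹ * ∑ i ∈ Finset.Icc (1 : ℤ) (n : ℤ), J (pseudoObs U n i ω)) -
    ∫ ω', J (U 0 ω') ∂P)

lemma ScoreFn.measurable_rankDev (hJ : ScoreFn J νp νm w c₀ c₁ δ₀) (hm : ∀ i, Measurable (U i))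
    (n : ℕ) : Measurable (rankDev P U J n) := by
  have e : ∀ ω, ∑ i ∈ Finset.Icc (1 : ℤ) (n : ℤ), J (pseudoObs U n i ω) =
      ∑ i ∈ Finset.Icc (1 : ℤ) (n : ℤ), cube.indicator J (pseudoObs U n i ω) := fun ω =>
    Finset.sum_congr rfl fun i hi' => by
      rw [indicator_of_mem]
      intro j
      have := pseudoObs_mem (U := U) hi' ω j
      exact ⟨(lo_pos n).trans_le this.1, this.2.trans_lt (hi_lt_one n)⟩
  unfold rankDev
  simp only [e]
  refine Measurable.const_mul (Measurable.sub_const (Measurable.const_mul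
    (Finset.measurable_fun_sum _ fun i _ => ?_) _) _) _
  exact hJ.measurable_indicator.comp (measurable_pi_lambda _ fun j => measurable_pseudoObs hm n i j)

lemma tendsto_weight_mul {w κ : ℝ} (hw0 : 0 ≤ w) (hκ : w < κ) :
    Tendsto (fun n : ℕ => ((n : ℝ) + 2) ^ w * (n : ℝ) ^ (-κ)) atTop (nhds 0) := by
  have h := ((tendsto_rpow_neg_atTop (sub_pos.2 hκ)).comp
    (tendsto_natCast_atTop_atTop (R := ℝ))).const_mul ((3 : ℝ) ^ w)
  rw [mul_zero] at h
  refine squeeze_zero' (Eventually.of_forall fun n => by positivity) ?_ h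
  filter_upwards [eventually_gt_atTop 0] with n hn
  have hn1 : (1 : ℝ) ≤ n := by exact_mod_cast hn
  calc ((n : ℝ) + 2) ^ w * (n : ℝ) ^ (-κ) ≤ (3 * (n : ℝ)) ^ w * (n : ℝ) ^ (-κ) := by
        gcongr; linarith
    _ = 3 ^ w * (n : ℝ) ^ (-(κ - w)) := by
        rw [Real.mul_rpow (by norm_num) (by linarith), mul_assoc, ← Real.rpow_add (by linarith)]
        congr 2; ring

/-- Convergence of the characteristic functions of the rank statistic. -/
lemma UnifSeq.tendsto_charFun_rankDev (h : UnifSeq P U) (hC : Condition21 (cop P U))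
    (hJ : ScoreFn J νp νm w c₀ c₁ δ₀) (hw0 : 0 < w) (hw : w < 1 / 2) (t : ℝ) :
    Tendsto (fun n : ℕ => ∫ ω, Complex.exp (Complex.I * ((t * rankDev P U J n ω : ℝ) : ℂ)) ∂P) atTop
      (nhds ((Real.exp (-(t ^ 2 * sigmaSq P U νp νm / 2)) : ℝ) : ℂ)) := by
  have hν : ScoreMeas νp νm w := hJ.toScoreMeas
  have := hν.sigmaFinite
  obtain ⟨s, hsm, hs, hsJ⟩ := hν.exists_sign
  obtain ⟨K, hR⟩ := h.exists_copReg hC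
  obtain ⟨κ, hwκ, hκ⟩ := exists_between hw
  have hκ0 := hw0.trans hwκ
  obtain ⟨C, hC0, hb⟩ := h.exists_integral_emp_hfc_sq_le hC hκ0 hκ
  have hI := h.intEmp hν hsm hs hR hC0 hwκ.le hb
  have hlin := h.tendsto_charFun_linear hν hsm hs hsJ hR hC0 hwκ.le hb t
  have hL1 := h.tendsto_integral_ecp_sub hC hν hsm hs hR hC0 hκ0 hκ hwκ.le hb
  have hbias := (hJ.tendsto_bias h hw0.le hw).abs
  have herr := ((h.tendsto_good hκ).const_mul 2).add
    ((((((tendsto_weight_mul hw0.le hwκ).const_mul (6 * |c₁|)).add hbias).add hL1)).const_mul |t|)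
  simp only [abs_zero, mul_zero, add_zero] at herr
  set Z : ℕ → Ω → ℝ := fun n ω => ∫ u, emp P U n (hfc P U u) ω * s u ∂(νp + νm) with hZ
  have hdiff : Tendsto (fun n : ℕ =>
      (∫ ω, Complex.exp (Complex.I * ((t * rankDev P U J n ω : ℝ) : ℂ)) ∂P) -
      ∫ ω, Complex.exp (Complex.I * ((t * Z n ω : ℝ) : ℂ)) ∂P) atTop (nhds 0) := by
    refine squeeze_zero_norm' ?_ herr
    filter_upwards [eventually_gt_atTop 0, hJ.eventually_lt] with n hn hnδ
    have : IsFiniteMeasure ((νp + νm).restrict (rankBox n)) :=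
      ⟨by simpa using (hν.rankBox_ne_top n).lt_top⟩
    have iE : Integrable (fun q : (Fin 2 → ℝ) × Ω => ecp P U n q.1 q.2 * s q.1)
        (((νp + νm).restrict (rankBox n)).prod P) :=
      integrable_of_abs_le ((h.measurable_ecp n).mul (hsm.comp measurable_fst))
        (M := (Real.sqrt n)⁻¹ * n) fun q => by
          rw [abs_mul, hs, mul_one]; exact h.abs_ecp_le n _ _
    have iA := iE.integral_prod_right
    have iZ : Integrable (Z n) P := by
      have := (hI.integrable_prod h.meas hn).integral_prod_right
      simpa only [emp_mul_const] using this
    refine norm_integral_cexp_sub_le (hJ.measurable_rankDev h.meas n).aemeasurable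
      iZ.aemeasurable (iA.sub iZ).abs (measurableSet_Good h.meas n (tieLen κ n))
      (by positivity) (fun ω => abs_nonneg _) (fun ω hω => ?_) t
    have hn' : (0 : ℝ) < n := by exact_mod_cast hn
    have k1 := h.abs_sum_score_sub_le hJ hsm hs hsJ hn hnδ (one_le_tieLen hκ hn) hω
    have k2 : 6 * |c₁| * ((n : ℝ) + 2) ^ w * ((Real.sqrt n)⁻¹ * tieLen κ n) ≤
        6 * |c₁| * (((n : ℝ) + 2) ^ w * (n : ℝ) ^ (-κ)) := by
      rw [← mul_assoc (6 * |c₁|)]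
      exact mul_le_mul_of_nonneg_left (tieLen_le κ hn) (by positivity)
    have e : rankDev P U J n ω - Z n ω =
        (((Real.sqrt n)⁻¹ * (∑ i ∈ Finset.Icc (1 : ℤ) n, J (pseudoObs U n i ω) -
          n * ∫ ω', J (clipV n (U 0 ω')) ∂P) - ∫ u in rankBox n, ecp P U n u ω * s u ∂(νp + νm)) +
        Real.sqrt n * ((∫ ω', J (clipV n (U 0 ω')) ∂P) - ∫ ω', J (U 0 ω') ∂P)) +
        ((∫ u in rankBox n, ecp P U n u ω * s u ∂(νp + νm)) - Z n ω) := by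
      have hsq : Real.sqrt n * (n : ℝ)⁻¹ = (Real.sqrt n)⁻¹ := by
        rw [← div_eq_mul_inv, Real.sqrt_div_self', one_div]
      have hsq' : (Real.sqrt n)⁻¹ * n = Real.sqrt n := by
        rw [inv_mul_eq_div, Real.div_sqrt]
      unfold rankDev
      rw [mul_sub, ← mul_assoc, hsq, mul_sub (Real.sqrt n)⁻¹, ← mul_assoc (Real.sqrt n)⁻¹, hsq']
      ring
    rw [e]
    refine (abs_add_le _ _).trans (add_le_add ((abs_add_le _ _).trans (add_le_add
      (k1.trans k2) le_rfl)) le_rfl)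
  have := hdiff.add hlin
  rw [zero_add] at this
  exact this.congr fun n => by simp only [hZ, sub_add_cancel]

/-- Lévy's continuity theorem for a sequence of characteristic functions with Gaussian limit. -/
lemma tendsto_integral_gaussian {Y : ℕ → Ω → ℝ} (hY : ∀ n, Measurable (Y n)) {v : ℝ}
    (hch : ∀ t : ℝ, Tendsto (fun n : ℕ => ∫ ω, Complex.exp (Complex.I * ((t * Y n ω : ℝ) : ℂ)) ∂P)
      atTop (nhds ((Real.exp (-(t ^ 2 * v / 2)) : ℝ) : ℂ))) (f : BoundedContinuousFunction ℝ ℝ) :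
    Tendsto (fun n => ∫ ω, f (Y n ω) ∂P) atTop
      (nhds (∫ x, f x ∂(ProbabilityTheory.gaussianReal 0 (Real.toNNReal v)))) := by
  have hv : 0 ≤ v := by
    have h1 : ‖((Real.exp (-(1 ^ 2 * v / 2)) : ℝ) : ℂ)‖ ≤ 1 := by
      refine le_of_tendsto (hch 1).norm (Eventually.of_forall fun n => ?_)
      refine (norm_integral_le_of_norm_le_const (C := 1) (ae_of_all _ fun ω => by
        rw [Complex.norm_exp_I_mul_ofReal])).trans ?_
      simp
    rw [Complex.norm_real, Real.norm_of_nonneg (Real.exp_pos _).le, Real.exp_le_one_iff] at h1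
    linarith
  let μ : ℕ → ProbabilityMeasure ℝ := fun n =>
    ⟨P.map (Y n), Measure.isProbabilityMeasure_map (hY n).aemeasurable⟩
  let γ : ProbabilityMeasure ℝ := ⟨ProbabilityTheory.gaussianReal 0 (Real.toNNReal v), inferInstance⟩
  have hμ : Tendsto μ atTop (nhds γ) := by
    rw [ProbabilityMeasure.tendsto_iff_tendsto_charFun]
    intro t
    have e1 : ∀ n, charFun (μ n : Measure ℝ) t =
        ∫ ω, Complex.exp (Complex.I * ((t * Y n ω : ℝ) : ℂ)) ∂P := fun n => by
      change charFun (P.map (Y n)) t = _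
      rw [charFun_apply_real, integral_map (hY n).aemeasurable (by fun_prop)]
      congr 1; ext ω; congr 1; push_cast; ring
    have e2 : charFun (γ : Measure ℝ) t = ((Real.exp (-(t ^ 2 * v / 2)) : ℝ) : ℂ) := by
      change charFun (ProbabilityTheory.gaussianReal 0 (Real.toNNReal v)) t = _
      rw [ProbabilityTheory.charFun_gaussianReal]
      have : (((Real.toNNReal v : ℝ≥0) : ℝ) : ℂ) = (v : ℂ) := by
        rw [Real.coe_toNNReal v hv]
      rw [this]
      push_cast
      congr 1; ring
    simp only [e1, e2]
    exact hch t
  have := ProbabilityMeasure.tendsto_iff_forall_integral_tendsto.1 hμ f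
  have e : ∀ n, ∫ x, f x ∂(μ n : Measure ℝ) = ∫ ω, f (Y n ω) ∂P := fun n =>
    integral_map (hY n).aemeasurable f.continuous.aestronglyMeasurable
  exact this.congr e

lemma UnifSeq.cop_Uv {X : ℤ → Ω → Fin 2 → ℝ} (h : UnifSeq P (Uv P X)) :
    cop P (Uv P X) = cop P X := by
  ext u; unfold cop; rw [h.Uv_eq]

lemma UnifSeq.sigmaSq_eq {X : ℤ → Ω → Fin 2 → ℝ} (h : UnifSeq P (Uv P X)) :
    sigmaSq P (Uv P X) νp νm = sigmaSq P X νp νm := by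
  unfold sigmaSq GammaCov kcov
  rw [h.Uv_eq, h.cop_Uv]

lemma ScoreFn.integral_comp_eq (hJ : ScoreFn J νp νm w c₀ c₁ δ₀) (h : UnifSeq P U) (i : ℤ) :
    ∫ ω, J (U i ω) ∂P = ∫ ω, J (U 0 ω) ∂P := by
  have e : ∀ k : ℤ, ∫ ω, J (U k ω) ∂P = ∫ x, cube.indicator J x ∂(P.map (U k)) := fun k => by
    rw [integral_map (h.meas k).aemeasurable hJ.measurable_indicator.aestronglyMeasurable]
    refine integral_congr_ae ?_
    filter_upwards [h.ae_cube k] with ω hω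
    rw [indicator_of_mem hω]
  rw [e i, e 0]
  congr 1
  ext A hA
  rw [Measure.map_apply (h.meas i) hA, Measure.map_apply (h.meas 0) hA,
    h.stat.measure_one h.meas hA i]

end

/-- Theorem 3.3: asymptotic normality of bivariate rank statistics
`R_n = n⁻¹ Σ_i J(Û_{i1}, Û_{i2})` for exponentially alpha-mixing strictly stationary
bivariate observations, for score functions `J` of locally bounded Hardy–Krause
variation satisfying the weighted integrability conditions.  The function `J` is
represented through the Jordan pair `(ν⁺, ν⁻)` of the (unique) locally finite signed
measure `dJ` attached to the right-continuous function `J ∈ BVHK_loc((0,1)²)`. -/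
theorem rank_statistic_clt
    {Ω : Type*} [MeasurableSpace Ω]
    (P : Measure Ω) [IsProbabilityMeasure P] (X : ℤ → Ω → Fin 2 → ℝ)
    (hmeas : ∀ i, Measurable (X i)) (hstat : StrictlyStationary P X)
    (hmix : ExpAlphaMixing P X) (hcont : ∀ j, Continuous (margF P X j))
    (hC : Condition21 (cop P X))
    (J : (Fin 2 → ℝ) → ℝ)
    -- `J` is right-continuous on `(0,1)²`
    (hJrc : ∀ u : Fin 2 → ℝ, (∀ j, 0 < u j ∧ u j < 1) →
      ContinuousWithinAt J {v | ∀ j, u j ≤ v j} u)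
    -- the Jordan pair of measures representing `dJ` on `(0,1)²`
    (νp νm : Measure (Fin 2 → ℝ))
    (hfin : ∀ x y : Fin 2 → ℝ, (∀ j, 0 < x j) → (∀ j, y j < 1) →
      νp {w | ∀ j, x j ≤ w j ∧ w j ≤ y j} < ⊤ ∧ νm {w | ∀ j, x j ≤ w j ∧ w j ≤ y j} < ⊤)
    (hsupp : νp {u | ¬ ∀ j, 0 < u j ∧ u j < 1} = 0 ∧ νm {u | ¬ ∀ j, 0 < u j ∧ u j < 1} = 0)
    (hsing : νp ⟂ₘ νm)
    (hrepr : ∀ x y : Fin 2 → ℝ, (∀ j, 0 < x j) → (∀ j, x j ≤ y j) → (∀ j, y j < 1) →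
      (νp {w | ∀ j, x j < w j ∧ w j ≤ y j}).toReal - (νm {w | ∀ j, x j < w j ∧ w j ≤ y j}).toReal
        = J y - J (Function.update y 0 (x 0)) - J (Function.update y 1 (x 1)) + J x)
    -- weight exponent and growth/integrability conditions
    (w : ℝ) (hw : w ∈ Set.Ioo (0 : ℝ) (1/2))
    (c₀ : ℝ) (hJb : ∀ u : Fin 2 → ℝ, (∀ j, 0 < u j ∧ u j < 1) → |J u| ≤ c₀ * (gW w u)⁻¹)
    (hint : ∫⁻ u, ENNReal.ofReal (gW w u) ∂(νp + νm) < ⊤)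
    -- conditions (3.2) and (3.3): the section variations are `O(δ^{−ω})` as `δ → 0`
    (hbdry : ∃ c₁ : ℝ, ∃ δ₀ ∈ Set.Ioo (0 : ℝ) (1/2), ∀ δ ∈ Set.Ioo (0 : ℝ) δ₀,
      eVariationOn (fun s => J ![s, δ]) (Set.Ioc δ (1 - δ)) ≤ ENNReal.ofReal (c₁ * δ ^ (-w)) ∧
      eVariationOn (fun s => J ![s, 1 - δ]) (Set.Ioc δ (1 - δ)) ≤ ENNReal.ofReal (c₁ * δ ^ (-w)) ∧
      eVariationOn (fun s => J ![δ, s]) (Set.Ioc δ (1 - δ)) ≤ ENNReal.ofReal (c₁ * δ ^ (-w)) ∧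
      eVariationOn (fun s => J ![1 - δ, s]) (Set.Ioc δ (1 - δ)) ≤ ENNReal.ofReal (c₁ * δ ^ (-w))) :
    -- conclusion: `√n (R_n − E[J(U₁)])` converges in distribution to `N(0, σ²)`
    ∀ f : BoundedContinuousFunction ℝ ℝ,
      Tendsto (fun n : ℕ => ∫ ω, f (Real.sqrt n *
            (((n : ℝ)⁻¹ * ∑ i ∈ Finset.Icc (1 : ℤ) (n : ℤ), J (pseudoObs X n i ω))
              - ∫ ω', J (Uv P X 1 ω') ∂P)) ∂P)
        atTop
        (nhds (∫ x, f x ∂(ProbabilityTheory.gaussianReal 0 (Real.toNNReal (sigmaSq P X νp νm))))) := by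
  have h := unifSeq_Uv hmeas hstat hmix hcont
  obtain ⟨c₁, δ₀, hδ₀, hb⟩ := hbdry
  have hJ : ScoreFn J νp νm w c₀ c₁ δ₀ :=
    { fin := hfin
      supp := hsupp
      sing := hsing
      int := hint
      repr := hrepr
      bound := hJb
      pos := hδ₀.1
      bdry := fun δ hδ => ⟨(hb δ hδ).2.1, (hb δ hδ).2.2.2⟩ }
  have hCU : Condition21 (cop P (Uv P X)) := by rwa [h.cop_Uv]
  intro f
  have key := tendsto_integral_gaussian (fun n => hJ.measurable_rankDev h.meas n)
    (fun t => h.tendsto_charFun_rankDev hCU hJ hw.1 hw.2 t) f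
  rw [h.sigmaSq_eq] at key
  refine key.congr fun n => integral_congr_ae ?_
  filter_upwards [ae_pseudoObs_eq hmeas hstat hcont] with ω hω
  simp only [rankDev, hω, hJ.integral_comp_eq h 1]

end BBV
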